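/- Fix an integer g ≥ 2 and set μ_g = (g−1)/2. There exist a constant c > 0 and a threshold x_0 (both depending only on g) such that for every real x ≥ x_0 and every integer ℓ ≥ 0 satisfying gcd(ℓ, g−1) = 1 and |ℓ − μ_g (log x)/(log g)| ≤ g, the number of primes p ≤ x with s_g(p) = ℓ is at least c · x/(log x)^{3/2}. -/

import Mathlib

namespace DS
open Finset

/-- additive character `e(t) = exp(2 π i t)` -/
noncomputable def ee (t : ℝ) : ℂ := Complex.exp ((2 * Real.pi * t : ℝ) * Complex.I)

lemma ee_add (s t : ℝ) : ee (s + t) = ee s * ee t := by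
  unfold ee
  rw [← Complex.exp_add]; congr 1; push_cast; ring

@[simp] lemma norm_ee (t : ℝ) : ‖ee t‖ = 1 := by
  unfold ee; exact Complex.norm_exp_ofReal_mul_I _

@[simp] lemma ee_zero : ee 0 = 1 := by simp [ee]

lemma ee_ne_zero (t : ℝ) : ee t ≠ 0 := by
  unfold ee; exact Complex.exp_ne_zero _

lemma ee_neg (t : ℝ) : ee (-t) = (ee t)⁻¹ := by
  have := ee_add t (-t)
  rw [add_neg_cancel, ee_zero] at this
  exact eq_inv_of_mul_eq_one_right this.symm

lemma conj_ee (t : ℝ) : (starRingEnd ℂ) (ee t) = ee (-t) := by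
  unfold ee
  rw [← Complex.exp_conj]; congr 1
  rw [map_mul, Complex.conj_ofReal, Complex.conj_I]
  push_cast; ring

lemma ee_sub (s t : ℝ) : ee (s - t) = ee s * (starRingEnd ℂ) (ee t) := by
  rw [conj_ee, ← ee_add, sub_eq_add_neg]

lemma ee_int (m : ℤ) : ee m = 1 := by
  unfold ee
  rw [Complex.exp_eq_one_iff]
  exact ⟨m, by push_cast; ring⟩

lemma ee_nat (m : ℕ) : ee m = 1 := by
  have := ee_int m
  simpa using this

lemma ee_add_int (t : ℝ) (m : ℤ) : ee (t + m) = ee t := by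
  rw [ee_add, ee_int, mul_one]

lemma ee_add_nat (t : ℝ) (m : ℕ) : ee (t + m) = ee t := by
  rw [ee_add, ee_nat, mul_one]

lemma ee_nat_mul (n : ℕ) (t : ℝ) : ee (n * t) = ee t ^ n := by
  unfold ee
  rw [← Complex.exp_nat_mul]; congr 1; push_cast; ring

lemma ee_sum {ι : Type*} (s : Finset ι) (f : ι → ℝ) : ee (∑ i ∈ s, f i) = ∏ i ∈ s, ee (f i) := by
  classical
  induction s using Finset.induction_on with
  | empty => simp
  | insert a s ha ih => rw [sum_insert ha, prod_insert ha, ee_add, ih]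

lemma ee_re (t : ℝ) : (ee t).re = Real.cos (2 * Real.pi * t) := by
  unfold ee; rw [Complex.exp_ofReal_mul_I_re]

lemma norm_ee_sub_le (s t : ℝ) : ‖ee s - ee t‖ ≤ 2 * Real.pi * |s - t| := by
  have h : ee s - ee t = ee t * (ee (s - t) - 1) := by
    rw [mul_sub, ← ee_add]; simp
  rw [h, norm_mul, norm_ee, one_mul]
  have := Real.norm_exp_I_mul_ofReal_sub_one_le (x := 2 * Real.pi * (s - t))
  unfold ee
  rw [mul_comm]
  refine this.trans ?_
  rw [Real.norm_eq_abs, abs_mul, abs_of_pos Real.two_pi_pos]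

lemma continuous_ee : Continuous ee := by
  unfold ee; fun_prop

/-- distance to the nearest integer -/
noncomputable def nn (t : ℝ) : ℝ := |t - round t|

lemma nn_nonneg (t : ℝ) : 0 ≤ nn t := abs_nonneg _
lemma nn_le_half (t : ℝ) : nn t ≤ 1 / 2 := abs_sub_round t
lemma nn_le (t : ℝ) (m : ℤ) : nn t ≤ |t - m| := round_le t m
lemma nn_le_abs (t : ℝ) : nn t ≤ |t| := by simpa using nn_le t 0

lemma nn_add_int (t : ℝ) (m : ℤ) : nn (t + m) = nn t := by
  unfold nn; rw [round_add_intCast]; push_cast; congr 1; ring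

lemma nn_add_nat (t : ℝ) (m : ℕ) : nn (t + m) = nn t := by
  have := nn_add_int t m
  simpa using this

lemma nn_neg (t : ℝ) : nn (-t) = nn t := by
  apply le_antisymm
  · refine (nn_le (-t) (-(round t))).trans ?_
    unfold nn; push_cast; rw [← abs_neg]; apply le_of_eq; congr 1; ring
  · refine (nn_le t (-(round (-t)))).trans ?_
    unfold nn; push_cast; rw [← abs_neg]; apply le_of_eq; congr 1; ring

lemma nn_add_le (s t : ℝ) : nn (s + t) ≤ nn s + nn t := by
  refine (nn_le (s + t) (round s + round t)).trans ?_
  unfold nn; push_cast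
  have : s + t - (round s + round t) = (s - round s) + (t - round t) := by ring
  rw [this]; exact abs_add_le _ _

lemma nn_nat_mul (k : ℕ) (t : ℝ) : nn (k * t) ≤ k * nn t := by
  refine (nn_le (k * t) (k * round t)).trans ?_
  unfold nn; push_cast
  rw [← mul_sub, abs_mul, Nat.abs_cast]

lemma nn_int_mul (k : ℤ) (t : ℝ) : nn (k * t) ≤ |(k:ℝ)| * nn t := by
  refine (nn_le (k * t) (k * round t)).trans ?_
  unfold nn; push_cast
  rw [← mul_sub, abs_mul]

lemma nn_eq_abs {t : ℝ} (h : |t| ≤ 1 / 2) : nn t = |t| := by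
  apply le_antisymm (nn_le_abs t)
  unfold nn
  by_cases h0 : round t = 0
  · simp [h0]
  · have h1 : (1:ℝ) ≤ |((round t : ℤ) : ℝ)| := by
      rw [← Int.cast_abs]; exact_mod_cast Int.one_le_abs h0
    have h2 : |((round t : ℤ) : ℝ)| ≤ |t - round t| + |t| := by
      have := abs_sub_abs_le_abs_sub ((round t : ℤ) : ℝ) t
      rw [abs_sub_comm] at this; linarith
    linarith

/-- rational number with denominator `q` not an integer -/
lemma nn_div_ge {j : ℤ} {q : ℕ} (hq : 0 < q) (h : ¬ (q : ℤ) ∣ j) : 1 / (q:ℝ) ≤ nn (j / q) := by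
  unfold nn
  have hq' : (0:ℝ) < q := by exact_mod_cast hq
  set m := round ((j:ℝ) / q)
  have h1 : (1:ℝ) ≤ |(j:ℝ) - m * q| := by
    have : j - m * q ≠ 0 := by
      intro h0; apply h; exact ⟨m, by linarith⟩
    have := Int.one_le_abs this
    exact_mod_cast this
  have : (j:ℝ) / q - m = (j - m * q) / q := by field_simp
  rw [this, abs_div, abs_of_pos hq']
  gcongr

lemma norm_one_sub_ee_ge (t : ℝ) : 4 * nn t ≤ ‖1 - ee t‖ := by
  have h1 : ee t = ee (t - round t) := by
    rw [sub_eq_add_neg, ← Int.cast_neg, ee_add_int]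
  have h2 : ‖1 - ee t‖ = 2 * |Real.sin (Real.pi * (t - round t))| := by
    rw [h1, norm_sub_rev]
    have := Complex.norm_exp_I_mul_ofReal_sub_one (2 * Real.pi * (t - round t))
    unfold ee
    rw [mul_comm, this, Real.norm_eq_abs, abs_mul]
    rw [abs_of_pos (by norm_num : (0:ℝ) < 2)]
    congr 3; ring
  rw [h2]
  unfold nn
  have hle : |t - round t| ≤ 1 / 2 := abs_sub_round t
  set u := t - round t
  have h3 : |Real.sin (Real.pi * u)| = Real.sin (Real.pi * |u|) := by
    rcases le_total 0 u with h | h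
    · rw [abs_of_nonneg h] at *
      rw [abs_of_nonneg]
      apply Real.sin_nonneg_of_nonneg_of_le_pi
      · positivity
      · nlinarith [Real.pi_pos]
    · rw [abs_of_nonpos h] at *
      rw [show Real.pi * u = -(Real.pi * -u) by ring, Real.sin_neg, abs_neg, abs_of_nonneg]
      apply Real.sin_nonneg_of_nonneg_of_le_pi
      · have := Real.pi_pos; nlinarith
      · nlinarith [Real.pi_pos]
  rw [h3]
  have := Real.mul_le_sin (x := Real.pi * |u|) (by positivity) (by nlinarith [Real.pi_pos])
  have h4 : 2 / Real.pi * (Real.pi * |u|) = 2 * |u| := by field_simp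
  linarith

/-- smooth version of `min M (1/‖t‖)` -/
noncomputable def mb (M t : ℝ) : ℝ := 2 * M / (1 + M * nn t)

lemma mb_nonneg {M : ℝ} (hM : 0 ≤ M) (t : ℝ) : 0 ≤ mb M t := by
  unfold mb; have := nn_nonneg t; positivity

lemma mb_le {M : ℝ} (hM : 0 ≤ M) (t : ℝ) : mb M t ≤ 2 * M := by
  unfold mb; have := nn_nonneg t
  apply div_le_self (by positivity)
  nlinarith [mul_nonneg hM this]

lemma mb_le_div {M : ℝ} (hM : 0 ≤ M) {t : ℝ} {d : ℝ} (hd : 0 < d) (h : d ≤ nn t) :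
    mb M t ≤ 2 / d := by
  unfold mb
  rw [div_le_div_iff₀ (by positivity [nn_nonneg t]) hd]
  nlinarith [mul_le_mul_of_nonneg_left h hM]

lemma mb_mono {M M' : ℝ} (hM : 0 ≤ M) (h : M ≤ M') (t : ℝ) : mb M t ≤ mb M' t := by
  unfold mb
  have h0 := nn_nonneg t
  have hM' := hM.trans h
  rw [div_le_div_iff₀ (by positivity) (by positivity)]
  nlinarith

lemma div_le_mb {M : ℝ} {t : ℝ} {d : ℝ} (hd : 0 < d) (h : d ≤ nn t) (hM : 1 / d ≤ M) :
    1 / nn t ≤ mb M t := by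
  unfold mb
  have h0 : 0 < nn t := hd.trans_le h
  have hM0 : 0 < M := lt_of_lt_of_le (by positivity) hM
  rw [div_le_div_iff₀ h0 (by positivity)]
  have : 1 ≤ M * nn t := by
    calc (1:ℝ) = 1 / d * d := by field_simp
      _ ≤ M * nn t := by gcongr
  linarith

lemma norm_geom_le (M : ℕ) (t : ℝ) : ‖∑ m ∈ range M, ee (m * t)‖ ≤ mb M t := by
  have h0 := nn_nonneg t
  have htriv : ‖∑ m ∈ range M, ee (m * t)‖ ≤ M := by
    refine (norm_sum_le _ _).trans ?_
    simp
  have h1 : ‖∑ m ∈ range M, ee (m * t)‖ * (4 * nn t) ≤ 2 := by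
    have e1 : (∑ m ∈ range M, ee (m * t)) * (1 - ee t) = 1 - ee t ^ M := by
      simp_rw [ee_nat_mul]
      rw [geom_sum_mul_neg]
    calc _ ≤ ‖∑ m ∈ range M, ee (m * t)‖ * ‖1 - ee t‖ := by
          gcongr; exact norm_one_sub_ee_ge t
      _ = ‖1 - ee t ^ M‖ := by rw [← norm_mul, e1]
      _ ≤ ‖(1:ℂ)‖ + ‖ee t ^ M‖ := norm_sub_le _ _
      _ = 2 := by simp; norm_num
  unfold mb
  rw [le_div_iff₀ (by positivity)]
  set S := ‖∑ m ∈ range M, ee (m * t)‖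
  have hS : 0 ≤ S := norm_nonneg _
  have hM : (0:ℝ) ≤ M := Nat.cast_nonneg _
  nlinarith [mul_le_mul_of_nonneg_left h1 hM]

lemma norm_geom_Icc_le (M : ℕ) (t : ℝ) : ‖∑ m ∈ Icc 1 M, ee (m * t)‖ ≤ mb M t := by
  have : ∑ m ∈ Icc 1 M, ee (m * t) = ee t * ∑ m ∈ range M, ee (m * t) := by
    rw [mul_sum, Finset.range_eq_Ico, ← Finset.Ico_add_one_right_eq_Icc]
    rw [Finset.sum_Ico_eq_sum_range, Finset.sum_Ico_eq_sum_range]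
    apply Finset.sum_congr (by simp)
    intro m _
    rw [← ee_add]; congr 1; push_cast; ring
  rw [this, norm_mul, norm_ee, one_mul]
  exact norm_geom_le M t

lemma harmonic_le (K : ℕ) (hK : 1 ≤ K) : ∑ k ∈ Icc 1 K, (1:ℝ) / k ≤ 1 + Real.log K := by
  have := harmonic_le_one_add_log K
  rw [harmonic_eq_sum_Icc] at this
  push_cast at this
  simpa using this

/-- sum over well spaced points -/
lemma spaced_sum {ι : Type*} (I : Finset ι) (θ : ι → ℝ) {δ : ℝ} (hδ : 0 < δ) (hδ1 : δ ≤ 1)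
    (hsp : ∀ i ∈ I, ∀ j ∈ I, i ≠ j → δ ≤ nn (θ i - θ j)) {M : ℝ} (hM : 0 ≤ M) :
    ∑ i ∈ I, mb M (θ i) ≤ 4 * M + 4 / δ * (1 + Real.log (1 / δ)) := by
  classical
  set K : ℕ := ⌊1 / δ⌋₊
  have hK1 : 1 ≤ K := by
    rw [Nat.one_le_floor_iff, le_div_iff₀ hδ]; linarith
  -- the bin of a point
  let σ : ι → ℝ := fun i => θ i - round (θ i)
  let bin : ι → ℕ := fun i => ⌊|σ i| / δ⌋₊
  have hbin : ∀ i, (bin i : ℝ) * δ ≤ nn (θ i) := by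
    intro i
    have : (bin i : ℝ) ≤ |σ i| / δ := Nat.floor_le (by positivity)
    rw [le_div_iff₀ hδ] at this
    exact this
  have hbin2 : ∀ i, nn (θ i) < (bin i + 1) * δ := by
    intro i
    have : |σ i| / δ < bin i + 1 := Nat.lt_floor_add_one _
    rw [div_lt_iff₀ hδ] at this
    exact this
  have hbinK : ∀ i, bin i ≤ K := by
    intro i
    apply Nat.floor_le_floor
    have : |σ i| ≤ 1 / 2 := abs_sub_round _
    gcongr
    linarith
  have hval : ∀ i, mb M (θ i) ≤ 2 * M / (1 + M * (bin i * δ)) := by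
    intro i
    unfold mb
    have := hbin i
    gcongr
  have key : ∀ s : Bool, ∑ i ∈ I.filter (fun i => decide (0 ≤ σ i) = s), mb M (θ i)
      ≤ ∑ k ∈ range (K + 1), 2 * M / (1 + M * (k * δ)) := by
    intro s
    have hinj : Set.InjOn bin (I.filter (fun i => decide (0 ≤ σ i) = s)) := by
      intro i hi j hj hij
      by_contra hne
      simp only [coe_filter, Set.mem_ofPred_eq] at hi hj
      have h1 := hsp i hi.1 j hj.1 hne
      have h2 : nn (θ i - θ j) ≤ |σ i - σ j| := by
        have := nn_le (θ i - θ j) (round (θ i) - round (θ j))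
        refine this.trans (le_of_eq ?_)
        simp only [σ]; push_cast; congr 1; ring
      have h3 : |σ i - σ j| = |(|σ i| - |σ j|)| := by
        have hs : (0 ≤ σ i ∧ 0 ≤ σ j) ∨ (σ i ≤ 0 ∧ σ j ≤ 0) := by
          have := hi.2.trans hj.2.symm
          by_cases h : 0 ≤ σ i
          · left; refine ⟨h, ?_⟩
            simpa [h] using this
          · right
            have h' : ¬ 0 ≤ σ j := by simpa [h] using this
            constructor <;> linarith
        rcases hs with ⟨ha, hb⟩ | ⟨ha, hb⟩
        · rw [abs_of_nonneg ha, abs_of_nonneg hb]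
        · rw [abs_of_nonpos ha, abs_of_nonpos hb, ← abs_neg]; congr 1; ring
      have a1 := hbin i
      have a2 := hbin2 i
      have a3 := hbin j
      have a4 := hbin2 j
      rw [← hij] at a3 a4
      have : |(|σ i| - |σ j|)| < δ := by
        have e1 : |σ i| = nn (θ i) := rfl
        have e2 : |σ j| = nn (θ j) := rfl
        rw [e1, e2, abs_lt]
        constructor <;> nlinarith
      linarith
    calc _ ≤ ∑ i ∈ I.filter (fun i => decide (0 ≤ σ i) = s), 2 * M / (1 + M * (bin i * δ)) :=
          sum_le_sum fun i _ => hval i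
      _ = ∑ k ∈ (I.filter (fun i => decide (0 ≤ σ i) = s)).image bin, 2 * M / (1 + M * (k * δ)) := by
          rw [sum_image hinj]
      _ ≤ _ := by
          apply sum_le_sum_of_subset_of_nonneg
          · intro k hk
            rw [mem_image] at hk
            obtain ⟨i, _, rfl⟩ := hk
            rw [mem_range]; have := hbinK i; omega
          · intros; positivity
  have hsum : ∑ i ∈ I, mb M (θ i) = ∑ s : Bool, ∑ i ∈ I.filter (fun i => decide (0 ≤ σ i) = s), mb M (θ i) := by
    rw [Finset.sum_fiberwise]
  have hK2 : ∑ k ∈ range (K + 1), 2 * M / (1 + M * (k * δ)) ≤ 2 * M + 2 / δ * (1 + Real.log (1 / δ)) := by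
    rw [sum_range_succ']
    have : ∑ k ∈ range K, 2 * M / (1 + M * (((k + 1 : ℕ) : ℝ) * δ)) ≤ 2 / δ * (1 + Real.log (1 / δ)) := by
      calc _ ≤ ∑ k ∈ range K, 2 / δ * (1 / ((k + 1 : ℕ) : ℝ)) := by
            apply sum_le_sum
            intro k _
            rw [div_mul_div_comm, div_le_div_iff₀ (by positivity) (by positivity)]
            push_cast
            nlinarith [mul_nonneg hM hδ.le]
        _ = 2 / δ * ∑ k ∈ Icc 1 K, (1:ℝ) / k := by
            rw [← mul_sum]; congr 1
            rw [Finset.range_eq_Ico, Finset.sum_Ico_add' (fun k : ℕ => 1 / (k:ℝ)) 0 K 1]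
            rfl
        _ ≤ 2 / δ * (1 + Real.log (1 / δ)) := by
            gcongr
            refine (harmonic_le K hK1).trans ?_
            gcongr
            exact Nat.floor_le (by positivity)
    have e0 : 2 * M / (1 + M * (((0:ℕ):ℝ) * δ)) = 2 * M := by simp
    linarith
  rw [hsum]
  rw [Fintype.sum_bool]
  have h1 := key true
  have h2 := key false
  have : 4 / δ * (1 + Real.log (1 / δ)) = 2 * (2 / δ * (1 + Real.log (1 / δ))) := by ring
  linarith

/-- sum over an arithmetic progression: differences `η r`, `0 < r < B`, are `δ`-far from integers -/
lemma ap_sum {η τ : ℝ} {B : ℕ} (hB : 1 ≤ B) {δ : ℝ} (hδ : 0 < δ) (hδ1 : δ ≤ 1)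
    (hsp : ∀ r : ℕ, 0 < r → r < B → δ ≤ nn (η * r)) {M : ℝ} (hM : 0 ≤ M) (a N : ℕ) :
    ∑ n ∈ Ico a (a + N), mb M (η * n + τ) ≤ (N / B + 1) * (4 * M + 4 / δ * (1 + Real.log (1 / δ))) := by
  have hblock : ∀ a b : ℕ, b ≤ a + B → ∑ n ∈ Ico a b, mb M (η * n + τ) ≤ 4 * M + 4 / δ * (1 + Real.log (1 / δ)) := by
    intro a b hab
    apply spaced_sum _ _ hδ hδ1 _ hM
    intro i hi j hj hij
    rw [mem_Ico] at hi hj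
    rcases lt_or_gt_of_ne hij with h | h
    · have := hsp (j - i) (by omega) (by omega)
      rw [Nat.cast_sub h.le] at this
      rw [← nn_neg]
      convert this using 2; ring
    · have := hsp (i - j) (by omega) (by omega)
      rw [Nat.cast_sub h.le] at this
      convert this using 2; ring
  have hlog : 0 ≤ Real.log (1 / δ) := by
    apply Real.log_nonneg; rw [le_div_iff₀ hδ]; linarith
  set V := 4 * M + 4 / δ * (1 + Real.log (1 / δ)) with hV
  have hV0 : 0 ≤ V := by positivity
  have hind : ∀ k : ℕ, ∀ a : ℕ, ∑ n ∈ Ico a (a + k * B), mb M (η * n + τ) ≤ k * V := by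
    intro k
    induction k with
    | zero => intro a; simp
    | succ k ih =>
      intro a
      rw [← sum_Ico_consecutive _ (Nat.le_add_right a (k * B)) (by nlinarith)]
      have h1 := ih a
      have h2 := hblock (a + k * B) (a + (k + 1) * B) (by ring_nf; omega)
      push_cast
      linarith
  calc ∑ n ∈ Ico a (a + N), mb M (η * n + τ)
      ≤ ∑ n ∈ Ico a (a + (N / B + 1) * B), mb M (η * n + τ) := by
        apply sum_le_sum_of_subset_of_nonneg
        · apply Ico_subset_Ico le_rfl
          have := Nat.lt_div_mul_add (a := N) (b := B) (by omega)
          nlinarith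
        · intros; exact mb_nonneg hM _
    _ ≤ ((N / B + 1 : ℕ) : ℝ) * V := hind _ a
    _ ≤ _ := by
        gcongr
        push_cast
        gcongr
        exact Nat.cast_div_le

end DS

namespace DS
open Finset ArithmeticFunction

lemma hyperbola {β : Type*} [AddCommMonoid β] (X : ℕ) (F : ℕ → ℕ → β) :
    ∑ n ∈ Icc 1 X, ∑ p ∈ n.divisorsAntidiagonal, F p.1 p.2 =
      ∑ d ∈ Icc 1 X, ∑ e ∈ Icc 1 (X / d), F d e := by
  rw [Finset.sum_sigma', Finset.sum_sigma']
  refine Finset.sum_bij' (fun x _ => ⟨x.2.1, x.2.2⟩) (fun y _ => ⟨y.1 * y.2, (y.1, y.2)⟩) ?_ ?_ ?_ ?_ ?_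
  · rintro ⟨n, a, b⟩ h
    simp only [mem_sigma, mem_Icc, Nat.mem_divisorsAntidiagonal] at h ⊢
    obtain ⟨⟨h1, h2⟩, h3, h4⟩ := h
    have ha : 0 < a := Nat.pos_of_ne_zero (by rintro rfl; simp at h3; omega)
    have hb : 0 < b := Nat.pos_of_ne_zero (by rintro rfl; simp at h3; omega)
    refine ⟨⟨ha, ?_⟩, hb, ?_⟩
    · nlinarith
    · rw [Nat.le_div_iff_mul_le ha]; nlinarith
  · rintro ⟨a, b⟩ h
    simp only [mem_sigma, mem_Icc, Nat.mem_divisorsAntidiagonal] at h ⊢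
    obtain ⟨⟨h1, h2⟩, h3, h4⟩ := h
    rw [Nat.le_div_iff_mul_le h1] at h4
    have : 0 < a * b := Nat.mul_pos h1 h3
    refine ⟨⟨this, by nlinarith⟩, trivial, by omega⟩
  · rintro ⟨n, a, b⟩ h
    simp only [mem_sigma, mem_Icc, Nat.mem_divisorsAntidiagonal] at h ⊢
    obtain ⟨_, h3, _⟩ := h
    subst h3; rfl
  · rintro ⟨a, b⟩ h; rfl
  · rintro ⟨n, a, b⟩ h; rfl

lemma sum_mul_conv (u v : ArithmeticFunction ℝ) (X : ℕ) (f : ℕ → ℂ) :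
    ∑ n ∈ Icc 1 X, (((u * v) n : ℝ) : ℂ) * f n =
      ∑ d ∈ Icc 1 X, ∑ e ∈ Icc 1 (X / d), (u d : ℂ) * (v e : ℂ) * f (d * e) := by
  rw [← hyperbola X (fun d e => (u d : ℂ) * (v e : ℂ) * f (d * e))]
  refine Finset.sum_congr rfl fun n hn => ?_
  rw [ArithmeticFunction.mul_apply]
  push_cast
  rw [Finset.sum_mul]
  refine Finset.sum_congr rfl fun p hp => ?_
  rw [(Nat.mem_divisorsAntidiagonal.1 hp).1]

/-- truncation of an arithmetic function -/
noncomputable def trunc (U : ℕ) (u : ArithmeticFunction ℝ) : ArithmeticFunction ℝ :=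
  ⟨fun n => if n ≤ U then u n else 0, by simp⟩

lemma trunc_apply (U : ℕ) (u : ArithmeticFunction ℝ) (n : ℕ) :
    trunc U u n = if n ≤ U then u n else 0 := rfl

noncomputable def muR : ArithmeticFunction ℝ := ((moebius : ArithmeticFunction ℤ) : ArithmeticFunction ℝ)
noncomputable def zeR : ArithmeticFunction ℝ := ((zeta : ArithmeticFunction ℕ) : ArithmeticFunction ℝ)

lemma muR_abs (n : ℕ) : |muR n| ≤ 1 := by
  have := ArithmeticFunction.abs_moebius_le_one (n := n)
  simp only [muR, ArithmeticFunction.intCoe_apply]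
  exact_mod_cast this

lemma zeR_apply {n : ℕ} (hn : n ≠ 0) : zeR n = 1 := by
  simp [zeR, hn]

lemma vaughan_id (U : ℕ) : vonMangoldt = trunc U vonMangoldt + trunc U muR * ArithmeticFunction.log
    - (trunc U muR * trunc U vonMangoldt) * zeR
    + (muR - trunc U muR) * ((vonMangoldt - trunc U vonMangoldt) * zeR) := by
  have h1 : muR * zeR = 1 := by
    have := ArithmeticFunction.coe_moebius_mul_coe_zeta (R := ℝ)
    exact this
  have h2 : vonMangoldt * zeR = ArithmeticFunction.log := vonMangoldt_mul_zeta
  rw [← h2]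
  linear_combination (-(vonMangoldt - trunc U vonMangoldt)) * h1

lemma log_nonneg_nat (n : ℕ) : 0 ≤ Real.log n := Real.log_natCast_nonneg n

lemma conv_zeta (u : ArithmeticFunction ℝ) (n : ℕ) :
    (u * zeR) n = ∑ d ∈ n.divisors, u d := by
  rw [ArithmeticFunction.mul_apply, Nat.sum_divisorsAntidiagonal (f := fun a b => u a * zeR b)]
  refine Finset.sum_congr rfl fun d hd => ?_
  have h := Nat.mem_divisors.1 hd
  rw [zeR_apply, mul_one]
  have := Nat.div_pos (Nat.le_of_dvd (Nat.pos_of_ne_zero h.2) h.1) (Nat.pos_of_mem_divisors hd)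
  omega

lemma b_bounds (U n : ℕ) : 0 ≤ ((vonMangoldt - trunc U vonMangoldt) * zeR) n ∧
    ((vonMangoldt - trunc U vonMangoldt) * zeR) n ≤ Real.log n := by
  rw [conv_zeta]
  have key : ∀ d, 0 ≤ (vonMangoldt - trunc U vonMangoldt) d ∧
      (vonMangoldt - trunc U vonMangoldt) d ≤ vonMangoldt d := by
    intro d
    rw [sub_eq_add_neg, ArithmeticFunction.add_apply, ArithmeticFunction.neg_apply, trunc_apply]
    have := vonMangoldt_nonneg (n := d)
    split_ifs <;> constructor <;> linarith
  constructor
  · exact Finset.sum_nonneg fun d _ => (key d).1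
  · rw [← vonMangoldt_sum]
    exact Finset.sum_le_sum fun d _ => (key d).2

lemma b_zero (U n : ℕ) (h : n ≤ U) : ((vonMangoldt - trunc U vonMangoldt) * zeR) n = 0 := by
  rw [conv_zeta]
  refine Finset.sum_eq_zero fun d hd => ?_
  have h2 : d ≤ U := (Nat.divisor_le hd).trans h
  rw [sub_eq_add_neg, ArithmeticFunction.add_apply, ArithmeticFunction.neg_apply, trunc_apply,
    if_pos h2]; ring

lemma c_bound (U n : ℕ) : |(trunc U muR * trunc U vonMangoldt) n| ≤ Real.log n := by
  rw [ArithmeticFunction.mul_apply, ← vonMangoldt_sum]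
  rw [← Nat.sum_divisorsAntidiagonal' (f := fun _ b => vonMangoldt b)]
  refine (Finset.abs_sum_le_sum_abs _ _).trans (Finset.sum_le_sum fun p _ => ?_)
  rw [abs_mul]
  have h1 : |trunc U muR p.1| ≤ 1 := by
    rw [trunc_apply]; split_ifs
    · exact muR_abs _
    · simp
  have h2 : |trunc U vonMangoldt p.2| ≤ vonMangoldt p.2 := by
    have := vonMangoldt_nonneg (n := p.2)
    rw [trunc_apply]; split_ifs
    · rw [abs_of_nonneg this]
    · simpa using this
  nlinarith [abs_nonneg (trunc U muR p.1), abs_nonneg (trunc U vonMangoldt p.2)]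

lemma c_zero (U n : ℕ) (h : U * U < n) : (trunc U muR * trunc U vonMangoldt) n = 0 := by
  rw [ArithmeticFunction.mul_apply]
  refine Finset.sum_eq_zero fun p hp => ?_
  have h3 := (Nat.mem_divisorsAntidiagonal.1 hp).1
  rw [trunc_apply, trunc_apply]
  split_ifs with h1 h2
  · exfalso
    have : p.1 * p.2 ≤ U * U := Nat.mul_le_mul h1 h2
    omega
  all_goals simp

/-- partial summation with the logarithm -/
lemma log_partial (g : ℕ → ℂ) (T : ℝ) (y : ℕ) (h : ∀ z ≤ y, ‖∑ e ∈ Icc 1 z, g e‖ ≤ T) :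
    ‖∑ e ∈ Icc 1 y, (Real.log e : ℂ) * g e‖ ≤ 2 * Real.log y * T := by
  have hT : 0 ≤ T := (norm_nonneg _).trans (h 0 (Nat.zero_le _))
  have key : ∀ z ≤ y, ‖(Real.log z : ℂ) * ∑ e ∈ Icc 1 z, g e - ∑ e ∈ Icc 1 z, (Real.log e : ℂ) * g e‖
      ≤ Real.log z * T := by
    intro z
    induction z with
    | zero => intro _; simp
    | succ z ih =>
      intro hz
      have ih := ih (by omega)
      rw [Finset.sum_Icc_succ_top (by omega), Finset.sum_Icc_succ_top (by omega)]
      have e1 : (Real.log ((z+1:ℕ):ℝ) : ℂ) * (∑ e ∈ Icc 1 z, g e + g (z+1)) -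
          (∑ e ∈ Icc 1 z, (Real.log e : ℂ) * g e + (Real.log ((z+1:ℕ):ℝ) : ℂ) * g (z+1)) =
          ((Real.log z : ℂ) * ∑ e ∈ Icc 1 z, g e - ∑ e ∈ Icc 1 z, (Real.log e : ℂ) * g e)
          + ((Real.log ((z+1:ℕ):ℝ) - Real.log z : ℝ) : ℂ) * ∑ e ∈ Icc 1 z, g e := by
        push_cast; ring
      rw [e1]
      refine (norm_add_le _ _).trans ?_
      rw [norm_mul, Complex.norm_real]
      have hm : Real.log z ≤ Real.log ((z+1:ℕ):ℝ) := by
        rcases Nat.eq_zero_or_pos z with rfl | hz0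
        · simp
        · exact Real.log_le_log (by exact_mod_cast hz0) (by push_cast; linarith)
      rw [Real.norm_of_nonneg (by linarith)]
      have := h z (by omega)
      nlinarith
  have k := key y le_rfl
  have k2 := h y le_rfl
  have : ∑ e ∈ Icc 1 y, (Real.log e : ℂ) * g e = (Real.log y : ℂ) * ∑ e ∈ Icc 1 y, g e -
     ((Real.log y : ℂ) * ∑ e ∈ Icc 1 y, g e - ∑ e ∈ Icc 1 y, (Real.log e : ℂ) * g e) := by ring
  rw [this]
  refine (norm_sub_le _ _).trans ?_
  rw [norm_mul, Complex.norm_real, Real.norm_of_nonneg (log_nonneg_nat y)]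
  nlinarith [log_nonneg_nat y]

end DS

namespace DS
open Finset ArithmeticFunction

lemma typeII_sum (f : ℕ → ℂ) (hf : ∀ n, ‖f n‖ ≤ 1) (X U : ℕ) (hU : 2 ≤ U) (hUX : U * U ≤ X)
    (E2 D : ℝ) (hE2 : 0 ≤ E2) (hD : 1 ≤ D)
    (hII : ∀ M N, U ≤ M → U ≤ N → M * N ≤ X → ∀ a b : ℕ → ℂ, (∀ n, ‖a n‖ ≤ 1) →
      (∀ n, ‖b n‖ ≤ 1) → ‖∑ m ∈ Icc 1 M, ∑ n ∈ Icc 1 N, a m * b n * f (m * n)‖ ≤ E2)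
    (a b : ℕ → ℂ) (ha : ∀ n, ‖a n‖ ≤ 1) (hb : ∀ n ≤ X, ‖b n‖ ≤ 1) (ha0 : ∀ n ≤ U, a n = 0)
    (hb0 : ∀ n ≤ U, b n = 0) :
    ‖∑ d ∈ Icc 1 X, ∑ e ∈ Icc 1 (X / d), a d * b e * f (d * e)‖ ≤
      (D * Real.log X + 1) * E2 + X * (1 + Real.log X) / D + X / U := by
  have hX1 : 1 ≤ X := by nlinarith
  have hXr : (1:ℝ) ≤ X := by exact_mod_cast hX1
  have hlX : 0 ≤ Real.log X := log_nonneg_nat X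
  set idx : ℕ → ℕ := fun d => ⌊D * Real.log d⌋₊ with hidx
  set M : ℕ → ℕ := fun i => ⌊Real.exp ((i + 1 : ℝ) / D)⌋₊ with hM
  set N : ℕ → ℕ := fun i => X / M i with hN
  have hdM : ∀ d, 1 ≤ d → d ≤ M (idx d) := by
    intro d hd
    refine Nat.le_floor ?_
    have hd0 : (0:ℝ) < d := by exact_mod_cast hd
    rw [← Real.log_le_iff_le_exp hd0, le_div_iff₀ (by linarith)]
    have := Nat.lt_floor_add_one (D * Real.log d)
    simp only [hidx]; nlinarith
  have hNX : ∀ d, 1 ≤ d → N (idx d) ≤ X / d := fun d hd => Nat.div_le_div_left (hdM d hd) hd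
  have split : ∀ d ∈ Icc 1 X, ∑ e ∈ Icc 1 (X / d), a d * b e * f (d * e) =
      ∑ e ∈ Icc 1 (N (idx d)), a d * b e * f (d * e) +
      ∑ e ∈ Ioc (N (idx d)) (X / d), a d * b e * f (d * e) := by
    intro d hd
    have hd1 := (mem_Icc.1 hd).1
    have h := hNX d hd1
    rw [← Finset.sum_union]
    · congr 1
      ext e; simp only [mem_Icc, mem_union, mem_Ioc]; omega
    · rw [Finset.disjoint_left]; intro e; simp only [mem_Icc, mem_Ioc]; omega
  rw [Finset.sum_congr rfl split, Finset.sum_add_distrib]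
  refine (norm_add_le _ _).trans ?_
  rw [add_assoc]
  refine add_le_add ?_ ?_
  · -- blocks
    set I := ⌊D * Real.log X⌋₊ with hI
    have hmaps : ∀ d ∈ Icc 1 X, idx d ∈ range (I + 1) := by
      intro d hd
      rw [mem_range, Nat.lt_succ_iff]
      refine Nat.floor_le_floor ?_
      have h := mem_Icc.1 hd
      have : Real.log d ≤ Real.log X := Real.log_le_log (by exact_mod_cast h.1) (by exact_mod_cast h.2)
      nlinarith
    rw [← Finset.sum_fiberwise_of_maps_to hmaps]
    refine (norm_sum_le _ _).trans ?_
    have hbl : ∀ i ∈ range (I+1), ‖∑ d ∈ Icc 1 X with idx d = i,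
        ∑ e ∈ Icc 1 (N (idx d)), a d * b e * f (d * e)‖ ≤ E2 := by
      intro i _
      by_cases hNi : N i < U
      · rw [Finset.sum_eq_zero]
        · simpa using hE2
        · intro d hd
          have h1 := (mem_filter.1 hd).2
          refine Finset.sum_eq_zero fun e he => ?_
          rw [h1] at he
          rw [hb0 e (by have := (mem_Icc.1 he).2; omega)]; ring
      push Not at hNi
      by_cases hMi : M i < U
      · rw [Finset.sum_eq_zero]
        · simpa using hE2
        · intro d hd
          have h1 := mem_filter.1 hd
          have h2 := hdM d (mem_Icc.1 h1.1).1
          rw [h1.2] at h2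
          refine Finset.sum_eq_zero fun e he => ?_
          rw [ha0 d (by omega)]; ring
      push Not at hMi
      have hMN : M i * N i ≤ X := Nat.mul_div_le X (M i)
      have hNX' : N i ≤ X := Nat.div_le_self _ _
      have := hII (M i) (N i) hMi hNi hMN (fun d => if d ≤ X ∧ idx d = i then a d else 0)
        (fun e => if e ≤ X then b e else 0)
        (by intro n; split_ifs; exacts [ha n, by simp])
        (by intro n; split_ifs with h; exacts [hb n h, by simp])
      refine le_trans (le_of_eq ?_) this
      congr 1
      rw [Finset.sum_filter]
      have e1 : ∑ m ∈ Icc 1 (M i), ∑ n ∈ Icc 1 (N i), (if m ≤ X ∧ idx m = i then a m else 0) *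
          (if n ≤ X then b n else 0) * f (m * n) = ∑ m ∈ Icc 1 (M i), if m ≤ X ∧ idx m = i then
            ∑ n ∈ Icc 1 (N i), a m * b n * f (m * n) else 0 := by
        refine Finset.sum_congr rfl fun m _ => ?_
        split_ifs with h
        · refine Finset.sum_congr rfl fun n hn => ?_
          rw [if_pos ((mem_Icc.1 hn).2.trans hNX')]
        · simp
      rw [e1, ← Finset.sum_filter, ← Finset.sum_filter]
      refine Finset.sum_congr ?_ ?_
      · ext d
        simp only [mem_filter, mem_Icc]
        constructor
        · rintro ⟨⟨h1, h2⟩, h3⟩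
          have := hdM d h1
          rw [h3] at this
          exact ⟨⟨h1, this⟩, h2, h3⟩
        · rintro ⟨⟨h1, h2⟩, h3, h4⟩
          exact ⟨⟨h1, h3⟩, h4⟩
      · intro d hd
        rw [(mem_filter.1 hd).2.2]
    refine (Finset.sum_le_sum hbl).trans ?_
    rw [Finset.sum_const, card_range, nsmul_eq_mul]
    refine mul_le_mul_of_nonneg_right ?_ hE2
    push_cast
    have := Nat.floor_le (a := D * Real.log X) (by positivity)
    linarith
  · refine (norm_sum_le _ _).trans ?_
    have hper : ∀ d ∈ Icc 1 X, ‖∑ e ∈ Ioc (N (idx d)) (X / d), a d * b e * f (d * e)‖ ≤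
        (X:ℝ) / D * (1 / d) + if d ≤ X / U then 1 else 0 := by
      intro d hd
      have hd1 := (mem_Icc.1 hd).1
      have hd0 : (0:ℝ) < d := by exact_mod_cast hd1
      by_cases hc : X / d ≤ U
      · rw [Finset.sum_eq_zero]
        · simp only [norm_zero]
          split_ifs <;> positivity
        · intro e he
          rw [hb0 e (by have := (mem_Ioc.1 he).2; omega)]; ring
      · push Not at hc
        have hdU : d ≤ X / U := by
          rw [Nat.le_div_iff_mul_le (by omega)]
          have h1 := (Nat.le_div_iff_mul_le hd1).1 hc.le
          linarith [Nat.mul_comm d U]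
        rw [if_pos hdU]
        refine (norm_sum_le_of_le _ (f := fun e => a d * b e * f (d * e)) (n := fun _ => (1:ℝ)) ?_).trans ?_
        · intro e he
          have heX : e ≤ X := (mem_Ioc.1 he).2.trans (Nat.div_le_self _ _)
          rw [norm_mul, norm_mul]
          have h1 := ha d
          have h2 := hb e heX
          have h3 := hf (d * e)
          calc ‖a d‖ * ‖b e‖ * ‖f (d * e)‖ ≤ 1 * 1 * 1 := by gcongr
            _ = 1 := by ring
        · rw [Finset.sum_const, Nat.card_Ioc, nsmul_eq_mul, mul_one, Nat.cast_sub (hNX d hd1)]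
          have h1 : ((X / d : ℕ) : ℝ) ≤ X / d := Nat.cast_div_le
          have hMpos : 0 < M (idx d) := lt_of_lt_of_le hd1 (hdM d hd1)
          have hMr : (0:ℝ) < M (idx d) := by exact_mod_cast hMpos
          have h2 : (X:ℝ) / M (idx d) - 1 ≤ (N (idx d) : ℝ) := by
            have := Nat.lt_div_mul_add (a := X) hMpos
            have h' : (X:ℝ) < (N (idx d) : ℝ) * M (idx d) + M (idx d) := by exact_mod_cast this
            rw [sub_le_iff_le_add, div_le_iff₀ hMr]
            nlinarith
          have h3 : (M (idx d) : ℝ) ≤ d * Real.exp (1 / D) := by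
            have h4 : (M (idx d) : ℝ) ≤ Real.exp ((idx d + 1 : ℝ) / D) := Nat.floor_le (Real.exp_pos _).le
            refine h4.trans ?_
            rw [add_div, Real.exp_add]
            refine mul_le_mul_of_nonneg_right ?_ (Real.exp_pos _).le
            have h5 : (idx d : ℝ) ≤ D * Real.log d := Nat.floor_le (by have := log_nonneg_nat d; positivity)
            calc Real.exp ((idx d : ℝ) / D) ≤ Real.exp (Real.log d) := by
                  apply Real.exp_le_exp.2
                  rw [div_le_iff₀ (by linarith)]; linarith
              _ = d := Real.exp_log hd0
          have h6 : (X:ℝ) / d * Real.exp (-(1/D)) ≤ X / M (idx d) := by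
            rw [Real.exp_neg, ← div_eq_mul_inv, div_div]
            gcongr
          have h7 : 1 - 1 / D ≤ Real.exp (-(1/D)) := by
            have := Real.add_one_le_exp (-(1/D)); linarith
          have h8 : (0:ℝ) ≤ X / d := by positivity
          have h9 : (X:ℝ) / D * (1 / d) = X / d * (1 / D) := by ring
          rw [h9]
          nlinarith
    refine (Finset.sum_le_sum hper).trans ?_
    rw [Finset.sum_add_distrib, ← Finset.mul_sum]
    refine add_le_add ?_ ?_
    · have := harmonic_le X hX1
      calc (X:ℝ) / D * ∑ i ∈ Icc 1 X, (1:ℝ) / i ≤ X / D * (1 + Real.log X) := by gcongr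
        _ = _ := by ring
    · rw [← Finset.sum_filter, Finset.sum_const, nsmul_eq_mul, mul_one]
      have : (Icc 1 X).filter (fun d => d ≤ X / U) ⊆ Icc 1 (X / U) := by
        intro d; simp only [mem_filter, mem_Icc]; omega
      have h1 := Finset.card_le_card this
      rw [Nat.card_Icc, Nat.add_sub_cancel] at h1
      calc _ ≤ ((X / U : ℕ) : ℝ) := by exact_mod_cast h1
        _ ≤ _ := Nat.cast_div_le

lemma vaughan_bound (f : ℕ → ℂ) (hf : ∀ n, ‖f n‖ ≤ 1) (X U : ℕ) (hU : 2 ≤ U) (hUX : U * U ≤ X)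
    (t : ℕ → ℝ) (E1 E2 D : ℝ) (hE2 : 0 ≤ E2) (hD : 1 ≤ D)
    (hI : ∀ m ∈ Icc 1 (U * U), ∀ y ≤ X / m, ‖∑ n ∈ Icc 1 y, f (m * n)‖ ≤ t m)
    (hE1 : ∑ m ∈ Icc 1 (U * U), t m ≤ E1)
    (hII : ∀ M N, U ≤ M → U ≤ N → M * N ≤ X → ∀ a b : ℕ → ℂ, (∀ n, ‖a n‖ ≤ 1) →
      (∀ n, ‖b n‖ ≤ 1) → ‖∑ m ∈ Icc 1 M, ∑ n ∈ Icc 1 N, a m * b n * f (m * n)‖ ≤ E2) :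
    ‖∑ n ∈ Icc 1 X, (vonMangoldt n : ℂ) * f n‖ ≤ U * Real.log X + 3 * Real.log X * E1 +
      Real.log X * ((D * Real.log X + 1) * E2 + X * (1 + Real.log X) / D + X / U) := by
  have hX1 : 1 < X := by nlinarith
  have hXr : (1:ℝ) < X := by exact_mod_cast hX1
  have hlX : 0 < Real.log X := Real.log_pos hXr
  have hlog : ∀ n : ℕ, n ≤ X → Real.log n ≤ Real.log X := by
    intro n hn
    rcases Nat.eq_zero_or_pos n with rfl | h0
    · simpa using hlX.le
    · exact Real.log_le_log (by exact_mod_cast h0) (by exact_mod_cast hn)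
  have ht : ∀ m ∈ Icc 1 (U * U), 0 ≤ t m := fun m hm =>
    (norm_nonneg _).trans (hI m hm 0 (Nat.zero_le _))
  have hid : ∀ n, vonMangoldt n = trunc U vonMangoldt n + (trunc U muR * ArithmeticFunction.log) n
      - ((trunc U muR * trunc U vonMangoldt) * zeR) n
      + ((muR - trunc U muR) * ((vonMangoldt - trunc U vonMangoldt) * zeR)) n := by
    intro n
    conv_lhs => rw [vaughan_id U]
    simp only [sub_eq_add_neg, ArithmeticFunction.add_apply, ArithmeticFunction.neg_apply]
  have hsum : ∑ n ∈ Icc 1 X, (vonMangoldt n : ℂ) * f n =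
      ∑ n ∈ Icc 1 X, ((trunc U vonMangoldt n : ℝ) : ℂ) * f n +
      ∑ n ∈ Icc 1 X, (((trunc U muR * ArithmeticFunction.log) n : ℝ) : ℂ) * f n -
      ∑ n ∈ Icc 1 X, ((((trunc U muR * trunc U vonMangoldt) * zeR) n : ℝ) : ℂ) * f n +
      ∑ n ∈ Icc 1 X, ((((muR - trunc U muR) * ((vonMangoldt - trunc U vonMangoldt) * zeR)) n : ℝ) : ℂ) * f n := by
    rw [← Finset.sum_add_distrib, ← Finset.sum_sub_distrib, ← Finset.sum_add_distrib]
    refine Finset.sum_congr rfl fun n _ => ?_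
    rw [hid n]; push_cast; ring
  have hUX' : U ≤ U * U := by nlinarith
  -- term 1
  have t1 : ‖∑ n ∈ Icc 1 X, ((trunc U vonMangoldt n : ℝ) : ℂ) * f n‖ ≤ U * Real.log X := by
    have h1 : ∀ n ∈ Icc 1 X, ‖((trunc U vonMangoldt n : ℝ) : ℂ) * f n‖ ≤
        if n ≤ U then Real.log X else 0 := by
      intro n hn
      rw [norm_mul, Complex.norm_real, trunc_apply]
      split_ifs with h
      · rw [Real.norm_of_nonneg vonMangoldt_nonneg]
        have h2 := vonMangoldt_le_log (n := n)
        have h3 := hlog n (mem_Icc.1 hn).2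
        have := hf n
        have h4 := vonMangoldt_nonneg (n := n)
        nlinarith [norm_nonneg (f n)]
      · simp
    refine (norm_sum_le_of_le _ h1).trans ?_
    rw [← Finset.sum_filter, Finset.sum_const, nsmul_eq_mul]
    refine mul_le_mul_of_nonneg_right ?_ hlX.le
    have : (Icc 1 X).filter (fun d => d ≤ U) ⊆ Icc 1 U := by
      intro d; simp only [mem_filter, mem_Icc]; omega
    have h1 := Finset.card_le_card this
    rw [Nat.card_Icc, Nat.add_sub_cancel] at h1
    exact_mod_cast h1
  have t2 : ‖∑ n ∈ Icc 1 X, (((trunc U muR * ArithmeticFunction.log) n : ℝ) : ℂ) * f n‖ ≤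
      2 * Real.log X * E1 := by
    rw [sum_mul_conv]
    have h1 : ∀ d ∈ Icc 1 X, ‖∑ e ∈ Icc 1 (X / d), ((trunc U muR d : ℝ) : ℂ) *
        ((ArithmeticFunction.log e : ℝ) : ℂ) * f (d * e)‖ ≤
        if d ≤ U * U then 2 * Real.log X * t d else 0 := by
      intro d hd
      simp_rw [mul_assoc]
      rw [← Finset.mul_sum, norm_mul, Complex.norm_real, trunc_apply]
      by_cases hdU : d ≤ U
      · rw [if_pos hdU, if_pos (hdU.trans hUX')]
        have hd' : d ∈ Icc 1 (U * U) := mem_Icc.2 ⟨(mem_Icc.1 hd).1, hdU.trans hUX'⟩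
        have h2 := log_partial (fun e => f (d * e)) (t d) (X / d) (fun z hz => hI d hd' z hz)
        have h3 := hlog (X / d) (Nat.div_le_self _ _)
        have h4 := muR_abs d
        rw [← Real.norm_eq_abs] at h4
        simp only [ArithmeticFunction.log_apply]
        have h5 := ht d hd'
        calc _ ≤ 1 * (2 * Real.log ((X / d : ℕ):ℝ) * t d) := by gcongr
          _ ≤ _ := by nlinarith
      · rw [if_neg hdU]
        simp only [norm_zero, zero_mul]
        split_ifs with h
        · have := ht d (mem_Icc.2 ⟨(mem_Icc.1 hd).1, h⟩)
          positivity
        · exact le_rfl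
    refine (norm_sum_le_of_le _ h1).trans ?_
    rw [← Finset.sum_filter, ← Finset.mul_sum]
    have : (Icc 1 X).filter (fun d => d ≤ U * U) = Icc 1 (U * U) := by
      ext d; simp only [mem_filter, mem_Icc]; omega
    rw [this]
    gcongr
  have t3 : ‖∑ n ∈ Icc 1 X, ((((trunc U muR * trunc U vonMangoldt) * zeR) n : ℝ) : ℂ) * f n‖ ≤
      Real.log X * E1 := by
    rw [sum_mul_conv]
    have h1 : ∀ d ∈ Icc 1 X, ‖∑ e ∈ Icc 1 (X / d), (((trunc U muR * trunc U vonMangoldt) d : ℝ) : ℂ) *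
        ((zeR e : ℝ) : ℂ) * f (d * e)‖ ≤
        if d ≤ U * U then Real.log X * t d else 0 := by
      intro d hd
      have h0 : ∀ e ∈ Icc 1 (X / d), (((trunc U muR * trunc U vonMangoldt) d : ℝ) : ℂ) *
        ((zeR e : ℝ) : ℂ) * f (d * e) = (((trunc U muR * trunc U vonMangoldt) d : ℝ) : ℂ) * f (d * e) := by
        intro e he
        rw [zeR_apply (by have := (mem_Icc.1 he).1; omega)]; push_cast; ring
      rw [Finset.sum_congr rfl h0, ← Finset.mul_sum, norm_mul, Complex.norm_real]
      split_ifs with hdU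
      · have hd' : d ∈ Icc 1 (U * U) := mem_Icc.2 ⟨(mem_Icc.1 hd).1, hdU⟩
        have h2 := hI d hd' (X / d) le_rfl
        have h3 := (c_bound U d).trans (hlog d (mem_Icc.1 hd).2)
        rw [← Real.norm_eq_abs] at h3
        gcongr
      · rw [c_zero U d (by omega)]; simp
    refine (norm_sum_le_of_le _ h1).trans ?_
    rw [← Finset.sum_filter, ← Finset.mul_sum]
    have : (Icc 1 X).filter (fun d => d ≤ U * U) = Icc 1 (U * U) := by
      ext d; simp only [mem_filter, mem_Icc]; omega
    rw [this]
    gcongr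
  have t4 : ‖∑ n ∈ Icc 1 X, ((((muR - trunc U muR) * ((vonMangoldt - trunc U vonMangoldt) * zeR)) n : ℝ) : ℂ) * f n‖ ≤
      Real.log X * ((D * Real.log X + 1) * E2 + X * (1 + Real.log X) / D + X / U) := by
    rw [sum_mul_conv]
    set B := (vonMangoldt - trunc U vonMangoldt) * zeR with hB
    have hmu : ∀ d, (muR - trunc U muR) d = if d ≤ U then 0 else muR d := by
      intro d
      rw [sub_eq_add_neg, ArithmeticFunction.add_apply, ArithmeticFunction.neg_apply, trunc_apply]
      split_ifs <;> ring
    have key := typeII_sum f hf X U hU hUX E2 D hE2 hD hII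
      (fun d => (((muR - trunc U muR) d : ℝ) : ℂ)) (fun e => ((B e / Real.log X : ℝ) : ℂ))
      (by
        intro n
        rw [Complex.norm_real, hmu]
        split_ifs
        · simp
        · exact muR_abs n)
      (by
        intro n hn
        rw [Complex.norm_real, Real.norm_of_nonneg (div_nonneg (b_bounds U n).1 hlX.le), div_le_one hlX]
        exact (b_bounds U n).2.trans (hlog n hn))
      (by intro n hn; rw [hmu, if_pos hn]; simp)
      (by intro n hn; rw [hB, b_zero U n hn]; simp)
    have e1 : ∑ d ∈ Icc 1 X, ∑ e ∈ Icc 1 (X / d), (((muR - trunc U muR) d : ℝ) : ℂ) * ((B e : ℝ) : ℂ) * f (d * e)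
        = (Real.log X : ℂ) * ∑ d ∈ Icc 1 X, ∑ e ∈ Icc 1 (X / d),
          (((muR - trunc U muR) d : ℝ) : ℂ) * ((B e / Real.log X : ℝ) : ℂ) * f (d * e) := by
      rw [Finset.mul_sum]
      refine Finset.sum_congr rfl fun d _ => ?_
      rw [Finset.mul_sum]
      refine Finset.sum_congr rfl fun e _ => ?_
      have : (Real.log X : ℂ) ≠ 0 := by exact_mod_cast hlX.ne'
      rw [Complex.ofReal_div]
      field_simp
    rw [e1, norm_mul, Complex.norm_real, Real.norm_of_nonneg hlX.le]
    exact mul_le_mul_of_nonneg_left key hlX.le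
  rw [hsum]
  calc _ ≤ _ + _ := norm_add_le _ _
    _ ≤ (_ + _) + _ := by gcongr; exact norm_sub_le _ _
    _ ≤ ((_ + _) + _) + _ := by gcongr; exact norm_add_le _ _
    _ ≤ _ := by linarith

end DS

namespace DS
open Finset ArithmeticFunction

lemma approx_spacing {γ : ℝ} {a : ℤ} {q : ℕ} (hq : 0 < q) (hcop : IsCoprime a (q:ℤ))
    (happ : |γ - a / q| ≤ 1 / (q:ℝ)^2) (r : ℕ) (hr : 0 < r) (hrB : r < q / 2 + 1) (_hq2 : 2 ≤ q) :
    1 / (2 * (q:ℝ)) ≤ nn (γ * r) := by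
  have hqr : (0:ℝ) < q := by exact_mod_cast hq
  have hnd : ¬ (q:ℤ) ∣ a * r := by
    intro h
    have h1 : (q:ℤ) ∣ (r:ℤ) := hcop.symm.dvd_of_dvd_mul_left h
    have h2 := Int.le_of_dvd (by exact_mod_cast hr) h1
    omega
  have h1 := nn_div_ge hq hnd
  have h2 : nn (((a * r : ℤ):ℝ) / q) ≤ nn (γ * r) + nn (((a * r : ℤ):ℝ) / q - γ * r) := by
    have := nn_add_le (γ * r) (((a * r : ℤ):ℝ) / q - γ * r)
    rwa [add_sub_cancel] at this
  have h3 : nn (((a * r : ℤ):ℝ) / q - γ * r) ≤ 1 / (2 * q) := by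
    refine (nn_le_abs _).trans ?_
    have e : ((a * r : ℤ):ℝ) / q - γ * r = -((γ - a / q) * r) := by push_cast; ring
    rw [e, abs_neg, abs_mul, Nat.abs_cast]
    have h4 : 2 * (r:ℝ) ≤ q := by exact_mod_cast (by omega : 2 * r ≤ q)
    calc |γ - a / q| * r ≤ 1 / (q:ℝ)^2 * (q / 2) := by gcongr; linarith
      _ = _ := by field_simp
  have e : 1 / (q:ℝ) = 1 / (2 * q) + 1 / (2 * q) := by field_simp; norm_num
  linarith

/-- bilinear bound for exponential -/
lemma vin_bilinear (γ : ℝ) (M N : ℕ) (K : ℝ)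
    (hK : ∀ s : ℝ, ∑ n ∈ Icc 1 N, mb M (γ * n + s) ≤ K)
    (a b : ℕ → ℂ) (ha : ∀ n, ‖a n‖ ≤ 1) (hb : ∀ n, ‖b n‖ ≤ 1) :
    ‖∑ m ∈ Icc 1 M, ∑ n ∈ Icc 1 N, a m * b n * ee (γ * ((m * n : ℕ):ℝ))‖ ^ 2 ≤ M * (N * K) := by
  set T : ℕ → ℂ := fun m => ∑ n ∈ Icc 1 N, b n * ee (γ * ((m * n : ℕ):ℝ)) with hT
  have h1 : ‖∑ m ∈ Icc 1 M, ∑ n ∈ Icc 1 N, a m * b n * ee (γ * ((m * n : ℕ):ℝ))‖ ≤ ∑ m ∈ Icc 1 M, ‖T m‖ := by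
    refine norm_sum_le_of_le _ fun m _ => ?_
    simp_rw [mul_assoc]
    rw [← Finset.mul_sum, norm_mul]
    have := ha m
    nlinarith [norm_nonneg (T m)]
  have h2 : (∑ m ∈ Icc 1 M, ‖T m‖)^2 ≤ M * ∑ m ∈ Icc 1 M, ‖T m‖^2 := by
    have := sq_sum_le_card_mul_sum_sq (s := Icc 1 M) (f := fun m => ‖T m‖)
    simpa using this
  have h3 : ((∑ m ∈ Icc 1 M, ‖T m‖^2 : ℝ) : ℂ) = ∑ n ∈ Icc 1 N, ∑ n' ∈ Icc 1 N,
      b n * (starRingEnd ℂ) (b n') * ∑ m ∈ Icc 1 M, ee (m * (γ * n + -(γ * n'))) := by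
    push_cast
    simp_rw [← Complex.mul_conj', hT, map_sum, Finset.sum_mul_sum, Finset.mul_sum]
    rw [Finset.sum_comm]
    refine Finset.sum_congr rfl fun n _ => ?_
    rw [Finset.sum_comm]
    refine Finset.sum_congr rfl fun n' _ => ?_
    refine Finset.sum_congr rfl fun m _ => ?_
    have : (m:ℝ) * (γ * n + -(γ * n')) = γ * ((m * n : ℕ):ℝ) - γ * ((m * n' : ℕ):ℝ) := by push_cast; ring
    rw [this, ee_sub, map_mul]; ring
  have h4 : ∑ m ∈ Icc 1 M, ‖T m‖^2 ≤ N * K := by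
    have h5 : ‖((∑ m ∈ Icc 1 M, ‖T m‖^2 : ℝ) : ℂ)‖ ≤ ∑ n' ∈ Icc 1 N, K := by
      rw [h3, Finset.sum_comm]
      refine norm_sum_le_of_le _ fun n' _ => ?_
      refine le_trans (norm_sum_le_of_le _ (n := fun n : ℕ => mb M (γ * n + -(γ * n'))) fun n _ => ?_) (hK (-(γ * n')))
      rw [norm_mul, norm_mul, RCLike.norm_conj]
      have g1 := norm_geom_Icc_le M (γ * n + -(γ * n'))
      have g2 := hb n
      have g3 := hb n'
      calc _ ≤ 1 * 1 * mb M (γ * n + -(γ * n')) := by gcongr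
        _ = _ := by ring
    rw [Complex.norm_real, Real.norm_of_nonneg (by positivity)] at h5
    simpa using h5
  have h0 := norm_nonneg (∑ m ∈ Icc 1 M, ∑ n ∈ Icc 1 N, a m * b n * ee (γ * ((m * n : ℕ):ℝ)))
  calc _ ≤ (∑ m ∈ Icc 1 M, ‖T m‖)^2 := by gcongr
    _ ≤ _ := h2
    _ ≤ _ := by gcongr

lemma vin_numA {L l Z : ℝ} (hZ : 0 ≤ Z) (hL : 3 ≤ L) (hl1 : 1 ≤ l) (hl : l ≤ 2 * L) :
    (L + 336 * L * l + L * ((L+1) * (6 * l) + (1 + L) + 1)) * Z ≤ (1100 * L^3) * Z := by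
  refine mul_le_mul_of_nonneg_right ?_ hZ
  have a1 : L * l ≤ L * (2 * L) := by gcongr
  have a2 : L * ((L+1) * (6 * l)) ≤ L * ((L+1) * (6 * (2 * L))) := by gcongr
  have a3 : 3 * L^2 ≤ L^3 := by
    have : L^3 = L * L^2 := by ring
    rw [this]; gcongr
  have a4 : 3 * L ≤ L^2 := by
    have : L^2 = L * L := by ring
    rw [this]; gcongr
  nlinarith

lemma vin_numB {q l P s1 s2 t y : ℝ} (hl1 : 1 ≤ l) (hq : 0 ≤ q) (hqP : q ≤ P) (hy0 : 0 ≤ y) (hy : y ≤ P)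
    (ht : t ≤ 2) (h1 : s1 ≤ 64 * q * l)
    (h2 : s2 ≤ (t + 1) * (8 * y + 8 * q * l)) : s1 + s2 ≤ 112 * l * P := by
  have s6 : (t + 1) * (8 * y + 8 * q * l) ≤ 3 * (8 * y + 8 * q * l) := by
    gcongr; linarith
  have s8 : q * l ≤ P * l := by gcongr
  have s9 : P ≤ P * l := by nlinarith
  nlinarith

lemma vin_numC {N M q l P : ℝ} (hl1 : 1 ≤ l) (hq : 0 < q) (hP : 0 ≤ P) (hN : N ≤ P) (hM : M ≤ P) (hqP : q ≤ P)
    (h : N * M / q ≤ P) : (2 * N / q + 1) * (4 * M + 8 * q * l) ≤ 36 * P * l := by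
  have g5 : (2 * N / q + 1) * (4 * M + 8 * q * l) = 8 * (N * M / q) + 16 * N * l + 4 * M + 8 * q * l := by
    field_simp; ring
  rw [g5]
  have h1 : N * l ≤ P * l := by gcongr
  have h2 : q * l ≤ P * l := by gcongr
  have h3 : P ≤ P * l := by nlinarith
  nlinarith

set_option maxHeartbeats 1000000 in
lemma vinogradov (γ : ℝ) (a : ℤ) (q X W : ℕ) (hW : 2 ≤ W) (hcop : IsCoprime a (q:ℤ))
    (happ : |γ - a / q| ≤ 1 / (q:ℝ)^2) (hq1 : W ^ 8 ≤ q) (hq2 : q * W ^ 8 ≤ X) :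
    ‖∑ n ∈ Icc 1 X, (vonMangoldt n : ℂ) * ee (γ * n)‖ ≤ 1100 * X * Real.log X ^ 3 / W := by
  have hW8 : 256 ≤ W ^ 8 := by
    calc 256 = 2 ^ 8 := by norm_num
      _ ≤ W ^ 8 := Nat.pow_le_pow_left hW 8
  have hq : 2 ≤ q := by omega
  have hWr : (2:ℝ) ≤ W := by exact_mod_cast hW
  have hqr : (2:ℝ) ≤ q := by exact_mod_cast hq
  have hX : 256 * 256 ≤ X := by nlinarith
  have hXr : (65536:ℝ) ≤ X := by exact_mod_cast hX
  set L := Real.log X with hL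
  have hL1 : 3 ≤ L := by
    rw [hL, Real.le_log_iff_exp_le (by linarith)]
    have : Real.exp 3 = Real.exp 1 ^ 3 := by rw [← Real.exp_nat_mul]; norm_num
    rw [this]
    have h1 := Real.exp_one_lt_d9
    have h2 := Real.exp_pos 1
    have : Real.exp 1 ^ 3 ≤ 3 ^ 3 := by gcongr; linarith
    linarith
  set l : ℝ := 1 + Real.log (2 * q) with hl
  have hq1r : (W:ℝ)^8 ≤ q := by exact_mod_cast hq1
  have hq2r : (q:ℝ) * (W:ℝ)^8 ≤ X := by exact_mod_cast hq2
  have hW8r : (256:ℝ) ≤ (W:ℝ)^8 := by exact_mod_cast hW8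
  have hl1 : 1 ≤ l := by
    have := Real.log_nonneg (x := 2 * q) (by linarith)
    linarith
  have hlL : l ≤ 2 * L := by
    have h0 : 2 * (q:ℝ) ≤ X := by nlinarith
    have : Real.log (2 * q) ≤ L := Real.log_le_log (by linarith) h0
    linarith
  set B := q / 2 + 1 with hB
  have hsp := fun r hr hrB => approx_spacing (by omega) hcop happ r hr hrB hq
  have hBr : (q:ℝ) / 2 ≤ B := by
    have : q ≤ 2 * B := by omega
    have : (q:ℝ) ≤ 2 * B := by exact_mod_cast this
    linarith
  have hδ1 : 1 / (2 * (q:ℝ)) ≤ 1 := by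
    rw [div_le_one (by linarith)]; linarith
  have hδl : 1 + Real.log (1 / (1 / (2 * (q:ℝ)))) = l := by rw [one_div_one_div]
  have hδd : 4 / (1 / (2 * (q:ℝ))) = 8 * q := by field_simp; norm_num
  -- general block bound
  have blk : ∀ (M : ℝ), 0 ≤ M → ∀ (A N : ℕ) (s : ℝ), ∑ n ∈ Ico A (A + N), mb M (γ * n + s) ≤
      (2 * N / q + 1) * (4 * M + 8 * q * l) := by
    intro M hM A N s
    have h := ap_sum (η := γ) (τ := s) (B := B) (by omega) (δ := 1 / (2 * (q:ℝ))) (by positivity) hδ1 hsp hM A N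
    rw [hδl, hδd] at h
    refine h.trans ?_
    refine mul_le_mul_of_nonneg_right ?_ (by positivity)
    have : (N:ℝ) / B ≤ 2 * N / q := by
      rw [div_le_div_iff₀ (by positivity) (by positivity)]
      have : (0:ℝ) ≤ N := Nat.cast_nonneg N
      nlinarith
    linarith
  set U := W ^ 4 with hU
  have hUr : ((U:ℕ):ℝ) = (W:ℝ)^4 := by rw [hU]; push_cast; ring
  have hUU : (W:ℝ)^8 = (U:ℝ) * U := by rw [hUr]; ring
  have hU2 : 2 ≤ U := hW.trans (Nat.le_self_pow (by norm_num) W)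
  have hU0 : (2:ℝ) ≤ U := by exact_mod_cast hU2
  have hWU : (W:ℝ)^2 * W^2 = U := by rw [hUr]; ring
  rw [hUU] at hq1r hq2r hW8r
  have hq0 : (0:ℝ) < q := by linarith
  have hMM : ∀ y : ℕ, ∀ M : ℝ, (y:ℝ) ≤ M → ∀ m, ‖∑ n ∈ Icc 1 y, ee (γ * ((m * n : ℕ):ℝ))‖ ≤ mb M (γ * m) := by
    intro y M hy m
    have h := norm_geom_Icc_le y (γ * m)
    have e : ∀ n : ℕ, γ * ((m * n : ℕ):ℝ) = n * (γ * m) := by intro n; push_cast; ring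
    simp_rw [e]
    exact h.trans (mb_mono (Nat.cast_nonneg y) hy _)
  have key := vaughan_bound (fun n => ee (γ * n)) (fun n => by simp) X U hU2
    (by
      have : (U:ℝ) * U ≤ X := hq1r.trans (le_trans (le_mul_of_one_le_right hq0.le (by linarith)) hq2r)
      exact_mod_cast this)
    (fun m => mb (X / m) (γ * m)) (112 * l * X / (U * U)) (6 * X * l / W^2) W
    (by positivity) (by linarith)
    (by
      intro m hm y hy
      refine hMM y _ ?_ m
      exact (Nat.cast_le.2 hy).trans Nat.cast_div_le)
    (by
      have hsub : Icc 1 (U * U) ⊆ Ico 1 (1 + (B - 1)) ∪ Ico B (B + U * U) := by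
        intro m; simp only [mem_Icc, mem_union, mem_Ico]; omega
      have hnn : ∀ m : ℕ, 0 ≤ mb (X / m) (γ * m) := fun m => mb_nonneg (by positivity) _
      refine (Finset.sum_le_sum_of_subset_of_nonneg hsub (fun m _ _ => hnn m)).trans ?_
      rw [Finset.sum_union (by rw [Finset.disjoint_left]; intro m; simp only [mem_Ico]; omega)]
      have s1 : ∑ m ∈ Ico 1 (1 + (B - 1)), mb (X / m) (γ * m) ≤ 64 * q * l := by
        have h1 : ∀ m ∈ Ico 1 (1 + (B - 1)), mb (X / m) (γ * m) ≤ 2 * mb (2 * q) (γ * m + 0) := by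
          intro m hm
          have hm' := mem_Ico.1 hm
          have h2 := hsp m (by omega) (by omega)
          have h3 : 0 < nn (γ * m) := lt_of_lt_of_le (by positivity) h2
          have h4 := mb_le_div (M := X / m) (by positivity) h3 le_rfl
          have h5 := div_le_mb (M := 2 * q) (d := 1 / (2 * (q:ℝ))) (by positivity) h2 (by rw [one_div_one_div])
          rw [add_zero]
          calc _ ≤ _ := h4
            _ = 2 * (1 / nn (γ * m)) := by ring
            _ ≤ _ := by gcongr
        refine (Finset.sum_le_sum h1).trans ?_
        rw [← Finset.mul_sum]
        have h2 := blk (2 * q) (by positivity) 1 (B - 1) 0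
        have h3 : 2 * ((B - 1 : ℕ):ℝ) / q ≤ 1 := by
          rw [div_le_one hq0]
          have : 2 * (B - 1) ≤ q := by omega
          exact_mod_cast this
        have h4 : (2 * ((B - 1 : ℕ):ℝ) / q + 1) * (4 * (2 * q) + 8 * q * l) ≤ 2 * (4 * (2 * q) + 8 * q * l) := by
          gcongr; linarith
        calc _ ≤ 2 * (2 * (4 * (2 * (q:ℝ)) + 8 * q * l)) := by gcongr; exact h2.trans h4
          _ ≤ 64 * q * l := by
            have : (q:ℝ) ≤ q * l := le_mul_of_one_le_right hq0.le hl1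
            linarith
      have s2 : ∑ m ∈ Ico B (B + U * U), mb (X / m) (γ * m) ≤ (2 * ((U * U : ℕ):ℝ) / q + 1) * (4 * (2 * X / q) + 8 * q * l) := by
        refine le_trans (Finset.sum_le_sum fun m hm => ?_) (blk (2 * X / q) (by positivity) B (U * U) 0)
        rw [add_zero]
        refine mb_mono (by positivity) ?_ _
        have hm' : B ≤ m := (mem_Ico.1 hm).1
        have : (q:ℝ) / 2 ≤ m := hBr.trans (by exact_mod_cast hm')
        rw [div_le_div_iff₀ (by linarith) hq0]
        have hX0 : (0:ℝ) ≤ X := by linarith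
        calc (X:ℝ) * q = X * (2 * (q / 2)) := by ring
          _ ≤ X * (2 * m) := by gcongr
          _ = 2 * X * m := by ring
      have s3 : (q:ℝ) ≤ X / (U * U) := by rw [le_div_iff₀ (by nlinarith)]; exact hq2r
      have s4 : (X:ℝ) / q ≤ X / (U * U) := by gcongr
      have s5 : 2 * ((U * U : ℕ):ℝ) / q ≤ 2 := by
        push_cast
        rw [div_le_iff₀ hq0]; linarith
      have e1 : 4 * (2 * (X:ℝ) / q) = 8 * (X / q) := by ring
      have e2 : 112 * l * X / ((U:ℝ) * U) = 112 * l * (X / (U * U)) := by ring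
      rw [e1] at s2
      rw [e2]
      exact vin_numB hl1 hq0.le s3 (by positivity) s4 s5 s1 s2)
    (by
      intro M N hM hN hMN a b ha hb
      have hMr : (U:ℝ) ≤ M := by exact_mod_cast hM
      have hNr : (U:ℝ) ≤ N := by exact_mod_cast hN
      have hMNr : (M:ℝ) * N ≤ X := by exact_mod_cast hMN
      have h := vin_bilinear γ M N ((2 * N / q + 1) * (4 * M + 8 * q * l)) (by
        intro s
        have := blk M (by positivity) 1 N s
        have e : Ico 1 (1 + N) = Icc 1 N := by ext; simp only [mem_Ico, mem_Icc]; omega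
        rwa [e] at this) a b ha hb
      refine abs_le_of_sq_le_sq' ?_ (by positivity) |>.2
      refine h.trans ?_
      have hX0 : (0:ℝ) ≤ X := by linarith
      -- M*N*(...) ≤ 36 X^2 l / U
      have hU0' : (0:ℝ) < U := by linarith
      have g1 : (N:ℝ) ≤ X / U := by
        rw [le_div_iff₀ hU0']
        calc (N:ℝ) * U ≤ N * M := by gcongr
          _ = M * N := mul_comm _ _
          _ ≤ X := hMNr
      have g2 : (M:ℝ) ≤ X / U := by
        rw [le_div_iff₀ hU0']
        calc (M:ℝ) * U ≤ M * N := by gcongr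
          _ ≤ X := hMNr
      have hUq : (U:ℝ) ≤ q := by
        refine le_trans ?_ hq1r
        calc (U:ℝ) = 1 * U := by ring
          _ ≤ U * U := by gcongr; linarith
      have g3 : (q:ℝ) ≤ X / U := by
        rw [le_div_iff₀ hU0']
        refine le_trans ?_ hq2r
        gcongr
        calc (U:ℝ) = 1 * U := by ring
          _ ≤ U * U := by gcongr; linarith
      have g4 : (N:ℝ) * M / q ≤ X / U := by
        rw [mul_comm (N:ℝ)]
        gcongr
      have g6 : (2 * (N:ℝ) / q + 1) * (4 * M + 8 * q * l) ≤ 36 * (X / U) * l :=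
        vin_numC hl1 hq0 (by positivity) g1 g2 g3 g4
      calc (M:ℝ) * (N * ((2 * N / q + 1) * (4 * M + 8 * q * l))) = (M * N) * ((2 * N / q + 1) * (4 * M + 8 * q * l)) := by ring
        _ ≤ X * (36 * (X / U) * l) := by gcongr
        _ = (6 * X / W^2)^2 * l := by rw [← hWU]; field_simp; norm_num
        _ ≤ (6 * X / W^2)^2 * l^2 := by gcongr; nlinarith
        _ = (6 * X * l / W ^ 2) ^ 2 := by ring)
  refine key.trans ?_
  have hZ : (0:ℝ) < X / W := by positivity
  have hUW : (W:ℝ) ≤ U := by rw [hUr]; exact le_self_pow₀ (by linarith) (by norm_num)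
  have c1 : (U:ℝ) ≤ X / W := by
    rw [le_div_iff₀ (by linarith)]
    calc (U:ℝ) * W ≤ U * U := by gcongr
      _ ≤ q := hq1r
      _ ≤ q * (U * U) := by nlinarith
      _ ≤ X := hq2r
  have c2 : 112 * l * X / ((U:ℝ) * U) ≤ 112 * l * (X / W) := by
    have : X / ((U:ℝ) * U) ≤ X / W := by
      apply div_le_div_of_nonneg_left (by linarith) (by linarith)
      calc (W:ℝ) ≤ U := hUW
        _ = 1 * U := by ring
        _ ≤ U * U := by gcongr; linarith
    calc _ = 112 * l * (X / ((U:ℝ) * U)) := by ring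
      _ ≤ _ := by gcongr
  have c3 : (W * L + 1) * (6 * X * l / W^2) ≤ (L + 1) * (6 * l) * (X / W) := by
    have : W * L + 1 ≤ W * (L + 1) := by rw [mul_add]; linarith
    calc (W * L + 1) * (6 * X * l / W^2) ≤ (W * (L + 1)) * (6 * X * l / W^2) := by gcongr
      _ = _ := by field_simp
  have c4 : (X:ℝ) / U ≤ X / W := by gcongr
  have c5 : (X:ℝ) * (1 + L) / W = (1 + L) * (X / W) := by ring
  rw [c5]
  have e : 1100 * X * L ^ 3 / W = 1100 * L^3 * (X / W) := by ring
  rw [e]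
  set Z := (X:ℝ) / W
  have hL2 : 9 ≤ L^2 := by nlinarith
  calc _ ≤ Z * L + 3 * L * (112 * l * Z) + L * ((L + 1) * (6 * l) * Z + (1 + L) * Z + Z) := by gcongr
    _ = (L + 336 * L * l + L * ((L+1) * (6 * l) + (1 + L) + 1)) * Z := by ring
    _ ≤ (1100 * L^3) * Z := vin_numA hZ.le hL1 hl1 hlL

end DS

namespace DS
open Finset

lemma ee_eq_one_iff {j : ℤ} {Q : ℕ} (hQ : 0 < Q) : ee ((j:ℝ) / Q) = 1 ↔ (Q:ℤ) ∣ j := by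
  constructor
  · intro h
    by_contra hn
    have h1 := nn_div_ge hQ hn
    have h2 := norm_one_sub_ee_ge ((j:ℝ)/Q)
    rw [h, sub_self, norm_zero] at h2
    have : (0:ℝ) < 1 / Q := by positivity
    linarith
  · rintro ⟨m, rfl⟩
    have : (((Q:ℤ) * m : ℤ) : ℝ) / Q = (m:ℤ) := by push_cast; field_simp
    rw [this, ee_int]

lemma orth {Q : ℕ} (hQ : 0 < Q) (j : ℤ) :
    ∑ k ∈ range Q, ee ((k:ℝ) * ((j:ℝ) / Q)) = if (Q:ℤ) ∣ j then (Q:ℂ) else 0 := by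
  simp_rw [ee_nat_mul]
  split_ifs with h
  · rw [(ee_eq_one_iff hQ).2 h]; simp
  · have h1 : ee ((j:ℝ)/Q) ≠ 1 := fun h2 => h ((ee_eq_one_iff hQ).1 h2)
    rw [geom_sum_eq h1, ← ee_nat_mul]
    have : (Q:ℝ) * ((j:ℝ) / Q) = (j:ℤ) := by field_simp
    rw [this, ee_int]; simp

noncomputable def Fr (Q : ℕ) (h : ℕ → ℂ) (θ : ℝ) : ℂ := (1 / (Q:ℂ)) * ∑ u ∈ range Q, h u * ee (-(θ * u))

lemma Fr_add_int (Q : ℕ) (h : ℕ → ℂ) (θ : ℝ) (m : ℤ) : Fr Q h (θ + m) = Fr Q h θ := by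
  unfold Fr
  congr 1
  refine Finset.sum_congr rfl fun u _ => ?_
  have : -((θ + m) * u) = -(θ * u) + ((-(m * u) : ℤ):ℝ) := by push_cast; ring
  rw [this, ee_add_int]

lemma Fr_norm_le (Q : ℕ) (h : ℕ → ℂ) (θ : ℝ) (hh : ∀ u, ‖h u‖ ≤ 1) : ‖Fr Q h θ‖ ≤ 1 := by
  unfold Fr
  rcases Nat.eq_zero_or_pos Q with rfl | hQ
  · simp
  rw [norm_mul]
  have : ‖∑ u ∈ range Q, h u * ee (-(θ * u))‖ ≤ ∑ u ∈ range Q, (1:ℝ) :=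
    norm_sum_le_of_le _ fun u _ => by rw [norm_mul, norm_ee, mul_one]; exact hh u
  simp only [sum_const, card_range, nsmul_eq_mul, mul_one] at this
  have hQr : (0:ℝ) < Q := by exact_mod_cast hQ
  have e : ‖1 / (Q:ℂ)‖ = 1 / (Q:ℝ) := by simp
  rw [e, div_mul_eq_mul_div, one_mul, div_le_one hQr]
  exact this

lemma dft_inv {Q : ℕ} (hQ : 0 < Q) (h : ℕ → ℂ) (n : ℕ) (hp : h (n % Q) = h n) :
    h n = ∑ k ∈ range Q, Fr Q h ((k:ℝ) / Q) * ee ((k:ℝ) * n / Q) := by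
  have hQc : (Q:ℂ) ≠ 0 := by exact_mod_cast hQ.ne'
  have e1 : ∑ k ∈ range Q, Fr Q h ((k:ℝ) / Q) * ee ((k:ℝ) * n / Q) =
      (1 / (Q:ℂ)) * ∑ u ∈ range Q, h u * ∑ k ∈ range Q, ee ((k:ℝ) * ((((n:ℤ) - (u:ℤ) : ℤ):ℝ) / Q)) := by
    unfold Fr
    simp_rw [mul_assoc]
    rw [← Finset.mul_sum]
    congr 1
    simp_rw [Finset.sum_mul, Finset.mul_sum]
    rw [Finset.sum_comm]
    refine Finset.sum_congr rfl fun u _ => Finset.sum_congr rfl fun k _ => ?_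
    rw [mul_assoc, ← ee_add]
    congr 2
    push_cast; ring
  rw [e1]
  simp_rw [orth hQ]
  rw [Finset.sum_eq_single (n % Q)]
  · have : (Q:ℤ) ∣ (n:ℤ) - ((n % Q : ℕ):ℤ) := by
      push_cast
      exact Int.dvd_self_sub_emod
    rw [if_pos this, hp]; field_simp
  · intro u hu hne
    rw [if_neg, mul_zero]
    intro hd
    apply hne
    have h1 : (u:ℤ) ≡ n [ZMOD Q] := (Int.modEq_iff_dvd).2 hd
    have h2 : u ≡ n [MOD Q] := (Int.natCast_modEq_iff).1 h1
    rw [← h2, Nat.mod_eq_of_lt (mem_range.1 hu)]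
  · intro hn
    exact absurd (mem_range.2 (Nat.mod_lt _ hQ)) hn

lemma parseval {Q : ℕ} (hQ : 0 < Q) (h : ℕ → ℂ) (θ : ℝ) :
    ∑ k ∈ range Q, ‖Fr Q h (θ + (k:ℝ) / Q)‖ ^ 2 = (1 / (Q:ℝ)) * ∑ u ∈ range Q, ‖h u‖ ^ 2 := by
  have hQc : (Q:ℂ) ≠ 0 := by exact_mod_cast hQ.ne'
  have e : ((∑ k ∈ range Q, ‖Fr Q h (θ + (k:ℝ) / Q)‖ ^ 2 : ℝ) : ℂ) =
      (((1 / (Q:ℝ)) * ∑ u ∈ range Q, ‖h u‖ ^ 2 : ℝ) : ℂ) := by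
    push_cast
    simp_rw [← Complex.mul_conj']
    have e1 : ∀ k ∈ range Q, Fr Q h (θ + (k:ℝ) / Q) * (starRingEnd ℂ) (Fr Q h (θ + (k:ℝ) / Q)) =
        (1 / (Q:ℂ)) * (1 / (Q:ℂ)) * ∑ u ∈ range Q, ∑ v ∈ range Q,
          h u * (starRingEnd ℂ) (h v) * ee (-(θ * u) + θ * v) * ee ((k:ℝ) * ((((v:ℤ) - (u:ℤ) : ℤ):ℝ) / Q)) := by
      intro k _
      unfold Fr
      rw [map_mul, map_sum, mul_mul_mul_comm, Finset.sum_mul_sum]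
      congr 1
      · simp
      refine Finset.sum_congr rfl fun u _ => Finset.sum_congr rfl fun v _ => ?_
      rw [map_mul, conj_ee, mul_assoc (h u * _), ← ee_add, mul_mul_mul_comm, ← ee_add]
      congr 2
      push_cast; ring
    rw [Finset.sum_congr rfl e1, ← Finset.mul_sum, Finset.sum_comm]
    have e2 : ∀ u ∈ range Q, ∑ k ∈ range Q, ∑ v ∈ range Q,
          h u * (starRingEnd ℂ) (h v) * ee (-(θ * u) + θ * v) * ee ((k:ℝ) * ((((v:ℤ) - (u:ℤ) : ℤ):ℝ) / Q))
          = (Q:ℂ) * (h u * (starRingEnd ℂ) (h u)) := by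
      intro u hu
      rw [Finset.sum_comm]
      simp_rw [← Finset.mul_sum, orth hQ]
      rw [Finset.sum_eq_single u]
      · simp; ring
      · intro v hv hne
        rw [if_neg, mul_zero]
        intro hd
        apply hne
        have h1 : (u:ℤ) ≡ v [ZMOD Q] := (Int.modEq_iff_dvd).2 hd
        have h2 : u ≡ v [MOD Q] := (Int.natCast_modEq_iff).1 h1
        exact (Nat.ModEq.eq_of_lt_of_lt h2 (mem_range.1 hu) (mem_range.1 hv)).symm
      · intro hn; exact absurd hu hn
    rw [Finset.sum_congr rfl e2, ← Finset.mul_sum]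
    field_simp
  exact_mod_cast e

lemma sum_range_mul_split {β : Type*} [AddCommMonoid β] (A B : ℕ) (F : ℕ → β) :
    ∑ u ∈ range (A * B), F u = ∑ v ∈ range B, ∑ w ∈ range A, F (w + A * v) := by
  induction B with
  | zero => simp
  | succ B ih =>
    rw [Nat.mul_succ, Finset.sum_range_add, Finset.sum_range_succ, ih]
    congr 1
    exact Finset.sum_congr rfl fun w _ => by rw [add_comm]

end DS

namespace DS
open Finset ArithmeticFunction

/-- `h` is a trigonometric polynomial with frequencies in `(1/Q) ℤ` and coefficient sum at most `K` -/
def AB (Q : ℕ) (h : ℕ → ℂ) (K : ℝ) : Prop :=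
  ∃ (ι : Type) (_ : Fintype ι) (k : ι → ℤ) (c : ι → ℂ),
    (∀ n : ℕ, h n = ∑ i, c i * ee ((k i : ℝ) * n / Q)) ∧ ∑ i, ‖c i‖ ≤ K

lemma AB.mono {Q : ℕ} {h : ℕ → ℂ} {K K' : ℝ} (H : AB Q h K) (hK : K ≤ K') : AB Q h K' := by
  obtain ⟨ι, _, k, c, h1, h2⟩ := H
  exact ⟨ι, _, k, c, h1, h2.trans hK⟩

lemma AB.const (Q : ℕ) (z : ℂ) : AB Q (fun _ => z) ‖z‖ :=
  ⟨Unit, inferInstance, fun _ => 0, fun _ => z, fun n => by simp, by simp⟩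

lemma AB.add {Q : ℕ} {h h' : ℕ → ℂ} {K K' : ℝ} (H : AB Q h K) (H' : AB Q h' K') :
    AB Q (fun n => h n + h' n) (K + K') := by
  obtain ⟨ι, _, k, c, h1, h2⟩ := H
  obtain ⟨ι', _, k', c', h1', h2'⟩ := H'
  refine ⟨ι ⊕ ι', inferInstance, Sum.elim k k', Sum.elim c c', fun n => ?_, ?_⟩
  · beta_reduce; rw [h1, h1', Fintype.sum_sum_type]; rfl
  · rw [Fintype.sum_sum_type]; exact add_le_add h2 h2'

lemma AB.mul {Q : ℕ} {h h' : ℕ → ℂ} {K K' : ℝ} (hK : 0 ≤ K) (H : AB Q h K) (H' : AB Q h' K') :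
    AB Q (fun n => h n * h' n) (K * K') := by
  obtain ⟨ι, _, k, c, h1, h2⟩ := H
  obtain ⟨ι', _, k', c', h1', h2'⟩ := H'
  refine ⟨ι × ι', inferInstance, fun p => k p.1 + k' p.2, fun p => c p.1 * c' p.2, fun n => ?_, ?_⟩
  · beta_reduce; rw [h1, h1', Fintype.sum_prod_type, Finset.sum_mul_sum]
    refine Finset.sum_congr rfl fun i _ => Finset.sum_congr rfl fun j _ => ?_
    have : ((k i + k' j : ℤ):ℝ) * n / Q = (k i : ℝ) * n / Q + (k' j : ℝ) * n / Q := by push_cast; ring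

    rw [this, ee_add]; ring
  · rw [Fintype.sum_prod_type]
    simp_rw [norm_mul]
    rw [← Finset.sum_mul_sum]
    exact mul_le_mul h2 h2' (Finset.sum_nonneg fun _ _ => norm_nonneg _) hK

lemma AB.sum {Q : ℕ} {α : Type*} (s : Finset α) {h : α → ℕ → ℂ} {K : α → ℝ}
    (H : ∀ a ∈ s, AB Q (h a) (K a)) : AB Q (fun n => ∑ a ∈ s, h a n) (∑ a ∈ s, K a) := by
  classical
  induction s using Finset.induction_on with
  | empty => simpa using AB.const Q 0
  | insert a s ha ih =>
    simp_rw [Finset.sum_insert ha]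
    exact (H a (mem_insert_self _ _)).add (ih fun b hb => H b (mem_insert_of_mem hb))

lemma AB.pow {Q : ℕ} {h : ℕ → ℂ} {K : ℝ} (hK : 0 ≤ K) (H : AB Q h K) (d : ℕ) :
    AB Q (fun n => h n ^ d) (K ^ d) := by
  induction d with
  | zero => simpa using AB.const Q 1
  | succ d ih => simp_rw [pow_succ]; exact AB.mul (by positivity) ih H

lemma AB.lift {Q : ℕ} (R : ℕ) (hR : 0 < R) {h : ℕ → ℂ} {K : ℝ} (H : AB Q h K) : AB (Q * R) h K := by
  obtain ⟨ι, _, k, c, h1, h2⟩ := H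
  refine ⟨ι, inferInstance, fun i => k i * R, c, fun n => ?_, h2⟩
  rw [h1]
  refine Finset.sum_congr rfl fun i _ => ?_
  have hR' : (R:ℝ) ≠ 0 := by exact_mod_cast hR.ne'
  congr 2
  push_cast
  rcases Nat.eq_zero_or_pos Q with rfl | hQ
  · simp
  · have : (Q:ℝ) ≠ 0 := by exact_mod_cast hQ.ne'
    field_simp

lemma AB.of_dft {Q : ℕ} (hQ : 0 < Q) {h : ℕ → ℂ} (hp : ∀ n, h (n % Q) = h n) {K : ℝ}
    (hK : ∑ k ∈ range Q, ‖Fr Q h ((k:ℝ)/Q)‖ ≤ K) : AB Q h K := by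
  refine ⟨Fin Q, inferInstance, fun i => (i:ℕ), fun i => Fr Q h (((i:ℕ):ℝ)/Q), fun n => ?_, ?_⟩
  · rw [dft_inv hQ h n (hp n), Finset.sum_range]; simp
  · rw [Finset.sum_range] at hK; exact hK

/-- digit -/
def dg (g j n : ℕ) : ℕ := n / g ^ j % g

lemma dg_split (g j c w : ℕ) (hc : c < g) (hw : w < g ^ j) : dg g j (w + g ^ j * c) = c := by
  unfold dg
  have : 0 < g ^ j := by omega
  rw [Nat.add_mul_div_left _ _ this, Nat.div_eq_of_lt hw, zero_add, Nat.mod_eq_of_lt hc]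

lemma dg_lt {g : ℕ} (hg : 0 < g) (j n : ℕ) : dg g j n < g := Nat.mod_lt _ hg

lemma dg_mod_pow (g : ℕ) {j k : ℕ} (h : j < k) (n : ℕ) : dg g j (n % g ^ k) = dg g j n := by
  unfold dg
  obtain ⟨i, rfl⟩ : ∃ i, k = j + 1 + i := ⟨k - (j+1), by omega⟩
  have e : g ^ (j + 1 + i) = g ^ j * (g * g ^ i) := by ring
  rw [e, Nat.mod_mul_right_div_self, Nat.mod_mul_right_mod]

lemma ab_dig {g : ℕ} (hg : 2 ≤ g) (j : ℕ) :
    AB (g ^ (j+1)) (fun n => (dg g j n : ℂ)) (16 * (g:ℝ)^2 * (1 + Real.log ((g:ℝ) ^ (j+1)))) := by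
  set m := g ^ (j+1) with hm
  have hm0 : 0 < m := by positivity
  have hmr : (0:ℝ) < m := by exact_mod_cast hm0
  have hmg : m = g ^ j * g := by rw [hm, pow_succ]
  refine AB.of_dft hm0 (fun n => by rw [dg_mod_pow g (Nat.lt_succ_self j)]) ?_
  have hb : ∀ k ∈ range m, ‖Fr m (fun n => (dg g j n : ℂ)) ((k:ℝ)/m)‖ ≤ (g:ℝ)^2 / m * mb m ((1/m:ℝ) * k + 0) := by
    intro k _
    unfold Fr
    have e0 : ‖1 / (m:ℂ)‖ = 1 / (m:ℝ) := by simp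
    rw [norm_mul, e0]
    have h1 : ‖∑ u ∈ range m, (dg g j u : ℂ) * ee (-((k:ℝ)/m * u))‖ ≤ ∑ c ∈ range g, (g:ℝ) * mb m ((1/m:ℝ) * k + 0) := by
      conv_lhs => rw [hmg, sum_range_mul_split]
      refine norm_sum_le_of_le _ fun c hc => ?_
      have e1 : ∀ w ∈ range (g ^ j), (dg g j (w + g ^ j * c) : ℂ) * ee (-((k:ℝ)/((g^j * g : ℕ):ℝ) * ((w + g ^ j * c : ℕ):ℝ))) =
          ((c:ℂ) * ee (-((k:ℝ)/m * (g ^ j * c)))) * ee (w * (-((k:ℝ)/m))) := by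
        intro w hw
        rw [dg_split g j c w (mem_range.1 hc) (mem_range.1 hw), mul_assoc, ← ee_add, ← hmg]
        congr 2
        push_cast; ring
      rw [Finset.sum_congr rfl e1, ← Finset.mul_sum, norm_mul, norm_mul, norm_ee, mul_one]
      have h2 := norm_geom_le (g ^ j) (-((k:ℝ)/m))
      have h3 : mb ((g ^ j : ℕ):ℝ) (-((k:ℝ)/m)) ≤ mb m (-((k:ℝ)/m)) := by
        refine mb_mono (by positivity) ?_ _
        rw [hm]; push_cast
        exact pow_le_pow_right₀ (by exact_mod_cast (by omega : 1 ≤ g)) (Nat.le_succ j)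
      have h4 : mb m (-((k:ℝ)/m)) = mb m ((1/m:ℝ) * k + 0) := by
        unfold mb; rw [nn_neg]; congr 4; ring
      rw [h4] at h3
      have h5 : ‖(c:ℂ)‖ ≤ g := by
        rw [Complex.norm_natCast]
        exact_mod_cast (mem_range.1 hc).le
      exact mul_le_mul h5 (h2.trans h3) (norm_nonneg _) (by positivity)
    rw [Finset.sum_const, card_range, nsmul_eq_mul] at h1
    calc _ ≤ 1 / (m:ℝ) * (g * (g * mb m ((1/m:ℝ) * k + 0))) := by gcongr
      _ = _ := by ring
  refine (Finset.sum_le_sum hb).trans ?_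
  rw [← Finset.mul_sum]
  have h := ap_sum (η := 1 / (m:ℝ)) (τ := 0) (B := m) hm0 (δ := 1 / (m:ℝ)) (by positivity)
    (by rw [div_le_one hmr]; exact_mod_cast hm0) (by
      intro r h0 hr
      have : ¬ (m:ℤ) ∣ (r:ℤ) := by
        intro hd
        have := Int.le_of_dvd (by exact_mod_cast h0) hd
        omega
      have := nn_div_ge hm0 this
      have e : 1 / (m:ℝ) * r = ((r:ℤ):ℝ) / m := by push_cast; ring
      rw [e]; exact this) (M := m) hmr.le 0 m
  have e1 : Ico 0 (0 + m) = range m := by simp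
  rw [e1, one_div_one_div, div_self hmr.ne'] at h
  have hlog : Real.log m = Real.log ((g:ℝ)^(j+1)) := by rw [hm]; push_cast; rfl
  have hl0 : 0 ≤ Real.log m := log_nonneg_nat m
  rw [← hlog]
  calc _ ≤ (g:ℝ)^2 / m * ((1 + 1) * (4 * m + 4 / (1 / (m:ℝ)) * (1 + Real.log m))) := by gcongr
    _ = (g:ℝ)^2 * (16 + 8 * Real.log m) := by field_simp; ring
    _ ≤ _ := by nlinarith [sq_nonneg (g:ℝ)]

end DS

namespace DS
open Finset ArithmeticFunction

noncomputable def SS (X : ℕ) (γ : ℝ) : ℂ := ∑ n ∈ Icc 1 X, (vonMangoldt n : ℂ) * ee (γ * n)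

lemma SS_add_int (X : ℕ) (γ : ℝ) (m : ℤ) : SS X (γ + m) = SS X γ := by
  unfold SS
  refine Finset.sum_congr rfl fun n _ => ?_
  have : (γ + m) * n = γ * n + ((m * n : ℤ):ℝ) := by push_cast; ring
  rw [this, ee_add_int]

lemma sum_vonMangoldt_le (X : ℕ) : ∑ n ∈ Icc 1 X, vonMangoldt n ≤ X * Real.log X := by
  have : ∀ n ∈ Icc 1 X, vonMangoldt n ≤ Real.log X := by
    intro n hn
    have h := mem_Icc.1 hn
    exact vonMangoldt_le_log.trans (Real.log_le_log (by exact_mod_cast h.1) (by exact_mod_cast h.2))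
  refine (Finset.sum_le_sum this).trans ?_
  simp

lemma SS_triv (X : ℕ) (γ : ℝ) : ‖SS X γ‖ ≤ X * Real.log X := by
  refine le_trans (norm_sum_le_of_le _ (n := fun n => vonMangoldt n) fun n _ => ?_) (sum_vonMangoldt_le X)
  rw [norm_mul, norm_ee, mul_one, Complex.norm_real, Real.norm_of_nonneg vonMangoldt_nonneg]

lemma Fr_low {g k1 k2 : ℕ} (hg : 2 ≤ g) (hk : k1 ≤ k2) (h : ℕ → ℂ) (H : ℝ) (hH : ∀ u, ‖h u‖ ≤ H)
    (hlow : ∀ w v, w < g ^ k1 → h (w + g ^ k1 * v) = h (g ^ k1 * v)) (θ : ℝ) :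
    ‖Fr (g ^ k2) h θ‖ ≤ H * mb ((g ^ k1 : ℕ):ℝ) θ / (g ^ k1 : ℕ) := by
  have hA0 : 0 < g ^ k1 := by positivity
  have hAr : (0:ℝ) < (g ^ k1 : ℕ) := by exact_mod_cast hA0
  obtain ⟨j, rfl⟩ : ∃ j, k2 = k1 + j := ⟨k2 - k1, by omega⟩
  have hB0 : (0:ℝ) < (g ^ j : ℕ) := by
    have : 0 < g ^ j := by positivity
    exact_mod_cast this
  unfold Fr
  rw [pow_add]
  have e0 : ‖1 / ((g ^ k1 * g ^ j : ℕ):ℂ)‖ = 1 / (((g ^ k1 : ℕ):ℝ) * (g ^ j : ℕ)) := by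
    simp
  rw [norm_mul, e0, sum_range_mul_split]
  have h1 : ‖∑ v ∈ range (g ^ j), ∑ w ∈ range (g ^ k1), h (w + g ^ k1 * v) * ee (-(θ * ((w + g ^ k1 * v : ℕ):ℝ)))‖ ≤
      ∑ v ∈ range (g ^ j), H * mb ((g ^ k1 : ℕ):ℝ) θ := by
    refine norm_sum_le_of_le _ fun v _ => ?_
    have e1 : ∀ w ∈ range (g ^ k1), h (w + g ^ k1 * v) * ee (-(θ * ((w + g ^ k1 * v : ℕ):ℝ))) =
        (h (g ^ k1 * v) * ee (-(θ * (g ^ k1 * v)))) * ee (w * (-θ)) := by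
      intro w hw
      rw [hlow w v (mem_range.1 hw), mul_assoc, ← ee_add]
      congr 2; push_cast; ring
    rw [Finset.sum_congr rfl e1, ← Finset.mul_sum, norm_mul, norm_mul, norm_ee, mul_one]
    have h2 := norm_geom_le (g ^ k1) (-θ)
    have h4 : mb ((g ^ k1 : ℕ):ℝ) (-θ) = mb ((g ^ k1 : ℕ):ℝ) θ := by unfold mb; rw [nn_neg]
    rw [h4] at h2
    exact mul_le_mul (hH _) h2 (norm_nonneg _) ((norm_nonneg _).trans (hH 0))
  rw [Finset.sum_const, card_range, nsmul_eq_mul] at h1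
  calc _ ≤ 1 / (((g ^ k1 : ℕ):ℝ) * (g ^ j : ℕ)) * ((g ^ j : ℕ) * (H * mb ((g ^ k1 : ℕ):ℝ) θ)) := by gcongr
    _ = _ := by field_simp

lemma major_far {Q q0 b W8 N0 r g : ℕ} (hQ : 0 < Q) (hq0 : 0 < q0) (hq0g : q0 < g) (hr0 : 0 < r) (hrQ : r < Q)
    (ρ : ℚ) (hρ : |((r:ℝ)/Q + (b:ℝ)/q0) - ρ| ≤ 1 / ((N0 + 1) * ρ.den)) (hden : ρ.den < W8)
    (hN1 : 2 * Q ≤ N0) (hN2 : 2 * g * W8 ≤ N0) : 1 / (2 * (g:ℝ) * W8) ≤ nn ((r:ℝ)/Q) := by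
  have hd0 : 0 < ρ.den := ρ.den_pos
  have hdr : (1:ℝ) ≤ ρ.den := by exact_mod_cast hd0
  have hQr : (0:ℝ) < Q := by exact_mod_cast hQ
  have hq0r : (0:ℝ) < q0 := by exact_mod_cast hq0
  have hN0r : (0:ℝ) < N0 + 1 := by positivity
  set e := ((r:ℝ)/Q + (b:ℝ)/q0) - ρ with he
  have he1 : |e| ≤ 1 / (N0 + 1) := by
    refine hρ.trans ?_
    apply one_div_le_one_div_of_le hN0r
    nlinarith
  set P : ℤ := ρ.num * q0 - b * ρ.den with hP
  have hrat : (r:ℝ)/Q = ((P:ℤ):ℝ) / ((ρ.den * q0 : ℕ):ℝ) + e := by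
    rw [he, hP]
    have : (ρ:ℝ) = (ρ.num:ℝ) / ρ.den := by exact_mod_cast (Rat.num_div_den ρ).symm
    rw [this]; push_cast
    field_simp; ring
  by_cases hdvd : ((ρ.den * q0 : ℕ):ℤ) ∣ P
  · exfalso
    obtain ⟨m, hm⟩ := hdvd
    have h1 : nn ((r:ℝ)/Q) ≤ 1 / (N0 + 1) := by
      have h2 := nn_le ((r:ℝ)/Q) m
      refine h2.trans ?_
      have : (r:ℝ)/Q - m = e := by
        rw [hrat, hm]; push_cast; field_simp; ring
      rw [this]; exact he1
    have h3 : ¬ (Q:ℤ) ∣ (r:ℤ) := by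
      intro hd
      have := Int.le_of_dvd (by exact_mod_cast hr0) hd
      omega
    have h4 := nn_div_ge hQ h3
    push_cast at h4
    have h5 : (1:ℝ) / (N0 + 1) < 1 / Q := by
      apply one_div_lt_one_div_of_lt hQr
      have : (2:ℝ) * Q ≤ N0 := by exact_mod_cast hN1
      linarith
    linarith
  · have h1 := nn_div_ge (by positivity) hdvd
    have h2 : nn (((P:ℤ):ℝ) / ((ρ.den * q0 : ℕ):ℝ)) ≤ nn ((r:ℝ)/Q) + nn (-e) := by
      have := nn_add_le ((r:ℝ)/Q) (-e)
      rwa [hrat, add_neg_cancel_right, ← hrat] at this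
    rw [nn_neg] at h2
    have h3 := (nn_le_abs e).trans he1
    have hg0 : (0:ℝ) < g := by
      have : 0 < g := by omega
      exact_mod_cast this
    have hW0 : (0:ℝ) < W8 := by
      have : 0 < W8 := by omega
      exact_mod_cast this
    have h4 : 1 / ((g:ℝ) * W8) ≤ 1 / ((ρ.den * q0 : ℕ):ℝ) := by
      apply one_div_le_one_div_of_le (by positivity)
      have : ρ.den * q0 ≤ g * W8 := by nlinarith
      exact_mod_cast this
    have h5 : (1:ℝ) / (N0 + 1) ≤ 1 / (2 * g * W8) := by
      apply one_div_le_one_div_of_le (by positivity)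
      have : (2:ℝ) * g * W8 ≤ N0 := by exact_mod_cast hN2
      linarith
    have e1 : 1 / ((g:ℝ) * W8) = 1 / (2 * g * W8) + 1 / (2 * g * W8) := by field_simp; norm_num
    linarith

lemma prime_fourier_b {g k1 k2 X W : ℕ} (hg : 2 ≤ g) (hW : 2 ≤ W) (hk : k1 ≤ k2)
    (hX1 : 2 * g ^ k2 * W ^ 8 ≤ X) (hX2 : g * W ^ 8 ≤ g ^ k2) (h : ℕ → ℂ) (K H : ℝ)
    (hAB : AB (g ^ k2) h K) (hH : ∀ u, ‖h u‖ ≤ H)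
    (hlow : ∀ w v, w < g ^ k1 → h (w + g ^ k1 * v) = h (g ^ k1 * v)) (b : ℕ) (hb : b < g - 1) :
    ‖∑ n ∈ Icc 1 X, (vonMangoldt n : ℂ) * ee ((b:ℝ) / ((g-1:ℕ):ℝ) * n) * h n - Fr (g ^ k2) h 0 * SS X ((b:ℝ) / ((g-1:ℕ):ℝ))‖ ≤
      K * (1100 * X * Real.log X ^ 3 / W) + 3 * (W:ℝ) ^ 16 * (4 * g * W ^ 8 * H / (g ^ k1 : ℕ) * (X * Real.log X)) := by
  classical
  obtain ⟨ι, _, k, c, hc, hK⟩ := hAB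
  set Q := g ^ k2 with hQdef
  have hQ : 0 < Q := by positivity
  have hQr : (0:ℝ) < Q := by exact_mod_cast hQ
  have hQc : (Q:ℂ) ≠ 0 := by exact_mod_cast hQ.ne'
  set q0 := g - 1 with hq0
  have hH0 : 0 ≤ H := (norm_nonneg _).trans (hH 0)
  set E := 1100 * X * Real.log X ^ 3 / (W:ℝ) with hE
  have hlX := log_nonneg_nat X
  have hE0 : 0 ≤ E := by positivity
  set η := 4 * g * (W:ℝ) ^ 8 * H / (g ^ k1 : ℕ) with hη
  have hη0 : 0 ≤ η := by positivity
  set r : ι → ℕ := fun i => (k i % (Q:ℤ)).toNat with hr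
  have hrc : ∀ i, ((r i : ℕ):ℤ) = k i % (Q:ℤ) := fun i =>
    Int.toNat_of_nonneg (Int.emod_nonneg _ (by exact_mod_cast hQ.ne'))
  have hrQ : ∀ i, r i ∈ range Q := by
    intro i
    rw [mem_range]
    have := Int.emod_lt_of_pos (k i) (by exact_mod_cast hQ : (0:ℤ) < Q)
    rw [← hrc] at this
    exact_mod_cast this
  have hkr : ∀ i, ((k i : ℤ):ℝ) / Q = (r i : ℝ) / Q + ((k i / (Q:ℤ) : ℤ):ℝ) := by
    intro i
    have h1 := Int.emod_add_mul_ediv (k i) Q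
    rw [← hrc] at h1
    have h2 : ((r i : ℕ):ℝ) + (Q:ℝ) * ((k i / (Q:ℤ) : ℤ):ℝ) = k i := by exact_mod_cast h1
    rw [← h2]; field_simp
  set C : ℕ → ℂ := fun j => ∑ i with r i = j, c i with hC
  have hCF : ∀ j ∈ range Q, C j = Fr Q h ((j:ℝ)/Q) := by
    intro j hj
    unfold Fr
    simp_rw [hc, Finset.sum_mul]
    rw [Finset.sum_comm]
    have e1 : ∀ i : ι, ∑ u ∈ range Q, c i * ee ((k i : ℝ) * u / Q) * ee (-((j:ℝ)/Q * u)) =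
        if r i = j then (Q:ℂ) * c i else 0 := by
      intro i
      have e2 : ∀ u ∈ range Q, c i * ee ((k i : ℝ) * u / Q) * ee (-((j:ℝ)/Q * u)) =
          c i * ee ((u:ℝ) * (((((r i : ℕ):ℤ) - (j:ℤ) : ℤ):ℝ) / Q)) := by
        intro u _
        rw [mul_assoc, ← ee_add]
        have : (k i : ℝ) * u / Q + -((j:ℝ)/Q * u) = (u:ℝ) * (((((r i : ℕ):ℤ) - (j:ℤ) : ℤ):ℝ) / Q) +
            ((k i / (Q:ℤ) * u : ℤ):ℝ) := by
          have := hkr i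
          have e3 : (k i : ℝ) * u / Q = (k i : ℝ) / Q * u := by ring
          rw [e3, this]; push_cast; ring
        rw [this, ee_add_int]
      rw [Finset.sum_congr rfl e2, ← Finset.mul_sum, orth hQ]
      have hlt1 := mem_range.1 (hrQ i)
      have hlt2 := mem_range.1 hj
      by_cases hij : r i = j
      · rw [if_pos hij, if_pos (by rw [hij]; simp)]; ring
      · rw [if_neg hij, if_neg, mul_zero]
        intro hd
        apply hij
        obtain ⟨m, hm⟩ := hd
        have : m = 0 := by
          by_contra hm0
          rcases lt_or_gt_of_ne hm0 with hh | hh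
          · have : (Q:ℤ) * m ≤ -Q := by nlinarith
            omega
          · have : (Q:ℤ) * m ≥ Q := by nlinarith
            omega
        rw [this] at hm; omega
    rw [Finset.sum_congr rfl (fun i _ => e1 i), ← Finset.sum_filter, ← Finset.mul_sum, hC]
    field_simp
  have hCK : ∑ j ∈ range Q, ‖C j‖ ≤ K := by
    refine le_trans ?_ hK
    rw [← Finset.sum_fiberwise_of_maps_to (s := univ) (t := range Q) (g := r) (fun i _ => hrQ i)]
    exact Finset.sum_le_sum fun j _ => norm_sum_le _ _
  have hexp : ∑ n ∈ Icc 1 X, (vonMangoldt n : ℂ) * ee ((b:ℝ) / (q0:ℝ) * n) * h n =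
      ∑ j ∈ range Q, C j * SS X ((j:ℝ)/Q + (b:ℝ)/q0) := by
    have e1 : ∑ n ∈ Icc 1 X, (vonMangoldt n : ℂ) * ee ((b:ℝ) / (q0:ℝ) * n) * h n =
        ∑ i, c i * SS X ((k i : ℝ)/Q + (b:ℝ)/q0) := by
      unfold SS
      simp_rw [hc, Finset.mul_sum]
      rw [Finset.sum_comm]
      refine Finset.sum_congr rfl fun i _ => Finset.sum_congr rfl fun n _ => ?_
      have : ((k i : ℝ)/Q + (b:ℝ)/q0) * n = (b:ℝ) / (q0:ℝ) * n + (k i : ℝ) * n / Q := by ring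
      rw [this, ee_add]; ring
    rw [e1, ← Finset.sum_fiberwise_of_maps_to (s := univ) (t := range Q) (g := r) (fun i _ => hrQ i)]
    refine Finset.sum_congr rfl fun j _ => ?_
    rw [hC, Finset.sum_mul]
    refine Finset.sum_congr rfl fun i hi => ?_
    have hij := (mem_filter.1 hi).2
    rw [hkr i, hij, add_right_comm, SS_add_int]
  have h0 : (0:ℕ) ∈ range Q := mem_range.2 hQ
  rw [hexp, ← Finset.add_sum_erase _ _ h0, hCF 0 h0]
  simp only [Nat.cast_zero, zero_div, zero_add, add_sub_cancel_left]
  set Maj := ((range Q).erase 0).filter (fun j : ℕ => ¬ ‖SS X ((j:ℝ)/Q + (b:ℝ)/q0)‖ ≤ E) with hMaj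
  set N0 := X / W ^ 8 with hN0
  have hW8 : 0 < W ^ 8 := by positivity
  have hN1 : 2 * Q ≤ N0 := by rw [hN0, Nat.le_div_iff_mul_le hW8]; exact hX1
  have hN2 : 2 * g * W ^ 8 ≤ N0 := by
    refine le_trans ?_ hN1; rw [mul_assoc]; omega
  have hN0pos : 0 < N0 := by omega
  have happ : ∀ j : ℕ, ∃ ρ : ℚ, |((j:ℝ)/Q + (b:ℝ)/q0) - ρ| ≤ 1 / ((N0 + 1) * ρ.den) ∧ ρ.den ≤ N0 :=
    fun j => Real.exists_rat_abs_sub_le_and_den_le _ hN0pos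
  choose ρ hρ1 hρ2 using happ
  have hmaj : ∀ j ∈ Maj, (ρ j).den < W ^ 8 := by
    intro j hj
    by_contra hcon
    push Not at hcon
    apply (mem_filter.1 hj).2
    refine vinogradov _ (ρ j).num (ρ j).den X W hW ?_ ?_ hcon ?_
    · exact Int.isCoprime_iff_gcd_eq_one.2 (by
        have := (ρ j).reduced
        rwa [Nat.Coprime] at this)
    · have e : ((ρ j : ℚ):ℝ) = ((ρ j).num:ℝ) / (ρ j).den := by exact_mod_cast (Rat.num_div_den (ρ j)).symm
      rw [← e]
      refine (hρ1 j).trans ?_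
      have hd : (0:ℝ) < (ρ j).den := by exact_mod_cast (ρ j).den_pos
      apply one_div_le_one_div_of_le (by positivity)
      rw [sq]
      have : ((ρ j).den:ℝ) ≤ N0 := by exact_mod_cast hρ2 j
      gcongr; linarith
    · calc (ρ j).den * W ^ 8 ≤ N0 * W ^ 8 := by gcongr; exact hρ2 j
        _ ≤ X := Nat.div_mul_le_self _ _
  have hq0pos : 0 < q0 := by omega
  have hq0r : (0:ℝ) < q0 := by exact_mod_cast hq0pos
  have hcard : (Maj.card : ℝ) ≤ 3 * (W:ℝ)^16 := by
    have hinj : Maj.card ≤ ((Finset.Icc (0:ℤ) (2 * (W ^ 8 : ℕ))) ×ˢ (Finset.Icc 1 (W ^ 8))).card := by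
      refine Finset.card_le_card_of_injOn (fun j => ((ρ j).num, (ρ j).den)) ?_ ?_
      · intro j hj
        have hjM : j ∈ Maj := hj
        have hden := hmaj j hjM
        have hjQ : j < Q := mem_range.1 (mem_erase.1 (mem_filter.1 hjM).1).2
        rw [Finset.mem_coe, Finset.mem_product, mem_Icc, mem_Icc]
        have hd : (0:ℝ) < (ρ j).den := by exact_mod_cast (ρ j).den_pos
        have e : ((ρ j : ℚ):ℝ) = ((ρ j).num:ℝ) / (ρ j).den := by exact_mod_cast (Rat.num_div_den (ρ j)).symm
        have h1 := hρ1 j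
        rw [e] at h1
        have h2 : |((j:ℝ)/Q + (b:ℝ)/q0) * (ρ j).den - (ρ j).num| < 1 := by
          have e2 : ((j:ℝ)/Q + (b:ℝ)/q0) * (ρ j).den - (ρ j).num =
            (((j:ℝ)/Q + (b:ℝ)/q0) - ((ρ j).num:ℝ) / (ρ j).den) * (ρ j).den := by field_simp
          rw [e2, abs_mul, Nat.abs_cast]
          have hNr : (1:ℝ) ≤ N0 := by exact_mod_cast hN0pos
          calc _ ≤ 1 / ((N0 + 1) * ((ρ j).den:ℝ)) * (ρ j).den := by gcongr
            _ = 1 / (N0 + 1) := by field_simp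
            _ < 1 := by rw [div_lt_one (by linarith)]; linarith
        have h3 := abs_lt.1 h2
        have g0 : 0 ≤ (j:ℝ)/Q + (b:ℝ)/q0 := by positivity
        have g1 : (j:ℝ)/Q + (b:ℝ)/q0 ≤ 2 := by
          have a1 : (j:ℝ)/Q ≤ 1 := by rw [div_le_one hQr]; exact_mod_cast hjQ.le
          have a2 : (b:ℝ)/q0 ≤ 1 := by rw [div_le_one hq0r]; exact_mod_cast hb.le
          linarith
        have hdW : ((ρ j).den:ℝ) + 1 ≤ (W ^ 8 : ℕ) := by exact_mod_cast hden
        refine ⟨⟨?_, ?_⟩, (ρ j).den_pos, hden.le⟩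
        · have : (-1:ℝ) < (ρ j).num := by nlinarith
          have : (-1:ℤ) < (ρ j).num := by exact_mod_cast this
          dsimp only; omega
        · have : ((ρ j).num:ℝ) ≤ 2 * (W ^ 8 : ℕ) := by nlinarith
          exact_mod_cast this
      · intro j hj j' hj' heq
        have hd : ρ j = ρ j' := by
          rw [Prod.mk.injEq] at heq
          exact Rat.ext heq.1 heq.2
        have h1 := hρ1 j
        have h2 := hρ1 j'
        rw [← hd] at h2
        have hden1 : (1:ℝ) ≤ (ρ j).den := by exact_mod_cast (ρ j).den_pos
        have hbd : 1 / (((N0:ℝ) + 1) * (ρ j).den) < 1 / (2 * Q) := by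
          apply one_div_lt_one_div_of_lt (by positivity)
          have : (2:ℝ) * Q ≤ N0 := by exact_mod_cast hN1
          nlinarith
        have h3 : |(j:ℝ)/Q - (j':ℝ)/Q| < 1 / Q := by
          have e : 1 / (Q:ℝ) = 1 / (2 * Q) + 1 / (2 * Q) := by field_simp; norm_num
          have h4 := abs_le.1 h1
          have h5 := abs_le.1 h2
          rw [abs_lt]; constructor <;> linarith [h4.1, h4.2, h5.1, h5.2]
        rw [← sub_div, abs_div, abs_of_pos hQr, div_lt_div_iff_of_pos_right hQr] at h3
        have h6 : |(j:ℤ) - (j':ℤ)| < 1 := by exact_mod_cast h3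
        have := Int.abs_lt_one_iff.1 h6
        omega
    have hc2 : ((Finset.Icc (0:ℤ) (2 * (W ^ 8 : ℕ))) ×ˢ (Finset.Icc 1 (W ^ 8))).card = (2 * W ^ 8 + 1) * W ^ 8 := by
      rw [Finset.card_product, Int.card_Icc, Nat.card_Icc]
      congr 1
    rw [hc2] at hinj
    have h3 : (2 * W ^ 8 + 1) * W ^ 8 ≤ 3 * W ^ 16 := by
      have : W ^ 16 = W ^ 8 * W ^ 8 := by ring
      rw [this]; nlinarith
    exact_mod_cast hinj.trans h3
  have hper : ∀ j ∈ (range Q).erase 0, ‖C j * SS X ((j:ℝ)/Q + (b:ℝ)/q0)‖ ≤ ‖C j‖ * E +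
      if ¬ ‖SS X ((j:ℝ)/Q + (b:ℝ)/q0)‖ ≤ E then η * (X * Real.log X) else 0 := by
    intro j hj
    rw [norm_mul]
    by_cases hS : ¬ ‖SS X ((j:ℝ)/Q + (b:ℝ)/q0)‖ ≤ E
    · rw [if_pos hS]
      have hjM : j ∈ Maj := mem_filter.2 ⟨hj, hS⟩
      have hj0 := mem_erase.1 hj
      have hfar := major_far (g := g) hQ hq0pos (by omega) (Nat.pos_of_ne_zero hj0.1) (mem_range.1 hj0.2) (ρ j) (hρ1 j)
        (hmaj j hjM) hN1 hN2
      have hg0 : (0:ℝ) < g := by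
        have : 0 < g := by omega
        exact_mod_cast this
      have hWr : (0:ℝ) < (W ^ 8 : ℕ) := by exact_mod_cast hW8
      have h1 := Fr_low hg hk h H hH hlow ((j:ℝ)/Q)
      have h2 := mb_le_div (M := ((g ^ k1 : ℕ):ℝ)) (by positivity) (by positivity) hfar
      have h3 : ‖C j‖ ≤ η := by
        rw [hCF j hj0.2]
        refine h1.trans ?_
        calc H * mb ((g ^ k1 : ℕ):ℝ) ((j:ℝ)/Q) / (g ^ k1 : ℕ) ≤ H * (2 / (1 / (2 * (g:ℝ) * (W ^ 8 : ℕ)))) / (g ^ k1 : ℕ) := by gcongr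
          _ = η := by rw [hη]; push_cast; field_simp; norm_num
      have h4 := SS_triv X ((j:ℝ)/Q + (b:ℝ)/q0)
      have h5 : 0 ≤ ‖C j‖ * E := by positivity
      have h6 : ‖C j‖ * ‖SS X ((j:ℝ)/Q + (b:ℝ)/q0)‖ ≤ η * (X * Real.log X) := by gcongr
      linarith
    · rw [if_neg hS]
      push Not at hS
      have : ‖C j‖ * ‖SS X ((j:ℝ)/Q + (b:ℝ)/q0)‖ ≤ ‖C j‖ * E := by gcongr
      linarith
  refine (norm_sum_le_of_le _ hper).trans ?_
  rw [Finset.sum_add_distrib, ← Finset.sum_mul, ← Finset.sum_filter, Finset.sum_const, nsmul_eq_mul]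
  refine add_le_add ?_ ?_
  · refine mul_le_mul_of_nonneg_right ?_ hE0
    refine le_trans ?_ hCK
    exact Finset.sum_le_sum_of_subset_of_nonneg (Finset.erase_subset _ _) fun _ _ _ => norm_nonneg _
  · refine mul_le_mul_of_nonneg_right hcard (by positivity)

end DS

namespace DS
open Finset

/-- `G`-multiplicative unimodular function -/
def GM (G : ℕ) (f : ℕ → ℂ) : Prop :=
  (∀ n, ‖f n‖ = 1) ∧ ∀ w v, w < G → f (w + G * v) = f w * f v

lemma GM.pow {G : ℕ} {f : ℕ → ℂ} (hG : 0 < G) (hf : GM G f) (k : ℕ) : GM (G ^ (k+1)) f := by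
  refine ⟨hf.1, ?_⟩
  induction k with
  | zero => simpa using hf.2
  | succ k ih =>
    intro w v hw
    have h1 : w = w % G + G * (w / G) := (Nat.mod_add_div w G).symm
    have h2 : w / G < G ^ (k+1) := by
      rw [Nat.div_lt_iff_lt_mul hG]; rwa [pow_succ] at hw
    have h3 : w % G < G := Nat.mod_lt _ hG
    have e : w + G ^ (k+1+1) * v = w % G + G * (w / G + G ^ (k+1) * v) := by
      conv_lhs => rw [h1]
      ring
    rw [e, hf.2 _ _ h3, ih _ _ h2, ← mul_assoc, ← hf.2 _ _ h3, ← h1]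

lemma Fr_mul {A B : ℕ} (hA : 0 < A) {f : ℕ → ℂ}
    (hf : ∀ w v, w < A → f (w + A * v) = f w * f v) (θ : ℝ) :
    Fr (A * B) f θ = Fr A f θ * Fr B f (A * θ) := by
  unfold Fr
  rw [sum_range_mul_split]
  have : ∑ v ∈ range B, ∑ w ∈ range A, f (w + A * v) * ee (-(θ * ((w + A * v : ℕ):ℝ))) =
      (∑ w ∈ range A, f w * ee (-(θ * w))) * ∑ v ∈ range B, f v * ee (-(A * θ * v)) := by
    rw [Finset.sum_mul_sum, Finset.sum_comm]
    refine Finset.sum_congr rfl fun w hw => Finset.sum_congr rfl fun v _ => ?_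
    rw [hf w v (mem_range.1 hw)]
    have : -(θ * ((w + A * v : ℕ):ℝ)) = -(θ * w) + -(A * θ * v) := by push_cast; ring
    rw [this, ee_add]; ring
  rw [this]
  push_cast
  ring

lemma Fr_one {f : ℕ → ℂ} (hf0 : f 0 = 1) (θ : ℝ) : Fr 1 f θ = 1 := by
  unfold Fr; simp [hf0]

/-- absolute value of the Fourier transform of the digit function on `G^k` -/
noncomputable def FA (G : ℕ) (f : ℕ → ℂ) (k : ℕ) (θ : ℝ) : ℝ := ‖Fr (G ^ k) f θ‖

lemma FA_nonneg (G : ℕ) (f : ℕ → ℂ) (k : ℕ) (θ : ℝ) : 0 ≤ FA G f k θ := norm_nonneg _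

lemma GM.f0 {G : ℕ} {f : ℕ → ℂ} (hG : 0 < G) (hf : GM G f) : f 0 = 1 := by
  have := hf.2 0 0 hG
  simp only [mul_zero, add_zero] at this
  have h0 : f 0 ≠ 0 := by
    intro h; have := hf.1 0; rw [h, norm_zero] at this; norm_num at this
  exact (mul_right_cancel₀ h0 (by rw [one_mul]; exact this)).symm

lemma FA_le_one {G : ℕ} {f : ℕ → ℂ} (hf : GM G f) (k : ℕ) (θ : ℝ) : FA G f k θ ≤ 1 :=
  Fr_norm_le _ _ _ fun u => (hf.1 u).le

lemma GM.pow' {G : ℕ} {f : ℕ → ℂ} (hG : 0 < G) (hf : GM G f) (k : ℕ) : ∀ w v, w < G ^ k → f (w + G ^ k * v) = f w * f v := by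
  rcases k with _ | k
  · intro w v hw
    have : w = 0 := by simpa using hw
    subst this; simp [hf.f0 hG]
  · exact (hf.pow hG k).2

lemma FA_add {G : ℕ} {f : ℕ → ℂ} (hG : 0 < G) (hf : GM G f) (j k : ℕ) (θ : ℝ) :
    FA G f (j + k) θ = FA G f j θ * FA G f k ((G ^ j : ℕ) * θ) := by
  unfold FA
  rw [pow_add, Fr_mul (by positivity) (hf.pow' hG j), norm_mul]

lemma FA_add_int (G : ℕ) (f : ℕ → ℂ) (k : ℕ) (θ : ℝ) (m : ℤ) : FA G f k (θ + m) = FA G f k θ := by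
  unfold FA; rw [Fr_add_int]

lemma FA_parseval {G : ℕ} {f : ℕ → ℂ} (hG : 0 < G) (hf : GM G f) (k : ℕ) (θ : ℝ) :
    ∑ c ∈ range (G ^ k), FA G f k (θ + (c:ℝ) / (G ^ k : ℕ)) ^ 2 = 1 := by
  have := parseval (Q := G ^ k) (by positivity) f θ
  unfold FA
  rw [this]
  simp only [hf.1, one_pow, sum_const, card_range, nsmul_eq_mul, mul_one]
  have : ((G ^ k : ℕ):ℝ) ≠ 0 := by positivity
  field_simp

/-- the quadratic form of pairs congruent mod `m` -/
noncomputable def CC (N m : ℕ) (x : ℕ → ℝ) : ℝ :=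
  ∑ c ∈ range N, ∑ c' ∈ range N, if c ≡ c' [MOD m] then x c * x c' else 0

lemma fiber_sq (N d : ℕ) (p : ℕ → ℕ) (hp : ∀ c, p c < d) (x : ℕ → ℝ) :
    ∑ r ∈ range d, (∑ c ∈ range N with p c = r, x c) ^ 2 =
      ∑ c ∈ range N, ∑ c' ∈ range N, if p c = p c' then x c * x c' else 0 := by
  have h1 : ∀ r, (∑ c ∈ range N with p c = r, x c) ^ 2 =
      ∑ c ∈ range N, ∑ c' ∈ range N, if p c = r then (if p c = p c' then x c * x c' else 0) else 0 := by
    intro r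
    rw [sq, Finset.sum_mul_sum, Finset.sum_filter]
    refine Finset.sum_congr rfl fun c _ => ?_
    split_ifs with h
    · rw [Finset.sum_filter]
      refine Finset.sum_congr rfl fun c' _ => ?_
      rw [h]; simp only [eq_comm]
    · simp
  simp_rw [h1]
  rw [Finset.sum_comm]
  refine Finset.sum_congr rfl fun c _ => ?_
  rw [Finset.sum_comm]
  refine Finset.sum_congr rfl fun c' _ => ?_
  rw [Finset.sum_ite_eq, if_pos (mem_range.2 (hp c))]

lemma CC_eq (N m : ℕ) (hm : 0 < m) (x : ℕ → ℝ) :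
    CC N m x = ∑ r ∈ range m, (∑ c ∈ range N with c % m = r, x c) ^ 2 := by
  rw [fiber_sq N m (fun c => c % m) (fun c => Nat.mod_lt _ hm)]
  rfl

lemma card_res (N d : ℕ) (hd : 0 < d) (hdN : d ∣ N) (r : ℕ) : #{h ∈ range N | h % d = r} ≤ N / d := by
  have : #{h ∈ range N | h % d = r} ≤ #(range (N / d)) := by
    refine Finset.card_le_card_of_injOn (fun h => h / d) ?_ ?_
    · intro h hh
      rw [Finset.mem_coe, mem_filter, mem_range] at hh
      rw [Finset.mem_coe, mem_range]
      exact Nat.div_lt_div_of_lt_of_dvd hdN hh.1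
    · intro h hh h' hh' e
      rw [Finset.mem_coe, mem_filter, mem_range] at hh hh'
      dsimp only at e
      rw [← Nat.mod_add_div h d, ← Nat.mod_add_div h' d, hh.2, hh'.2, e]
  simpa using this

lemma CC_le_triv (N m : ℕ) (hm : 0 < m) (hmN : m ∣ N) (x : ℕ → ℝ) :
    CC N m x ≤ ((N / m : ℕ):ℝ) * ∑ c ∈ range N, x c ^ 2 := by
  rw [CC_eq N m hm]
  have h1 : ∀ r ∈ range m, (∑ c ∈ range N with c % m = r, x c) ^ 2 ≤
      ((N / m : ℕ):ℝ) * ∑ c ∈ range N with c % m = r, x c ^ 2 := by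
    intro r _
    refine (sq_sum_le_card_mul_sum_sq).trans ?_
    gcongr
    exact card_res N m hm hmN r
  refine (Finset.sum_le_sum h1).trans ?_
  rw [← Finset.mul_sum, Finset.sum_fiberwise_of_maps_to]
  intro c _
  exact mem_range.2 (Nat.mod_lt _ hm)

/-- `S(λ,d)` -/
noncomputable def SP (G : ℕ) (f : ℕ → ℂ) (k d : ℕ) : ℝ :=
  CC (G ^ k) d (fun h => FA G f k ((h:ℝ) / (G ^ k : ℕ)))

lemma SP_triv {G : ℕ} {f : ℕ → ℂ} (hG : 0 < G) (hf : GM G f) (k d : ℕ) (hd : d ∣ G ^ k) :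
    SP G f k d ≤ ((G ^ k / d : ℕ):ℝ) := by
  unfold SP
  have hd0 : 0 < d := Nat.pos_of_dvd_of_pos hd (by positivity)
  refine (CC_le_triv _ d hd0 hd _).trans ?_
  have := FA_parseval hG hf k 0
  simp only [zero_add] at this
  rw [this, mul_one]

lemma SP_rec {G : ℕ} {f : ℕ → ℂ} (hG : 0 < G) (hf : GM G f) (k d : ℕ) (hd : d ∣ G ^ (k+1)) (C : ℝ)
    (hC : ∀ θ, CC G (d / Nat.gcd d (G ^ k)) (fun c => FA G f 1 (θ + (c:ℝ) / G)) ≤ C) :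
    SP G f (k+1) d ≤ C * SP G f k (Nat.gcd d (G ^ k)) := by
  set Q1 := G ^ k with hQ1
  have hQ1pos : 0 < Q1 := by positivity
  have hd0 : 0 < d := Nat.pos_of_dvd_of_pos hd (by positivity)
  set d1 := Nat.gcd d Q1 with hd1
  have hd1pos : 0 < d1 := Nat.gcd_pos_of_pos_left _ hd0
  set m := d / d1 with hm
  have hdm : d = d1 * m := (Nat.mul_div_cancel' (Nat.gcd_dvd_left _ _)).symm
  have hmpos : 0 < m := by
    rcases Nat.eq_zero_or_pos m with h | h
    · rw [h] at hdm; omega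
    · exact h
  have hd1Q : d1 ∣ Q1 := Nat.gcd_dvd_right _ _
  have hd1d : d1 ∣ d := Nat.gcd_dvd_left _ _
  have hQ1r : (Q1:ℝ) ≠ 0 := by exact_mod_cast hQ1pos.ne'
  have hGr : (G:ℝ) ≠ 0 := by exact_mod_cast hG.ne'
  set a : ℕ → ℝ := fun w => FA G f k ((w:ℝ) / Q1) with ha
  set Φ : ℕ → ℕ → ℝ := fun w c => FA G f 1 ((w:ℝ) / (G ^ (k+1) : ℕ) + (c:ℝ) / G) with hΦ
  set Y : ℕ → ℕ → ℝ := fun w r => ∑ c ∈ range G with (w + Q1 * c) % d = r, Φ w c with hY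
  have ha0 : ∀ w, 0 ≤ a w := fun w => FA_nonneg _ _ _ _
  have hsplit : ∀ w c : ℕ, FA G f (k+1) (((w + Q1 * c : ℕ):ℝ) / (G ^ (k+1) : ℕ)) = a w * Φ w c := by
    intro w c
    rw [add_comm k 1, FA_add hG hf, mul_comm]
    congr 1
    · rw [ha]
      dsimp only
      have : ((G ^ 1 : ℕ):ℝ) * (((w + Q1 * c : ℕ):ℝ) / (G ^ (1+k) : ℕ)) = (w:ℝ) / Q1 + (c:ℤ) := by
        rw [pow_add, pow_one, ← hQ1]; push_cast; field_simp
      rw [this, FA_add_int]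
    · rw [hΦ]
      dsimp only
      congr 1
      rw [add_comm 1 k, pow_succ, ← hQ1]; push_cast; field_simp
  have hYsq : ∀ w, ∑ r ∈ range d, Y w r ^ 2 ≤ C := by
    intro w
    rw [hY]
    dsimp only
    rw [fiber_sq G d (fun c => (w + Q1 * c) % d) (fun c => Nat.mod_lt _ hd0)]
    refine le_trans (le_of_eq ?_) (hC ((w:ℝ) / (G ^ (k+1) : ℕ)))
    unfold CC
    refine Finset.sum_congr rfl fun c _ => Finset.sum_congr rfl fun c' _ => ?_
    have : ((w + Q1 * c) % d = (w + Q1 * c') % d) ↔ c ≡ c' [MOD m] := by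
      constructor
      · intro h
        have h2 : Q1 * c ≡ Q1 * c' [MOD d] := Nat.ModEq.add_left_cancel' w h
        exact Nat.ModEq.cancel_left_div_gcd hd0 h2
      · intro h
        apply Nat.ModEq.add_left w
        obtain ⟨z, hz⟩ := hd1Q
        have h2 : d1 * c ≡ d1 * c' [MOD d] := by rw [hdm]; exact h.mul_left' d1
        have h3 := h2.mul_left z
        rw [hz]
        rw [← mul_assoc, ← mul_assoc, mul_comm z d1] at h3
        exact h3
    simp only [this]
    rfl
  have hT : ∀ r1 ∈ range d1, ∀ r2 ∈ range m, (∑ h ∈ range (G ^ (k+1)) with h % d = r1 + d1 * r2,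
      FA G f (k+1) ((h:ℝ) / (G ^ (k+1) : ℕ))) = ∑ w ∈ range Q1 with w % d1 = r1, a w * Y w (r1 + d1 * r2) := by
    intro r1 hr1 r2 _
    rw [Finset.sum_filter, pow_succ, ← hQ1, sum_range_mul_split, Finset.sum_comm, Finset.sum_filter]
    refine Finset.sum_congr rfl fun w _ => ?_
    rw [hY]
    dsimp only
    split_ifs with hw
    · rw [Finset.mul_sum, Finset.sum_filter]
      refine Finset.sum_congr rfl fun c _ => ?_
      split_ifs with hc
      · have := hsplit w c
        rw [pow_succ, ← hQ1] at this
        exact this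
      · rfl
    · refine Finset.sum_eq_zero fun c _ => ?_
      rw [if_neg]
      intro hc
      apply hw
      have h1 : (w + Q1 * c) % d % d1 = (r1 + d1 * r2) % d1 := by rw [hc]
      rw [Nat.mod_mod_of_dvd _ hd1d, Nat.add_mul_mod_self_left, Nat.mod_eq_of_lt (mem_range.1 hr1)] at h1
      obtain ⟨z, hz⟩ := hd1Q
      rw [hz, mul_assoc, Nat.add_mul_mod_self_left] at h1
      exact h1
  unfold SP
  rw [CC_eq _ d hd0, CC_eq _ d1 hd1pos]
  conv_lhs => rw [hdm]
  rw [sum_range_mul_split, Finset.sum_comm, Finset.mul_sum]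
  refine Finset.sum_le_sum fun r1 hr1 => ?_
  have hstep : ∀ r2 ∈ range m, (∑ h ∈ range (G ^ (k+1)) with h % d = r1 + d1 * r2,
      FA G f (k+1) ((h:ℝ) / (G ^ (k+1) : ℕ))) ^ 2 ≤
      (∑ w ∈ range Q1 with w % d1 = r1, a w) * ∑ w ∈ range Q1 with w % d1 = r1, a w * Y w (r1 + d1 * r2) ^ 2 := by
    intro r2 hr2
    rw [hT r1 hr1 r2 hr2]
    refine Finset.sum_sq_le_sum_mul_sum_of_sq_le_mul _ (fun w _ => ha0 w)
      (fun w _ => mul_nonneg (ha0 w) (sq_nonneg _)) (fun w _ => le_of_eq (by ring))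
  rw [← hdm]
  refine (Finset.sum_le_sum hstep).trans ?_
  rw [← Finset.mul_sum, sq, ← mul_assoc, mul_comm C, mul_assoc]
  refine mul_le_mul_of_nonneg_left ?_ (Finset.sum_nonneg fun w _ => ha0 w)
  rw [Finset.sum_comm, Finset.mul_sum]
  refine Finset.sum_le_sum fun w _ => ?_
  rw [← Finset.mul_sum, mul_comm C]
  refine mul_le_mul_of_nonneg_left ?_ (ha0 w)
  refine le_trans ?_ (hYsq w)
  have hinj : ∑ r2 ∈ range m, Y w (r1 + d1 * r2) ^ 2 = ∑ r ∈ (range m).image (fun r2 => r1 + d1 * r2), Y w r ^ 2 := by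
    rw [Finset.sum_image]
    intro x _ y _ hxy
    dsimp only at hxy
    have : d1 * x = d1 * y := by omega
    exact Nat.eq_of_mul_eq_mul_left hd1pos this
  rw [hinj]
  apply Finset.sum_le_sum_of_subset_of_nonneg
  · intro r hr
    rw [mem_image] at hr
    obtain ⟨r2, hr2, rfl⟩ := hr
    rw [mem_range] at hr1 hr2 ⊢
    calc r1 + d1 * r2 < d1 + d1 * r2 := by omega
      _ = d1 * (r2 + 1) := by ring
      _ ≤ d1 * m := Nat.mul_le_mul_left _ hr2
      _ = d := hdm.symm
  · intro _ _ _; positivity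

/-- spectral gap hypothesis -/
def SG (G : ℕ) (f : ℕ → ℂ) (η : ℝ) : Prop :=
  ∀ m, m ∣ G → (G = 4 ∧ m = 2) ∨ ∀ θ, CC G m (fun c => FA G f 1 (θ + (c:ℝ) / G)) ≤ ((G / m : ℕ):ℝ) ^ (1 - η)

lemma SP_bound {G : ℕ} {f : ℕ → ℂ} (hG : 0 < G) (hf : GM G f) {η : ℝ} (hη : η ≤ 1) (hs : SG G f η) :
    ∀ k d, d ∣ G ^ k → SP G f k d ≤ 2 * ((G ^ k / d : ℕ):ℝ) ^ (1 - η) := by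
  intro k
  induction k with
  | zero =>
    intro d hd
    have : d = 1 := by simpa using hd
    subst this
    refine (SP_triv hG hf 0 1 (by simp)).trans ?_
    simp
  | succ k ih =>
    intro d hd
    have hd0 : 0 < d := Nat.pos_of_dvd_of_pos hd (by positivity)
    have hQ1pos : 0 < G ^ k := by positivity
    have hd1pos : 0 < Nat.gcd d (G ^ k) := Nat.gcd_pos_of_pos_left _ hd0
    by_cases h2 : G ^ (k+1) / d ≤ 2
    · refine (SP_triv hG hf (k+1) d hd).trans ?_
      have h1 : 1 ≤ G ^ (k+1) / d := Nat.div_pos (Nat.le_of_dvd (by positivity) hd) hd0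
      have h3 : (1:ℝ) ≤ ((G ^ (k+1) / d : ℕ):ℝ) ^ (1 - η) := by
        apply Real.one_le_rpow
        · exact_mod_cast h1
        · linarith
      have h4 : ((G ^ (k+1) / d : ℕ):ℝ) ≤ 2 := by exact_mod_cast h2
      linarith
    · set d1 := Nat.gcd d (G ^ k) with hd1
      set m := d / d1 with hm
      have hdm : d = d1 * m := (Nat.mul_div_cancel' (Nat.gcd_dvd_left _ _)).symm
      have hd1Q : d1 ∣ G ^ k := Nat.gcd_dvd_right _ _
      have hcop : Nat.Coprime m (G ^ k / d1) := Nat.coprime_div_gcd_div_gcd hd1pos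
      have hmpos : 0 < m := by
        rcases Nat.eq_zero_or_pos m with h | h
        · rw [h] at hdm; omega
        · exact h
      have hmG : m ∣ G := by
        have h3 : d1 * m ∣ d1 * ((G ^ k / d1) * G) := by
          rw [← mul_assoc, Nat.mul_div_cancel' hd1Q, ← pow_succ, ← hdm]; exact hd
        have h4 := Nat.dvd_of_mul_dvd_mul_left hd1pos h3
        exact hcop.dvd_of_dvd_mul_left h4
      have hquot : G ^ (k+1) / d = (G ^ k / d1) * (G / m) := by
        obtain ⟨z, hz⟩ := hd1Q
        obtain ⟨y, hy⟩ := hmG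
        have e1 : G ^ k / d1 = z := by rw [hz]; exact Nat.mul_div_cancel_left _ hd1pos
        have e2 : G / m = y := by
          conv_lhs => rw [hy]
          exact Nat.mul_div_cancel_left _ hmpos
        have e3 : G ^ (k+1) = d * (z * y) := by
          rw [pow_succ, hz, hdm]
          conv_lhs => rw [hy]
          ring
        rw [e1, e2, e3]; exact Nat.mul_div_cancel_left _ hd0
      rcases hs m hmG with ⟨hG4, hm2⟩ | hC
      · exfalso
        -- d1 = G^k
        apply h2
        have hcop2 : Nat.Coprime 2 (G ^ k / d1) := hm2 ▸ hcop
        have h5 : G ^ k / d1 ∣ 2 ^ (2 * k) := by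
          rw [pow_mul]; norm_num
          rw [← hG4]; exact Nat.div_dvd_of_dvd hd1Q
        have h6 : Nat.Coprime (2 ^ (2*k)) (G ^ k / d1) := Nat.Coprime.pow_left _ hcop2
        have h7 : G ^ k / d1 = 1 := Nat.eq_one_of_dvd_coprimes h6 h5 dvd_rfl
        rw [hquot, h7, hG4, hm2]
      · have h8 := SP_rec hG hf k d hd _ hC
        have h9 := ih d1 hd1Q
        refine h8.trans ?_
        calc ((G / m : ℕ):ℝ) ^ (1 - η) * SP G f k d1 ≤ ((G / m : ℕ):ℝ) ^ (1 - η) * (2 * ((G ^ k / d1 : ℕ):ℝ) ^ (1 - η)) := by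
              gcongr
          _ = 2 * ((G ^ (k+1) / d : ℕ):ℝ) ^ (1 - η) := by
              rw [hquot]; push_cast
              rw [Real.mul_rpow (by positivity) (by positivity)]; ring
end DS

namespace DS
open Finset

/-- digit sum -/
def sd (g n : ℕ) : ℕ := (Nat.digits g n).sum

lemma sd_add {g : ℕ} (hg : 2 ≤ g) (w v : ℕ) (hw : w < g) : sd g (w + g * v) = w + sd g v := by
  unfold sd
  by_cases h : w ≠ 0 ∨ v ≠ 0
  · rw [Nat.digits_add g (by omega) w v hw h]; simp
  · push Not at h
    obtain ⟨rfl, rfl⟩ := h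
    simp

lemma sd_lt {g : ℕ} (hg : 2 ≤ g) (w : ℕ) (hw : w < g) : sd g w = w := by
  have := sd_add hg w 0 hw
  simpa [sd] using this

noncomputable def fd (g : ℕ) (α : ℝ) (n : ℕ) : ℂ := ee (α * sd g n)

lemma fd_GM {g : ℕ} (hg : 2 ≤ g) (α : ℝ) : GM g (fd g α) := by
  refine ⟨fun n => norm_ee _, fun w v hw => ?_⟩
  unfold fd
  rw [sd_add hg w v hw, sd_lt hg w hw, ← ee_add]
  congr 1; push_cast; ring

noncomputable def ph (g : ℕ) (t : ℝ) : ℝ := ‖(1 / (g:ℂ)) * ∑ u ∈ range g, ee (u * t)‖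

lemma FA_one {g : ℕ} (hg : 2 ≤ g) (α θ : ℝ) : FA g (fd g α) 1 θ = ph g (α - θ) := by
  unfold FA Fr ph fd
  rw [pow_one]
  congr 2
  refine Finset.sum_congr rfl fun u hu => ?_
  rw [sd_lt hg u (mem_range.1 hu), ← ee_add]
  congr 1; ring

lemma norm_one_add_ee (t : ℝ) : ‖1 + ee t‖ ≤ 2 - 4 * nn t ^ 2 := by
  have h1 := norm_one_sub_ee_ge t
  have h2 : ‖1 + ee t‖ ^ 2 + ‖1 - ee t‖ ^ 2 = 4 := by
    have := parallelogram_law_with_norm ℝ (1:ℂ) (ee t)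
    rw [norm_ee, norm_one] at this
    nlinarith
  have h3 := nn_nonneg t
  have h4 := nn_le_half t
  have h5 : ‖1 + ee t‖ ^ 2 ≤ (2 - 4 * nn t ^ 2) ^ 2 := by nlinarith [sq_nonneg (nn t ^ 2)]
  exact abs_le_of_sq_le_sq' h5 (by nlinarith) |>.2

lemma ph_le {g : ℕ} (hg : 2 ≤ g) (t : ℝ) : ph g t ≤ Real.exp (-(4 / g) * nn t ^ 2) := by
  have hg0 : (0:ℝ) < g := by
    have : 0 < g := by omega
    exact_mod_cast this
  have h1 : ph g t ≤ 1 - 4 / g * nn t ^ 2 := by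
    unfold ph
    obtain ⟨k, rfl⟩ : ∃ k, g = 2 + k := ⟨g - 2, by omega⟩
    rw [Finset.sum_range_add, norm_mul]
    have e : ‖1 / ((2 + k : ℕ):ℂ)‖ = 1 / ((2 + k : ℕ):ℝ) := by
      rw [norm_div, norm_one, Complex.norm_natCast]
    rw [e]
    have h2 : ‖∑ u ∈ range 2, ee (u * t) + ∑ u ∈ range k, ee (((2 + u : ℕ):ℝ) * t)‖ ≤ (2 - 4 * nn t ^ 2) + k := by
      refine (norm_add_le _ _).trans (add_le_add ?_ ?_)
      · rw [Finset.sum_range_succ, Finset.sum_range_one]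
        simpa using norm_one_add_ee t
      · refine (norm_sum_le _ _).trans ?_
        simp
    have h3 : 1 - 4 / ((2 + k : ℕ):ℝ) * nn t ^ 2 = 1 / ((2 + k : ℕ):ℝ) * ((2 - 4 * nn t ^ 2) + k) := by
      field_simp; push_cast; ring
    rw [h3]
    gcongr
  refine h1.trans ?_
  have := Real.add_one_le_exp (-(4 / (g:ℝ)) * nn t ^ 2)
  linarith

lemma FA_sup {g : ℕ} (hg : 2 ≤ g) (α : ℝ) (k : ℕ) (θ : ℝ) :
    FA g (fd g α) k θ ≤ Real.exp (-(2 / (g * (g ^ 2 + 1))) * ((k:ℝ) - 1) * nn ((g - 1) * α) ^ 2) := by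
  have hf := fd_GM hg α
  have hgpos : 0 < g := by omega
  have hg0 : (0:ℝ) < g := by exact_mod_cast hgpos
  have h1 : ∀ k : ℕ, ∀ θ, FA g (fd g α) k θ ≤ Real.exp (-(4 / g) * ∑ j ∈ range k, nn (α - g ^ j * θ) ^ 2) := by
    intro k
    induction k with
    | zero => intro θ; simpa using FA_le_one hf 0 θ
    | succ k ih =>
      intro θ
      rw [FA_add hgpos hf k 1, Finset.sum_range_succ, mul_add, Real.exp_add]
      refine mul_le_mul (ih θ) ?_ (FA_nonneg _ _ _ _) (Real.exp_pos _).le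
      rw [FA_one hg]
      push_cast
      exact ph_le hg _
  refine (h1 k θ).trans ?_
  rw [Real.exp_le_exp]
  set z := nn ((g - 1) * α) with hz
  set t : ℕ → ℝ := fun j => nn (α - g ^ j * θ) with ht
  have hz0 : 0 ≤ z := nn_nonneg _
  have hpair : ∀ j, z ^ 2 ≤ (g ^ 2 + 1) * (t j ^ 2 + t (j+1) ^ 2) := by
    intro j
    have e : ((g:ℝ) - 1) * α = g * (α - g ^ j * θ) + -(α - g ^ (j+1) * θ) := by rw [pow_succ]; ring
    have h2 : z ≤ g * t j + t (j+1) := by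
      rw [hz, e]
      refine (nn_add_le _ _).trans ?_
      rw [nn_neg]
      have := nn_nat_mul g (α - g ^ j * θ)
      linarith
    have h3 : z ^ 2 ≤ (g * t j + t (j+1)) ^ 2 := by gcongr
    nlinarith [sq_nonneg (g * t (j+1) - t j)]
  have hsum : ∀ k : ℕ, ((k:ℝ) - 1) * z ^ 2 ≤ (g ^ 2 + 1) * (2 * ∑ j ∈ range k, t j ^ 2) := by
    intro k
    have h4 : ∀ k : ℕ, ((k:ℝ)) * z ^ 2 + (g ^ 2 + 1) * t k ^ 2 ≤ (g ^ 2 + 1) * (2 * ∑ j ∈ range (k+1), t j ^ 2) := by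
      intro k
      induction k with
      | zero => simp; nlinarith [sq_nonneg (t 0), sq_nonneg ((g:ℝ) * t 0)]
      | succ k ih =>
        rw [Finset.sum_range_succ]
        have := hpair k
        push_cast
        nlinarith [sq_nonneg (t (k+1))]
    rcases k with _ | k
    · simp; positivity
    · have := h4 k
      push_cast
      have h5 : 0 ≤ ((g:ℝ) ^ 2 + 1) * t k ^ 2 := by positivity
      linarith
  have h6 := hsum k
  have h7 : 2 / ((g:ℝ) * (g ^ 2 + 1)) * (((k:ℝ) - 1) * z ^ 2) ≤ 4 / g * ∑ j ∈ range k, t j ^ 2 := by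
    have e : 4 / (g:ℝ) * ∑ j ∈ range k, t j ^ 2 = 2 / ((g:ℝ) * (g ^ 2 + 1)) * ((g ^ 2 + 1) * (2 * ∑ j ∈ range k, t j ^ 2)) := by
      field_simp; ring
    rw [e]
    gcongr
  have e2 : ∑ j ∈ range k, nn (α - g ^ j * θ) ^ 2 = ∑ j ∈ range k, t j ^ 2 := rfl
  rw [e2]
  linarith

lemma eta_exists (G : ℕ) (hG : 2 ≤ G) (δ : ℝ) (hδ : 0 < δ) (hδ1 : δ ≤ 1) :
    ∃ η : ℝ, 0 < η ∧ η ≤ 1 ∧ ∀ e : ℕ, 1 ≤ e → e ≤ G → (e:ℝ) - δ ≤ (e:ℝ) ^ (1 - η) := by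
  have hGr : (2:ℝ) ≤ G := by exact_mod_cast hG
  have hlG : 0 < Real.log G := Real.log_pos (by linarith)
  set ρ : ℝ := 1 - δ / (2 * G) with hρ
  have hq : δ / (2 * G) ≤ 1 / 4 := by
    rw [div_le_iff₀ (by positivity)]; linarith
  have hq0 : 0 < δ / (2 * G) := by positivity
  have hρ0 : 0 < ρ := by linarith
  have hρ1 : ρ < 1 := by linarith
  refine ⟨-Real.log ρ / Real.log G, ?_, ?_, ?_⟩
  · apply div_pos _ hlG
    have := Real.log_neg hρ0 hρ1
    linarith
  · rw [div_le_one hlG, ← Real.log_inv]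
    apply Real.log_le_log (by positivity)
    rw [inv_le_comm₀ hρ0 (by linarith)]
    have : (G:ℝ)⁻¹ ≤ 2⁻¹ := by
      apply inv_anti₀ <;> linarith
    norm_num at this ⊢
    linarith
  · intro e he heG
    have her : (1:ℝ) ≤ e := by exact_mod_cast he
    have heGr : (e:ℝ) ≤ G := by exact_mod_cast heG
    rw [sub_eq_add_neg 1, Real.rpow_add (by linarith), Real.rpow_one]
    have h1 : ρ ≤ (e:ℝ) ^ (-(-Real.log ρ / Real.log G)) := by
      have h2 : (G:ℝ) ^ (-(-Real.log ρ / Real.log G)) = ρ := by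
        rw [Real.rpow_def_of_pos (by linarith)]
        have : Real.log G * (-(-Real.log ρ / Real.log G)) = Real.log ρ := by field_simp
        rw [this, Real.exp_log hρ0]
      conv_lhs => rw [← h2]
      apply Real.rpow_le_rpow_of_nonpos (by linarith) heGr
      have := Real.log_neg hρ0 hρ1
      have : 0 < -Real.log ρ / Real.log G := div_pos (by linarith) hlG
      linarith
    have h3 : (e:ℝ) - δ ≤ e * ρ := by
      rw [hρ]
      have : (e:ℝ) * (δ / (2 * G)) ≤ δ := by
        rw [mul_div_assoc', div_le_iff₀ (by positivity)]; nlinarith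
      linarith
    refine h3.trans ?_
    gcongr

lemma sq_sum_deficit (s : Finset ℕ) (x : ℕ → ℝ) {a b : ℕ} (ha : a ∈ s) (hb : b ∈ s) (hab : a ≠ b) :
    (∑ c ∈ s, x c) ^ 2 + (x a - x b) ^ 2 ≤ #s * ∑ c ∈ s, x c ^ 2 := by
  have hb' : b ∈ s.erase a := mem_erase.2 ⟨hab.symm, hb⟩
  have hc : (#s : ℝ) = #((s.erase a).erase b) + 2 := by
    have h1 := Finset.card_erase_add_one ha
    have h2 := Finset.card_erase_add_one hb'
    have : #s = #((s.erase a).erase b) + 2 := by omega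
    exact_mod_cast this
  rw [← Finset.add_sum_erase s _ ha, ← Finset.add_sum_erase _ _ hb', ← Finset.add_sum_erase s (fun c => x c ^ 2) ha,
    ← Finset.add_sum_erase _ (fun c => x c ^ 2) hb', hc]
  have hT := sq_sum_le_card_mul_sum_sq (s := (s.erase a).erase b) (f := x)
  have hT0 : 0 ≤ ∑ c ∈ (s.erase a).erase b, x c ^ 2 := Finset.sum_nonneg fun _ _ => sq_nonneg _
  rcases Nat.eq_zero_or_pos (#((s.erase a).erase b)) with h0 | hpos
  · rw [Finset.card_eq_zero] at h0
    rw [h0]; simp; nlinarith [sq_nonneg (x a - x b)]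
  · have hn : (1:ℝ) ≤ (#((s.erase a).erase b) : ℝ) := by exact_mod_cast hpos
    set n : ℝ := (#((s.erase a).erase b) : ℝ)
    set T := ∑ c ∈ (s.erase a).erase b, x c
    set T2 := ∑ c ∈ (s.erase a).erase b, x c ^ 2
    set A := x a
    set B := x b
    have key : 2 * (A + B) * T ≤ n * (A ^ 2 + B ^ 2) + 2 * T2 := by
      have h1 : 2 * n * (A + B) * T ≤ n * (n * (A ^ 2 + B ^ 2) + 2 * T2) := by
        nlinarith [sq_nonneg (n * (A + B) - 2 * T), sq_nonneg (n * (A - B))]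
      have h2 : n * (2 * (A + B) * T) ≤ n * (n * (A ^ 2 + B ^ 2) + 2 * T2) := by linarith
      exact le_of_mul_le_mul_left h2 (by linarith)
    nlinarith

lemma CC_deficit (N m : ℕ) (hm : 0 < m) (hmN : m ∣ N) (x : ℕ → ℝ) {a b : ℕ} (ha : a < N) (hb : b < N)
    (hab : a ≠ b) (hmod : a % m = b % m) :
    CC N m x + (x a - x b) ^ 2 ≤ ((N / m : ℕ):ℝ) * ∑ c ∈ range N, x c ^ 2 := by
  rw [CC_eq N m hm]
  have h1 : ∀ r ∈ range m, (∑ c ∈ range N with c % m = r, x c) ^ 2 + (if r = a % m then (x a - x b) ^ 2 else 0) ≤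
      ((N / m : ℕ):ℝ) * ∑ c ∈ range N with c % m = r, x c ^ 2 := by
    intro r _
    split_ifs with hr
    · refine (sq_sum_deficit _ x (a := a) (b := b) ?_ ?_ hab).trans ?_
      · simp [ha, hr]
      · simp [hb, hr, hmod]
      · gcongr
        exact card_res N m hm hmN r
    · rw [add_zero]
      refine (sq_sum_le_card_mul_sum_sq).trans ?_
      gcongr
      exact card_res N m hm hmN r
  have h2 := Finset.sum_le_sum h1
  rw [Finset.sum_add_distrib, Finset.sum_ite_eq', if_pos (mem_range.2 (Nat.mod_lt _ hm)), ← Finset.mul_sum,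
    Finset.sum_fiberwise_of_maps_to (fun c _ => mem_range.2 (Nat.mod_lt _ hm))] at h2
  exact h2
end DS

namespace DS
open Finset

lemma sum_periodic_shift {g : ℕ} (y : ℕ → ℂ) (hy : ∀ c, y (c + g) = y c) (m : ℕ) :
    ∑ c ∈ range g, y (c + m) = ∑ c ∈ range g, y c := by
  induction m with
  | zero => simp
  | succ m ih =>
    rw [← ih]
    have h1 := Finset.sum_range_succ (fun c => y (c + m)) g
    have h2 := Finset.sum_range_succ' (fun c => y (c + m)) g
    have h3 : y (g + m) = y (0 + m) := by rw [add_comm g m, zero_add, hy]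
    have h4 : ∑ c ∈ range g, y (c + (m+1)) = ∑ c ∈ range g, y (c + 1 + m) :=
      Finset.sum_congr rfl fun c _ => by congr 1; ring
    rw [h4]
    have := h1.symm.trans h2
    beta_reduce at this
    rw [h3] at this
    exact (add_right_cancel this).symm

lemma ph_nonneg (g : ℕ) (t : ℝ) : 0 ≤ ph g t := norm_nonneg _

lemma ph_add_int (g : ℕ) (t : ℝ) (m : ℤ) : ph g (t + m) = ph g t := by
  unfold ph
  congr 2
  refine Finset.sum_congr rfl fun u _ => ?_
  have : (u:ℝ) * (t + m) = u * t + ((u * m : ℤ):ℝ) := by push_cast; ring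
  rw [this, ee_add_int]

lemma ph_le_one {g : ℕ} (hg : 2 ≤ g) (t : ℝ) : ph g t ≤ 1 := by
  have := FA_le_one (fd_GM hg 0) 1 (0 - t)
  rwa [FA_one hg, sub_sub_cancel] at this

lemma hat_one {g : ℕ} (hg : 2 ≤ g) (t : ℝ) :
    ((g:ℝ) - 2) / g ≤ ‖∑ c ∈ range g, ((ph g (t - c / g) ^ 2 : ℝ):ℂ) * ee (c / g)‖ := by
  have hgpos : 0 < g := by omega
  have hgr : (0:ℝ) < g := by exact_mod_cast hgpos
  have hgc : (g:ℂ) ≠ 0 := by exact_mod_cast hgpos.ne'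
  have e1 : ∀ c : ℕ, ((ph g (t - c / g) ^ 2 : ℝ):ℂ) = (1 / (g:ℂ)) ^ 2 * ∑ u ∈ range g, ∑ v ∈ range g,
      ee (((u:ℝ) - v) * t) * ee (-((((u:ℤ) - v : ℤ):ℝ) * c / g)) := by
    intro c
    unfold ph
    push_cast
    rw [← Complex.mul_conj', map_mul, map_sum, mul_mul_mul_comm, Finset.sum_mul_sum]
    congr 1
    · simp [sq]
    · refine Finset.sum_congr rfl fun u _ => Finset.sum_congr rfl fun v _ => ?_
      rw [conj_ee, ← ee_add, ← ee_add]
      congr 1; ring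
  have e2 : ∑ c ∈ range g, ((ph g (t - c / g) ^ 2 : ℝ):ℂ) * ee (c / g) =
      (1 / (g:ℂ)) ^ 2 * ∑ u ∈ range g, ∑ v ∈ range g, ee (((u:ℝ) - v) * t) *
        ∑ c ∈ range g, ee ((c:ℝ) * (((1 - ((u:ℤ) - v) : ℤ):ℝ) / g)) := by
    simp_rw [e1, mul_assoc, ← Finset.mul_sum]
    congr 1
    simp_rw [Finset.sum_mul, Finset.mul_sum]
    rw [Finset.sum_comm]
    refine Finset.sum_congr rfl fun u _ => ?_
    rw [Finset.sum_comm]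
    refine Finset.sum_congr rfl fun v _ => Finset.sum_congr rfl fun c _ => ?_
    rw [mul_assoc, ← ee_add]
    congr 2
    push_cast; ring
  have e3 : ∑ u ∈ range g, ∑ v ∈ range g, ee (((u:ℝ) - v) * t) *
        ∑ c ∈ range g, ee ((c:ℝ) * (((1 - ((u:ℤ) - v) : ℤ):ℝ) / g)) =
      g * (((g:ℂ) - 1) * ee t + ee ((1 - g) * t)) := by
    simp_rw [orth hgpos]
    obtain ⟨k, rfl⟩ : ∃ k, g = k + 1 := ⟨g - 1, by omega⟩
    rw [Finset.sum_range_succ']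
    have h1 : ∀ u ∈ range k, ∑ v ∈ range (k+1), ee (((u + 1 : ℕ):ℝ) * t - v * t) *
        (if ((k + 1 : ℕ):ℤ) ∣ 1 - (((u + 1 : ℕ):ℤ) - v) then ((k+1 : ℕ):ℂ) else 0) = ee t * ((k+1 : ℕ):ℂ) := by
      intro u hu
      rw [mem_range] at hu
      rw [Finset.sum_eq_single u]
      · rw [if_pos]
        · congr 2; push_cast; ring
        · push_cast; ring_nf; exact dvd_zero _
      · intro v hv hne
        rw [mem_range] at hv
        rw [if_neg, mul_zero]
        rintro ⟨z, hz⟩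
        push_cast at hz
        have : z = 0 := by nlinarith [Int.lt_iff_add_one_le.1 (show -1 < z by nlinarith), Int.lt_iff_add_one_le.1 (show z < 1 by nlinarith)]
        subst this
        apply hne; omega
      · intro h; exact absurd (mem_range.2 (by omega)) h
    have h2 : ∑ v ∈ range (k+1), ee (((0 : ℕ):ℝ) * t - v * t) *
        (if ((k + 1 : ℕ):ℤ) ∣ 1 - (((0 : ℕ):ℤ) - v) then ((k+1 : ℕ):ℂ) else 0) = ee ((1 - (k+1:ℕ)) * t) * ((k+1 : ℕ):ℂ) := by
      rw [Finset.sum_eq_single k]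
      · rw [if_pos]
        · congr 2; push_cast; ring
        · push_cast; ring_nf; exact dvd_rfl
      · intro v hv hne
        rw [mem_range] at hv
        rw [if_neg, mul_zero]
        rintro ⟨z, hz⟩
        push_cast at hz
        have hv' : v < k := by omega
        have : z = 0 := by nlinarith [Int.lt_iff_add_one_le.1 (show -1 < z by nlinarith), Int.lt_iff_add_one_le.1 (show z < 1 by nlinarith)]
        subst this
        omega
      · intro h; exact absurd (mem_range.2 (by omega)) h
    simp_rw [sub_mul] at *
    rw [Finset.sum_congr rfl h1, h2]
    simp only [sum_const, card_range, nsmul_eq_mul]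
    push_cast; ring
  rw [e2, e3]
  have e4 : (1 / (g:ℂ)) ^ 2 * (g * (((g:ℂ) - 1) * ee t + ee ((1 - g) * t))) =
      (1 / (g:ℂ)) * (((g:ℂ) - 1) * ee t + ee ((1 - g) * t)) := by field_simp
  rw [e4, norm_mul]
  have e5 : ‖1 / (g:ℂ)‖ = 1 / (g:ℝ) := by simp
  rw [e5, div_eq_mul_one_div, mul_comm]
  gcongr
  have h3 := norm_sub_le_norm_add (((g:ℂ) - 1) * ee t) (ee ((1 - g) * t))
  have h4 : ‖((g:ℂ) - 1) * ee t‖ = (g:ℝ) - 1 := by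
    rw [norm_mul, norm_ee, mul_one]
    have : ((g:ℂ) - 1) = (((g:ℝ) - 1 : ℝ):ℂ) := by push_cast; rfl
    rw [this, Complex.norm_real, Real.norm_eq_abs, abs_of_nonneg]
    have : (1:ℝ) ≤ g := by exact_mod_cast hgpos
    linarith
  rw [h4, norm_ee] at h3
  linarith

lemma ph_pair {g : ℕ} (hg : 3 ≤ g) (t : ℝ) (m : ℕ) (hm : 0 < m) (hmg : m < g) :
    ∃ c < g, 4 / (g:ℝ) ^ 6 ≤ (ph g (t - c / g) - ph g (t - ((c + m : ℕ):ℝ) / g)) ^ 2 := by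
  have hgpos : 0 < g := by omega
  have hgr : (0:ℝ) < g := by exact_mod_cast hgpos
  have hg3 : (3:ℝ) ≤ g := by exact_mod_cast hg
  by_contra hcon
  push Not at hcon
  set x : ℕ → ℝ := fun c => ph g (t - c / g) with hx
  set y : ℕ → ℂ := fun c => ((x c ^ 2 : ℝ):ℂ) * ee (c / g) with hy
  have hper : ∀ c, y (c + g) = y c := by
    intro c
    rw [hy]; dsimp only
    have e : ((c + g : ℕ):ℝ) / g = c / g + ((1:ℤ):ℝ) := by push_cast; field_simp
    have e' : t - ((c + g : ℕ):ℝ) / g = t - c / g + ((-1:ℤ):ℝ) := by rw [e]; push_cast; ring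
    rw [hx]; dsimp only
    rw [e', ph_add_int, e, ee_add_int]
  have hs := sum_periodic_shift y hper m
  set H := ∑ c ∈ range g, y c with hH
  have hH1 : ((g:ℝ) - 2) / g ≤ ‖H‖ := hat_one (by omega) t
  have hx0 : ∀ c, 0 ≤ x c := fun c => ph_nonneg _ _
  have hx1 : ∀ c, x c ≤ 1 := fun c => ph_le_one (by omega) _
  have h1 : ∑ c ∈ range g, (((x c ^ 2 - x (c + m) ^ 2 : ℝ)):ℂ) * ee (c / g) = H * (1 - ee (((-(m:ℤ) : ℤ):ℝ) / g)) := by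
    have : ∀ c : ℕ, (((x c ^ 2 - x (c + m) ^ 2 : ℝ)):ℂ) * ee (c / g) = y c - y (c + m) * ee (((-(m:ℤ) : ℤ):ℝ) / g) := by
      intro c
      rw [hy]; dsimp only
      rw [mul_assoc, ← ee_add]
      have : ((c + m : ℕ):ℝ) / g + ((-(m:ℤ) : ℤ):ℝ) / g = c / g := by push_cast; ring
      rw [this]; push_cast; ring
    simp_rw [this]
    rw [Finset.sum_sub_distrib, ← Finset.sum_mul, hs]
    ring
  have h2 : 4 * (1 / (g:ℝ)) ≤ ‖1 - ee (((-(m:ℤ) : ℤ):ℝ) / g)‖ := by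
    refine le_trans ?_ (norm_one_sub_ee_ge _)
    have := nn_div_ge (q := g) (j := -(m:ℤ)) hgpos (by
      rw [Int.dvd_neg, Int.natCast_dvd_natCast]
      exact Nat.not_dvd_of_pos_of_lt hm hmg)
    linarith
  have h3 : ‖∑ c ∈ range g, (((x c ^ 2 - x (c + m) ^ 2 : ℝ)):ℂ) * ee (c / g)‖ < g * (4 / (g:ℝ) ^ 3) := by
    refine (norm_sum_le _ _).trans_lt ?_
    have : ∑ c ∈ range g, ‖(((x c ^ 2 - x (c + m) ^ 2 : ℝ)):ℂ) * ee (c / g)‖ < ∑ c ∈ range g, 4 / (g:ℝ) ^ 3 := by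
      apply Finset.sum_lt_sum_of_nonempty ⟨0, mem_range.2 hgpos⟩
      intro c hc
      rw [norm_mul, norm_ee, mul_one, Complex.norm_real, Real.norm_eq_abs]
      have h4 := hcon c (mem_range.1 hc)
      have h5 : |x c - x (c + m)| < 2 / (g:ℝ) ^ 3 := by
        apply abs_lt_of_sq_lt_sq _ (by positivity)
        have : (2 / (g:ℝ) ^ 3) ^ 2 = 4 / (g:ℝ) ^ 6 := by rw [div_pow]; ring
        rw [this]; exact h4
      have e : x c ^ 2 - x (c + m) ^ 2 = (x c - x (c + m)) * (x c + x (c + m)) := by ring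
      rw [e, abs_mul, abs_of_nonneg (add_nonneg (hx0 _) (hx0 _))]
      have h6 : x c + x (c + m) ≤ 2 := by linarith [hx1 c, hx1 (c + m)]
      calc |x c - x (c + m)| * (x c + x (c + m)) ≤ |x c - x (c + m)| * 2 := by gcongr
        _ < 2 / (g:ℝ) ^ 3 * 2 := by linarith
        _ = 4 / (g:ℝ) ^ 3 := by ring
    refine this.trans_le ?_
    simp
  rw [h1, norm_mul] at h3
  have h7 : (1:ℝ) / g ≤ ((g:ℝ) - 2) / g := by gcongr; linarith
  have h8 : (1 / (g:ℝ)) * (4 * (1 / (g:ℝ))) ≤ ‖H‖ * ‖1 - ee (((-(m:ℤ) : ℤ):ℝ) / g)‖ := by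
    gcongr; exact h7.trans hH1
  have h9 : (1 / (g:ℝ)) * (4 * (1 / (g:ℝ))) = g * (4 / (g:ℝ) ^ 3) := by field_simp
  linarith

lemma SG_ge3 {g : ℕ} (hg : 3 ≤ g) : ∃ η : ℝ, 0 < η ∧ η ≤ 1 ∧ ∀ α, SG g (fd g α) η := by
  have hg3 : (3:ℝ) ≤ g := by exact_mod_cast hg
  have hgpos : 0 < g := by omega
  have hgr : (0:ℝ) < g := by exact_mod_cast hgpos
  obtain ⟨η, h0, h1, h2⟩ := eta_exists g (by omega) (4 / (g:ℝ) ^ 6) (by positivity) (by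
    rw [div_le_one (by positivity)]
    calc (4:ℝ) ≤ 3 ^ 6 := by norm_num
      _ ≤ (g:ℝ) ^ 6 := by gcongr)
  refine ⟨η, h0, h1, fun α m hmg => Or.inr fun θ => ?_⟩
  have hm : 0 < m := Nat.pos_of_dvd_of_pos hmg hgpos
  set x : ℕ → ℝ := fun c => FA g (fd g α) 1 (θ + (c:ℝ) / g) with hx
  have hpar : ∑ c ∈ range g, x c ^ 2 = 1 := by
    have := FA_parseval hgpos (fd_GM (by omega) α) 1 θ
    rw [pow_one] at this
    exact this
  have hle : m ≤ g := Nat.le_of_dvd hgpos hmg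
  rcases eq_or_lt_of_le hle with rfl | hlt
  · have := CC_le_triv m m hm dvd_rfl x
    rw [hpar] at this
    rw [Nat.div_self hm] at *
    simpa using this
  · obtain ⟨c, hc, h3⟩ := ph_pair hg (α - θ) m hm hlt
    have hxe : ∀ c : ℕ, x c = ph g (α - θ - c / g) := by
      intro c; rw [hx]; dsimp only; rw [FA_one (by omega)]; congr 1; ring
    have hmodx : x ((c + m) % g) = x (c + m) := by
      rw [hx]; dsimp only
      have : θ + ((c + m : ℕ):ℝ) / g = θ + (((c + m) % g : ℕ):ℝ) / g + (((c + m) / g : ℕ):ℤ) := by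
        have h := Nat.mod_add_div (c + m) g
        have h' : (((c + m) % g : ℕ):ℝ) + g * ((c + m) / g : ℕ) = ((c + m : ℕ):ℝ) := by exact_mod_cast h
        have hz : ((((c + m) / g : ℕ):ℤ):ℝ) = (((c + m) / g : ℕ):ℝ) := by norm_cast
        have hg0 : (g:ℝ) ≠ 0 := by positivity
        rw [← h', hz, add_div, mul_div_cancel_left₀ _ hg0]; ring
      rw [this, FA_add_int]
    have h4 := CC_deficit g m hm hmg x (a := c) (b := (c + m) % g) hc (Nat.mod_lt _ hgpos) (by
        intro h
        rcases lt_or_ge (c + m) g with h5 | h5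
        · rw [Nat.mod_eq_of_lt h5] at h; omega
        · rw [Nat.mod_eq_sub_mod h5, Nat.mod_eq_of_lt (by omega)] at h; omega) (by
        rw [Nat.mod_mod_of_dvd _ hmg]; simp)
    rw [hpar, mul_one, hmodx, hxe c, hxe (c + m)] at h4
    have h5 := h2 (g / m) (Nat.div_pos hle hm) (Nat.div_le_self _ _)
    linarith

lemma ph_two_sq (t : ℝ) : ph 2 t ^ 2 = (1 + Real.cos (2 * Real.pi * t)) / 2 := by
  unfold ph
  rw [norm_mul, mul_pow, Finset.sum_range_succ, Finset.sum_range_one]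
  have e : ‖((0:ℕ):ℝ)‖ = 0 := by simp
  have h : ‖ee (((0:ℕ):ℝ) * t) + ee (((1:ℕ):ℝ) * t)‖ ^ 2 = 2 + 2 * Real.cos (2 * Real.pi * t) := by
    simp only [Nat.cast_zero, zero_mul, ee_zero, Nat.cast_one, one_mul]
    have h1 := Complex.normSq_add 1 (ee t)
    rw [Complex.normSq_eq_norm_sq, Complex.normSq_eq_norm_sq, Complex.normSq_eq_norm_sq, norm_ee] at h1
    rw [h1]
    simp only [norm_one, one_mul, Complex.conj_re, ee_re]
    ring
  rw [h]
  simp; ring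

lemma SG_two_num (v u u' a0 a1 a2 a3 : ℝ) (hv0 : 0 ≤ v) (hv1 : v ≤ 1) (huu : u ^ 2 + u' ^ 2 = 1)
    (h0 : a0 ^ 2 = v * ((1 + u) / 2)) (h2 : a2 ^ 2 = v * ((1 - u) / 2))
    (h1 : a1 ^ 2 = (1 - v) * ((1 + u') / 2)) (h3 : a3 ^ 2 = (1 - v) * ((1 - u') / 2))
    (p0 : 0 ≤ a0) (p1 : 0 ≤ a1) (p2 : 0 ≤ a2) (p3 : 0 ≤ a3) :
    (a0 + a1 + a2 + a3) ^ 2 ≤ 7 / 2 := by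
  have q1 : (a0 + a2) ^ 2 ≤ v * (1 + |u'|) := by
    have : (2 * (a0 * a2)) ≤ v * |u'| := by
      apply abs_le_of_sq_le_sq' _ (by positivity) |>.2
      have e : (2 * (a0 * a2)) ^ 2 = 4 * (a0 ^ 2 * a2 ^ 2) := by ring
      rw [e, h0, h2, mul_pow, sq_abs]
      nlinarith [sq_nonneg v]
    nlinarith
  have q2 : (a1 + a3) ^ 2 ≤ (1 - v) * (1 + |u|) := by
    have : (2 * (a1 * a3)) ≤ (1 - v) * |u| := by
      have h1v : 0 ≤ 1 - v := by linarith
      apply abs_le_of_sq_le_sq' _ (by positivity) |>.2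
      have e : (2 * (a1 * a3)) ^ 2 = 4 * (a1 ^ 2 * a3 ^ 2) := by ring
      rw [e, h1, h3, mul_pow, sq_abs]
      nlinarith [sq_nonneg (1 - v)]
    nlinarith
  have hs : |u| + |u'| ≤ 3 / 2 := by
    nlinarith [sq_abs u, sq_abs u', sq_nonneg (|u| - |u'|), abs_nonneg u, abs_nonneg u']
  set s := a0 + a2
  set r := a1 + a3
  set A := 1 + |u'|
  set B := 1 + |u|
  have hA : 1 ≤ A := by have := abs_nonneg u'; simp only [A]; linarith
  have hB : 1 ≤ B := by have := abs_nonneg u; simp only [B]; linarith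
  have hAB : A + B ≤ 7 / 2 := by simp only [A, B]; linarith
  have e : a0 + a1 + a2 + a3 = s + r := by simp only [s, r]; ring
  rw [e]
  -- (s + r)^2 ≤ (s^2/A + r^2/B) (A+B) ≤ A + B
  have h5 : (s + r) ^ 2 ≤ (s ^ 2 / A + r ^ 2 / B) * (A + B) := by
    have : (s ^ 2 / A + r ^ 2 / B) * (A + B) - (s + r) ^ 2 = (s * B - r * A) ^ 2 / (A * B) := by
      field_simp; ring
    have h6 : 0 ≤ (s * B - r * A) ^ 2 / (A * B) := by positivity
    linarith
  have h6 : s ^ 2 / A ≤ v := by rw [div_le_iff₀ (by linarith)]; exact q1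
  have h7 : r ^ 2 / B ≤ 1 - v := by rw [div_le_iff₀ (by linarith)]; exact q2
  have h8 : (s ^ 2 / A + r ^ 2 / B) * (A + B) ≤ 1 * (A + B) := by
    apply mul_le_mul_of_nonneg_right _ (by linarith); linarith
  linarith

lemma FA_four (α θ : ℝ) : FA 4 (fd 2 α) 1 θ = ph 2 (α - θ) * ph 2 (α - 2 * θ) := by
  have h := FA_add (G := 2) (by norm_num) (fd_GM le_rfl α) 1 1 θ
  rw [FA_one le_rfl, FA_one le_rfl] at h
  have e : FA 4 (fd 2 α) 1 θ = FA 2 (fd 2 α) (1 + 1) θ := by unfold FA; norm_num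
  rw [e, h]; norm_num

lemma fd_two_GM (α : ℝ) : GM 4 (fd 2 α) := by
  have := (fd_GM (g := 2) le_rfl α).pow (by norm_num) 1
  norm_num at this; exact this

lemma SG_two : ∃ η : ℝ, 0 < η ∧ η ≤ 1 ∧ ∀ α, SG 4 (fd 2 α) η := by
  obtain ⟨η, h0, h1, h2⟩ := eta_exists 4 (by norm_num) (1/2) (by norm_num) (by norm_num)
  refine ⟨η, h0, h1, fun α m hm4 => ?_⟩
  have hm : m ∈ Nat.divisors 4 := Nat.mem_divisors.2 ⟨hm4, by norm_num⟩
  have : Nat.divisors 4 = {1, 2, 4} := by decide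
  rw [this] at hm
  simp only [mem_insert, mem_singleton] at hm
  rcases hm with rfl | rfl | rfl
  · right
    intro θ
    rw [CC_eq _ _ (by norm_num)]
    have h3 := h2 4 (by norm_num) le_rfl
    refine le_trans ?_ (h3.trans (by norm_num))
    simp only [range_one, sum_singleton, Nat.mod_one, filter_true, Finset.sum_range_succ, Finset.sum_range_zero]
    simp only [FA_four]
    norm_num
    set t := α - θ with ht
    set w := α - 2 * θ with hw
    have ph_p : ∀ t, ph 2 (t + 1) = ph 2 t := fun t => by simpa using ph_add_int 2 t 1
    have c1 : ph 2 (α - 2 * (θ + 1 / 4)) ^ 2 = 1 - ph 2 w ^ 2 := by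
      rw [ph_two_sq, ph_two_sq]
      have : 2 * Real.pi * (α - 2 * (θ + 1 / 4)) = 2 * Real.pi * w - Real.pi := by rw [hw]; ring
      rw [this, Real.cos_sub_pi]; ring
    have c2 : ph 2 (α - 2 * (θ + 1 / 2)) = ph 2 w := by
      rw [← ph_p]; congr 1; rw [hw]; ring
    have c3 : ph 2 (α - 2 * (θ + 3 / 4)) = ph 2 (α - 2 * (θ + 1 / 4)) := by
      rw [← ph_p]; congr 1; ring
    have d2 : ph 2 (α - (θ + 1 / 2)) ^ 2 = (1 - Real.cos (2 * Real.pi * t)) / 2 := by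
      rw [ph_two_sq]
      have : 2 * Real.pi * (α - (θ + 1 / 2)) = 2 * Real.pi * t - Real.pi := by rw [ht]; ring
      rw [this, Real.cos_sub_pi]; ring
    have d1 : ph 2 (α - (θ + 1 / 4)) ^ 2 = (1 + Real.sin (2 * Real.pi * t)) / 2 := by
      rw [ph_two_sq]
      have : 2 * Real.pi * (α - (θ + 1 / 4)) = 2 * Real.pi * t - Real.pi / 2 := by rw [ht]; ring
      rw [this, Real.cos_sub_pi_div_two]
    have d3 : ph 2 (α - (θ + 3 / 4)) ^ 2 = (1 - Real.sin (2 * Real.pi * t)) / 2 := by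
      rw [ph_two_sq]
      have : 2 * Real.pi * (α - (θ + 3 / 4)) = 2 * Real.pi * t - Real.pi / 2 - Real.pi := by rw [ht]; ring
      rw [this, Real.cos_sub_pi, Real.cos_sub_pi_div_two]; ring
    have hw1 : ph 2 w ^ 2 ≤ 1 := by
      have := ph_le_one (g := 2) le_rfl w
      have := ph_nonneg 2 w
      nlinarith
    refine SG_two_num (ph 2 w ^ 2) (Real.cos (2 * Real.pi * t)) (Real.sin (2 * Real.pi * t)) _ _ _ _ (sq_nonneg _) hw1
      (Real.cos_sq_add_sin_sq _) ?_ ?_ ?_ ?_ ?_ ?_ ?_ ?_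
    · rw [mul_pow, ph_two_sq t]; ring
    · rw [mul_pow, d2, c2]; ring
    · rw [mul_pow, d1, c1]; ring
    · rw [c3, mul_pow, d3, c1]; ring
    all_goals exact mul_nonneg (ph_nonneg _ _) (ph_nonneg _ _)
  · left; exact ⟨rfl, rfl⟩
  · right
    intro θ
    have := CC_le_triv 4 4 (by norm_num) dvd_rfl (fun c => FA 4 (fd 2 α) 1 (θ + (c:ℝ) / (4:ℕ)))
    have hpar := FA_parseval (G := 4) (by norm_num) (fd_two_GM α) 1 θ
    rw [pow_one] at hpar
    rw [hpar] at this
    simpa using this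
end DS

namespace DS
open Finset

lemma sym_sum (R : ℕ) (F : ℕ → ℕ → ℝ) (hs : ∀ a b, F a b = F b a) (hF : ∀ a b, 0 ≤ F a b) :
    ∑ w ∈ range R, ∑ w' ∈ range R, F w w' ≤
      ∑ w ∈ range R, F w w + 2 * ∑ i ∈ range R, ∑ w ∈ range R, F (w + i + 1) w := by
  have h1 : ∀ R, ∑ w ∈ range R, ∑ w' ∈ range R, F w w' =
      ∑ w ∈ range R, F w w + 2 * ∑ w ∈ range R, ∑ w' ∈ range w, F w w' := by
    intro R
    induction R with
    | zero => simp
    | succ R ih =>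
      simp only [Finset.sum_range_succ, Finset.sum_add_distrib]
      rw [ih]
      have : ∑ x ∈ range R, F x R = ∑ x ∈ range R, F R x := Finset.sum_congr rfl fun x _ => hs _ _
      rw [this]; ring
  rw [h1]
  have h2 : ∑ w ∈ range R, ∑ w' ∈ range w, F w w' = ∑ w' ∈ range R, ∑ w ∈ Ico (w' + 1) R, F w w' := by
    apply Finset.sum_comm'
    intro a b; simp only [mem_range, mem_Ico]; omega
  rw [h2]
  have h3 : ∑ i ∈ range R, ∑ w ∈ range R, F (w + i + 1) w = ∑ w ∈ range R, ∑ i ∈ range R, F (w + i + 1) w :=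
    Finset.sum_comm
  rw [h3]
  gcongr with w hw
  rw [Finset.sum_Ico_eq_sum_range]
  calc ∑ k ∈ range (R - (w + 1)), F (w + 1 + k) w = ∑ k ∈ range (R - (w + 1)), F (w + k + 1) w := by
        apply Finset.sum_congr rfl; intro k _; congr 1; ring
    _ ≤ _ := Finset.sum_le_sum_of_subset_of_nonneg (by intro k; simp only [mem_range]; omega) fun _ _ _ => hF _ _

lemma vdc (M N R : ℕ) (hR : 0 < R) (a b : ℕ → ℂ) (ha : ∀ n, ‖a n‖ ≤ 1) (hb : ∀ n, ‖b n‖ ≤ 1)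
    (x : ℕ → ℕ → ℂ) (hx : ∀ m n, ‖x m n‖ ≤ 1) :
    ‖∑ m ∈ Icc 1 M, ∑ n ∈ Icc 1 N, a m * b n * x m n‖ ^ 2 ≤
      M * ((N / R + 1 : ℕ) * (M * N + 2 * ∑ i ∈ range R, ∑ n ∈ Icc 1 N,
        ‖∑ m ∈ Icc 1 M, x m (n + i + 1) * (starRingEnd ℂ) (x m n)‖)) := by
  set K := N / R + 1 with hK
  set B : ℕ → ℂ := fun n => if n ∈ Icc 1 N then b n else 0 with hB
  set ind : ℕ → ℝ := fun n => if n ∈ Icc 1 N then 1 else 0 with hind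
  have hBn : ∀ n, ‖B n‖ ≤ ind n := by
    intro n; simp only [hB, hind]; split_ifs
    · exact hb n
    · simp
  have hind0 : ∀ n, 0 ≤ ind n := by intro n; simp only [hind]; split_ifs <;> norm_num
  have hind1 : ∀ n, ind n ≤ 1 := by intro n; simp only [hind]; split_ifs <;> norm_num
  set V : ℕ → ℕ → ℝ := fun n n' => ‖∑ m ∈ Icc 1 M, x m n * (starRingEnd ℂ) (x m n')‖ with hV
  have hVs : ∀ n n', V n n' = V n' n := by
    intro n n'; simp only [hV]
    rw [← Complex.norm_conj, map_sum]; congr 1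
    apply Finset.sum_congr rfl; intro m _; rw [map_mul, Complex.conj_conj, mul_comm]
  have hV0 : ∀ n n', 0 ≤ V n n' := fun n n' => norm_nonneg _
  have hVM : ∀ n n', V n n' ≤ M := by
    intro n n'; simp only [hV]
    refine (norm_sum_le _ _).trans ((Finset.sum_le_card_nsmul _ _ 1 ?_).trans ?_)
    · intro m _; rw [norm_mul, Complex.norm_conj]
      exact mul_le_one₀ (hx _ _) (norm_nonneg _) (hx _ _)
    · simp
  have hsub : Icc 1 N ⊆ range (R * K) := by
    intro n; simp only [mem_Icc, mem_range, hK]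
    have := Nat.lt_mul_div_succ N hR
    omega
  have hsplit : ∀ m, ∑ n ∈ Icc 1 N, b n * x m n = ∑ v ∈ range K, ∑ w ∈ range R, B (w + R * v) * x m (w + R * v) := by
    intro m
    rw [← sum_range_mul_split R K (fun u => B u * x m u)]
    rw [← Finset.sum_subset hsub]
    · apply Finset.sum_congr rfl; intro n hn; simp only [hB]; rw [if_pos hn]
    · intro n _ hn; simp only [hB]; rw [if_neg hn, zero_mul]
  have hcount : ∀ (c : ℕ → ℝ), ∑ v ∈ range K, ∑ w ∈ range R, ind (w + R * v) * c (w + R * v) = ∑ n ∈ Icc 1 N, c n := by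
    intro c
    rw [← sum_range_mul_split R K (fun u => ind u * c u), ← Finset.sum_subset hsub]
    · apply Finset.sum_congr rfl; intro n hn; simp only [hind]; rw [if_pos hn, one_mul]
    · intro n _ hn; simp only [hind]; rw [if_neg hn, zero_mul]
  have hblock : ∀ v, ∑ m ∈ Icc 1 M, ‖∑ w ∈ range R, B (w + R * v) * x m (w + R * v)‖ ^ 2 ≤
      ∑ w ∈ range R, ∑ w' ∈ range R, (ind (w + R * v) * ind (w' + R * v)) * V (w + R * v) (w' + R * v) := by
    intro v
    have h1 : ((∑ m ∈ Icc 1 M, ‖∑ w ∈ range R, B (w + R * v) * x m (w + R * v)‖ ^ 2 : ℝ) : ℂ) =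
      ∑ w ∈ range R, ∑ w' ∈ range R, (B (w + R * v) * (starRingEnd ℂ) (B (w' + R * v))) *
        ∑ m ∈ Icc 1 M, x m (w + R * v) * (starRingEnd ℂ) (x m (w' + R * v)) := by
      rw [Complex.ofReal_sum]
      have : ∀ m ∈ Icc 1 M, ((‖∑ w ∈ range R, B (w + R * v) * x m (w + R * v)‖ ^ 2 : ℝ) : ℂ) =
          ∑ w ∈ range R, ∑ w' ∈ range R, (B (w + R * v) * (starRingEnd ℂ) (B (w' + R * v))) *
            (x m (w + R * v) * (starRingEnd ℂ) (x m (w' + R * v))) := by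
        intro m _
        rw [Complex.ofReal_pow, ← Complex.mul_conj', map_sum, Finset.sum_mul_sum]
        apply Finset.sum_congr rfl; intro w _; apply Finset.sum_congr rfl; intro w' _
        rw [map_mul]; ring
      rw [Finset.sum_congr rfl this, Finset.sum_comm]
      apply Finset.sum_congr rfl; intro w _
      rw [Finset.sum_comm]
      apply Finset.sum_congr rfl; intro w' _
      rw [Finset.mul_sum]
    have h2 : (∑ m ∈ Icc 1 M, ‖∑ w ∈ range R, B (w + R * v) * x m (w + R * v)‖ ^ 2 : ℝ) =
      ‖((∑ m ∈ Icc 1 M, ‖∑ w ∈ range R, B (w + R * v) * x m (w + R * v)‖ ^ 2 : ℝ) : ℂ)‖ := by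
      rw [Complex.norm_real, Real.norm_of_nonneg]
      exact Finset.sum_nonneg fun _ _ => by positivity
    rw [h2, h1]
    refine (norm_sum_le _ _).trans (Finset.sum_le_sum fun w _ => (norm_sum_le _ _).trans (Finset.sum_le_sum fun w' _ => ?_))
    rw [norm_mul, norm_mul, Complex.norm_conj]
    have := hBn (w + R * v); have := hBn (w' + R * v)
    gcongr
  have hblock2 : ∀ v, ∑ m ∈ Icc 1 M, ‖∑ w ∈ range R, B (w + R * v) * x m (w + R * v)‖ ^ 2 ≤
      ∑ w ∈ range R, ind (w + R * v) * (M:ℝ) + 2 * ∑ i ∈ range R, ∑ w ∈ range R, ind (w + R * v) * V (w + R * v + i + 1) (w + R * v) := by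
    intro v
    refine (hblock v).trans ((sym_sum R (fun w w' => (ind (w + R * v) * ind (w' + R * v)) * V (w + R * v) (w' + R * v)) ?_ ?_).trans ?_)
    · intro p q; rw [hVs, mul_comm (ind _)]
    · intro p q; exact mul_nonneg (mul_nonneg (hind0 _) (hind0 _)) (hV0 _ _)
    · gcongr with w _ i _ w _
      · exact mul_le_of_le_one_right (hind0 _) (hind1 _)
      · exact hVM _ _
      · exact mul_le_of_le_one_left (hind0 _) (hind1 _)
      · rw [show w + i + 1 + R * v = w + R * v + i + 1 by ring]
  calc ‖∑ m ∈ Icc 1 M, ∑ n ∈ Icc 1 N, a m * b n * x m n‖ ^ 2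
      ≤ (∑ m ∈ Icc 1 M, ‖∑ n ∈ Icc 1 N, b n * x m n‖) ^ 2 := by
        gcongr
        refine (norm_sum_le _ _).trans (Finset.sum_le_sum fun m _ => ?_)
        have : ∑ n ∈ Icc 1 N, a m * b n * x m n = a m * ∑ n ∈ Icc 1 N, b n * x m n := by
          rw [Finset.mul_sum]; apply Finset.sum_congr rfl; intro n _; ring
        rw [this, norm_mul]
        exact mul_le_of_le_one_left (norm_nonneg _) (ha m)
    _ ≤ M * ∑ m ∈ Icc 1 M, ‖∑ n ∈ Icc 1 N, b n * x m n‖ ^ 2 := by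
        have := sq_sum_le_card_mul_sum_sq (s := Icc 1 M) (f := fun m => ‖∑ n ∈ Icc 1 N, b n * x m n‖)
        simpa using this
    _ ≤ M * ∑ m ∈ Icc 1 M, (K * ∑ v ∈ range K, ‖∑ w ∈ range R, B (w + R * v) * x m (w + R * v)‖ ^ 2) := by
        gcongr with m _
        rw [hsplit m]
        calc _ ≤ (∑ v ∈ range K, ‖∑ w ∈ range R, B (w + R * v) * x m (w + R * v)‖) ^ 2 := by
              gcongr; exact norm_sum_le _ _
          _ ≤ _ := by
              have := sq_sum_le_card_mul_sum_sq (s := range K) (f := fun v => ‖∑ w ∈ range R, B (w + R * v) * x m (w + R * v)‖)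
              simpa using this
    _ = M * (K * ∑ v ∈ range K, ∑ m ∈ Icc 1 M, ‖∑ w ∈ range R, B (w + R * v) * x m (w + R * v)‖ ^ 2) := by
        rw [← Finset.mul_sum, Finset.sum_comm]
    _ ≤ M * (K * ∑ v ∈ range K, (∑ w ∈ range R, ind (w + R * v) * (M:ℝ) + 2 * ∑ i ∈ range R, ∑ w ∈ range R, ind (w + R * v) * V (w + R * v + i + 1) (w + R * v))) := by
        gcongr with v _
        exact hblock2 v
    _ = _ := by
        rw [Finset.sum_add_distrib, hcount (fun _ => (M:ℝ)), ← Finset.mul_sum, Finset.sum_comm]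
        congr 3
        · simp [mul_comm]
        · congr 1
          apply Finset.sum_congr rfl; intro i _
          rw [hcount (fun n => V (n + i + 1) n)]

end DS

namespace DS
open Finset

lemma exc_count (m N δ Q : ℕ) (hm : 0 < m) (hQ : 0 < Q) :
    #{n ∈ Icc 1 N | Q ≤ m * n % Q + m * δ} ≤ (m * N / Q + 1) * δ := by
  have : #{n ∈ Icc 1 N | Q ≤ m * n % Q + m * δ} ≤ #(range (m * N / Q + 1) ×ˢ range δ) := by
    refine Finset.card_le_card_of_injOn (fun n => (m * n / Q, (m * n % Q + m * δ - Q) / m)) ?_ ?_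
    · intro n hn
      simp only [coe_filter, mem_Icc, Set.mem_setOf_eq] at hn
      simp only [coe_product, Set.mem_prod, mem_coe, mem_range]
      constructor
      · exact Nat.lt_succ_of_le (Nat.div_le_div_right (Nat.mul_le_mul_left _ hn.1.2))
      · apply Nat.div_lt_of_lt_mul
        have := Nat.mod_lt (m * n) hQ
        omega
    · have key : ∀ n n' : ℕ, n < n' → Q ≤ m * n % Q + m * δ → m * n / Q = m * n' / Q →
          (m * n % Q + m * δ - Q) / m = (m * n' % Q + m * δ - Q) / m → False := by
        intro n n' hlt hn h1 h2
        have e1 := Nat.div_add_mod (m * n) Q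
        have e2 := Nat.div_add_mod (m * n') Q
        rw [← h1] at e2
        have h3 : m * (n + 1) ≤ m * n' := Nat.mul_le_mul_left _ hlt
        rw [mul_add, mul_one] at h3
        have h4 := Nat.div_add_mod (m * n % Q + m * δ - Q) m
        have h5 := Nat.div_add_mod (m * n' % Q + m * δ - Q) m
        rw [← h2] at h5
        have h6 := Nat.mod_lt (m * n' % Q + m * δ - Q) hm
        omega
      intro n hn n' hn' heq
      simp only [coe_filter, mem_Icc, Set.mem_setOf_eq] at hn hn'
      simp only [Prod.mk.injEq] at heq
      rcases lt_trichotomy n n' with h | h | h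
      · exact (key n n' h hn.2 heq.1 heq.2).elim
      · exact h
      · exact (key n' n h hn'.2 heq.1.symm heq.2.symm).elim
  simpa using this

lemma trunc_eq {G : ℕ} {f : ℕ → ℂ} (hG : 0 < G) (hf : GM G f) (k m n δ : ℕ)
    (h : m * n % G ^ k + m * δ < G ^ k) :
    f (m * (n + δ)) * (starRingEnd ℂ) (f (m * n)) =
      f (m * (n + δ) % G ^ k) * (starRingEnd ℂ) (f (m * n % G ^ k)) := by
  have hp := GM.pow' hG hf k
  have e1 := Nat.mod_add_div (m * n) (G ^ k)
  have hQ : 0 < G ^ k := by positivity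
  have h1 : m * (n + δ) = (m * n % G ^ k + m * δ) + G ^ k * (m * n / G ^ k) := by
    rw [mul_add]; omega
  have h2 : m * (n + δ) % G ^ k = m * n % G ^ k + m * δ := by
    rw [h1, Nat.add_mul_mod_self_left, Nat.mod_eq_of_lt h]
  rw [h2]
  have h3 : f (m * n) = f (m * n % G ^ k) * f (m * n / G ^ k) := by
    conv_lhs => rw [← e1]
    exact hp _ _ (Nat.mod_lt _ hQ)
  have h4 : f (m * (n + δ)) = f (m * n % G ^ k + m * δ) * f (m * n / G ^ k) := by
    conv_lhs => rw [h1]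
    exact hp _ _ h
  rw [h3, h4, map_mul]
  have h5 : f (m * n / G ^ k) * (starRingEnd ℂ) (f (m * n / G ^ k)) = 1 := by
    rw [Complex.mul_conj', hf.1]; simp
  linear_combination (f (m * n % G ^ k + m * δ) * (starRingEnd ℂ) (f (m * n % G ^ k))) * h5

lemma trunc_fourier {G : ℕ} {f : ℕ → ℂ} (hG : 0 < G) (k M n δ : ℕ) :
    ‖∑ m ∈ Icc 1 M, f (m * (n + δ) % G ^ k) * (starRingEnd ℂ) (f (m * n % G ^ k))‖ ≤
    ∑ h ∈ range (G ^ k), ∑ l ∈ range (G ^ k), FA G f k ((h:ℝ) / (G ^ k : ℕ)) * FA G f k ((l:ℝ) / (G ^ k : ℕ)) *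
      mb M ((((h:ℤ) - l : ℤ):ℝ) / (G ^ k : ℕ) * n + (δ * h : ℝ) / (G ^ k : ℕ)) := by
  have hQ : 0 < G ^ k := by positivity
  set Q := G ^ k with hQd
  have hQr : (Q:ℝ) ≠ 0 := by exact_mod_cast hQ.ne'
  set fQ : ℕ → ℂ := fun u => f (u % Q) with hfQ
  have hFr : ∀ θ, Fr Q fQ θ = Fr Q f θ := by
    intro θ; unfold Fr; congr 1
    apply Finset.sum_congr rfl; intro u hu
    simp only [hfQ]; rw [Nat.mod_eq_of_lt (mem_range.mp hu)]
  have hinv : ∀ u, f (u % Q) = ∑ h ∈ range Q, Fr Q f ((h:ℝ) / Q) * ee ((h:ℝ) * u / Q) := by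
    intro u
    have := dft_inv hQ fQ u (by simp only [hfQ]; rw [Nat.mod_mod])
    simp only [hFr] at this
    exact this
  have e : ∑ m ∈ Icc 1 M, f (m * (n + δ) % Q) * (starRingEnd ℂ) (f (m * n % Q)) =
      ∑ h ∈ range Q, ∑ l ∈ range Q, Fr Q f ((h:ℝ) / Q) * (starRingEnd ℂ) (Fr Q f ((l:ℝ) / Q)) *
        ∑ m ∈ Icc 1 M, ee (m * ((((h:ℤ) - l : ℤ):ℝ) / Q * n + (δ * h : ℝ) / Q)) := by
    have : ∀ m ∈ Icc 1 M, f (m * (n + δ) % Q) * (starRingEnd ℂ) (f (m * n % Q)) =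
        ∑ h ∈ range Q, ∑ l ∈ range Q, Fr Q f ((h:ℝ) / Q) * (starRingEnd ℂ) (Fr Q f ((l:ℝ) / Q)) *
        ee (m * ((((h:ℤ) - l : ℤ):ℝ) / Q * n + (δ * h : ℝ) / Q)) := by
      intro m _
      rw [hinv, hinv, map_sum, Finset.sum_mul_sum]
      apply Finset.sum_congr rfl; intro h _; apply Finset.sum_congr rfl; intro l _
      rw [map_mul, conj_ee]
      have : ee (m * ((((h:ℤ) - l : ℤ):ℝ) / Q * n + (δ * h : ℝ) / Q)) = ee ((h:ℝ) * (m * (n + δ) : ℕ) / Q) * ee (-((l:ℝ) * (m * n : ℕ) / Q)) := by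
        rw [← ee_add]; congr 1; push_cast; field_simp; ring
      rw [this]; ring
    rw [Finset.sum_congr rfl this, Finset.sum_comm]
    apply Finset.sum_congr rfl; intro h _
    rw [Finset.sum_comm]
    apply Finset.sum_congr rfl; intro l _
    rw [Finset.mul_sum]
  rw [e]
  refine (norm_sum_le _ _).trans (Finset.sum_le_sum fun h _ => (norm_sum_le _ _).trans (Finset.sum_le_sum fun l _ => ?_))
  rw [norm_mul, norm_mul, Complex.norm_conj]
  have := norm_geom_Icc_le M ((((h:ℤ) - l : ℤ):ℝ) / Q * n + (δ * h : ℝ) / Q)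
  unfold FA
  gcongr

lemma mb_scale {M : ℝ} (hM : 0 ≤ M) (q : ℕ) (hq : 0 < q) (y : ℝ) : mb M y ≤ q * mb M (q * y) := by
  unfold mb
  have h1 := nn_nat_mul q y
  have h0 := nn_nonneg y
  have h2 := nn_nonneg (q * y)
  have hq1 : (1:ℝ) ≤ q := by exact_mod_cast hq
  rw [mul_div_assoc', div_le_div_iff₀ (by positivity) (by positivity)]
  have h3 : 1 + M * nn (q * y) ≤ q * (1 + M * nn y) := by nlinarith [mul_le_mul_of_nonneg_left h1 hM]
  nlinarith [mul_le_mul_of_nonneg_left h3 (by positivity : 0 ≤ 2 * M)]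

lemma mb_add_int (M t : ℝ) (m : ℤ) : mb M (t + m) = mb M t := by
  unfold mb; rw [nn_add_int]

lemma pair_big (Q N M : ℕ) (hQ : 0 < Q) (j : ℤ) (d : ℕ) (hd : Int.gcd j Q = d) (τ : ℝ) :
    ∑ n ∈ Icc 1 N, mb M ((j:ℝ) / Q * n + τ) ≤
      ((N:ℝ) / (Q / d : ℕ) + 1) * (4 * M + 4 * (Q / d : ℕ) * (1 + Real.log (Q / d : ℕ))) := by
  have hd0 : 0 < d := by
    rw [← hd]; apply Int.gcd_pos_of_ne_zero_right; exact_mod_cast hQ.ne'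
  have hdQ : d ∣ Q := by rw [← hd]; exact_mod_cast Int.gcd_dvd_right j Q
  have hdj : (d:ℤ) ∣ j := by rw [← hd]; exact Int.gcd_dvd_left j Q
  obtain ⟨q, rfl⟩ := hdQ
  obtain ⟨c, rfl⟩ := hdj
  rw [Nat.mul_div_cancel_left _ hd0]
  have hq : 0 < q := Nat.pos_of_mul_pos_left hQ
  have hcop : Int.gcd c q = 1 := by
    push_cast at hd
    rw [Int.gcd_mul_left, Int.natAbs_natCast] at hd
    exact Nat.eq_of_mul_eq_mul_left hd0 (by simpa using hd)
  have hqr : (1:ℝ) ≤ q := by exact_mod_cast hq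
  have h := ap_sum (η := (((d:ℤ) * c : ℤ):ℝ) / (d * q : ℕ)) (τ := τ) (B := q) hq (δ := 1 / q) (by positivity)
    (by rw [div_le_one (by positivity)]; exact hqr) (by
      intro r hr0 hr
      have hdr : (0:ℝ) < d := by exact_mod_cast hd0
      have : (((d:ℤ) * c : ℤ):ℝ) / (d * q : ℕ) * r = ((c * r : ℤ):ℝ) / q := by
        push_cast; field_simp
      rw [this]
      apply nn_div_ge hq
      intro hdiv
      have : (q:ℤ) ∣ r := (Int.isCoprime_iff_gcd_eq_one.mpr hcop).symm.dvd_of_dvd_mul_left hdiv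
      have := Int.le_of_dvd (by exact_mod_cast hr0) this
      omega) (M := M) (by positivity) 1 N
  rw [one_div_one_div, show (4:ℝ) / (1 / q) = 4 * q by field_simp] at h
  rw [← Finset.Ico_add_one_right_eq_Icc, add_comm N 1]
  exact h

lemma pair_small (Q N M : ℕ) (hQ : 0 < Q) (j : ℤ) (d : ℕ) (hd : Int.gcd j Q = d) (τ : ℝ) :
    ∑ n ∈ Icc 1 N, mb M ((j:ℝ) / Q * n + τ) ≤ N * ((Q / d : ℕ) * mb M ((Q / d : ℕ) * τ)) := by
  have hd0 : 0 < d := by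
    rw [← hd]; apply Int.gcd_pos_of_ne_zero_right; exact_mod_cast hQ.ne'
  have hdQ : d ∣ Q := by rw [← hd]; exact_mod_cast Int.gcd_dvd_right j Q
  have hdj : (d:ℤ) ∣ j := by rw [← hd]; exact Int.gcd_dvd_left j Q
  obtain ⟨q, rfl⟩ := hdQ
  obtain ⟨c, rfl⟩ := hdj
  rw [Nat.mul_div_cancel_left _ hd0]
  have hq : 0 < q := Nat.pos_of_mul_pos_left hQ
  have hqr : (0:ℝ) < q := by exact_mod_cast hq
  have hdr : (0:ℝ) < d := by exact_mod_cast hd0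
  have : ∀ n ∈ Icc 1 N, mb M ((((d:ℤ) * c : ℤ):ℝ) / (d * q : ℕ) * n + τ) ≤ q * mb M (q * τ) := by
    intro n _
    refine (mb_scale (by positivity) q hq _).trans ?_
    have e : (q:ℝ) * ((((d:ℤ) * c : ℤ):ℝ) / (d * q : ℕ) * n + τ) = q * τ + ((c * n : ℤ):ℝ) := by
      push_cast; field_simp; ring
    rw [e, mb_add_int]
  refine (Finset.sum_le_card_nsmul _ _ _ this).trans ?_
  simp

end DS

namespace DS
open Finset

lemma small_h_sum (Q M e : ℕ) (he : 0 < e) (heQ : e ≤ Q) :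
    ∑ h ∈ range Q, mb M ((e:ℝ) * h / Q) ≤ (2 * e + 1) * (4 * M + 4 * Q * (1 + Real.log Q)) := by
  have hQ : 0 < Q := by omega
  have hB : 1 ≤ Q / e := Nat.div_pos heQ he
  have hQr : (1:ℝ) ≤ Q := by exact_mod_cast hQ
  have hlog : 0 ≤ Real.log Q := Real.log_nonneg hQr
  have h := ap_sum (η := (e:ℝ) / Q) (τ := 0) (B := Q / e) hB (δ := 1 / Q) (by positivity)
    (by rw [div_le_one (by positivity)]; exact hQr) (by
      intro r hr0 hr
      have : (e:ℝ) / Q * r = ((e * r : ℤ):ℝ) / Q := by push_cast; ring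
      rw [this]
      apply nn_div_ge hQ
      intro hdiv
      have h1 := Int.le_of_dvd (by positivity) hdiv
      have h2 : e * r < Q := by
        have : e * r < e * (Q / e) := Nat.mul_lt_mul_of_pos_left hr he
        exact this.trans_le (Nat.mul_div_le Q e)
      have : ((e * r : ℕ):ℤ) < Q := by exact_mod_cast h2
      push_cast at this; omega) (M := M) (by positivity) 0 Q
  rw [one_div_one_div, show (4:ℝ) / (1 / Q) = 4 * Q by field_simp, zero_add, ← Finset.range_eq_Ico] at h
  calc _ = ∑ n ∈ range Q, mb M ((e:ℝ) / Q * n + 0) := by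
        apply Finset.sum_congr rfl; intro n _; congr 1; ring
    _ ≤ _ := h
    _ ≤ _ := by
      have : (Q:ℝ) / (Q / e : ℕ) ≤ 2 * e := by
        rw [div_le_iff₀ (by exact_mod_cast hB)]
        have h1 : Q < 2 * e * (Q / e) := by
          have := Nat.lt_mul_div_succ Q he
          nlinarith
        exact_mod_cast h1.le
      gcongr

noncomputable def CD (G k N M δ R1 : ℕ) (η ε : ℝ) (d : ℕ) : ℝ :=
  if R1 < G ^ k / d then 2 * ((G ^ k / d : ℕ):ℝ) ^ (1 - η) *
      (((N:ℝ) / (G ^ k / d : ℕ) + 1) * (4 * M + 4 * (G ^ k / d : ℕ) * (1 + Real.log (G ^ k / d : ℕ))))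
    else ε ^ 2 * (N * (G ^ k / d : ℕ) ^ 2 * ((2 * ((G ^ k / d * δ : ℕ):ℝ) + 1) * (4 * M + 4 * (G ^ k : ℕ) * (1 + Real.log (G ^ k : ℕ)))))

lemma main_d {G : ℕ} {f : ℕ → ℂ} (hG : 0 < G) (hf : GM G f) {η : ℝ} (hη : η ≤ 1) (hs : SG G f η)
    (k N M δ R1 : ℕ) (hδ : 0 < δ) (hR1 : R1 * δ ≤ G ^ k) {ε : ℝ} (hε : ∀ θ, FA G f k θ ≤ ε) (d : ℕ) (hd : d ∣ G ^ k) :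
    ∑ h ∈ range (G ^ k), ∑ l ∈ range (G ^ k), (if Int.gcd ((h:ℤ) - l) (G ^ k : ℕ) = d then
      FA G f k ((h:ℝ) / (G ^ k : ℕ)) * FA G f k ((l:ℝ) / (G ^ k : ℕ)) *
      ∑ n ∈ Icc 1 N, mb M ((((h:ℤ) - l : ℤ):ℝ) / (G ^ k : ℕ) * n + (δ * h : ℝ) / (G ^ k : ℕ)) else 0) ≤
    CD G k N M δ R1 η ε d := by
  have hQ : 0 < G ^ k := by positivity
  set Q := G ^ k with hQd
  have hd0 : 0 < d := Nat.pos_of_dvd_of_pos hd hQ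
  have hq : 0 < Q / d := Nat.div_pos (Nat.le_of_dvd hQ hd) hd0
  have hqr : (1:ℝ) ≤ (Q / d : ℕ) := by exact_mod_cast hq
  have hmod : ∀ h l : ℕ, Int.gcd ((h:ℤ) - l) (Q : ℕ) = d → h ≡ l [MOD d] := by
    intro h l hh
    have : (d:ℤ) ∣ (h:ℤ) - l := by rw [← hh]; exact Int.gcd_dvd_left _ _
    exact ((Nat.modEq_iff_dvd).mpr this).symm
  have hlq : 0 ≤ Real.log (Q / d : ℕ) := Real.log_nonneg hqr
  have hε0 : 0 ≤ ε := (FA_nonneg G f k 0).trans (hε 0)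
  unfold CD
  by_cases hc : R1 < Q / d
  · rw [if_pos hc]
    set T : ℝ := ((N:ℝ) / (Q / d : ℕ) + 1) * (4 * M + 4 * (Q / d : ℕ) * (1 + Real.log (Q / d : ℕ))) with hT
    have hT0 : 0 ≤ T := by positivity
    have h1 := SP_bound hG hf hη hs k d hd
    calc _ ≤ ∑ h ∈ range Q, ∑ l ∈ range Q, (if h ≡ l [MOD d] then
          FA G f k ((h:ℝ) / (Q : ℕ)) * FA G f k ((l:ℝ) / (Q : ℕ)) else 0) * T := by
          gcongr with h _ l _
          have h0 := mul_nonneg (FA_nonneg G f k ((h:ℝ) / (Q : ℕ))) (FA_nonneg G f k ((l:ℝ) / (Q : ℕ)))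
          by_cases hh : Int.gcd ((h:ℤ) - l) (Q : ℕ) = d
          · rw [if_pos hh, if_pos (hmod h l hh)]
            exact mul_le_mul_of_nonneg_left (pair_big Q N M hQ _ d hh _) h0
          · rw [if_neg hh]
            split_ifs <;> positivity
      _ = SP G f k d * T := by
          unfold SP CC
          rw [Finset.sum_mul]; apply Finset.sum_congr rfl; intro h _; rw [Finset.sum_mul]
      _ ≤ _ := mul_le_mul_of_nonneg_right h1 hT0
  · rw [if_neg hc]
    push Not at hc
    set q := Q / d with hqd
    have hcard : ∀ h : ℕ, (#{l ∈ range Q | h ≡ l [MOD d]} : ℝ) ≤ q := by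
      intro h
      have := card_res Q d hd0 hd (h % d)
      have e : {l ∈ range Q | h ≡ l [MOD d]} = {l ∈ range Q | l % d = h % d} := by
        apply Finset.filter_congr; intro l _; unfold Nat.ModEq; exact eq_comm
      rw [e]; exact_mod_cast this
    calc _ ≤ ∑ h ∈ range Q, ∑ l ∈ range Q, (if h ≡ l [MOD d] then
          ε ^ 2 * (N * (q * mb M (q * ((δ * h : ℝ) / Q)))) else 0) := by
          gcongr with h _ l _
          have h0 := mul_nonneg (FA_nonneg G f k ((h:ℝ) / (Q : ℕ))) (FA_nonneg G f k ((l:ℝ) / (Q : ℕ)))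
          have hm0 := mb_nonneg (M := M) (by positivity) (q * ((δ * h : ℝ) / Q))
          by_cases hh : Int.gcd ((h:ℤ) - l) (Q : ℕ) = d
          · rw [if_pos hh, if_pos (hmod h l hh)]
            apply mul_le_mul _ (pair_small Q N M hQ _ d hh _)
            · exact Finset.sum_nonneg fun _ _ => mb_nonneg (by positivity) _
            · positivity
            · rw [sq]; exact mul_le_mul (hε _) (hε _) (FA_nonneg _ _ _ _) hε0
          · rw [if_neg hh]
            split_ifs <;> positivity
      _ ≤ ∑ h ∈ range Q, q * (ε ^ 2 * (N * (q * mb M (q * ((δ * h : ℝ) / Q))))) := by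
          gcongr with h _
          have hm0 := mb_nonneg (M := M) (by positivity) (q * ((δ * h : ℝ) / Q))
          rw [← Finset.sum_filter, Finset.sum_const, nsmul_eq_mul]
          exact mul_le_mul_of_nonneg_right (hcard h) (by positivity)
      _ = ε ^ 2 * (N * q ^ 2 * ∑ h ∈ range Q, mb M (((q * δ : ℕ):ℝ) * h / Q)) := by
          rw [Finset.mul_sum, Finset.mul_sum]
          apply Finset.sum_congr rfl; intro h _
          rw [show (q:ℝ) * ((δ * h : ℝ) / Q) = ((q * δ : ℕ):ℝ) * h / Q by push_cast; ring]; ring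
      _ ≤ _ := by
          have := small_h_sum Q M (q * δ) (by positivity) ((Nat.mul_le_mul_right _ hc).trans hR1)
          gcongr

lemma W_main {G : ℕ} {f : ℕ → ℂ} (hG : 0 < G) (hf : GM G f) {η : ℝ} (hη : η ≤ 1) (hs : SG G f η)
    (k N M δ R1 : ℕ) (hδ : 0 < δ) (hR1 : R1 * δ ≤ G ^ k) {ε : ℝ} (hε : ∀ θ, FA G f k θ ≤ ε) :
    ∑ n ∈ Icc 1 N, ‖∑ m ∈ Icc 1 M, f (m * (n + δ) % G ^ k) * (starRingEnd ℂ) (f (m * n % G ^ k))‖ ≤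
    ∑ d ∈ (G ^ k).divisors, CD G k N M δ R1 η ε d := by
  have hQ : 0 < G ^ k := by positivity
  calc _ ≤ ∑ n ∈ Icc 1 N, _ := Finset.sum_le_sum fun n _ => trunc_fourier hG k M n δ
    _ = ∑ h ∈ range (G ^ k), ∑ l ∈ range (G ^ k), FA G f k ((h:ℝ) / (G ^ k : ℕ)) * FA G f k ((l:ℝ) / (G ^ k : ℕ)) *
      ∑ n ∈ Icc 1 N, mb M ((((h:ℤ) - l : ℤ):ℝ) / (G ^ k : ℕ) * n + (δ * h : ℝ) / (G ^ k : ℕ)) := by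
        rw [Finset.sum_comm]
        apply Finset.sum_congr rfl; intro h _
        rw [Finset.sum_comm]
        apply Finset.sum_congr rfl; intro l _
        rw [Finset.mul_sum]
    _ = ∑ d ∈ (G ^ k).divisors, ∑ h ∈ range (G ^ k), ∑ l ∈ range (G ^ k), (if Int.gcd ((h:ℤ) - l) (G ^ k : ℕ) = d then
      FA G f k ((h:ℝ) / (G ^ k : ℕ)) * FA G f k ((l:ℝ) / (G ^ k : ℕ)) *
      ∑ n ∈ Icc 1 N, mb M ((((h:ℤ) - l : ℤ):ℝ) / (G ^ k : ℕ) * n + (δ * h : ℝ) / (G ^ k : ℕ)) else 0) := by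
        symm
        rw [Finset.sum_comm]
        apply Finset.sum_congr rfl; intro h _
        rw [Finset.sum_comm]
        apply Finset.sum_congr rfl; intro l _
        rw [Finset.sum_ite_eq, if_pos]
        rw [Nat.mem_divisors]
        exact ⟨by exact_mod_cast Int.gcd_dvd_right ((h:ℤ) - l) (G ^ k : ℕ), hQ.ne'⟩
    _ ≤ _ := Finset.sum_le_sum fun d hd => main_d hG hf hη hs k N M δ R1 hδ hR1 hε d (Nat.dvd_of_mem_divisors hd)

end DS

namespace DS
open Finset

lemma W_bound {G : ℕ} {f : ℕ → ℂ} (hG : 0 < G) (hf : GM G f) {η : ℝ} (hη : η ≤ 1) (hs : SG G f η)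
    (k N M δ R1 : ℕ) (hδ : 0 < δ) (hR1 : R1 * δ ≤ G ^ k) {ε : ℝ} (hε : ∀ θ, FA G f k θ ≤ ε) :
    ∑ n ∈ Icc 1 N, ‖∑ m ∈ Icc 1 M, f (m * (n + δ)) * (starRingEnd ℂ) (f (m * n))‖ ≤
    ∑ d ∈ (G ^ k).divisors, CD G k N M δ R1 η ε d + 2 * (M * ((M * N / (G ^ k : ℕ) + 1) * δ)) := by
  have hQ : 0 < G ^ k := by positivity
  have hn1 : ∀ u v : ℕ, ‖f u * (starRingEnd ℂ) (f v)‖ = 1 := by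
    intro u v; rw [norm_mul, Complex.norm_conj, hf.1, hf.1, mul_one]
  have h1 : ∀ n, ‖∑ m ∈ Icc 1 M, f (m * (n + δ)) * (starRingEnd ℂ) (f (m * n))‖ ≤
      ‖∑ m ∈ Icc 1 M, f (m * (n + δ) % G ^ k) * (starRingEnd ℂ) (f (m * n % G ^ k))‖ +
      ∑ m ∈ Icc 1 M, (if G ^ k ≤ m * n % G ^ k + m * δ then 2 else 0) := by
    intro n
    have h2 : ∑ m ∈ Icc 1 M, f (m * (n + δ)) * (starRingEnd ℂ) (f (m * n)) =
      ∑ m ∈ Icc 1 M, f (m * (n + δ) % G ^ k) * (starRingEnd ℂ) (f (m * n % G ^ k)) +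
      ∑ m ∈ Icc 1 M, (f (m * (n + δ)) * (starRingEnd ℂ) (f (m * n)) - f (m * (n + δ) % G ^ k) * (starRingEnd ℂ) (f (m * n % G ^ k))) := by
      rw [← Finset.sum_add_distrib]; apply Finset.sum_congr rfl; intro m _; ring
    rw [h2]
    refine (norm_add_le _ _).trans ?_
    gcongr
    refine (norm_sum_le _ _).trans (Finset.sum_le_sum fun m _ => ?_)
    by_cases hc : G ^ k ≤ m * n % G ^ k + m * δ
    · rw [if_pos hc]
      refine (norm_sub_le _ _).trans ?_
      rw [hn1, hn1]; norm_num
    · rw [if_neg hc, trunc_eq hG hf k m n δ (by omega), sub_self, norm_zero]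
  calc _ ≤ ∑ n ∈ Icc 1 N, _ := Finset.sum_le_sum fun n _ => h1 n
    _ = ∑ n ∈ Icc 1 N, ‖∑ m ∈ Icc 1 M, f (m * (n + δ) % G ^ k) * (starRingEnd ℂ) (f (m * n % G ^ k))‖ +
        ∑ m ∈ Icc 1 M, ∑ n ∈ Icc 1 N, (if G ^ k ≤ m * n % G ^ k + m * δ then (2:ℝ) else 0) := by
        rw [Finset.sum_add_distrib]; congr 1; rw [Finset.sum_comm]
    _ ≤ _ := by
        gcongr ?_ + ?_
        · exact W_main hG hf hη hs k N M δ R1 hδ hR1 hε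
        · calc _ ≤ ∑ m ∈ Icc 1 M, 2 * (((M * N / (G ^ k : ℕ) + 1) * δ : ℝ)) := by
                gcongr with m hm
                rw [mem_Icc] at hm
                rw [← Finset.sum_filter, Finset.sum_const, nsmul_eq_mul, mul_comm]
                gcongr
                have h3 := exc_count m N δ (G ^ k) hm.1 hQ
                calc (#{n ∈ Icc 1 N | G ^ k ≤ m * n % G ^ k + m * δ} : ℝ) ≤ (((m * N / G ^ k + 1) * δ : ℕ):ℝ) := by exact_mod_cast h3
                  _ ≤ _ := by
                    push_cast
                    have h4 : ((m * N / G ^ k : ℕ):ℝ) ≤ (m * N : ℕ) / (G ^ k : ℕ) := Nat.cast_div_le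
                    push_cast at h4
                    have h5 : (m:ℝ) ≤ M := by exact_mod_cast hm.2
                    gcongr
                    refine h4.trans ?_
                    gcongr
            _ = _ := by simp; ring

lemma CD_le {G k N M δ R1 : ℕ} {η ε : ℝ} (hG : 0 < G) (hη0 : 0 ≤ η) (hη : η ≤ 1) (hR1 : 0 < R1) (d : ℕ) (hd : d ∣ G ^ k) (R : ℕ) (hδ : δ ≤ R) :
    CD G k N M δ R1 η ε d ≤ 8 * (M * N) * (R1:ℝ) ^ (-η) +
      2 * ((G ^ k : ℕ):ℝ) ^ (1 - η) * (4 * N * (1 + Real.log (G ^ k : ℕ)) + 4 * M + 4 * (G ^ k : ℕ) * (1 + Real.log (G ^ k : ℕ))) +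
      ε ^ 2 * (N * R1 ^ 2 * ((2 * (R1 * R) + 1) * (4 * M + 4 * (G ^ k : ℕ) * (1 + Real.log (G ^ k : ℕ))))) := by
  have hQ : 0 < G ^ k := by positivity
  unfold CD
  set Q := G ^ k with hQd
  have hd0 : 0 < d := Nat.pos_of_dvd_of_pos hd hQ
  have hq : 0 < Q / d := Nat.div_pos (Nat.le_of_dvd hQ hd) hd0
  have hqQ : Q / d ≤ Q := Nat.div_le_self _ _
  set q := Q / d with hqd
  have hqr : (1:ℝ) ≤ q := by exact_mod_cast hq
  have hqQr : (q:ℝ) ≤ Q := by exact_mod_cast hqQ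
  have hlq : 0 ≤ Real.log q := Real.log_nonneg hqr
  have hlqQ : Real.log q ≤ Real.log Q := Real.log_le_log (by linarith) hqQr
  have hlQ : 0 ≤ Real.log Q := hlq.trans hlqQ
  by_cases hc : R1 < q
  · rw [if_pos hc]
    have hR1q : (R1:ℝ) ≤ q := by exact_mod_cast hc.le
    have hR1r : (0:ℝ) < R1 := by exact_mod_cast hR1
    have e1 : (q:ℝ) ^ (1 - η) = q * (q:ℝ) ^ (-η) := by
      rw [sub_eq_add_neg, Real.rpow_add (by linarith), Real.rpow_one]
    have e2 : (q:ℝ) ^ (-η) ≤ (R1:ℝ) ^ (-η) := Real.rpow_le_rpow_of_nonpos hR1r hR1q (by linarith)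
    have e3 : (q:ℝ) ^ (1 - η) ≤ (Q:ℝ) ^ (1 - η) := Real.rpow_le_rpow (by linarith) hqQr (by linarith)
    have e4 : 2 * (q:ℝ) ^ (1 - η) * (((N:ℝ) / q + 1) * (4 * M + 4 * q * (1 + Real.log q))) =
      8 * (M * N) * (q:ℝ) ^ (-η) + 2 * (q:ℝ) ^ (1 - η) * (4 * N * (1 + Real.log q) + 4 * M + 4 * q * (1 + Real.log q)) := by
      rw [e1]; field_simp; ring
    rw [e4]
    refine le_add_of_le_of_nonneg ?_ (by positivity)
    gcongr
  · rw [if_neg hc]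
    push Not at hc
    refine le_add_of_nonneg_of_le (by positivity) ?_
    push_cast
    have : (q:ℝ) ≤ R1 := by exact_mod_cast hc
    have : (δ:ℝ) ≤ R := by exact_mod_cast hδ
    gcongr

lemma typeII_num1 {M N R R1 G Q ℓ A B ε : ℝ} (hM : 1 ≤ M) (hMN : M ≤ N) (hR : 1 ≤ R) (hR1 : 1 ≤ R1) (hG : 1 ≤ G)
    (hQ2 : Q ≤ G * M * R ^ 2) (hQ1 : M ≤ Q) (hℓ : 1 ≤ ℓ) (hA : 0 ≤ A) (hB : 0 ≤ B) :
    8 * (M * N) * A + 2 * (Q * B) * (4 * N * ℓ + 4 * M + 4 * Q * ℓ) + ε ^ 2 * (N * R1 ^ 2 * ((2 * (R1 * R) + 1) * (4 * M + 4 * Q * ℓ))) ≤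
    M * N * (8 * A + 24 * G ^ 2 * R ^ 4 * ℓ * B + 24 * G * R1 ^ 3 * R ^ 3 * ℓ * ε ^ 2) := by
  have hN : 1 ≤ N := hM.trans hMN
  have hR2 : 1 ≤ R ^ 2 := by nlinarith
  have hGR : 1 ≤ G * R ^ 2 := by nlinarith
  have h1 : 4 * N * ℓ + 4 * M + 4 * Q * ℓ ≤ 12 * (G * R ^ 2) * ℓ * N := by
    have a1 : N * ℓ ≤ (G * R ^ 2) * (N * ℓ) := le_mul_of_one_le_left (by positivity) hGR
    have a2 : M ≤ (G * R ^ 2) * (N * ℓ) := by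
      have : M ≤ N * ℓ := by nlinarith
      linarith
    have a3 : Q * ℓ ≤ G * M * R ^ 2 * ℓ := by gcongr
    have a4 : G * M * R ^ 2 * ℓ ≤ G * N * R ^ 2 * ℓ := by gcongr
    nlinarith
  have h2 : 4 * M + 4 * Q * ℓ ≤ 8 * (G * M * R ^ 2) * ℓ := by
    have a3 : Q * ℓ ≤ G * M * R ^ 2 * ℓ := by gcongr
    have : M ≤ Q * ℓ := by nlinarith
    nlinarith
  have h3 : 2 * (R1 * R) + 1 ≤ 3 * (R1 * R) := by nlinarith
  have hQ0 : 0 ≤ Q := by linarith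
  calc _ ≤ 8 * (M * N) * A + 2 * (G * M * R ^ 2 * B) * (12 * (G * R ^ 2) * ℓ * N) + ε ^ 2 * (N * R1 ^ 2 * ((3 * (R1 * R)) * (8 * (G * M * R ^ 2) * ℓ))) := by
        gcongr
    _ = _ := by ring

lemma typeII_num2 {M N R K Q T : ℝ} (hM : 1 ≤ M) (hN : 1 ≤ N) (hR : 1 ≤ R) (hRN : R ^ 2 ≤ N) (hK0 : 0 ≤ K) (hK : K ≤ N / R + 1) (hQ : M * R ^ 2 ≤ Q) (hT : 0 ≤ T) :
    M * (K * (M * N + 2 * (R * (M * N * T + 2 * (M * ((M * N / Q + 1) * R)))))) ≤ (M * N) ^ 2 * (18 / R + 4 * T) := by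
  have hRN' : R ≤ N := by nlinarith
  have hK2 : K ≤ 2 * N / R := by
    refine hK.trans ?_
    rw [div_add_one (by positivity)]
    gcongr; linarith
  have hKR : K * R ≤ 2 * N := by rwa [le_div_iff₀ (by positivity)] at hK2
  have h1 : M * N / Q ≤ N / R ^ 2 := by
    rw [div_le_div_iff₀ (by nlinarith) (by positivity)]
    nlinarith
  have h2 : M * ((M * N / Q + 1) * R) ≤ 2 * (M * N / R) := by
    have : (M * N / Q + 1) * R ≤ 2 * (N / R) := by
      calc _ ≤ (N / R ^ 2 + N / R ^ 2) * R := by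
            gcongr
            rw [le_div_iff₀ (by positivity)]; linarith
        _ = _ := by field_simp; ring
    calc _ ≤ M * (2 * (N / R)) := by gcongr
      _ = _ := by ring
  calc _ ≤ M * (K * (M * N + 2 * (R * (M * N * T + 2 * (2 * (M * N / R)))))) := by gcongr
    _ = M * (K * (M * N)) + 2 * M * (K * R) * (M * N * T + 4 * (M * N / R)) := by ring
    _ ≤ M * (2 * N / R * (M * N)) + 2 * M * (2 * N) * (M * N * T + 4 * (M * N / R)) := by gcongr
    _ = _ := by field_simp; ring

lemma typeII_bound {G : ℕ} {f : ℕ → ℂ} (hG : 0 < G) (hf : GM G f) {η : ℝ} (hη0 : 0 ≤ η) (hη : η ≤ 1) (hs : SG G f η)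
    (k N M R R1 : ℕ) (hM : 0 < M) (hMN : M ≤ N) (hR : 0 < R) (hR1 : 0 < R1) (hRM : R ^ 2 ≤ M) (hQ1 : M * R ^ 2 ≤ G ^ k) (hQ2 : G ^ k ≤ G * M * R ^ 2)
    (hR1M : R1 * R ≤ G ^ k) {ε : ℝ} (hε : ∀ θ, FA G f k θ ≤ ε)
    (a b : ℕ → ℂ) (ha : ∀ n, ‖a n‖ ≤ 1) (hb : ∀ n, ‖b n‖ ≤ 1) :
    ‖∑ m ∈ Icc 1 M, ∑ n ∈ Icc 1 N, a m * b n * f (m * n)‖ ^ 2 ≤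
      ((M:ℝ) * N) ^ 2 * (18 / R + 4 * (#(G ^ k).divisors * (8 * (R1:ℝ) ^ (-η) + 24 * G ^ 2 * R ^ 4 * (1 + Real.log (G ^ k : ℕ)) * (M:ℝ) ^ (-η)
        + 24 * G * R1 ^ 3 * R ^ 3 * (1 + Real.log (G ^ k : ℕ)) * ε ^ 2))) := by
  have hQ : 0 < G ^ k := by positivity
  have hQr : (1:ℝ) ≤ (G ^ k : ℕ) := by exact_mod_cast hQ
  have hlog := Real.log_nonneg hQr
  have hMr : (1:ℝ) ≤ M := by exact_mod_cast hM
  have hMNr : (M:ℝ) ≤ N := by exact_mod_cast hMN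
  have hRr : (1:ℝ) ≤ R := by exact_mod_cast hR
  have hR1r : (1:ℝ) ≤ R1 := by exact_mod_cast hR1
  have hGr : (1:ℝ) ≤ G := by exact_mod_cast hG
  have hQ1r : (M:ℝ) * R ^ 2 ≤ (G ^ k : ℕ) := by exact_mod_cast hQ1
  have hQ2r : ((G ^ k : ℕ):ℝ) ≤ G * M * R ^ 2 := by exact_mod_cast hQ2
  have hMQ : (M:ℝ) ≤ (G ^ k : ℕ) := by nlinarith [sq_nonneg ((R:ℝ)-1)]
  set T : ℝ := #(G ^ k).divisors * (8 * (R1:ℝ) ^ (-η) + 24 * G ^ 2 * R ^ 4 * (1 + Real.log (G ^ k : ℕ)) * (M:ℝ) ^ (-η)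
        + 24 * G * R1 ^ 3 * R ^ 3 * (1 + Real.log (G ^ k : ℕ)) * ε ^ 2) with hT
  have hT0 : 0 ≤ T := by positivity
  have hW : ∀ i ∈ range R, ∑ n ∈ Icc 1 N, ‖∑ m ∈ Icc 1 M, f (m * (n + i + 1)) * (starRingEnd ℂ) (f (m * n))‖ ≤
      M * N * T + 2 * (M * ((M * N / (G ^ k : ℕ) + 1) * R)) := by
    intro i hi
    rw [mem_range] at hi
    refine (W_bound hG hf hη hs k N M (i + 1) R1 (by omega) ((Nat.mul_le_mul_left _ (by omega)).trans hR1M) hε).trans ?_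
    have hi' : ((i + 1 : ℕ):ℝ) ≤ R := by exact_mod_cast hi
    gcongr ?_ + 2 * (M * (_ * ?_))
    refine (Finset.sum_le_card_nsmul _ _ _ fun d hd => CD_le hG hη0 hη hR1 d (Nat.dvd_of_mem_divisors hd) R hi).trans ?_
    rw [nsmul_eq_mul, hT]
    refine (mul_le_mul_of_nonneg_left ?_ (Nat.cast_nonneg _)).trans_eq (mul_left_comm _ _ _)
    have e1 : ((G ^ k : ℕ):ℝ) ^ (1 - η) ≤ (G ^ k : ℕ) * (M:ℝ) ^ (-η) := by
      rw [sub_eq_add_neg, Real.rpow_add (by linarith), Real.rpow_one]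
      have hM0 : (0:ℝ) < M := by linarith
      exact mul_le_mul_of_nonneg_left (Real.rpow_le_rpow_of_nonpos hM0 hMQ (by linarith)) (by linarith)
    have e2 := typeII_num1 (A := (R1:ℝ) ^ (-η)) (B := (M:ℝ) ^ (-η)) (ε := ε) (ℓ := 1 + Real.log (G ^ k : ℕ)) hMr hMNr hRr hR1r hGr hQ2r hMQ (by linarith) (by positivity) (by positivity)
    refine le_trans ?_ e2
    gcongr
  refine (vdc M N R hR a b ha hb (fun m n => f (m * n)) (fun m n => (hf.1 _).le)).trans ?_
  refine le_trans ?_ (typeII_num2 (K := (N / R + 1 : ℕ)) hMr (hMr.trans hMNr) hRr (by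
    have : ((R:ℝ)) ^ 2 ≤ M := by exact_mod_cast hRM
    linarith) (by positivity) (by push_cast; gcongr; exact Nat.cast_div_le) hQ1r hT0)
  gcongr
  refine (Finset.sum_le_card_nsmul _ _ _ hW).trans ?_
  rw [nsmul_eq_mul, card_range]

end DS

namespace DS
open Finset

lemma gcd_pair_sum (Q : ℝ) (hQ : 0 ≤ Q) (m m' : ℕ) (hm : 0 < m) (hm' : 0 < m') :
    ∑ k ∈ range m, ∑ k' ∈ range m', mb Q (-((k:ℝ) / m) - -((k':ℝ) / m')) ≤
      (Nat.gcd m m' : ℝ) * (4 * Q + 4 * (m * (m' / Nat.gcd m m') : ℕ) * (1 + Real.log (m * (m' / Nat.gcd m m') : ℕ))) := by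
  obtain ⟨m1, hm1⟩ := Nat.gcd_dvd_left m m'
  obtain ⟨n1, hn1⟩ := Nat.gcd_dvd_right m m'
  set d := Nat.gcd m m' with hd
  have hd0 : 0 < d := Nat.gcd_pos_of_pos_left _ hm
  have hcop : Nat.Coprime m1 n1 := by
    have : d * Nat.gcd m1 n1 = d * 1 := by
      rw [← Nat.gcd_mul_left, ← hm1, ← hn1, mul_one]
    exact Nat.eq_of_mul_eq_mul_left hd0 this
  have hn1' : m' / d = n1 := by rw [hn1, Nat.mul_div_cancel_left _ hd0]
  rw [hn1']
  have hn10 : 0 < n1 := by rcases Nat.eq_zero_or_pos n1 with h | h; · simp [h] at hn1; omega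
                           · exact h
  have hl : 0 < m * n1 := by positivity
  have hlr : (1:ℝ) ≤ (m * n1 : ℕ) := by exact_mod_cast hl
  have hdr : (0:ℝ) < d := by exact_mod_cast hd0
  have hn1r : (0:ℝ) < n1 := by exact_mod_cast hn10
  have hmr : (0:ℝ) < m := by exact_mod_cast hm
  have hm1r : (m:ℝ) = d * m1 := by exact_mod_cast hm1
  have hn1rr : (m':ℝ) = d * n1 := by exact_mod_cast hn1
  have hone : ∀ e : ℕ, ∑ i ∈ range m ×ˢ range n1, mb Q (-((i.1:ℝ) / m) - -(((i.2 + n1 * e : ℕ):ℝ) / m')) ≤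
      4 * Q + 4 * (m * n1 : ℕ) * (1 + Real.log (m * n1 : ℕ)) := by
    intro e
    have := spaced_sum (range m ×ˢ range n1) (fun i => -((i.1:ℝ) / m) - -(((i.2 + n1 * e : ℕ):ℝ) / m')) (δ := 1 / (m * n1 : ℕ)) (by positivity) (by
      rw [div_le_one (by positivity)]; exact hlr) (by
      intro i hi j hj hij
      rw [mem_product, mem_range, mem_range] at hi hj
      have e1 : (-((i.1:ℝ) / m) - -(((i.2 + n1 * e : ℕ):ℝ) / m')) - (-((j.1:ℝ) / m) - -(((j.2 + n1 * e : ℕ):ℝ) / m')) =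
        ((((i.2:ℤ) - j.2) * m1 - ((i.1:ℤ) - j.1) * n1 : ℤ):ℝ) / (m * n1 : ℕ) := by
        push_cast
        rw [hn1rr, hm1r]
        have : (m1:ℝ) ≠ 0 := by intro h; rw [h] at hm1r; simp at hm1r; omega
        field_simp; ring
      beta_reduce
      rw [e1]
      apply nn_div_ge hl
      intro hdiv
      apply hij
      push_cast at hdiv
      have h1 : (n1:ℤ) ∣ ((i.2:ℤ) - j.2) := by
        have : (n1:ℤ) ∣ ((i.2:ℤ) - j.2) * m1 := by
          have h2 : (n1:ℤ) ∣ ((i.2:ℤ) - j.2) * m1 - ((i.1:ℤ) - j.1) * n1 := (Dvd.intro_left _ rfl).trans hdiv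
          have := dvd_add h2 (Dvd.intro_left ((i.1:ℤ) - j.1) rfl)
          simpa using this
        exact (Nat.isCoprime_iff_coprime.mpr hcop).symm.dvd_of_dvd_mul_right this
      have h2 : (i.2:ℤ) - j.2 = 0 := by
        apply Int.eq_zero_of_abs_lt_dvd h1
        rw [abs_lt]; omega
      rw [h2, zero_mul, zero_sub, dvd_neg] at hdiv
      have h3 : (m:ℤ) ∣ (i.1:ℤ) - j.1 := Int.dvd_of_mul_dvd_mul_right (by exact_mod_cast hn10.ne') hdiv
      have h4 : (i.1:ℤ) - j.1 = 0 := by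
        apply Int.eq_zero_of_abs_lt_dvd h3
        rw [abs_lt]; omega
      ext
      · omega
      · omega) hQ
    rw [one_div_one_div, show (4:ℝ) / (1 / (m * n1 : ℕ)) = 4 * (m * n1 : ℕ) by field_simp] at this
    exact this
  calc _ = ∑ k ∈ range m, ∑ e ∈ range d, ∑ k0 ∈ range n1, mb Q (-((k:ℝ) / m) - -(((k0 + n1 * e : ℕ):ℝ) / m')) := by
        apply Finset.sum_congr rfl; intro k _
        rw [← sum_range_mul_split n1 d (fun k' => mb Q (-((k:ℝ) / m) - -((k':ℝ) / m'))), mul_comm n1 d, ← hn1]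
    _ = ∑ e ∈ range d, ∑ i ∈ range m ×ˢ range n1, mb Q (-((i.1:ℝ) / m) - -(((i.2 + n1 * e : ℕ):ℝ) / m')) := by
        rw [Finset.sum_comm]; apply Finset.sum_congr rfl; intro e _
        rw [Finset.sum_product]
    _ ≤ _ := by
        refine (Finset.sum_le_card_nsmul _ _ _ fun e _ => hone e).trans ?_
        rw [card_range, nsmul_eq_mul]

lemma gcd_harm (V : ℕ) (hV : 1 ≤ V) : ∑ m ∈ Icc 1 V, ∑ m' ∈ Icc 1 V, (Nat.gcd m m' : ℝ) / (m * m') ≤ (1 + Real.log V) ^ 3 := by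
  set φ : ℕ × ℕ → ℕ × ℕ × ℕ := fun p => (Nat.gcd p.1 p.2, p.1 / Nat.gcd p.1 p.2, p.2 / Nat.gcd p.1 p.2) with hφ
  set w : ℕ × ℕ × ℕ → ℝ := fun q => (1 / (q.1:ℝ)) * ((1 / (q.2.1:ℝ)) * (1 / (q.2.2:ℝ))) with hw
  have h1 : ∀ p ∈ Icc 1 V ×ˢ Icc 1 V, (Nat.gcd p.1 p.2 : ℝ) / (p.1 * p.2) = w (φ p) := by
    intro p hp
    simp only [mem_product, mem_Icc] at hp
    have hd0 : 0 < Nat.gcd p.1 p.2 := Nat.gcd_pos_of_pos_left _ hp.1.1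
    have hdr : (0:ℝ) < Nat.gcd p.1 p.2 := by exact_mod_cast hd0
    simp only [hw, hφ]
    rw [Nat.cast_div (Nat.gcd_dvd_left _ _) hdr.ne', Nat.cast_div (Nat.gcd_dvd_right _ _) hdr.ne']
    have : (0:ℝ) < p.1 := by exact_mod_cast hp.1.1
    have : (0:ℝ) < p.2 := by exact_mod_cast hp.2.1
    field_simp
  have hinj : Set.InjOn φ (Icc 1 V ×ˢ Icc 1 V : Finset (ℕ × ℕ)) := by
    intro p hp q hq h
    simp only [hφ, Prod.mk.injEq] at h
    obtain ⟨ha, hb, hc⟩ := h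
    have e1 := Nat.mul_div_cancel' (Nat.gcd_dvd_left p.1 p.2)
    have e2 := Nat.mul_div_cancel' (Nat.gcd_dvd_right p.1 p.2)
    rw [hb, ha, Nat.mul_div_cancel' (Nat.gcd_dvd_left q.1 q.2)] at e1
    rw [hc, ha, Nat.mul_div_cancel' (Nat.gcd_dvd_right q.1 q.2)] at e2
    ext
    · exact e1.symm
    · exact e2.symm
  have hH := harmonic_le V hV
  have hH0 : 0 ≤ ∑ a ∈ Icc 1 V, 1 / (a:ℝ) := Finset.sum_nonneg fun _ _ => by positivity
  calc _ = ∑ p ∈ Icc 1 V ×ˢ Icc 1 V, w (φ p) := by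
        rw [← Finset.sum_congr rfl h1, Finset.sum_product]
    _ = ∑ q ∈ (Icc 1 V ×ˢ Icc 1 V).image φ, w q := (Finset.sum_image hinj).symm
    _ ≤ ∑ q ∈ Icc 1 V ×ˢ (Icc 1 V ×ˢ Icc 1 V), w q := by
        apply Finset.sum_le_sum_of_subset_of_nonneg
        · intro q hq
          rw [mem_image] at hq
          obtain ⟨p, hp, rfl⟩ := hq
          simp only [mem_product, mem_Icc] at hp
          simp only [hφ, mem_product, mem_Icc]
          have hd0 : 0 < Nat.gcd p.1 p.2 := Nat.gcd_pos_of_pos_left _ hp.1.1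
          have hl1 := Nat.gcd_le_left p.2 hp.1.1
          have hl2 := Nat.gcd_le_right p.1 hp.2.1
          refine ⟨⟨hd0, by omega⟩, ⟨Nat.div_pos hl1 hd0, (Nat.div_le_self _ _).trans hp.1.2⟩, ⟨Nat.div_pos hl2 hd0, (Nat.div_le_self _ _).trans hp.2.2⟩⟩
        · intro q _ _; simp only [hw]; positivity
    _ = (∑ a ∈ Icc 1 V, 1 / (a:ℝ)) ^ 3 := by
        rw [Finset.sum_product, pow_succ', sq, Finset.sum_mul_sum, Finset.sum_mul]
        apply Finset.sum_congr rfl; intro a _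
        rw [Finset.sum_product, Finset.mul_sum]
        apply Finset.sum_congr rfl; intro b _
        rw [Finset.mul_sum]
    _ ≤ _ := by gcongr

end DS

namespace DS
open Finset

lemma mb_neg (M t : ℝ) : mb M (-t) = mb M t := by unfold mb; rw [nn_neg]

lemma duality {ι : Type*} (I : Finset ι) (θ w : ι → ℝ) (hw : ∀ i, 0 ≤ w i) {Q : ℕ} (hQ : 0 < Q) (f : ℕ → ℂ)
    (hf : ∀ n, ‖f n‖ ≤ 1) :
    (∑ i ∈ I, w i * ‖Fr Q f (θ i)‖) ^ 2 ≤ (1 / (Q:ℝ)) * ∑ i ∈ I, ∑ j ∈ I, w i * w j * mb Q (θ i - θ j) := by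
  have hQr : (0:ℝ) < Q := by exact_mod_cast hQ
  have hQc : (Q:ℂ) ≠ 0 := by exact_mod_cast hQ.ne'
  set c : ι → ℂ := fun i => (starRingEnd ℂ) (Fr Q f (θ i)) / ‖Fr Q f (θ i)‖ with hc
  have hc1 : ∀ i, ‖c i‖ ≤ 1 := by
    intro i; simp only [hc]; rw [norm_div, Complex.norm_conj, Complex.norm_real, norm_norm]
    exact div_self_le_one _
  have hc2 : ∀ i, c i * Fr Q f (θ i) = (‖Fr Q f (θ i)‖ : ℂ) := by
    intro i; simp only [hc]
    rcases eq_or_ne (Fr Q f (θ i)) 0 with h | h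
    · simp [h]
    · have h' : (‖Fr Q f (θ i)‖ : ℂ) ≠ 0 := by exact_mod_cast (norm_ne_zero_iff.mpr h)
      rw [div_mul_eq_mul_div, mul_comm, Complex.mul_conj', sq, mul_div_assoc, div_self h', mul_one]
  set P : ℕ → ℂ := fun u => ∑ i ∈ I, (w i : ℂ) * c i * ee (-(θ i * u)) with hP
  have h1 : ((∑ i ∈ I, w i * ‖Fr Q f (θ i)‖ : ℝ) : ℂ) = (1 / (Q:ℂ)) * ∑ u ∈ range Q, f u * P u := by
    rw [Complex.ofReal_sum]
    have : ∀ i ∈ I, ((w i * ‖Fr Q f (θ i)‖ : ℝ) : ℂ) = ∑ u ∈ range Q, (1 / (Q:ℂ)) * (f u * ((w i : ℂ) * c i * ee (-(θ i * u)))) := by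
      intro i _
      rw [Complex.ofReal_mul, ← hc2]
      unfold Fr
      rw [Finset.mul_sum, Finset.mul_sum, Finset.mul_sum]
      apply Finset.sum_congr rfl; intro u _; ring
    rw [Finset.sum_congr rfl this, Finset.sum_comm, Finset.mul_sum]
    apply Finset.sum_congr rfl; intro u _
    simp only [hP]
    rw [Finset.mul_sum, Finset.mul_sum]
  have h2 : ∑ i ∈ I, w i * ‖Fr Q f (θ i)‖ ≤ (1 / (Q:ℝ)) * ∑ u ∈ range Q, ‖P u‖ := by
    have h0 : 0 ≤ ∑ i ∈ I, w i * ‖Fr Q f (θ i)‖ := Finset.sum_nonneg fun i _ => mul_nonneg (hw i) (norm_nonneg _)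
    have : ∑ i ∈ I, w i * ‖Fr Q f (θ i)‖ = ‖((∑ i ∈ I, w i * ‖Fr Q f (θ i)‖ : ℝ) : ℂ)‖ := by
      rw [Complex.norm_real, Real.norm_of_nonneg h0]
    rw [this, h1, norm_mul, norm_div, norm_one, Complex.norm_natCast]
    gcongr
    refine (norm_sum_le _ _).trans (Finset.sum_le_sum fun u _ => ?_)
    rw [norm_mul]; exact mul_le_of_le_one_left (norm_nonneg _) (hf u)
  have h3 : ∑ u ∈ range Q, ‖P u‖ ^ 2 ≤ ∑ i ∈ I, ∑ j ∈ I, w i * w j * mb Q (θ i - θ j) := by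
    have e : ((∑ u ∈ range Q, ‖P u‖ ^ 2 : ℝ) : ℂ) = ∑ i ∈ I, ∑ j ∈ I, (w i * c i) * ((w j) * (starRingEnd ℂ) (c j)) *
        ∑ u ∈ range Q, ee (u * (-(θ i - θ j))) := by
      rw [Complex.ofReal_sum]
      have : ∀ u ∈ range Q, ((‖P u‖ ^ 2 : ℝ) : ℂ) = ∑ i ∈ I, ∑ j ∈ I, (w i * c i) * ((w j) * (starRingEnd ℂ) (c j)) * ee (u * (-(θ i - θ j))) := by
        intro u _
        rw [Complex.ofReal_pow, ← Complex.mul_conj']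
        simp only [hP]
        rw [map_sum, Finset.sum_mul_sum]
        apply Finset.sum_congr rfl; intro i _; apply Finset.sum_congr rfl; intro j _
        rw [map_mul, map_mul, conj_ee, Complex.conj_ofReal]
        rw [show (u:ℝ) * (-(θ i - θ j)) = -(θ i * u) + - -(θ j * u) by ring, ee_add]
        ring
      rw [Finset.sum_congr rfl this, Finset.sum_comm]
      apply Finset.sum_congr rfl; intro i _
      rw [Finset.sum_comm]
      apply Finset.sum_congr rfl; intro j _
      rw [Finset.mul_sum]
    have h0 : 0 ≤ ∑ u ∈ range Q, ‖P u‖ ^ 2 := Finset.sum_nonneg fun _ _ => by positivity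
    rw [← Real.norm_of_nonneg h0, ← Complex.norm_real, e]
    refine (norm_sum_le _ _).trans (Finset.sum_le_sum fun i _ => (norm_sum_le _ _).trans (Finset.sum_le_sum fun j _ => ?_))
    rw [norm_mul, norm_mul, norm_mul, norm_mul, Complex.norm_conj, Complex.norm_real, Complex.norm_real,
      Real.norm_of_nonneg (hw i), Real.norm_of_nonneg (hw j)]
    have h4 := norm_geom_le Q (-(θ i - θ j))
    rw [mb_neg] at h4
    have h5 := hw i; have h6 := hw j
    have h7 : w i * ‖c i‖ ≤ w i := mul_le_of_le_one_right h5 (hc1 i)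
    have h8 : w j * ‖c j‖ ≤ w j := mul_le_of_le_one_right h6 (hc1 j)
    gcongr
  have h0 : 0 ≤ ∑ i ∈ I, w i * ‖Fr Q f (θ i)‖ := Finset.sum_nonneg fun i _ => mul_nonneg (hw i) (norm_nonneg _)
  have h9 : (∑ u ∈ range Q, ‖P u‖) ^ 2 ≤ Q * ∑ u ∈ range Q, ‖P u‖ ^ 2 := by
    have := sq_sum_le_card_mul_sum_sq (s := range Q) (f := fun u => ‖P u‖)
    simpa using this
  calc _ ≤ ((1 / (Q:ℝ)) * ∑ u ∈ range Q, ‖P u‖) ^ 2 := by gcongr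
    _ = (1 / (Q:ℝ)) ^ 2 * (∑ u ∈ range Q, ‖P u‖) ^ 2 := by ring
    _ ≤ (1 / (Q:ℝ)) ^ 2 * (Q * ∑ u ∈ range Q, ‖P u‖ ^ 2) := by gcongr
    _ = (1 / (Q:ℝ)) * ∑ u ∈ range Q, ‖P u‖ ^ 2 := by field_simp
    _ ≤ _ := by gcongr

lemma farey_sum (V Q : ℕ) (hV : 1 ≤ V) (hQ : V ^ 2 ≤ Q) (f : ℕ → ℂ) (hf : ∀ n, ‖f n‖ ≤ 1) :
    (∑ m ∈ Icc 1 V, (1 / (m:ℝ)) * ∑ k ∈ range m, ‖Fr Q f (-((k:ℝ) / m))‖) ^ 2 ≤ 12 * (1 + Real.log V) ^ 3 := by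
  have hQ0 : 0 < Q := lt_of_lt_of_le (by positivity) hQ
  have hQr : (0:ℝ) < Q := by exact_mod_cast hQ0
  have hVr : (1:ℝ) ≤ V := by exact_mod_cast hV
  have hlV := Real.log_nonneg hVr
  have hQV : (V:ℝ) ^ 2 ≤ Q := by exact_mod_cast hQ
  have h1 := duality ((Icc 1 V).sigma fun m => range m) (fun i => -((i.2:ℝ) / i.1)) (fun i => 1 / (i.1:ℝ)) (fun i => by positivity) hQ0 f hf
  rw [Finset.sum_sigma] at h1
  have e1 : ∑ m ∈ Icc 1 V, (1 / (m:ℝ)) * ∑ k ∈ range m, ‖Fr Q f (-((k:ℝ) / m))‖ =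
    ∑ a ∈ Icc 1 V, ∑ s ∈ range a, 1 / (a:ℝ) * ‖Fr Q f (-((s:ℝ) / a))‖ := by
    apply Finset.sum_congr rfl; intro m _; rw [Finset.mul_sum]
  rw [e1]
  refine h1.trans ?_
  have e2 : ∑ i ∈ (Icc 1 V).sigma fun m => range m, ∑ j ∈ (Icc 1 V).sigma fun m => range m,
      1 / (i.1:ℝ) * (1 / (j.1:ℝ)) * mb Q (-((i.2:ℝ) / i.1) - -((j.2:ℝ) / j.1)) =
      ∑ m ∈ Icc 1 V, ∑ m' ∈ Icc 1 V, 1 / (m:ℝ) * (1 / (m':ℝ)) * ∑ k ∈ range m, ∑ k' ∈ range m', mb Q (-((k:ℝ) / m) - -((k':ℝ) / m')) := by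
    rw [Finset.sum_sigma]
    apply Finset.sum_congr rfl; intro m _
    simp_rw [Finset.sum_sigma]
    rw [Finset.sum_comm]
    apply Finset.sum_congr rfl; intro m' _
    rw [Finset.mul_sum]
    apply Finset.sum_congr rfl; intro k _
    rw [Finset.mul_sum]
  rw [e2]
  have h2 : ∀ m ∈ Icc 1 V, ∀ m' ∈ Icc 1 V, 1 / (m:ℝ) * (1 / (m':ℝ)) * ∑ k ∈ range m, ∑ k' ∈ range m', mb Q (-((k:ℝ) / m) - -((k':ℝ) / m')) ≤
      4 * Q * ((Nat.gcd m m' : ℝ) / (m * m')) + 4 * (1 + 2 * Real.log V) := by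
    intro m hm m' hm'
    rw [mem_Icc] at hm hm'
    have hmr : (0:ℝ) < m := by exact_mod_cast hm.1
    have hmr' : (0:ℝ) < m' := by exact_mod_cast hm'.1
    have h3 := gcd_pair_sum Q hQr.le m m' hm.1 hm'.1
    have hd0 : 0 < Nat.gcd m m' := Nat.gcd_pos_of_pos_left _ hm.1
    have hdr : (0:ℝ) < Nat.gcd m m' := by exact_mod_cast hd0
    have hl : ((m * (m' / Nat.gcd m m') : ℕ):ℝ) = m * m' / Nat.gcd m m' := by
      rw [Nat.cast_mul, Nat.cast_div (Nat.gcd_dvd_right _ _) hdr.ne']; ring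
    have hl2 : Real.log ((m * (m' / Nat.gcd m m') : ℕ):ℝ) ≤ 2 * Real.log V := by
      have : ((m * (m' / Nat.gcd m m') : ℕ):ℝ) ≤ (V:ℝ) ^ 2 := by
        rw [hl]
        have : (m:ℝ) ≤ V := by exact_mod_cast hm.2
        have : (m':ℝ) ≤ V := by exact_mod_cast hm'.2
        have : (1:ℝ) ≤ Nat.gcd m m' := by exact_mod_cast hd0
        calc (m:ℝ) * m' / Nat.gcd m m' ≤ m * m' := div_le_self (by positivity) this
          _ ≤ V * V := by gcongr
          _ = _ := by ring
      calc _ ≤ Real.log ((V:ℝ) ^ 2) := Real.log_le_log (by rw [hl]; positivity) this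
        _ = _ := by rw [Real.log_pow]; norm_num
    calc _ ≤ 1 / (m:ℝ) * (1 / (m':ℝ)) * ((Nat.gcd m m' : ℝ) * (4 * Q + 4 * (m * (m' / Nat.gcd m m') : ℕ) * (1 + Real.log (m * (m' / Nat.gcd m m') : ℕ)))) := by gcongr
      _ ≤ 1 / (m:ℝ) * (1 / (m':ℝ)) * ((Nat.gcd m m' : ℝ) * (4 * Q + 4 * (m * (m' / Nat.gcd m m') : ℕ) * (1 + 2 * Real.log V))) := by gcongr
      _ = _ := by rw [hl]; field_simp
  calc _ ≤ (1 / (Q:ℝ)) * ∑ m ∈ Icc 1 V, ∑ m' ∈ Icc 1 V, (4 * Q * ((Nat.gcd m m' : ℝ) / (m * m')) + 4 * (1 + 2 * Real.log V)) := by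
        gcongr with m hm m' hm'
        exact h2 m hm m' hm'
    _ = 4 * ∑ m ∈ Icc 1 V, ∑ m' ∈ Icc 1 V, ((Nat.gcd m m' : ℝ) / (m * m')) + (V:ℝ) ^ 2 / Q * (4 * (1 + 2 * Real.log V)) := by
        simp_rw [Finset.sum_add_distrib, ← Finset.mul_sum]
        simp only [Finset.sum_const, Nat.card_Icc, nsmul_eq_mul, Nat.add_sub_cancel]
        field_simp
    _ ≤ 4 * (1 + Real.log V) ^ 3 + 1 * (4 * (1 + 2 * Real.log V)) := by
        have := gcd_harm V hV
        gcongr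
        rw [div_le_one hQr]; exact hQV
    _ ≤ _ := by nlinarith [mul_nonneg hlV hlV, mul_nonneg hlV (mul_nonneg hlV hlV)]

end DS

namespace DS
open Finset

noncomputable def Sz (f : ℕ → ℂ) (z : ℕ) (θ : ℝ) : ℂ := ∑ u ∈ range z, f u * ee (θ * u)

lemma Sz_full {G : ℕ} {f : ℕ → ℂ} (hG : 0 < G) (J : ℕ) (θ : ℝ) : ‖Sz f (G ^ J) θ‖ = (G:ℝ) ^ J * FA G f J (-θ) := by
  unfold Sz FA Fr
  have : (0:ℝ) < (G:ℝ) ^ J := by positivity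
  rw [norm_mul, norm_div, norm_one, Complex.norm_natCast, ← mul_assoc]
  push_cast
  rw [mul_one_div_cancel this.ne', one_mul]
  congr 1; apply Finset.sum_congr rfl; intro u _; congr 2; ring

lemma Sz_bound {G : ℕ} {f : ℕ → ℂ} (hG : 0 < G) (hf : GM G f) (θ : ℝ) (J : ℕ) : ∀ z, z ≤ G ^ J →
    ‖Sz f z θ‖ ≤ 1 + ∑ j ∈ range J, (G:ℝ) ^ (j + 1) * FA G f j (-θ) := by
  induction J with
  | zero =>
    intro z hz
    unfold Sz
    refine (norm_sum_le _ _).trans ?_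
    have : ∀ u ∈ range z, ‖f u * ee (θ * u)‖ ≤ 1 := by intro u _; rw [norm_mul, hf.1, norm_ee, one_mul]
    refine (Finset.sum_le_card_nsmul _ _ _ this).trans ?_
    simp at hz ⊢; exact_mod_cast hz
  | succ J ih =>
    intro z hz
    have hQ : 0 < G ^ J := by positivity
    set w := z % G ^ J with hw
    set v := z / G ^ J with hv
    have hz2 : z = G ^ J * v + w := (Nat.div_add_mod z (G ^ J)).symm
    have hvG : v ≤ G := by
      rw [hv]; apply Nat.div_le_of_le_mul; rw [← pow_succ]; exact hz
    have hwQ : w < G ^ J := Nat.mod_lt _ hQ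
    have hterm : ∀ a b : ℕ, a < G ^ J → f (a + G ^ J * b) * ee (θ * (a + G ^ J * b : ℕ)) =
        (f b * ee (θ * (G ^ J * b : ℕ))) * (f a * ee (θ * a)) := by
      intro a b ha
      rw [GM.pow' hG hf J a b ha, show θ * ((a + G ^ J * b : ℕ):ℝ) = θ * a + θ * (G ^ J * b : ℕ) by push_cast; ring, ee_add]
      ring
    have e : Sz f z θ = (∑ b ∈ range v, f b * ee (θ * (G ^ J * b : ℕ))) * Sz f (G ^ J) θ + (f v * ee (θ * (G ^ J * v : ℕ))) * Sz f w θ := by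
      unfold Sz
      conv_lhs => rw [hz2]
      rw [Finset.sum_range_add, sum_range_mul_split]
      congr 1
      · rw [Finset.sum_mul]
        apply Finset.sum_congr rfl; intro b _
        rw [Finset.mul_sum]
        apply Finset.sum_congr rfl; intro a ha
        exact hterm a b (mem_range.mp ha)
      · rw [Finset.mul_sum]
        apply Finset.sum_congr rfl; intro a ha
        rw [add_comm (G ^ J * v) a]
        exact hterm a v ((mem_range.mp ha).trans hwQ)
    rw [e, Finset.sum_range_succ]
    refine (norm_add_le _ _).trans ?_
    rw [norm_mul, norm_mul, norm_mul, hf.1, norm_ee, one_mul, one_mul, Sz_full hG]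
    have h1 : ‖∑ b ∈ range v, f b * ee (θ * (G ^ J * b : ℕ))‖ ≤ G := by
      have : ∀ u ∈ range v, ‖f u * ee (θ * (G ^ J * u : ℕ))‖ ≤ 1 := by intro u _; rw [norm_mul, hf.1, norm_ee, one_mul]
      refine (norm_sum_le _ _).trans ((Finset.sum_le_card_nsmul _ _ _ this).trans ?_)
      simp; exact_mod_cast hvG
    have h2 := ih w hwQ.le
    have h3 : ‖∑ b ∈ range v, f b * ee (θ * (G ^ J * b : ℕ))‖ * ((G:ℝ) ^ J * FA G f J (-θ)) ≤ G * ((G:ℝ) ^ J * FA G f J (-θ)) := by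
      have := FA_nonneg G f J (-θ)
      gcongr
    have h4 : (G:ℝ) * ((G:ℝ) ^ J * FA G f J (-θ)) = (G:ℝ) ^ (J + 1) * FA G f J (-θ) := by ring
    linarith

lemma Sz_bound2 {G : ℕ} {f : ℕ → ℂ} (hG : 2 ≤ G) (hf : GM G f) (θ : ℝ) (J l : ℕ) {ε : ℝ} (hε : ∀ θ, FA G f l θ ≤ ε) (z : ℕ) (hz : z ≤ G ^ J) :
    ‖Sz f z θ‖ ≤ 1 + 2 * (G:ℝ) ^ (2 * l) + 2 * (G:ℝ) ^ J * ε * FA G f l (-θ) := by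
  have hG0 : 0 < G := by omega
  have hGr : (2:ℝ) ≤ G := by exact_mod_cast hG
  have hε0 : 0 ≤ ε := (FA_nonneg G f l 0).trans (hε 0)
  have hgeo : ∀ n, ∑ j ∈ range n, (G:ℝ) ^ (j + 1) ≤ 2 * (G:ℝ) ^ n := by
    intro n
    induction n with
    | zero => simp
    | succ n ih =>
      rw [Finset.sum_range_succ]
      have : (0:ℝ) ≤ (G:ℝ) ^ n := by positivity
      have : (G:ℝ) ^ (n + 1) = G * (G:ℝ) ^ n := by ring
      nlinarith
  refine (Sz_bound hG0 hf θ J z hz).trans ?_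
  have hF := FA_nonneg G f l (-θ)
  have h1 : ∀ j, (G:ℝ) ^ (j + 1) * FA G f j (-θ) ≤ (if j < 2 * l then (G:ℝ) ^ (j + 1) else 0) + (G:ℝ) ^ (j + 1) * (ε * FA G f l (-θ)) := by
    intro j
    by_cases h : j < 2 * l
    · rw [if_pos h]
      have h2 := FA_le_one hf j (-θ)
      have : (G:ℝ) ^ (j + 1) * FA G f j (-θ) ≤ (G:ℝ) ^ (j + 1) := mul_le_of_le_one_right (by positivity) h2
      have : 0 ≤ (G:ℝ) ^ (j + 1) * (ε * FA G f l (-θ)) := by positivity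
      linarith
    · rw [if_neg h, zero_add]
      push Not at h
      obtain ⟨r, rfl⟩ := Nat.exists_eq_add_of_le h
      rw [show 2 * l + r = l + (l + r) by ring, FA_add hG0 hf, FA_add hG0 hf]
      have h2 := FA_le_one hf r ((G ^ l : ℕ) * ((G ^ l : ℕ) * (-θ)))
      have h3 := hε ((G ^ l : ℕ) * (-θ))
      have h4 := FA_nonneg G f r ((G ^ l : ℕ) * ((G ^ l : ℕ) * (-θ)))
      have h5 := FA_nonneg G f l ((G ^ l : ℕ) * (-θ))
      have h6 : FA G f l ((G ^ l : ℕ) * (-θ)) * FA G f r ((G ^ l : ℕ) * ((G ^ l : ℕ) * (-θ))) ≤ ε := by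
        calc _ ≤ ε * 1 := by gcongr
          _ = ε := mul_one _
      rw [mul_comm ε]
      gcongr
  have h2 : ∑ j ∈ range J, (if j < 2 * l then (G:ℝ) ^ (j + 1) else 0) ≤ 2 * (G:ℝ) ^ (2 * l) := by
    refine le_trans ?_ (hgeo (2 * l))
    rw [← Finset.sum_filter]
    apply Finset.sum_le_sum_of_subset_of_nonneg
    · intro j; simp only [mem_filter, mem_range]; tauto
    · intro j _ _; positivity
  have h3 : ∑ j ∈ range J, (G:ℝ) ^ (j + 1) * FA G f j (-θ) ≤ 2 * (G:ℝ) ^ (2 * l) + (2 * (G:ℝ) ^ J) * (ε * FA G f l (-θ)) := by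
    calc _ ≤ ∑ j ∈ range J, ((if j < 2 * l then (G:ℝ) ^ (j + 1) else 0) + (G:ℝ) ^ (j + 1) * (ε * FA G f l (-θ))) := Finset.sum_le_sum fun j _ => h1 j
      _ ≤ _ := by
        rw [Finset.sum_add_distrib, ← Finset.sum_mul]
        have := hgeo J
        gcongr
  linarith

lemma typeI_one {G : ℕ} {f : ℕ → ℂ} (hG : 2 ≤ G) (hf : GM G f) (J l X : ℕ) (hX : X + 1 ≤ G ^ J) {ε : ℝ} (hε : ∀ θ, FA G f l θ ≤ ε)
    (m : ℕ) (hm : 0 < m) (y : ℕ) (hy : y ≤ X / m) :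
    ‖∑ n ∈ Icc 1 y, f (m * n)‖ ≤ 2 + 2 * (G:ℝ) ^ (2 * l) + 2 * (G:ℝ) ^ J * ε * ((1 / (m:ℝ)) * ∑ k ∈ range m, FA G f l (-((k:ℝ) / m))) := by
  have hmr : (0:ℝ) < m := by exact_mod_cast hm
  have hmc : (m:ℂ) ≠ 0 := by exact_mod_cast hm.ne'
  have e1 : ∑ n ∈ Icc 1 y, f (m * n) = ∑ n ∈ range (y + 1), f (m * n) - f (m * 0) := by
    rw [Finset.sum_range_succ', ← Finset.Ico_add_one_right_eq_Icc, Finset.sum_Ico_eq_sum_range]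
    simp only [Nat.add_sub_cancel, add_sub_cancel_right]
    apply Finset.sum_congr rfl; intro n _; rw [add_comm]
  have e2 : ∑ n ∈ range (y + 1), f (m * n) = ∑ u ∈ range (m * y + 1), (if (m:ℤ) ∣ (u:ℤ) then f u else 0) := by
    rw [← Finset.sum_filter]
    apply Finset.sum_nbij (fun n => m * n)
    · intro n hn
      simp only [mem_range, mem_filter] at hn ⊢
      exact ⟨Nat.lt_succ_of_le (Nat.mul_le_mul_left _ (by omega)), by push_cast; exact Dvd.intro _ rfl⟩
    · intro a _ b _ h
      exact Nat.eq_of_mul_eq_mul_left hm h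
    · intro u hu
      simp only [coe_filter, mem_range, Set.mem_setOf_eq] at hu
      obtain ⟨n, rfl⟩ : m ∣ u := by exact_mod_cast hu.2
      refine ⟨n, ?_, rfl⟩
      simp only [coe_range, Set.mem_Iio]
      have := Nat.le_of_mul_le_mul_left (Nat.le_of_lt_succ hu.1) hm
      omega
    · intro n _; rfl
  have e3 : ∑ u ∈ range (m * y + 1), (if (m:ℤ) ∣ (u:ℤ) then f u else 0) = (1 / (m:ℂ)) * ∑ k ∈ range m, Sz f (m * y + 1) ((k:ℝ) / m) := by
    unfold Sz
    rw [Finset.sum_comm, Finset.mul_sum]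
    apply Finset.sum_congr rfl; intro u _
    have h := orth hm (u:ℤ)
    have : ∑ x ∈ range m, f u * ee ((x:ℝ) / m * u) = f u * ∑ k ∈ range m, ee ((k:ℝ) * (((u:ℤ):ℝ) / m)) := by
      rw [Finset.mul_sum]; apply Finset.sum_congr rfl; intro k _; congr 2; push_cast; ring
    rw [this, h]
    split_ifs
    · field_simp
    · ring
  have hzX : m * y + 1 ≤ G ^ J := by
    have : m * y ≤ X := (Nat.mul_le_mul_left _ hy).trans (Nat.mul_div_le X m)
    omega
  rw [e1, e2, e3]
  refine (norm_sub_le _ _).trans ?_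
  rw [hf.1, norm_mul, norm_div, norm_one, Complex.norm_natCast]
  have h4 : ‖∑ k ∈ range m, Sz f (m * y + 1) ((k:ℝ) / m)‖ ≤ m * (1 + 2 * (G:ℝ) ^ (2 * l)) + 2 * (G:ℝ) ^ J * ε * ∑ k ∈ range m, FA G f l (-((k:ℝ) / m)) := by
    calc _ ≤ ∑ k ∈ range m, (1 + 2 * (G:ℝ) ^ (2 * l) + 2 * (G:ℝ) ^ J * ε * FA G f l (-((k:ℝ) / m))) :=
          (norm_sum_le _ _).trans (Finset.sum_le_sum fun k _ => Sz_bound2 hG hf _ J l hε _ hzX)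
      _ = _ := by rw [Finset.sum_add_distrib, ← Finset.mul_sum]; simp; ring
  have h5 : 1 / (m:ℝ) * ‖∑ k ∈ range m, Sz f (m * y + 1) ((k:ℝ) / m)‖ ≤ 1 / (m:ℝ) * (m * (1 + 2 * (G:ℝ) ^ (2 * l)) + 2 * (G:ℝ) ^ J * ε * ∑ k ∈ range m, FA G f l (-((k:ℝ) / m))) := by gcongr
  have h6 : 1 / (m:ℝ) * (m * (1 + 2 * (G:ℝ) ^ (2 * l)) + 2 * (G:ℝ) ^ J * ε * ∑ k ∈ range m, FA G f l (-((k:ℝ) / m))) =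
    1 + 2 * (G:ℝ) ^ (2 * l) + 2 * (G:ℝ) ^ J * ε * ((1 / (m:ℝ)) * ∑ k ∈ range m, FA G f l (-((k:ℝ) / m))) := by field_simp
  linarith

lemma typeI_sum {G : ℕ} {f : ℕ → ℂ} (hf : GM G f) (J l V : ℕ) (hV : 1 ≤ V) (hVl : V ^ 2 ≤ G ^ l) {ε : ℝ} (hε0 : 0 ≤ ε) :
    ∑ m ∈ Icc 1 V, (2 + 2 * (G:ℝ) ^ (2 * l) + 2 * (G:ℝ) ^ J * ε * ((1 / (m:ℝ)) * ∑ k ∈ range m, FA G f l (-((k:ℝ) / m)))) ≤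
      V * (2 + 2 * (G:ℝ) ^ (2 * l)) + 2 * (G:ℝ) ^ J * ε * (4 * (1 + Real.log V) ^ 2) := by
  have h := farey_sum V (G ^ l) hV hVl f (fun n => (hf.1 n).le)
  have hl : 0 ≤ Real.log V := Real.log_nonneg (by exact_mod_cast hV)
  have h1 : ∑ m ∈ Icc 1 V, (1 / (m:ℝ)) * ∑ k ∈ range m, FA G f l (-((k:ℝ) / m)) ≤ 4 * (1 + Real.log V) ^ 2 := by
    refine (sq_le_sq₀ (Finset.sum_nonneg fun m _ => mul_nonneg (by positivity) (Finset.sum_nonneg fun k _ => FA_nonneg _ _ _ _)) (by positivity)).mp ?_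
    refine h.trans ?_
    have : (1 + Real.log V) ^ 3 ≤ (1 + Real.log V) ^ 4 := pow_le_pow_right₀ (by linarith) (by norm_num)
    nlinarith
  rw [Finset.sum_add_distrib, ← Finset.mul_sum]
  simp only [Finset.sum_const, Nat.card_Icc, nsmul_eq_mul, Nat.add_sub_cancel]
  gcongr

end DS

namespace DS
open Finset

lemma card_div_pow (G k : ℕ) (hG : 2 ≤ G) : #(G ^ k).divisors ≤ (k * G + 1) ^ G := by
  have hne : G ^ k ≠ 0 := by positivity
  rw [Nat.card_divisors hne]
  calc ∏ p ∈ (G ^ k).primeFactors, ((G ^ k).factorization p + 1) ≤ ∏ p ∈ (G ^ k).primeFactors, (k * G + 1) := by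
        apply Finset.prod_le_prod' ; intro p _
        rw [Nat.factorization_pow]
        simp only [Finsupp.smul_apply, smul_eq_mul]
        gcongr
        exact (Nat.factorization_lt p (by omega)).le
    _ = (k * G + 1) ^ #(G ^ k).primeFactors := by rw [Finset.prod_const]
    _ ≤ (k * G + 1) ^ G := by
        apply Nat.pow_le_pow_right (by omega)
        calc #(G ^ k).primeFactors ≤ #G.primeFactors := Finset.card_le_card (by
              intro p hp
              rw [Nat.mem_primeFactors] at hp ⊢
              exact ⟨hp.1, hp.1.dvd_of_dvd_pow hp.2.1, by omega⟩)
          _ ≤ #(Icc 1 G) := Finset.card_le_card (by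
              intro p hp
              rw [Nat.mem_primeFactors] at hp
              exact Finset.mem_Icc.mpr ⟨hp.1.one_le, Nat.le_of_dvd (by omega) hp.2.1⟩)
          _ = G := by simp

lemma log_pow_le {G k : ℕ} (hG : 2 ≤ G) {L : ℝ} (h : Real.log (G ^ k : ℕ) ≤ 2 * L) : (k : ℝ) ≤ 4 * L := by
  have h2 : (1:ℝ)/2 ≤ Real.log 2 := by have := Real.log_two_gt_d9; linarith
  have h3 : Real.log 2 ≤ Real.log G := Real.log_le_log (by norm_num) (by exact_mod_cast hG)
  push_cast at h
  rw [Real.log_pow] at h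
  have : (k:ℝ) * (1/2) ≤ k * Real.log G := by gcongr; linarith
  linarith

lemma div_bound {G k : ℕ} (hG : 2 ≤ G) {L : ℝ} (hL : 1 ≤ L) (h : Real.log (G ^ k : ℕ) ≤ 2 * L) :
    (#(G ^ k).divisors : ℝ) ≤ (5 * G) ^ G * L ^ G := by
  have h1 := card_div_pow G k hG
  have hk := log_pow_le hG h
  have hG' : (1:ℝ) ≤ G := by exact_mod_cast (by omega : 1 ≤ G)
  calc (#(G ^ k).divisors : ℝ) ≤ ((k * G + 1 : ℕ):ℝ) ^ G := by exact_mod_cast h1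
    _ ≤ (5 * G * L) ^ G := by
        gcongr
        push_cast
        have : (k:ℝ) * G ≤ 4 * L * G := by gcongr
        nlinarith
    _ = _ := by rw [mul_pow]

lemma tII_num {G a b : ℕ} {L R R1 η D M ε lg : ℝ} (hL : 1 ≤ L) (hG : (2:ℝ) ≤ G) (hη : 0 < η) (ha : (G:ℝ) + 13 ≤ a * η)
    (hb : G + 3 * a + 53 ≤ 2 * b) (hR : L ^ 13 ≤ R) (hR' : R ≤ 2 * L ^ 13) (hR1 : L ^ a ≤ R1) (hR1' : R1 ≤ 2 * L ^ a)
    (hD0 : 0 ≤ D) (hD : D ≤ (5 * G) ^ G * L ^ G) (hM : L ^ (G + 66) ≤ M ^ η) (hM0 : 0 < M) (hε0 : 0 ≤ ε) (hε : ε ≤ 1 / L ^ b)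
    (hlg : lg ≤ 2 * L) (hlg0 : 0 ≤ lg) :
    18 / R + 4 * (D * (8 * R1 ^ (-η) + 24 * G ^ 2 * R ^ 4 * (1 + lg) * M ^ (-η) + 24 * G * R1 ^ 3 * R ^ 3 * (1 + lg) * ε ^ 2)) ≤
      (18 + 4 * (5 * G) ^ G * (8 + 1152 * G ^ 2 + 4608 * G)) / L ^ 13 := by
  have hL0 : 0 < L := by linarith
  have hR0 : 0 < R := lt_of_lt_of_le (by positivity) hR
  have hR10 : 0 < R1 := lt_of_lt_of_le (by positivity) hR1
  have h1 : 18 / R ≤ 18 / L ^ 13 := by gcongr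
  have h2 : R1 ^ (-η) ≤ 1 / L ^ (G + 13) := by
    rw [Real.rpow_neg hR10.le, one_div]
    apply inv_anti₀ (by positivity)
    calc L ^ (G + 13) = L ^ ((G:ℝ) + 13) := by rw [← Real.rpow_natCast]; push_cast; rfl
      _ ≤ L ^ (a * η) := Real.rpow_le_rpow_of_exponent_le hL ha
      _ = (L ^ a) ^ η := by rw [Real.rpow_mul hL0.le, Real.rpow_natCast]
      _ ≤ R1 ^ η := Real.rpow_le_rpow (by positivity) hR1 hη.le
  have h3 : M ^ (-η) ≤ 1 / L ^ (G + 66) := by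
    rw [Real.rpow_neg hM0.le, one_div]
    exact inv_anti₀ (by positivity) hM
  have h4 : ε ^ 2 ≤ 1 / L ^ (G + 3 * a + 53) := by
    calc ε ^ 2 ≤ (1 / L ^ b) ^ 2 := by gcongr
      _ = 1 / L ^ (2 * b) := by rw [div_pow, one_pow, ← pow_mul, mul_comm b 2]
      _ ≤ _ := by gcongr
  have h5 : 1 + lg ≤ 3 * L := by linarith
  have hM' : 0 ≤ M ^ (-η) := by positivity
  have k1 : 24 * G ^ 2 * R ^ 4 * (1 + lg) * M ^ (-η) ≤ 1152 * G ^ 2 * (1 / L ^ (G + 13)) := by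
    calc 24 * G ^ 2 * R ^ 4 * (1 + lg) * M ^ (-η) ≤ 24 * G ^ 2 * (2 * L ^ 13) ^ 4 * (3 * L) * (1 / L ^ (G + 66)) := by gcongr
      _ = 1152 * G ^ 2 * (1 / L ^ (G + 13)) := by
        rw [show G + 66 = (G + 13) + 53 by ring, pow_add L (G + 13) 53]; field_simp; ring
  have k2 : 24 * G * R1 ^ 3 * R ^ 3 * (1 + lg) * ε ^ 2 ≤ 4608 * G * (1 / L ^ (G + 13)) := by
    calc 24 * G * R1 ^ 3 * R ^ 3 * (1 + lg) * ε ^ 2 ≤ 24 * G * (2 * L ^ a) ^ 3 * (2 * L ^ 13) ^ 3 * (3 * L) * (1 / L ^ (G + 3 * a + 53)) := by gcongr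
      _ = 4608 * G * (1 / L ^ (G + 13)) := by
        rw [show G + 3 * a + 53 = (G + 13) + (3 * a + 40) by ring, pow_add L (G + 13) (3 * a + 40), pow_add, mul_pow, ← pow_mul, mul_comm a 3]; field_simp; rw [pow_add]; ring
  calc _ ≤ 18 / L ^ 13 + 4 * ((5 * G) ^ G * L ^ G * (8 * (1 / L ^ (G + 13)) + 1152 * G ^ 2 * (1 / L ^ (G + 13)) + 4608 * G * (1 / L ^ (G + 13)))) := by
        gcongr
    _ = _ := by rw [pow_add]; field_simp

lemma tII_apply {G : ℕ} {f : ℕ → ℂ} (hG : 2 ≤ G) (hf : GM G f) {η : ℝ} (hη0 : 0 < η) (hη : η ≤ 1) (hs : SG G f η) {a b : ℕ}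
    (ha : (G:ℝ) + 13 ≤ a * η) (hb : G + 3 * a + 53 ≤ 2 * b) {X U : ℕ} {L : ℝ} (hLX : L = Real.log X) (hL : 1 ≤ L)
    (hLbig : (18 + 4 * (5 * G) ^ G * (8 + 1152 * G ^ 2 + 4608 * G)) * 136 ^ 2 ≤ L)
    (hU : 8 ≤ U) (hUX : X ≤ (2 * U) ^ 12) (hM : L ^ (G + 66) ≤ (U:ℝ) ^ η) (hM2 : 4 * L ^ (a + 26) ≤ U) (hXb : G * (4 * L ^ 26) ≤ X)
    (hFA : ∀ k, X ≤ (G ^ k) ^ 16 → ∀ θ, FA G f k θ ≤ 1 / L ^ b)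
    {M N : ℕ} (hUM : U ≤ M) (hMN : M ≤ N) (hMNX : M * N ≤ X) (u v : ℕ → ℂ) (hu : ∀ n, ‖u n‖ ≤ 1) (hv : ∀ n, ‖v n‖ ≤ 1) :
    ‖∑ m ∈ Icc 1 M, ∑ n ∈ Icc 1 N, u m * v n * f (m * n)‖ ≤ X / (136 * L ^ 6) := by
  have hL0 : 0 < L := by linarith
  set R := ⌈L ^ 13⌉₊ with hRdef
  set R1 := ⌈L ^ a⌉₊ with hR1def
  have hRl : L ^ 13 ≤ R := Nat.le_ceil _
  have hRu : (R:ℝ) ≤ 2 * L ^ 13 := by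
    have := Nat.ceil_lt_add_one (show 0 ≤ L ^ 13 by positivity)
    have h1 := one_le_pow₀ hL (n := 13)
    linarith
  have hR1l : L ^ a ≤ R1 := Nat.le_ceil _
  have hR1u : (R1:ℝ) ≤ 2 * L ^ a := by
    have := Nat.ceil_lt_add_one (show 0 ≤ L ^ a by positivity)
    have h1 := one_le_pow₀ hL (n := a)
    linarith
  have hRpos : 0 < R := Nat.ceil_pos.mpr (by positivity)
  have hR1pos : 0 < R1 := Nat.ceil_pos.mpr (by positivity)
  have hMpos : 0 < M := by omega
  have hRU : (R:ℝ) ^ 2 ≤ U := by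
    calc (R:ℝ) ^ 2 ≤ (2 * L ^ 13) ^ 2 := by gcongr
      _ = 4 * L ^ 26 := by ring
      _ ≤ 4 * L ^ (a + 26) := by gcongr; omega
      _ ≤ U := hM2
  have hRU' : R ^ 2 ≤ U := by exact_mod_cast hRU
  have hRM : R ^ 2 ≤ M := hRU'.trans hUM
  set k := Nat.clog G (M * R ^ 2) with hk
  have hMR : 1 < M * R ^ 2 := by
    have : 1 ≤ R ^ 2 := Nat.one_le_pow _ _ hRpos
    nlinarith
  have hQ1 : M * R ^ 2 ≤ G ^ k := Nat.le_pow_clog (by omega) _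
  have hQ2 : G ^ k ≤ G * M * R ^ 2 := by
    have h := Nat.pow_pred_clog_lt_self (by omega : 1 < G) hMR
    have hkpos : 0 < k := Nat.clog_pos (by omega) hMR
    have e : G ^ k = G * G ^ (k - 1) := by rw [← pow_succ']; congr 1; omega
    rw [e, mul_assoc]
    exact Nat.mul_le_mul_left _ h.le
  have hUk : U ≤ G ^ k := by nlinarith [Nat.one_le_pow 2 _ hRpos]
  have hRR : R1 * R ≤ G ^ k := by
    refine le_trans ?_ hUk
    have : (R1:ℝ) * R ≤ U := by
      calc (R1:ℝ) * R ≤ (2 * L ^ a) * (2 * L ^ 13) := by gcongr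
        _ = 4 * L ^ (a + 13) := by rw [pow_add]; ring
        _ ≤ 4 * L ^ (a + 26) := by gcongr; omega
        _ ≤ U := hM2
    exact_mod_cast this
  have hXk : X ≤ (G ^ k) ^ 16 := by
    calc X ≤ (2 * U) ^ 12 := hUX
      _ = 8 ^ 4 * U ^ 12 := by ring
      _ ≤ U ^ 4 * U ^ 12 := by gcongr
      _ = U ^ 16 := by ring
      _ ≤ _ := by gcongr
  have hXpos : 0 < X := lt_of_lt_of_le (by nlinarith) hMNX
  have hXpos' : (0:ℝ) < X := by exact_mod_cast hXpos
  have hMX : (M:ℝ) ≤ X := by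
    have : M ≤ X := le_trans (by nlinarith) hMNX
    exact_mod_cast this
  have hlog : Real.log (G ^ k : ℕ) ≤ 2 * L := by
    have : ((G ^ k : ℕ):ℝ) ≤ (X:ℝ) ^ 2 := by
      calc ((G ^ k : ℕ):ℝ) ≤ ((G * M * R ^ 2 : ℕ):ℝ) := by exact_mod_cast hQ2
        _ = G * R ^ 2 * M := by push_cast; ring
        _ ≤ G * (2 * L ^ 13) ^ 2 * X := by gcongr
        _ = (G * (4 * L ^ 26)) * X := by ring
        _ ≤ X * X := by gcongr
        _ = _ := by ring
    calc Real.log (G ^ k : ℕ) ≤ Real.log ((X:ℝ) ^ 2) := Real.log_le_log (by positivity) this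
      _ = 2 * L := by rw [Real.log_pow, hLX]; norm_num
  have hlog0 : 0 ≤ Real.log (G ^ k : ℕ) := Real.log_natCast_nonneg _
  have hMη : L ^ (G + 66) ≤ (M:ℝ) ^ η := hM.trans (Real.rpow_le_rpow (by positivity) (by exact_mod_cast hUM) hη0.le)
  have key := typeII_bound (by omega) hf hη0.le hη hs k N M R R1 hMpos hMN hRpos hR1pos hRM hQ1 hQ2 hRR (hFA k hXk) u v hu hv
  have hnum := tII_num (G := G) (D := (#(G ^ k).divisors : ℝ)) (ε := 1 / L ^ b) hL (by exact_mod_cast hG) hη0 ha hb hRl hRu hR1l hR1u (by positivity)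
    (div_bound hG hL hlog) hMη (by exact_mod_cast hMpos) (by positivity) le_rfl hlog hlog0
  refine le_of_sq_le_sq ?_ (by positivity)
  have hMNX' : (M:ℝ) * N ≤ X := by exact_mod_cast hMNX
  calc _ ≤ _ := key
    _ ≤ ((M:ℝ) * N) ^ 2 * ((18 + 4 * (5 * G) ^ G * (8 + 1152 * G ^ 2 + 4608 * G)) / L ^ 13) := by
        exact mul_le_mul_of_nonneg_left hnum (by positivity)
    _ ≤ (X:ℝ) ^ 2 * (1 / (136 ^ 2 * L ^ 12)) := by
        refine mul_le_mul (by gcongr) ?_ (by positivity) (by positivity)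
        rw [div_le_div_iff₀ (by positivity) (by positivity)]
        calc _ = ((18 + 4 * (5 * (G:ℝ)) ^ G * (8 + 1152 * G ^ 2 + 4608 * G)) * 136 ^ 2) * L ^ 12 := by ring
          _ ≤ L * L ^ 12 := by gcongr
          _ = _ := by ring
    _ = _ := by rw [div_pow, mul_pow, ← pow_mul]; ring

end DS

namespace DS
open Finset ArithmeticFunction Filter

lemma polylog (C : ℝ) (n : ℕ) {δ : ℝ} (hδ : 0 < δ) : ∀ᶠ X : ℕ in atTop, C * Real.log X ^ n ≤ (X:ℝ) ^ δ := by
  have h := (isLittleO_log_rpow_rpow_atTop (n:ℝ) hδ).const_mul_left C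
  have h2 := h.bound (c := 1) one_pos
  have h3 := tendsto_natCast_atTop_atTop (R := ℝ) |>.eventually h2
  filter_upwards [h3, eventually_ge_atTop 1] with X hX h1
  rw [one_mul, Real.norm_eq_abs, Real.norm_eq_abs, Real.rpow_natCast] at hX
  rw [abs_of_nonneg (a := (X:ℝ) ^ δ) (by positivity)] at hX
  exact (le_abs_self _).trans hX

lemma log_large (C : ℝ) : ∀ᶠ X : ℕ in atTop, C ≤ Real.log X :=
  (Real.tendsto_log_atTop.comp tendsto_natCast_atTop_atTop).eventually (eventually_ge_atTop C)

lemma U_exists (X : ℕ) (hX : 1 ≤ X) : ∃ U : ℕ, 1 ≤ U ∧ U ^ 12 ≤ X ∧ X ≤ (2 * U) ^ 12 ∧ (X:ℝ) ^ ((1:ℝ)/12) ≤ 2 * U := by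
  have hX' : (1:ℝ) ≤ X := by exact_mod_cast hX
  set z := (X:ℝ) ^ ((1:ℝ)/12) with hz
  have hz1 : 1 ≤ z := Real.one_le_rpow hX' (by norm_num)
  have hz12 : z ^ 12 = X := by
    rw [hz, ← Real.rpow_natCast, ← Real.rpow_mul (by positivity)]; norm_num
  have hU : 1 ≤ ⌊z⌋₊ := Nat.one_le_floor_iff _ |>.mpr hz1
  have hle : (⌊z⌋₊:ℝ) ≤ z := Nat.floor_le (by linarith)
  have hge : z ≤ 2 * (⌊z⌋₊:ℝ) := by
    have := (Nat.lt_floor_add_one z).le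
    have h1 : (1:ℝ) ≤ ⌊z⌋₊ := by exact_mod_cast hU
    linarith
  refine ⟨⌊z⌋₊, hU, ?_, ?_, hge⟩
  · have : ((⌊z⌋₊:ℝ)) ^ 12 ≤ X := by rw [← hz12]; gcongr
    exact_mod_cast this
  · have : (X:ℝ) ≤ (2 * (⌊z⌋₊:ℝ)) ^ 12 := by rw [← hz12]; gcongr
    exact_mod_cast this

lemma tI_num {G : ℝ} {X U L Gl GJ ε lV : ℝ} (hG : 2 ≤ G) (hL : 1 ≤ L) (hU : 8 ≤ U) (hUX : U ^ 12 ≤ X) (hGl : Gl ≤ G * U ^ 4) (hGl0 : 1 ≤ Gl)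
    (hGJ : GJ ≤ G * (2 * X)) (hε0 : 0 ≤ ε) (hε : ε ≤ 1 / L ^ 5) (hlV : lV ≤ L) (hlV0 : 0 ≤ lV) (hb1 : 48 * G ^ 2 * L ^ 2 ≤ U) (hb2 : 3072 * G ≤ L) :
    U * L + 3 * L * (U * U * (2 + 2 * Gl ^ 2) + 2 * GJ * ε * (4 * (1 + lV) ^ 2)) ≤ X / L / 4 := by
  have hX0 : 0 < X := lt_of_lt_of_le (by positivity) hUX
  have h1 : U * L ≤ X / L / 16 := by
    rw [div_div, le_div_iff₀ (by positivity)]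
    calc U * L * (L * 16) = (16 * L ^ 2) * U := by ring
      _ ≤ (48 * G ^ 2 * L ^ 2) * U := by
        gcongr
        nlinarith
      _ ≤ U * U := by gcongr
      _ = U ^ 2 := by ring
      _ ≤ U ^ 12 := by gcongr <;> [linarith; norm_num]
      _ ≤ X := hUX
  have h2 : 3 * L * (U * U * (2 + 2 * Gl ^ 2)) ≤ X / L / 8 := by
    rw [div_div, le_div_iff₀ (by positivity)]
    have q1 : Gl ^ 2 ≤ (G * U ^ 4) ^ 2 := by gcongr
    have q2 : 1 ≤ Gl ^ 2 := one_le_pow₀ hGl0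
    have q3 : 2 + 2 * Gl ^ 2 ≤ 4 * (G * U ^ 4) ^ 2 := by linarith
    calc 3 * L * (U * U * (2 + 2 * Gl ^ 2)) * (L * 8) ≤ 3 * L * (U * U * (4 * (G * U ^ 4) ^ 2)) * (L * 8) := by
          gcongr
      _ = (96 * G ^ 2 * L ^ 2) * U ^ 10 := by ring
      _ ≤ (2 * U) * U ^ 10 := mul_le_mul_of_nonneg_right (by linarith) (by positivity)
      _ ≤ (U * U) * U ^ 10 := by gcongr; linarith
      _ = U ^ 12 := by ring
      _ ≤ X := hUX
  have h3 : 3 * L * (2 * GJ * ε * (4 * (1 + lV) ^ 2)) ≤ X / L / 16 := by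
    rw [div_div, le_div_iff₀ (by positivity)]
    by_cases hGJ0 : 0 ≤ GJ
    · calc 3 * L * (2 * GJ * ε * (4 * (1 + lV) ^ 2)) * (L * 16) ≤ 3 * L * (2 * (G * (2 * X)) * (1 / L ^ 5) * (4 * (2 * L) ^ 2)) * (L * 16) := by
            gcongr; linarith
        _ = (3072 * G) * (X / L) := by field_simp; ring
        _ ≤ L * (X / L) := by gcongr
        _ = X := by field_simp
    · push Not at hGJ0
      refine le_trans ?_ hX0.le
      have : 0 ≤ 3 * L * (2 * (-GJ) * ε * (4 * (1 + lV) ^ 2)) * (L * 16) := by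
        have : 0 ≤ -GJ := by linarith
        positivity
      linarith
  linarith

theorem minor_abs (G : ℕ) (hG : 2 ≤ G) (η : ℝ) (hη0 : 0 < η) (hη : η ≤ 1) : ∃ b X0 : ℕ, ∀ X : ℕ, X0 ≤ X → ∀ f : ℕ → ℂ, GM G f → SG G f η →
    (∀ k, X ≤ (G ^ k) ^ 16 → ∀ θ, FA G f k θ ≤ 1 / Real.log X ^ b) →
    ‖∑ n ∈ Icc 1 X, (vonMangoldt n : ℂ) * f n‖ ≤ X / Real.log X := by
  obtain ⟨a, ha⟩ := exists_nat_ge (((G:ℝ) + 13) / η)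
  rw [div_le_iff₀ hη0] at ha
  set b := G + 3 * a + 53 with hb
  have ev := (((log_large ((18 + 4 * (5 * G) ^ G * (8 + 1152 * G ^ 2 + 4608 * G)) * 136 ^ 2)).and (log_large (3072 * G))).and
    ((polylog 2 (G + 66) (show 0 < η / 12 by positivity)).and (polylog 8 (a + 26) (show (0:ℝ) < 1 / 12 by norm_num)))).and
    (((polylog (G * 4) 26 one_pos).and (polylog (96 * G ^ 2) 2 (show (0:ℝ) < 1 / 12 by norm_num))).and
    (((polylog 16 0 (show (0:ℝ) < 1 / 12 by norm_num)).and (eventually_ge_atTop 1)).and (polylog 16 2 (show (0:ℝ) < 1 / 12 by norm_num))))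
  obtain ⟨X0, hX0⟩ := eventually_atTop.mp ev
  refine ⟨b, X0, fun X hXX f hf hs hFA => ?_⟩
  obtain ⟨⟨⟨e1, e2⟩, e3, e4⟩, ⟨e5, e6⟩, ⟨e7, e8⟩, e9⟩ := hX0 X hXX
  obtain ⟨U, hU1, hU12, hUX, hUr⟩ := U_exists X e8
  have hX1 : (1:ℝ) ≤ X := by exact_mod_cast e8
  set L := Real.log X with hL
  have hG' : (2:ℝ) ≤ G := by exact_mod_cast hG
  have hL1 : 1 ≤ L := by linarith
  have hU8 : (8:ℝ) ≤ U := by rw [pow_zero] at e7; linarith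
  have hU8' : 8 ≤ U := by exact_mod_cast hU8
  rw [Real.rpow_one] at e5
  have hM : L ^ (G + 66) ≤ (U:ℝ) ^ η := by
    have h1 : (X:ℝ) ^ (η / 12) ≤ (2 * (U:ℝ)) ^ η := by
      calc (X:ℝ) ^ (η / 12) = ((X:ℝ) ^ ((1:ℝ) / 12)) ^ η := by rw [← Real.rpow_mul (by positivity)]; congr 1; ring
        _ ≤ _ := Real.rpow_le_rpow (by positivity) hUr hη0.le
    rw [Real.mul_rpow (by norm_num) (by positivity)] at h1
    have h2 : (2:ℝ) ^ η ≤ 2 := by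
      calc (2:ℝ) ^ η ≤ 2 ^ (1:ℝ) := Real.rpow_le_rpow_of_exponent_le (by norm_num) hη
        _ = 2 := by norm_num
    have h3 : (2:ℝ) ^ η * (U:ℝ) ^ η ≤ 2 * (U:ℝ) ^ η := by gcongr
    linarith
  have hM2 : 4 * L ^ (a + 26) ≤ U := by linarith
  have hII : ∀ M N, U ≤ M → U ≤ N → M * N ≤ X → ∀ u v : ℕ → ℂ, (∀ n, ‖u n‖ ≤ 1) →
      (∀ n, ‖v n‖ ≤ 1) → ‖∑ m ∈ Icc 1 M, ∑ n ∈ Icc 1 N, u m * v n * f (m * n)‖ ≤ X / (136 * L ^ 6) := by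
    intro M N hUM hUN hMN u v hu hv
    rcases le_total M N with h | h
    · exact tII_apply hG hf hη0 hη hs ha (by omega) hL hL1 e1 hU8' hUX hM hM2 (by linarith) hFA hUM h hMN u v hu hv
    · have := tII_apply hG hf hη0 hη hs ha (by omega) hL hL1 e1 hU8' hUX hM hM2 (by linarith) hFA hUN h (by rwa [mul_comm]) v u hv hu
      rw [Finset.sum_comm]
      convert this using 5 with n _ m _
      · ring
      · rw [mul_comm]
  set l := Nat.clog G (U ^ 4) with hl
  set J := Nat.clog G (X + 1) with hJ
  have hUl : U ^ 4 ≤ G ^ l := Nat.le_pow_clog (by omega) _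
  have hclog : ∀ y, 1 < y → G ^ (Nat.clog G y) ≤ G * y := by
    intro y hy
    have h := Nat.pow_pred_clog_lt_self (by omega : 1 < G) hy
    have hkpos : 0 < Nat.clog G y := Nat.clog_pos (by omega) hy
    have e : G ^ Nat.clog G y = G * G ^ (Nat.clog G y - 1) := by rw [← pow_succ']; congr 1; omega
    rw [e]
    exact Nat.mul_le_mul_left _ h.le
  have hGl : (G:ℝ) ^ l ≤ G * (U:ℝ) ^ 4 := by exact_mod_cast hclog (U ^ 4) (Nat.one_lt_pow (by norm_num) (by omega))
  have hGJ : (G:ℝ) ^ J ≤ G * (2 * X) := by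
    have : G ^ J ≤ G * (2 * X) := (hclog (X + 1) (by omega)).trans (Nat.mul_le_mul_left _ (by omega))
    exact_mod_cast this
  have hXl : X ≤ (G ^ l) ^ 16 := by
    calc X ≤ (2 * U) ^ 12 := hUX
      _ = 8 ^ 4 * U ^ 12 := by ring
      _ ≤ U ^ 4 * U ^ 12 := by gcongr
      _ = (U ^ 1) ^ 16 := by ring
      _ ≤ (U ^ 4) ^ 16 := by gcongr <;> omega
      _ ≤ _ := by gcongr
  have hε0 : 0 ≤ 1 / L ^ b := by positivity
  have hUU : U * U ≤ X := by
    calc U * U = U ^ 2 := by ring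
      _ ≤ U ^ 12 := Nat.pow_le_pow_right (by omega) (by norm_num)
      _ ≤ X := hU12
  have hS := typeI_sum hf J l (U * U) (by nlinarith) (by calc (U * U) ^ 2 = U ^ 4 := by ring
                                                            _ ≤ _ := hUl) hε0
  have key := vaughan_bound f (fun n => (hf.1 n).le) X U (by omega) hUU _ _ (X / (136 * L ^ 6)) (16 * L ^ 3) (by positivity) (by
      have := one_le_pow₀ hL1 (n := 3); linarith)
      (fun m hm y hy => typeI_one hG hf J l X (Nat.le_pow_clog (by omega) _) (hFA l hXl) m (by have := (mem_Icc.mp hm).1; omega) y hy) hS hII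
  refine key.trans ?_
  have hlV : Real.log ((U * U : ℕ):ℝ) ≤ L := Real.log_le_log (by positivity) (by exact_mod_cast hUU)
  have n1 := tI_num (G := G) (X := X) (U := U) (L := L) (Gl := (G:ℝ) ^ l) (GJ := (G:ℝ) ^ J) (ε := 1 / L ^ b) (lV := Real.log ((U * U : ℕ):ℝ)) hG' hL1 hU8 (by exact_mod_cast hU12) hGl
    (one_le_pow₀ (by linarith)) hGJ hε0 (by gcongr; omega) hlV (Real.log_natCast_nonneg _) (by linarith) e2
  have n2 : L * ((16 * L ^ 3 * L + 1) * (X / (136 * L ^ 6)) + X * (1 + L) / (16 * L ^ 3) + X / U) ≤ X / L * (3 / 4) := by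
    have hL4 := one_le_pow₀ hL1 (n := 4)
    have k1 : (16 * L ^ 3 * L + 1) * (X / (136 * L ^ 6)) ≤ (17 * L ^ 4) * (X / (136 * L ^ 6)) := by
      gcongr; linarith
    have k2 : X * (1 + L) / (16 * L ^ 3) ≤ X * (2 * L) / (16 * L ^ 3) := by gcongr; linarith
    have k3 : (X:ℝ) / U ≤ X / (8 * L ^ 2) := by gcongr; linarith
    calc _ ≤ L * ((17 * L ^ 4) * (X / (136 * L ^ 6)) + X * (2 * L) / (16 * L ^ 3) + X / (8 * L ^ 2)) := by gcongr
      _ = X / L * (3 / 8) := by field_simp; ring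
      _ ≤ _ := by gcongr; norm_num
  have e10 : ((U * U : ℕ):ℝ) = (U:ℝ) * U := by push_cast; ring
  have e11 : (G:ℝ) ^ (2 * l) = ((G:ℝ) ^ l) ^ 2 := by rw [← pow_mul, mul_comm]
  rw [e10] at n1 ⊢
  rw [e11]
  linarith

end DS

namespace DS
open Finset ArithmeticFunction Filter

lemma data_exists (g : ℕ) (hg : 2 ≤ g) : ∃ (G : ℕ) (η c1 : ℝ), 2 ≤ G ∧ 0 < η ∧ η ≤ 1 ∧ 0 < c1 ∧ ∀ α, GM G (fd g α) ∧ SG G (fd g α) η ∧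
    ∀ k θ, FA G (fd g α) k θ ≤ Real.exp (-(c1 * ((k:ℝ) - 1) * nn ((g - 1) * α) ^ 2)) := by
  have hg0 : (0:ℝ) < g := by exact_mod_cast (by omega : 0 < g)
  have hc : 0 < 2 / ((g:ℝ) * (g ^ 2 + 1)) := by positivity
  rcases Nat.lt_or_ge 2 g with h | h
  · obtain ⟨η, h0, h1, h2⟩ := SG_ge3 h
    refine ⟨g, η, _, hg, h0, h1, hc, fun α => ⟨fd_GM hg α, h2 α, fun k θ => ?_⟩⟩
    refine (FA_sup hg α k θ).trans (le_of_eq ?_)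
    congr 1; ring
  · obtain rfl : g = 2 := by omega
    obtain ⟨η, h0, h1, h2⟩ := SG_two
    refine ⟨4, η, _, by norm_num, h0, h1, hc, fun α => ⟨fd_two_GM α, h2 α, fun k θ => ?_⟩⟩
    have e : FA 4 (fd 2 α) k θ = FA 2 (fd 2 α) (2 * k) θ := by
      unfold FA; rw [pow_mul]; norm_num
    rw [e]
    refine (FA_sup hg α (2 * k) θ).trans ?_
    apply Real.exp_le_exp.mpr
    push_cast
    have : 0 ≤ (k:ℝ) * nn (((2:ℝ) - 1) * α) ^ 2 := by positivity
    norm_num at this ⊢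
    nlinarith

theorem minor_fd (g : ℕ) (hg : 2 ≤ g) : ∃ (C0 : ℝ) (X0 : ℕ), 1 ≤ C0 ∧ ∀ X : ℕ, X0 ≤ X → ∀ α : ℝ,
    C0 * Real.log (Real.log X) ≤ nn ((g - 1) * α) ^ 2 * Real.log X →
    ‖∑ n ∈ Icc 1 X, (vonMangoldt n : ℂ) * fd g α n‖ ≤ X / Real.log X := by
  obtain ⟨G, η, c1, hG, h0, h1, hc, H⟩ := data_exists g hg
  obtain ⟨b, X0, hm⟩ := minor_abs G hG η h0 h1
  have hlG : 0 < Real.log G := Real.log_pos (by exact_mod_cast hG)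
  have ev := (log_large (32 * Real.log G)).and ((log_large 1).and (eventually_ge_atTop X0))
  obtain ⟨X1, hX1⟩ := eventually_atTop.mp ev
  refine ⟨32 * b * Real.log G / c1 + 1, X1, by linarith [show 0 ≤ 32 * b * Real.log G / c1 by positivity], fun X hX α hα => ?_⟩
  obtain ⟨e1, e2, e3⟩ := hX1 X hX
  obtain ⟨f1, f2, f3⟩ := H α
  refine hm X e3 _ f1 f2 (fun k hk θ => (f3 k θ).trans ?_)
  set L := Real.log X with hL
  have hLk : L ≤ 16 * (k * Real.log G) := by
    have hXpos : (0:ℝ) < X := by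
      rcases Nat.eq_zero_or_pos X with h | h
      · simp [hL, h] at e2; linarith
      · exact_mod_cast h
    have : (X:ℝ) ≤ ((G:ℝ) ^ k) ^ 16 := by exact_mod_cast hk
    calc L ≤ Real.log (((G:ℝ) ^ k) ^ 16) := Real.log_le_log hXpos this
      _ = _ := by rw [Real.log_pow, Real.log_pow]; norm_num
  have hk1 : L / (32 * Real.log G) ≤ (k:ℝ) - 1 := by
    rw [div_le_iff₀ (by positivity)]
    nlinarith
  have hLL : 0 ≤ Real.log L := Real.log_nonneg e2
  have hL0 : 0 < L := by linarith
  rw [one_div, ← Real.exp_log (show 0 < L ^ b by positivity), ← Real.exp_neg, Real.log_pow]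
  apply Real.exp_le_exp.mpr
  apply neg_le_neg
  set ν := nn ((g - 1) * α) ^ 2 with hν
  have hν0 : 0 ≤ ν := sq_nonneg _
  have h5 : 32 * b * Real.log G / c1 * Real.log L ≤ ν * L := by nlinarith
  calc (b:ℝ) * Real.log L = c1 / (32 * Real.log G) * (32 * b * Real.log G / c1 * Real.log L) := by field_simp
    _ ≤ c1 / (32 * Real.log G) * (ν * L) := by gcongr
    _ = c1 * (L / (32 * Real.log G)) * ν := by field_simp
    _ ≤ _ := by gcongr

end DS

namespace DS
open Finset ArithmeticFunction Filter

lemma abel_le (c : ℕ → ℂ) (w : ℕ → ℝ) (K : ℝ) (A B : ℕ) (hAB : A ≤ B) (hw0 : ∀ n, A ≤ n → 0 ≤ w n) (hw : ∀ n, A ≤ n → w (n+1) ≤ w n)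
    (hK : ∀ z, A ≤ z → ‖∑ n ∈ Ico A z, c n‖ ≤ K) : ‖∑ n ∈ Ico A B, c n * (w n : ℂ)‖ ≤ K * w A := by
  have h1 : ∀ z, A ≤ z → ∑ n ∈ Ico A z, c n * (w n : ℂ) = (∑ n ∈ Ico A z, c n) * (w z : ℂ) + ∑ n ∈ Ico A z, (∑ m ∈ Ico A (n+1), c m) * ((w n - w (n+1) : ℝ) : ℂ) := by
    intro z hz
    induction z, hz using Nat.le_induction with
    | base => simp
    | succ z hz ih =>
      rw [Finset.sum_Ico_succ_top hz, Finset.sum_Ico_succ_top hz (fun n => (∑ m ∈ Ico A (n+1), c m) * ((w n - w (n+1) : ℝ) : ℂ)), ih, Finset.sum_Ico_succ_top hz c]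
      push_cast; ring
  have h2 : ∀ z, A ≤ z → ∑ n ∈ Ico A z, (w n - w (n+1)) = w A - w z := by
    intro z hz
    induction z, hz using Nat.le_induction with
    | base => simp
    | succ z hz ih => rw [Finset.sum_Ico_succ_top hz, ih]; ring
  rw [h1 B hAB]
  refine (norm_add_le _ _).trans ?_
  have h3 : ‖(∑ n ∈ Ico A B, c n) * (w B : ℂ)‖ ≤ K * w B := by
    rw [norm_mul, Complex.norm_real, Real.norm_of_nonneg (hw0 B hAB)]
    exact mul_le_mul_of_nonneg_right (hK B hAB) (hw0 B hAB)
  have h4 : ‖∑ n ∈ Ico A B, (∑ m ∈ Ico A (n+1), c m) * ((w n - w (n+1) : ℝ) : ℂ)‖ ≤ ∑ n ∈ Ico A B, K * (w n - w (n+1)) := by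
    refine norm_sum_le_of_le _ fun n hn => ?_
    have hn' := (mem_Ico.mp hn).1
    have hd : 0 ≤ w n - w (n+1) := by linarith [hw n hn']
    rw [norm_mul, Complex.norm_real, Real.norm_of_nonneg hd]
    exact mul_le_mul_of_nonneg_right (hK _ (by omega)) hd
  rw [← Finset.mul_sum, h2 B hAB] at h4
  linarith

variable {q : ℕ} [NeZero q]

lemma chi_range (χ : DirichletCharacter ℂ q) (hχ : χ ≠ 1) (B : ℕ) : ‖∑ n ∈ range B, χ (n : ZMod q)‖ ≤ q := by
  have hq : 0 < q := Nat.pos_of_ne_zero (NeZero.ne q)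
  have hz : ∑ w ∈ range q, χ (w : ZMod q) = 0 := by
    rw [← MulChar.sum_eq_zero_of_ne_one hχ]
    refine Finset.sum_bij' (fun n _ => (n : ZMod q)) (fun a _ => a.val) ?_ ?_ ?_ ?_ ?_
    · intros; simp
    · intro a _; exact mem_range.mpr (ZMod.val_lt a)
    · intro n hn; exact ZMod.val_natCast_of_lt (mem_range.mp hn)
    · intro a _; exact ZMod.natCast_rightInverse a
    · intros; rfl
  rw [← Nat.div_add_mod B q, Finset.sum_range_add, sum_range_mul_split]
  have : ∀ v ∈ range (B / q), ∑ w ∈ range q, χ ((w + q * v : ℕ) : ZMod q) = 0 := by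
    intro v _; rw [← hz]; refine Finset.sum_congr rfl fun w _ => ?_; congr 1; simp
  rw [Finset.sum_eq_zero this, zero_add]
  refine (norm_sum_le_of_le _ (n := fun _ => (1:ℝ)) fun n _ => DirichletCharacter.norm_le_one χ _).trans ?_
  simp only [sum_const, card_range, nsmul_eq_mul, mul_one]
  exact_mod_cast (Nat.mod_lt B hq).le

lemma chi_Ico (χ : DirichletCharacter ℂ q) (hχ : χ ≠ 1) (A B : ℕ) (h : A ≤ B) : ‖∑ n ∈ Ico A B, χ (n : ZMod q)‖ ≤ 2 * q := by
  rw [Finset.sum_Ico_eq_sub _ h]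
  refine (norm_sub_le _ _).trans ?_
  have h1 := chi_range χ hχ A
  have h2 := chi_range χ hχ B
  linarith

lemma L1_tail (χ : DirichletCharacter ℂ q) (hχ : χ ≠ 1) (M : ℕ) :
    ‖DirichletCharacter.LFunction χ 1 - ∑ m ∈ Icc 1 M, χ (m : ZMod q) * ((1 / (m:ℝ) : ℝ) : ℂ)‖ ≤ 2 * q / (M + 1) := by
  have hs : ∀ s : ℝ, 1 < s → ‖DirichletCharacter.LFunction χ s - ∑ m ∈ Icc 1 M, χ (m : ZMod q) * (((m:ℝ) ^ (-s) : ℝ) : ℂ)‖ ≤ 2 * q / (M + 1) := by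
    intro s hs
    have hs' : 1 < (s:ℂ).re := by simpa using hs
    rw [DirichletCharacter.LFunction_eq_LSeries χ hs']
    have hsum := DirichletCharacter.LSeriesSummable_of_one_lt_re χ hs'
    have ht := (hsum.hasSum.tendsto_sum_nat).sub_const (∑ m ∈ Icc 1 M, χ (m : ZMod q) * (((m:ℝ) ^ (-s) : ℝ) : ℂ))
    refine le_of_tendsto ht.norm ?_
    filter_upwards [eventually_ge_atTop (M+1)] with N hN
    have hterm : ∀ n : ℕ, 1 ≤ n → LSeries.term (fun n => χ (n : ZMod q)) s n = χ (n : ZMod q) * (((n:ℝ) ^ (-s) : ℝ) : ℂ) := by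
      intro n hn
      rw [LSeries.term_of_ne_zero (by omega), Complex.ofReal_cpow (by positivity), div_eq_mul_inv]
      push_cast
      rw [Complex.cpow_neg]
    have e : ∑ i ∈ range N, LSeries.term (fun n => χ (n : ZMod q)) s i - ∑ m ∈ Icc 1 M, χ (m : ZMod q) * (((m:ℝ) ^ (-s) : ℝ) : ℂ) =
        ∑ n ∈ Ico (M+1) N, χ (n : ZMod q) * (((n:ℝ) ^ (-s) : ℝ) : ℂ) := by
      have e1 : Icc 1 M = Ico 1 (M+1) := by ext; simp
      have e2 : ∑ i ∈ range N, LSeries.term (fun n => χ (n : ZMod q)) s i = ∑ i ∈ Ico 1 N, χ (i : ZMod q) * (((i:ℝ) ^ (-s) : ℝ) : ℂ) := by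
        rw [Finset.range_eq_Ico, Finset.sum_eq_sum_Ico_succ_bot (by omega)]
        simp only [LSeries.term_zero, zero_add]
        exact Finset.sum_congr rfl fun n hn => hterm n (mem_Ico.mp hn).1
      rw [e2, e1, ← Finset.sum_Ico_consecutive _ (by omega : 1 ≤ M+1) hN]; ring
    rw [e]
    have := abel_le (fun n => χ (n : ZMod q)) (fun n => (n:ℝ) ^ (-s)) (2 * q) (M+1) N hN (fun n _ => by positivity)
      (fun n hn => by
        apply Real.rpow_le_rpow_of_nonpos
        · exact_mod_cast (by omega : 0 < n)
        · push_cast; linarith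
        · linarith)
      (fun z hz => chi_Ico χ hχ _ _ hz)
    refine this.trans ?_
    rw [div_eq_mul_inv]
    gcongr
    beta_reduce
    rw [← Real.rpow_neg_one]
    push_cast
    exact Real.rpow_le_rpow_of_exponent_le (by have : (0:ℝ) ≤ M := by positivity
                                               linarith) (by linarith)
  have hcont : Tendsto (fun s : ℝ => DirichletCharacter.LFunction χ s - ∑ m ∈ Icc 1 M, χ (m : ZMod q) * (((m:ℝ) ^ (-s) : ℝ) : ℂ)) (nhdsWithin 1 (Set.Ioi 1))
      (nhds (DirichletCharacter.LFunction χ 1 - ∑ m ∈ Icc 1 M, χ (m : ZMod q) * ((1 / (m:ℝ) : ℝ) : ℂ))) := by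
    have hc : ContinuousAt (fun s : ℝ => DirichletCharacter.LFunction χ s - ∑ m ∈ Icc 1 M, χ (m : ZMod q) * (((m:ℝ) ^ (-s) : ℝ) : ℂ)) 1 := by
      apply ContinuousAt.sub
      · exact ((DirichletCharacter.differentiable_LFunction hχ).continuous.comp Complex.continuous_ofReal).continuousAt
      · apply tendsto_finsetSum
        intro m hm
        have hm' : (0:ℝ) < m := by exact_mod_cast (mem_Icc.mp hm).1
        apply ContinuousAt.mul continuousAt_const
        apply Complex.continuous_ofReal.continuousAt.comp
        exact (Real.continuousAt_const_rpow hm'.ne').comp continuous_neg.continuousAt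
    have := hc.tendsto.mono_left (nhdsWithin_le_nhds (s := Set.Ioi 1))
    convert this using 2
    simp only [Complex.ofReal_one]
    congr 1
    refine Finset.sum_congr rfl fun m _ => ?_
    rw [Real.rpow_neg_one, one_div]
  refine le_of_tendsto hcont.norm ?_
  filter_upwards [self_mem_nhdsWithin] with s h
  exact hs s h

end DS

namespace DS
open Finset ArithmeticFunction Filter

lemma psi_nat_le (X : ℕ) : ∑ n ∈ Icc 1 X, vonMangoldt n ≤ 6 * X := by
  have h := Chebyshev.psi_le_const_mul_self (x := X) (by positivity)
  rw [Chebyshev.psi, Nat.floor_natCast] at h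
  have e : Ioc 0 X = Icc 1 X := by ext; simp; omega
  rw [e] at h
  refine h.trans ?_
  have h4 : Real.log 4 ≤ 2 := by
    rw [show (4:ℝ) = 2 ^ 2 by norm_num, Real.log_pow]
    have := Real.log_two_lt_d9; push_cast; linarith
  gcongr; linarith

lemma log_sum_conv (X : ℕ) (f : ℕ → ℂ) : ∑ n ∈ Icc 1 X, (Real.log n : ℂ) * f n = ∑ d ∈ Icc 1 X, ∑ e ∈ Icc 1 (X / d), (vonMangoldt d : ℂ) * f (d * e) := by
  have h := sum_mul_conv vonMangoldt zeR X f
  have e : vonMangoldt * zeR = ArithmeticFunction.log := vonMangoldt_mul_zeta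
  rw [e] at h
  simp only [log_apply] at h
  rw [h]
  refine Finset.sum_congr rfl fun d _ => Finset.sum_congr rfl fun e he => ?_
  rw [zeR_apply (by have := (mem_Icc.mp he).1; omega)]; simp

lemma log_sum_bounds (X : ℕ) (hX : 1 ≤ X) : X * Real.log X - X ≤ ∑ n ∈ Icc 1 X, Real.log n ∧ ∑ n ∈ Icc 1 X, Real.log n ≤ X * Real.log X := by
  constructor
  · induction X, hX using Nat.le_induction with
    | base => simp
    | succ n hn ih =>
      rw [Finset.sum_Icc_succ_top (by omega)]
      have hn0 : (0:ℝ) < n := by exact_mod_cast hn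
      have h : Real.log ((n+1:ℕ):ℝ) - Real.log n ≤ 1 / n := by
        rw [← Real.log_div (by positivity) (by positivity)]
        refine (Real.log_le_sub_one_of_pos (by positivity)).trans (le_of_eq ?_)
        push_cast; field_simp; ring
      have h2 : (n:ℝ) * (Real.log ((n+1:ℕ):ℝ) - Real.log n) ≤ 1 := by
        calc _ ≤ (n:ℝ) * (1 / n) := by gcongr
          _ = 1 := by field_simp
      push_cast at *
      nlinarith
  · calc _ ≤ ∑ n ∈ Icc 1 X, Real.log X := Finset.sum_le_sum fun n hn => by
          have := mem_Icc.mp hn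
          exact Real.log_le_log (by exact_mod_cast this.1) (by exact_mod_cast this.2)
      _ = _ := by simp

lemma mertens (X : ℕ) (hX : 1 ≤ X) : |∑ n ∈ Icc 1 X, vonMangoldt n / n - Real.log X| ≤ 6 := by
  have hX0 : (0:ℝ) < X := by exact_mod_cast hX
  have h := log_sum_conv X (fun _ => 1)
  have h' : ∑ n ∈ Icc 1 X, Real.log n = ∑ d ∈ Icc 1 X, vonMangoldt d * ((X / d : ℕ):ℝ) := by
    have : ((∑ n ∈ Icc 1 X, Real.log n : ℝ):ℂ) = ((∑ d ∈ Icc 1 X, vonMangoldt d * ((X / d : ℕ):ℝ) : ℝ) : ℂ) := by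
      simp only [mul_one, sum_const, Nat.card_Icc, nsmul_eq_mul, Nat.add_sub_cancel] at h
      rw [Complex.ofReal_sum, h, Complex.ofReal_sum]
      refine Finset.sum_congr rfl fun d _ => ?_
      rw [Complex.ofReal_mul, mul_comm]; simp
    exact_mod_cast this
  obtain ⟨b1, b2⟩ := log_sum_bounds X hX
  have hp := psi_nat_le X
  have u1 : ∑ d ∈ Icc 1 X, vonMangoldt d * ((X / d : ℕ):ℝ) ≤ X * ∑ n ∈ Icc 1 X, vonMangoldt n / n := by
    rw [Finset.mul_sum]
    refine Finset.sum_le_sum fun d _ => ?_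
    calc vonMangoldt d * ((X / d : ℕ):ℝ) ≤ vonMangoldt d * ((X:ℝ) / d) := mul_le_mul_of_nonneg_left Nat.cast_div_le vonMangoldt_nonneg
      _ = _ := by ring
  have u2 : X * ∑ n ∈ Icc 1 X, vonMangoldt n / n - ∑ n ∈ Icc 1 X, vonMangoldt n ≤ ∑ d ∈ Icc 1 X, vonMangoldt d * ((X / d : ℕ):ℝ) := by
    rw [Finset.mul_sum, ← Finset.sum_sub_distrib]
    refine Finset.sum_le_sum fun d hd => ?_
    have hd0 : 0 < d := (mem_Icc.mp hd).1
    have : (X:ℝ) / d ≤ ((X / d : ℕ):ℝ) + 1 := by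
      rw [div_le_iff₀ (by exact_mod_cast hd0)]
      have := Nat.lt_div_mul_add (a := X) hd0
      have h3 : X ≤ (X / d + 1) * d := by rw [Nat.add_mul]; omega
      exact_mod_cast h3
    calc _ = vonMangoldt d * ((X:ℝ) / d - 1) := by ring
      _ ≤ _ := mul_le_mul_of_nonneg_left (by linarith) vonMangoldt_nonneg
  rw [abs_le]
  constructor <;> nlinarith

variable {q : ℕ} [NeZero q]

lemma chi_log (χ : DirichletCharacter ℂ q) (hχ : χ ≠ 1) (X : ℕ) :
    ‖∑ n ∈ Icc 1 X, (Real.log n : ℂ) * (χ (n : ZMod q) * ((1 / (n:ℝ) : ℝ) : ℂ))‖ ≤ 2 + 2 * q := by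
  have e : ∑ n ∈ Icc 1 X, (Real.log n : ℂ) * (χ (n : ZMod q) * ((1 / (n:ℝ) : ℝ) : ℂ)) = ∑ n ∈ Ico 1 (X+1), χ (n : ZMod q) * ((Real.log n / n : ℝ) : ℂ) := by
    have e1 : Icc 1 X = Ico 1 (X+1) := by ext; simp
    rw [e1]; refine Finset.sum_congr rfl fun n _ => ?_
    push_cast; ring
  rw [e]
  have hlow : ∀ z : ℕ, z ≤ 3 → ‖∑ n ∈ Ico 1 z, χ (n : ZMod q) * ((Real.log n / n : ℝ) : ℂ)‖ ≤ 2 := by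
    intro z hz
    refine (norm_sum_le_of_le _ (n := fun _ => (1:ℝ)) fun n hn => ?_).trans ?_
    · rw [norm_mul, Complex.norm_real]
      have hn0 : (0:ℝ) < n := by exact_mod_cast (mem_Ico.mp hn).1
      have : ‖Real.log n / n‖ ≤ 1 := by
        rw [Real.norm_of_nonneg (div_nonneg (Real.log_natCast_nonneg n) hn0.le), div_le_one hn0]
        exact Real.log_le_self hn0.le
      calc _ ≤ 1 * 1 := mul_le_mul (DirichletCharacter.norm_le_one χ _) this (norm_nonneg _) (by norm_num)
        _ = 1 := by norm_num
    · simp only [sum_const, Nat.card_Ico, nsmul_eq_mul, mul_one]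
      exact_mod_cast (by omega : z - 1 ≤ 2)
  rcases Nat.lt_or_ge (X+1) 3 with h | h
  · have := hlow (X+1) h.le
    have : (0:ℝ) ≤ q := by positivity
    linarith
  · rw [← Finset.sum_Ico_consecutive _ (by norm_num : 1 ≤ 3) h]
    refine (norm_add_le _ _).trans ?_
    have h1 := hlow 3 le_rfl
    have he : Real.exp 1 ≤ 3 := by have := Real.exp_one_lt_d9; linarith
    have h2 := abel_le (fun n => χ (n : ZMod q)) (fun n => Real.log n / n) (2 * q) 3 (X+1) h
      (fun n _ => div_nonneg (Real.log_natCast_nonneg n) (by positivity))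
      (fun n hn => by
        have hn' : (3:ℝ) ≤ n := by exact_mod_cast hn
        exact Real.log_div_self_antitoneOn (Set.mem_Ici.mpr (he.trans hn')) (Set.mem_Ici.mpr (by push_cast; linarith)) (by push_cast; linarith))
      (fun z hz => chi_Ico χ hχ _ _ hz)
    have h3 : Real.log ((3:ℕ):ℝ) / ((3:ℕ):ℝ) ≤ 1 := by
      rw [div_le_one (by norm_num)]
      exact Real.log_le_self (by norm_num)
    have h4 : 2 * (q:ℝ) * (Real.log ((3:ℕ):ℝ) / ((3:ℕ):ℝ)) ≤ 2 * q * 1 := by gcongr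
    linarith

lemma chi_mertens (χ : DirichletCharacter ℂ q) (hχ : χ ≠ 1) : ∃ C : ℝ, ∀ X : ℕ, 1 ≤ X →
    ‖∑ n ∈ Icc 1 X, χ (n : ZMod q) * vonMangoldt n * ((1 / (n:ℝ) : ℝ) : ℂ)‖ ≤ C := by
  have hL := DirichletCharacter.LFunction_apply_one_ne_zero hχ
  set ℓ := DirichletCharacter.LFunction χ 1 with hℓ
  refine ⟨(2 + 14 * q) / ‖ℓ‖, fun X hX => ?_⟩
  have hX0 : (0:ℝ) < X := by exact_mod_cast hX
  rw [le_div_iff₀ (norm_pos_iff.mpr hL), ← norm_mul]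
  have h := log_sum_conv X (fun n => χ (n : ZMod q) * ((1 / (n:ℝ) : ℝ) : ℂ))
  have h1 := chi_log χ hχ X
  rw [h] at h1
  have e : (∑ n ∈ Icc 1 X, χ (n : ZMod q) * vonMangoldt n * ((1 / (n:ℝ) : ℝ) : ℂ)) * ℓ -
      ∑ d ∈ Icc 1 X, ∑ e ∈ Icc 1 (X / d), (vonMangoldt d : ℂ) * (χ ((d * e : ℕ) : ZMod q) * ((1 / ((d * e : ℕ):ℝ) : ℝ) : ℂ)) =
      ∑ d ∈ Icc 1 X, χ (d : ZMod q) * vonMangoldt d * ((1 / (d:ℝ) : ℝ) : ℂ) * (ℓ - ∑ m ∈ Icc 1 (X / d), χ (m : ZMod q) * ((1 / (m:ℝ) : ℝ) : ℂ)) := by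
    rw [Finset.sum_mul, ← Finset.sum_sub_distrib]
    refine Finset.sum_congr rfl fun d _ => ?_
    rw [mul_sub, Finset.mul_sum]
    congr 1
    refine Finset.sum_congr rfl fun m _ => ?_
    rw [Nat.cast_mul, map_mul]; push_cast
    rw [one_div, mul_inv]; ring
  have h2 : ‖∑ d ∈ Icc 1 X, χ (d : ZMod q) * vonMangoldt d * ((1 / (d:ℝ) : ℝ) : ℂ) * (ℓ - ∑ m ∈ Icc 1 (X / d), χ (m : ZMod q) * ((1 / (m:ℝ) : ℝ) : ℂ))‖ ≤
      ∑ d ∈ Icc 1 X, vonMangoldt d * (2 * q / X) := by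
    refine norm_sum_le_of_le _ fun d hd => ?_
    have hd0 : (0:ℝ) < d := by exact_mod_cast (mem_Icc.mp hd).1
    have ht := L1_tail χ hχ (X / d)
    have hXd : (X:ℝ) / d ≤ ((X / d : ℕ):ℝ) + 1 := by
      rw [div_le_iff₀ hd0]
      have := Nat.lt_div_mul_add (a := X) (mem_Icc.mp hd).1
      have h3 : X ≤ (X / d + 1) * d := by rw [Nat.add_mul]; omega
      exact_mod_cast h3
    rw [norm_mul, norm_mul, norm_mul, Complex.norm_real, Complex.norm_real, Real.norm_of_nonneg vonMangoldt_nonneg, Real.norm_of_nonneg (by positivity : 0 ≤ 1 / (d:ℝ))]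
    calc _ ≤ 1 * vonMangoldt d * (1 / (d:ℝ)) * (2 * q / ((X:ℝ) / d)) := by
          gcongr
          · exact DirichletCharacter.norm_le_one χ _
          · exact ht.trans (by gcongr)
      _ = _ := by field_simp
  have h3 : ∑ d ∈ Icc 1 X, vonMangoldt d * (2 * q / X) ≤ 12 * q := by
    rw [← Finset.sum_mul]
    calc _ ≤ 6 * (X:ℝ) * (2 * q / X) := by gcongr; exact psi_nat_le X
      _ = _ := by field_simp; ring
  rw [← e] at h2
  have h4 := norm_sub_norm_le ((∑ n ∈ Icc 1 X, χ (n : ZMod q) * vonMangoldt n * ((1 / (n:ℝ) : ℝ) : ℂ)) * ℓ) (∑ d ∈ Icc 1 X, ∑ e ∈ Icc 1 (X / d), (vonMangoldt d : ℂ) * (χ ((d * e : ℕ) : ZMod q) * ((1 / ((d * e : ℕ):ℝ) : ℝ) : ℂ)))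
  linarith

end DS

namespace DS
open Finset ArithmeticFunction Filter

lemma nonprime_bdd : ∃ B : ℝ, 0 ≤ B ∧ ∀ s : Finset ℕ, ∑ n ∈ s, (if n.Prime then 0 else vonMangoldt n) / (n:ℝ) ≤ B := by
  have h := vonMangoldt.summable_residueClass_non_primes_div (q := 1) 0
  have e : ∀ n : ℕ, (if n.Prime then 0 else vonMangoldt.residueClass (0 : ZMod 1) n) / (n:ℝ) = (if n.Prime then 0 else vonMangoldt n) / (n:ℝ) := by
    intro n
    congr 2
    rw [vonMangoldt.residueClass, Set.indicator_of_mem]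
    exact Subsingleton.elim _ _
  simp_rw [e] at h
  have h0 : ∀ n : ℕ, 0 ≤ (if n.Prime then 0 else vonMangoldt n) / (n:ℝ) := fun n => by
    split_ifs
    · simp
    · exact div_nonneg vonMangoldt_nonneg (by positivity)
  exact ⟨_, tsum_nonneg h0, fun s => h.sum_le_tsum s (fun n _ => h0 n)⟩

variable {q : ℕ} [NeZero q]

lemma principal_mertens : ∃ C : ℝ, ∀ X : ℕ, 1 ≤ X →
    ‖∑ n ∈ Icc 1 X, (1 : DirichletCharacter ℂ q) (n : ZMod q) * vonMangoldt n * ((1 / (n:ℝ) : ℝ) : ℂ) - Real.log X‖ ≤ C := by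
  obtain ⟨B, hB0, hB⟩ := nonprime_bdd
  refine ⟨6 + (B + ∑ n ∈ Icc 1 q, vonMangoldt n / (n:ℝ)), fun X hX => ?_⟩
  have hm := mertens X hX
  have hnn : ∀ n : ℕ, 0 ≤ vonMangoldt n / (n:ℝ) := fun n => div_nonneg vonMangoldt_nonneg (by positivity)
  have e : ∑ n ∈ Icc 1 X, (1 : DirichletCharacter ℂ q) (n : ZMod q) * vonMangoldt n * ((1 / (n:ℝ) : ℝ) : ℂ) - Real.log X =
      ((∑ n ∈ Icc 1 X, vonMangoldt n / n - Real.log X - ∑ n ∈ Icc 1 X, if IsUnit (n : ZMod q) then 0 else vonMangoldt n / (n:ℝ) : ℝ) : ℂ) := by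
    rw [Complex.ofReal_sub, Complex.ofReal_sub, Complex.ofReal_sum, Complex.ofReal_sum, sub_right_comm, ← Finset.sum_sub_distrib]
    congr 1
    refine Finset.sum_congr rfl fun n _ => ?_
    by_cases h : IsUnit (n : ZMod q)
    · rw [if_pos h, MulChar.one_apply h]; push_cast; ring
    · rw [if_neg h, MulChar.map_nonunit _ h]; push_cast; ring
  rw [e, Complex.norm_real, Real.norm_eq_abs]
  refine (abs_sub _ _).trans (add_le_add hm ?_)
  rw [abs_of_nonneg (Finset.sum_nonneg fun n _ => by split_ifs <;> [exact le_rfl; exact hnn n])]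
  have hle : ∀ n ∈ Icc 1 X, (if IsUnit (n : ZMod q) then 0 else vonMangoldt n / (n:ℝ)) ≤
      (if n.Prime then 0 else vonMangoldt n) / (n:ℝ) + if n ≤ q then vonMangoldt n / (n:ℝ) else 0 := by
    intro n _
    have h1 : 0 ≤ (if n.Prime then 0 else vonMangoldt n) / (n:ℝ) := by
      split_ifs <;> [simp; exact hnn n]
    have h2 : 0 ≤ if n ≤ q then vonMangoldt n / (n:ℝ) else 0 := by split_ifs <;> [exact hnn n; exact le_rfl]
    by_cases h : IsUnit (n : ZMod q)
    · rw [if_pos h]; linarith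
    · rw [if_neg h]
      by_cases hp : n.Prime
      · have : n ≤ q := by
          rw [ZMod.isUnit_iff_coprime] at h
          exact Nat.le_of_dvd (Nat.pos_of_ne_zero (NeZero.ne q)) ((Nat.Prime.dvd_iff_not_coprime hp).mpr h)
        rw [if_pos this]; linarith
      · rw [if_neg hp]; linarith
  refine (Finset.sum_le_sum hle).trans ?_
  rw [Finset.sum_add_distrib]
  refine add_le_add (hB _) ?_
  rw [← Finset.sum_filter]
  refine Finset.sum_le_sum_of_subset_of_nonneg ?_ (fun n _ _ => hnn n)
  intro n hn
  simp only [mem_filter, mem_Icc] at hn ⊢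
  omega

lemma ap_mertens {a : ZMod q} (ha : IsUnit a) : ∃ C : ℝ, 0 ≤ C ∧ ∀ X : ℕ, 1 ≤ X →
    |∑ n ∈ Icc 1 X, vonMangoldt.residueClass a n / n - Real.log X / q.totient| ≤ C := by
  classical
  have hφ : (0:ℝ) < q.totient := by exact_mod_cast Nat.totient_pos.mpr (Nat.pos_of_ne_zero (NeZero.ne q))
  have hall : ∀ χ : DirichletCharacter ℂ q, ∃ C : ℝ, ∀ X : ℕ, 1 ≤ X →
      ‖∑ n ∈ Icc 1 X, χ (n : ZMod q) * vonMangoldt n * ((1 / (n:ℝ) : ℝ) : ℂ) - if χ = 1 then (Real.log X : ℂ) else 0‖ ≤ C := by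
    intro χ
    by_cases h : χ = 1
    · subst h
      obtain ⟨C, hC⟩ := principal_mertens (q := q)
      exact ⟨C, fun X hX => by rw [if_pos rfl]; exact hC X hX⟩
    · obtain ⟨C, hC⟩ := chi_mertens χ h
      exact ⟨C, fun X hX => by rw [if_neg h, sub_zero]; exact hC X hX⟩
  choose C hC using hall
  have key : ∀ X : ℕ, 1 ≤ X → |∑ n ∈ Icc 1 X, vonMangoldt.residueClass a n / n - Real.log X / q.totient| ≤ (q.totient:ℝ)⁻¹ * ∑ χ, C χ := by
    intro X hX
    have e : ((∑ n ∈ Icc 1 X, vonMangoldt.residueClass a n / n - Real.log X / q.totient : ℝ) : ℂ) =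
        (q.totient : ℂ)⁻¹ * ∑ χ : DirichletCharacter ℂ q, χ a⁻¹ * (∑ n ∈ Icc 1 X, χ (n : ZMod q) * vonMangoldt n * ((1 / (n:ℝ) : ℝ) : ℂ) - if χ = 1 then (Real.log X : ℂ) else 0) := by
      simp_rw [mul_sub]
      rw [Finset.sum_sub_distrib, mul_sub, Complex.ofReal_sub, Complex.ofReal_sum]
      congr 1
      · simp_rw [Finset.mul_sum]
        symm
        rw [Finset.sum_comm]
        refine Finset.sum_congr rfl fun n _ => ?_
        rw [Complex.ofReal_div (vonMangoldt.residueClass a n), vonMangoldt.residueClass_apply ha n, Finset.mul_sum, Finset.sum_div]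
        refine Finset.sum_congr rfl fun χ _ => ?_
        push_cast; ring
      · simp only [mul_ite, mul_zero, Finset.sum_ite_eq', mem_univ, if_true]
        have hu : IsUnit (a⁻¹) := by
          obtain ⟨u, rfl⟩ := ha
          rw [ZMod.inv_coe_unit]; exact Units.isUnit _
        rw [MulChar.one_apply hu]
        push_cast; field_simp
    have h1 : |∑ n ∈ Icc 1 X, vonMangoldt.residueClass a n / n - Real.log X / q.totient| = ‖((∑ n ∈ Icc 1 X, vonMangoldt.residueClass a n / n - Real.log X / q.totient : ℝ) : ℂ)‖ := by
      rw [Complex.norm_real, Real.norm_eq_abs]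
    rw [h1, e, norm_mul, norm_inv, Complex.norm_natCast]
    gcongr
    refine norm_sum_le_of_le _ fun χ _ => ?_
    rw [norm_mul]
    calc _ ≤ 1 * C χ := mul_le_mul (DirichletCharacter.norm_le_one χ _) (hC χ X hX) (norm_nonneg _) (by norm_num)
      _ = _ := one_mul _
  exact ⟨_, (abs_nonneg _).trans (key 1 le_rfl), key⟩

theorem psi_ap_lower {a : ZMod q} (ha : IsUnit a) : ∃ c : ℝ, 0 < c ∧ ∃ X0 : ℕ, ∀ X : ℕ, X0 ≤ X →
    c * X ≤ ∑ n ∈ Icc 1 X, vonMangoldt.residueClass a n := by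
  obtain ⟨C, hC0, hC⟩ := ap_mertens ha
  have hφ : (0:ℝ) < q.totient := by exact_mod_cast Nat.totient_pos.mpr (Nat.pos_of_ne_zero (NeZero.ne q))
  obtain ⟨T, hT⟩ := exists_nat_ge (Real.exp ((2 * C + 1) * q.totient))
  have hT0 : (0:ℝ) < T := lt_of_lt_of_le (Real.exp_pos _) hT
  have hT0' : 0 < T := by exact_mod_cast hT0
  have hlT : (2 * C + 1) * q.totient ≤ Real.log T := (Real.le_log_iff_exp_le hT0).mpr hT
  refine ⟨1 / T, by positivity, T, fun X hX => ?_⟩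
  have hX0 : (0:ℝ) < X := by exact_mod_cast lt_of_lt_of_le hT0' hX
  set Y := X / T with hY
  have hY1 : 1 ≤ Y := (Nat.one_le_div_iff hT0').mpr hX
  have hYX : Y ≤ X := Nat.div_le_self _ _
  have hlY : Real.log Y ≤ Real.log X - Real.log T := by
    rw [← Real.log_div hX0.ne' hT0.ne']
    exact Real.log_le_log (by exact_mod_cast hY1) Nat.cast_div_le
  have h1 := abs_le.mp (hC X (by omega))
  have h2 := abs_le.mp (hC Y hY1)
  have hsplit : ∑ n ∈ Icc 1 X, vonMangoldt.residueClass a n / n = ∑ n ∈ Icc 1 Y, vonMangoldt.residueClass a n / n + ∑ n ∈ Ioc Y X, vonMangoldt.residueClass a n / n := by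
    rw [← Finset.sum_union]
    · congr 1; ext n; simp only [mem_Icc, mem_union, mem_Ioc]; omega
    · rw [Finset.disjoint_left]; intro n; simp only [mem_Icc, mem_Ioc]; omega
  have h3 : (Real.log X / q.totient - Real.log Y / q.totient) ≥ 2 * C + 1 := by
    rw [← sub_div, ge_iff_le, le_div_iff₀ hφ]; linarith
  have h4 : 1 ≤ ∑ n ∈ Ioc Y X, vonMangoldt.residueClass a n / n := by linarith
  have h5 : ∑ n ∈ Ioc Y X, vonMangoldt.residueClass a n / n ≤ ∑ n ∈ Ioc Y X, vonMangoldt.residueClass a n * (T / X) := by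
    refine Finset.sum_le_sum fun n hn => ?_
    have hn' := mem_Ioc.mp hn
    have hn0 : (0:ℝ) < n := by exact_mod_cast (by omega : 0 < n)
    rw [div_eq_mul_inv]
    refine mul_le_mul_of_nonneg_left ?_ (vonMangoldt.residueClass_nonneg a n)
    rw [inv_eq_one_div, div_le_div_iff₀ hn0 hX0, one_mul]
    have := Nat.lt_div_mul_add (a := X) hT0'
    have h6 : X ≤ T * n := by
      have : T * (Y + 1) ≤ T * n := Nat.mul_le_mul_left _ (by omega)
      have h7 : T * (Y + 1) = X / T * T + T := by rw [hY]; ring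
      omega
    exact_mod_cast h6
  have h6 : ∑ n ∈ Ioc Y X, vonMangoldt.residueClass a n ≤ ∑ n ∈ Icc 1 X, vonMangoldt.residueClass a n := by
    refine Finset.sum_le_sum_of_subset_of_nonneg ?_ (fun n _ _ => vonMangoldt.residueClass_nonneg a n)
    intro n; simp only [mem_Icc, mem_Ioc]; omega
  rw [← Finset.sum_mul] at h5
  have h7 : 1 ≤ (∑ n ∈ Icc 1 X, vonMangoldt.residueClass a n) * (T / X) := h4.trans (h5.trans (by gcongr))
  rw [mul_div_assoc', le_div_iff₀ hX0, one_mul] at h7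
  rw [one_div, inv_mul_le_iff₀ hT0]
  linarith

end DS

namespace DS
open Finset ArithmeticFunction

noncomputable def la (q a n : ℕ) : ℝ := if (q:ℤ) ∣ (n:ℤ) - (a:ℤ) then vonMangoldt n else 0

lemma la_nonneg (q a n : ℕ) : 0 ≤ la q a n := by
  unfold la; split_ifs
  · exact vonMangoldt_nonneg
  · exact le_rfl

lemma la_le (q a n : ℕ) : la q a n ≤ vonMangoldt n := by
  unfold la; split_ifs
  · exact le_rfl
  · exact vonMangoldt_nonneg

lemma la_sum {q : ℕ} (hq : 0 < q) (a X : ℕ) (F : ℕ → ℂ) :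
    ∑ n ∈ Icc 1 X, (la q a n : ℂ) * F n = (1 / (q:ℂ)) * ∑ b ∈ range q, ee (-((b:ℝ) * ((a:ℝ) / q))) *
      ∑ n ∈ Icc 1 X, (vonMangoldt n : ℂ) * ee ((b:ℝ) / q * n) * F n := by
  have hqc : (q:ℂ) ≠ 0 := by exact_mod_cast hq.ne'
  simp_rw [Finset.mul_sum]
  symm
  rw [Finset.sum_comm]
  refine Finset.sum_congr rfl fun n _ => ?_
  have h := orth hq ((n:ℤ) - (a:ℤ))
  have h2 : ∀ b ∈ range q, (1 / (q:ℂ)) * (ee (-((b:ℝ) * ((a:ℝ) / q))) * ((vonMangoldt n : ℂ) * ee ((b:ℝ) / q * n) * F n))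
      = ee ((b:ℝ) * ((((n:ℤ) - (a:ℤ) : ℤ):ℝ) / q)) * ((1 / (q:ℂ)) * (vonMangoldt n : ℂ) * F n) := by
    intro b _
    have : (b:ℝ) * ((((n:ℤ) - (a:ℤ) : ℤ):ℝ) / q) = -((b:ℝ) * ((a:ℝ) / q)) + (b:ℝ) / q * n := by
      push_cast; ring
    rw [this, ee_add]; ring
  rw [Finset.sum_congr rfl h2, ← Finset.sum_mul, h]
  unfold la
  split_ifs
  · field_simp
  · simp

lemma la_norm {q : ℕ} (hq : 0 < q) (a X : ℕ) (F : ℕ → ℂ) (E : ℝ)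
    (hE : ∀ b < q, ‖∑ n ∈ Icc 1 X, (vonMangoldt n : ℂ) * ee ((b:ℝ) / q * n) * F n‖ ≤ E) :
    ‖∑ n ∈ Icc 1 X, (la q a n : ℂ) * F n‖ ≤ E := by
  have hqr : (0:ℝ) < q := by exact_mod_cast hq
  rw [la_sum hq, norm_mul]
  have : ‖∑ b ∈ range q, ee (-((b:ℝ) * ((a:ℝ) / q))) *
      ∑ n ∈ Icc 1 X, (vonMangoldt n : ℂ) * ee ((b:ℝ) / q * n) * F n‖ ≤ ∑ b ∈ range q, E :=
    norm_sum_le_of_le _ fun b hb => by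
      rw [norm_mul, norm_ee, one_mul]; exact hE b (mem_range.1 hb)
  simp only [sum_const, card_range, nsmul_eq_mul] at this
  have e : ‖1 / (q:ℂ)‖ = 1 / (q:ℝ) := by simp
  rw [e, div_mul_eq_mul_div, one_mul, div_le_iff₀ hqr]
  linarith

lemma AB.sup {Q : ℕ} {h : ℕ → ℂ} {K : ℝ} (H : AB Q h K) (n : ℕ) : ‖h n‖ ≤ K := by
  obtain ⟨ι, _, k, c, h1, h2⟩ := H
  rw [h1]
  refine (norm_sum_le _ _).trans (le_trans (Finset.sum_le_sum fun i _ => ?_) h2)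
  rw [norm_mul, norm_ee, mul_one]

/-- error term -/
noncomputable def er (g X W k1 : ℕ) : ℝ :=
  1100 * X * Real.log X ^ 3 / W + 3 * (W:ℝ) ^ 16 * (4 * g * W ^ 8 / (g ^ k1 : ℕ) * (X * Real.log X))

lemma prime_fourier {g k1 k2 X W : ℕ} (hg : 2 ≤ g) (hW : 2 ≤ W) (hk : k1 ≤ k2)
    (hX1 : 2 * g ^ k2 * W ^ 8 ≤ X) (hX2 : g * W ^ 8 ≤ g ^ k2) (h : ℕ → ℂ) (K : ℝ)
    (hAB : AB (g ^ k2) h K)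
    (hlow : ∀ w v, w < g ^ k1 → h (w + g ^ k1 * v) = h (g ^ k1 * v)) (a : ℕ) :
    ‖∑ n ∈ Icc 1 X, (la (g-1) a n : ℂ) * h n - Fr (g ^ k2) h 0 * (∑ n ∈ Icc 1 X, la (g-1) a n : ℝ)‖ ≤
      K * er g X W k1 := by
  have hq : 0 < g - 1 := by omega
  have e : ∑ n ∈ Icc 1 X, (la (g-1) a n : ℂ) * h n - Fr (g ^ k2) h 0 * (∑ n ∈ Icc 1 X, la (g-1) a n : ℝ)
      = ∑ n ∈ Icc 1 X, (la (g-1) a n : ℂ) * (h n - Fr (g ^ k2) h 0) := by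
    rw [Complex.ofReal_sum, Finset.mul_sum, ← Finset.sum_sub_distrib]
    refine Finset.sum_congr rfl fun n _ => by ring
  rw [e]
  refine la_norm hq a X _ _ fun b hb => ?_
  have h1 := prime_fourier_b hg hW hk hX1 hX2 h K K hAB hAB.sup hlow b hb
  have e2 : ∑ n ∈ Icc 1 X, (vonMangoldt n : ℂ) * ee ((b:ℝ) / ((g-1:ℕ):ℝ) * n) * (h n - Fr (g ^ k2) h 0)
     = ∑ n ∈ Icc 1 X, (vonMangoldt n : ℂ) * ee ((b:ℝ) / ((g-1:ℕ):ℝ) * n) * h n - Fr (g ^ k2) h 0 * SS X ((b:ℝ) / ((g-1:ℕ):ℝ)) := by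
    unfold SS
    rw [Finset.mul_sum, ← Finset.sum_sub_distrib]
    refine Finset.sum_congr rfl fun n _ => by ring
  rw [e2]
  refine h1.trans (le_of_eq ?_)
  unfold er
  ring
end DS

namespace DS
open Finset

lemma taylor_pos (w : ℂ) (hw : ‖w‖ = 1) (hre : ∀ t : ℝ, ‖Complex.exp (w * t)‖ = 1) (d : ℕ) :
    ∀ t : ℝ, 0 ≤ t → ‖Complex.exp (w * t) - ∑ j ∈ range d, (w * t) ^ j / (j.factorial : ℂ)‖ ≤ t ^ d / d.factorial := by
  induction d with
  | zero => intro t _; simp [hre]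
  | succ d ih =>
    intro t ht
    have hB : ∀ x : ℝ, HasDerivAt (fun x : ℝ => x ^ (d+1) / ((d+1).factorial : ℝ)) (x ^ d / (d.factorial:ℝ)) x := by
      intro x
      have h := (hasDerivAt_pow (d+1) x).div_const ((d+1).factorial : ℝ)
      refine h.congr_deriv ?_
      have : ((d.factorial : ℕ):ℝ) ≠ 0 := by exact_mod_cast (Nat.factorial_pos d).ne'
      rw [Nat.factorial_succ]; push_cast
      field_simp
    have hlin : ∀ x : ℝ, HasDerivAt (fun x : ℝ => w * (x:ℂ)) w x := by
      intro x
      have := (Complex.ofRealCLM.hasDerivAt (x := x)).const_mul w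
      simpa using this
    have hF : ∀ x : ℝ, HasDerivAt (fun x : ℝ => Complex.exp (w * x) - ∑ j ∈ range (d+1), (w * x) ^ j / (j.factorial : ℂ))
        (w * (Complex.exp (w * x) - ∑ j ∈ range d, (w * x) ^ j / (j.factorial : ℂ))) x := by
      intro x
      have h1 := (hlin x).cexp
      have h2 : HasDerivAt (fun x : ℝ => ∑ j ∈ range (d+1), (w * x) ^ j / (j.factorial : ℂ))
          (∑ j ∈ range (d+1), ((j:ℂ) * (w * x) ^ (j-1) * w) / (j.factorial : ℂ)) x :=
        HasDerivAt.fun_sum fun j _ => ((hlin x).fun_pow j).div_const _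
      refine (h1.sub h2).congr_deriv ?_
      rw [Finset.sum_range_succ', mul_sub, Finset.mul_sum]
      simp only [Nat.cast_zero, zero_mul, zero_div, add_zero, Nat.add_sub_cancel]
      congr 1
      · ring
      · refine Finset.sum_congr rfl fun j _ => ?_
        have : ((j.factorial : ℕ):ℂ) ≠ 0 := by exact_mod_cast (Nat.factorial_pos j).ne'
        have h3 : ((j:ℂ) + 1) ≠ 0 := by exact_mod_cast (Nat.succ_ne_zero j)
        rw [Nat.factorial_succ]; push_cast
        field_simp
    have := image_norm_le_of_norm_deriv_right_le_deriv_boundary (a := 0) (b := t)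
      (fun x _ => (hF x).continuousAt.continuousWithinAt) (fun x _ => (hF x).hasDerivWithinAt)
      (B := fun x : ℝ => x ^ (d+1) / ((d+1).factorial : ℝ)) (B' := fun x : ℝ => x ^ d / (d.factorial:ℝ)) ?_ hB ?_
      (Set.right_mem_Icc.2 ht)
    · exact this
    · rw [Finset.sum_range_succ']; simp
    · intro x hx
      rw [norm_mul, hw, one_mul]
      exact ih x hx.1

lemma taylor_I (d : ℕ) (y : ℝ) :
    ‖Complex.exp (Complex.I * y) - ∑ j ∈ range d, (Complex.I * y) ^ j / (j.factorial : ℂ)‖ ≤ |y| ^ d / d.factorial := by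
  rcases le_total 0 y with h | h
  · rw [abs_of_nonneg h]
    refine taylor_pos Complex.I (by simp) (fun t => ?_) d y h
    rw [mul_comm, Complex.norm_exp_ofReal_mul_I]
  · rw [abs_of_nonpos h]
    have := taylor_pos (-Complex.I) (by simp) (fun t => ?_) d (-y) (by linarith)
    · simpa using this
    · have : -Complex.I * (t:ℂ) = ((-t:ℝ):ℂ) * Complex.I := by push_cast; ring
      rw [this, Complex.norm_exp_ofReal_mul_I]

lemma pow_le_cosh {d : ℕ} (y : ℝ) :
    |y| ^ d / d.factorial ≤ Real.exp (-(d:ℝ)) * (Real.exp (Real.exp 1 * y) + Real.exp (-(Real.exp 1 * y))) := by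
  have h := Real.pow_div_factorial_le_exp (Real.exp 1 * |y|) (by positivity) d
  rw [mul_pow, ← Real.exp_nat_mul, mul_one] at h
  have h2 : Real.exp (Real.exp 1 * |y|) ≤ Real.exp (Real.exp 1 * y) + Real.exp (-(Real.exp 1 * y)) := by
    rcases abs_cases y with ⟨h3, _⟩ | ⟨h3, _⟩ <;> rw [h3]
    · linarith [Real.exp_pos (-(Real.exp 1 * y))]
    · rw [mul_neg]; linarith [Real.exp_pos (Real.exp 1 * y)]
  have e : |y| ^ d / d.factorial = Real.exp (-(d:ℝ)) * (Real.exp d * |y| ^ d / d.factorial) := by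
    rw [mul_div_assoc, ← mul_assoc, ← Real.exp_add]; simp
  rw [e]
  exact mul_le_mul_of_nonneg_left (h.trans h2) (Real.exp_pos _).le

/-- product over digits -/
lemma dig_prod {R : Type*} [CommSemiring R] {g : ℕ} (hg : 2 ≤ g) (f : ℕ → R) (k m : ℕ) :
    ∑ u ∈ range (g ^ (k + m)), ∏ j ∈ Ico k (k + m), f (dg g j u) = (g ^ k : ℕ) * (∑ c ∈ range g, f c) ^ m := by
  induction m with
  | zero => simp
  | succ m ih =>
    rw [← add_assoc, pow_succ g, sum_range_mul_split]
    have h1 : ∀ v ∈ range g, ∑ w ∈ range (g ^ (k+m)), ∏ j ∈ Ico k (k + m + 1), f (dg g j (w + g ^ (k+m) * v))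
        = (∑ w ∈ range (g ^ (k+m)), ∏ j ∈ Ico k (k + m), f (dg g j w)) * f v := by
      intro v hv
      rw [Finset.sum_mul]
      refine Finset.sum_congr rfl fun w hw => ?_
      have hv := mem_range.1 hv
      have hw := mem_range.1 hw
      rw [Finset.prod_Ico_succ_top (by omega), dg_split g (k+m) v w hv hw]
      congr 1
      refine Finset.prod_congr rfl fun j hj => ?_
      have hj := mem_Ico.1 hj
      rw [← dg_mod_pow g hj.2, Nat.add_mul_mod_self_left, Nat.mod_eq_of_lt hw]
    rw [Finset.sum_congr rfl h1, ← Finset.mul_sum, ih, pow_succ, mul_assoc]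

/-- centred mean of digit exponentials -/
lemma cosh_mean {g : ℕ} (hg : 2 ≤ g) (t : ℝ) :
    ∑ c ∈ range g, Real.exp (t * ((c:ℝ) - ((g:ℝ)-1)/2)) ≤ g * Real.exp (t ^ 2 * (g:ℝ) ^ 2 / 8) := by
  have hr : ∑ c ∈ range g, Real.exp (t * ((c:ℝ) - ((g:ℝ)-1)/2)) = ∑ c ∈ range g, Real.exp (-(t * ((c:ℝ) - ((g:ℝ)-1)/2))) := by
    rw [← Finset.sum_range_reflect]
    refine Finset.sum_congr rfl fun c hc => ?_
    have hc := mem_range.1 hc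
    congr 1
    have : ((g - 1 - c : ℕ):ℝ) = (g:ℝ) - 1 - c := by
      rw [Nat.cast_sub (by omega), Nat.cast_sub (by omega)]; simp
    rw [this]; ring
  have h2 : ∑ c ∈ range g, Real.exp (t * ((c:ℝ) - ((g:ℝ)-1)/2)) = ∑ c ∈ range g, Real.cosh (t * ((c:ℝ) - ((g:ℝ)-1)/2)) := by
    simp_rw [Real.cosh_eq, ← Finset.sum_div, Finset.sum_add_distrib]
    rw [← hr]; ring
  rw [h2]
  have : ∀ c ∈ range g, Real.cosh (t * ((c:ℝ) - ((g:ℝ)-1)/2)) ≤ Real.exp (t ^ 2 * (g:ℝ) ^ 2 / 8) := by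
    intro c hc
    refine (Real.cosh_le_exp_half_sq _).trans (Real.exp_le_exp.2 ?_)
    have hc : (c:ℝ) + 1 ≤ g := by exact_mod_cast mem_range.1 hc
    have hc0 : (0:ℝ) ≤ c := Nat.cast_nonneg c
    have : ((c:ℝ) - ((g:ℝ)-1)/2)^2 ≤ (g:ℝ)^2/4 := by nlinarith
    have := mul_le_mul_of_nonneg_left this (sq_nonneg t)
    rw [mul_pow]; linarith
  refine (Finset.sum_le_sum this).trans ?_
  simp
end DS

namespace DS
open Finset

lemma Fr_zero (Q : ℕ) (h : ℕ → ℂ) : Fr Q h 0 = (1 / (Q:ℂ)) * ∑ u ∈ range Q, h u := by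
  unfold Fr; simp [ee_zero]

lemma taylor_abs {Q : ℕ} (y : ℕ → ℝ) (K er Ψ : ℝ) (hK : 0 ≤ K) (her : 0 ≤ er) (s : Finset ℕ) (wt : ℕ → ℝ)
    (hwt : ∀ n, 0 ≤ wt n) (hΨ : Ψ = ∑ n ∈ s, wt n) (low : (ℕ → ℂ) → Prop)
    (hlow : ∀ p : ℝ → ℂ, low (fun n => p (y n)))
    (hAB : AB Q (fun n => (y n : ℂ)) K)
    (pf : ∀ (h : ℕ → ℂ) (K' : ℝ), AB Q h K' → low h → ‖∑ n ∈ s, (wt n : ℂ) * h n - Fr Q h 0 * (Ψ:ℝ)‖ ≤ K' * er)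
    (d : ℕ) (hd : Even d) :
    ‖∑ n ∈ s, (wt n : ℂ) * Complex.exp (Complex.I * y n) - Fr Q (fun n => Complex.exp (Complex.I * y n)) 0 * (Ψ:ℝ)‖
      ≤ ((d:ℝ) + 1) * (1 + K) ^ d * er + 2 * Ψ * ((1 / (Q:ℝ)) * ∑ u ∈ range Q, |y u| ^ d / d.factorial) := by
  set M : ℕ → ℝ := fun n => |y n| ^ d / d.factorial with hM
  set EM : ℝ := (1 / (Q:ℝ)) * ∑ u ∈ range Q, M u with hEM
  set P : ℕ → ℂ := fun n => ∑ j ∈ range d, (Complex.I * y n) ^ j / (j.factorial : ℂ) with hP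
  have h1K : 1 ≤ (1 + K) ^ d := one_le_pow₀ (by linarith)
  have hΨ0 : 0 ≤ Ψ := by rw [hΨ]; exact Finset.sum_nonneg fun n _ => hwt n
  have hM0 : ∀ n, 0 ≤ M n := fun n => by rw [hM]; positivity
  have hterm : ∀ j ≤ d, AB Q (fun n => (Complex.I * y n) ^ j / (j.factorial : ℂ)) ((1 + K) ^ d) := by
    intro j hj
    have h1 : AB Q (fun n => Complex.I * (y n:ℂ)) K := by
      have := AB.mul (by simp) (AB.const Q Complex.I) hAB
      simpa using this
    have h2 := AB.mul (by positivity) (AB.pow hK h1 j) (AB.const Q (1 / (j.factorial : ℂ)))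
    have h3 : AB Q (fun n => (Complex.I * y n) ^ j / (j.factorial : ℂ)) (K ^ j * ‖1 / (j.factorial : ℂ)‖) := by
      convert h2 using 2
      ring
    refine h3.mono ?_
    have h4 : ‖1 / (j.factorial : ℂ)‖ ≤ 1 := by
      rw [norm_div, norm_one, Complex.norm_natCast]
      rw [div_le_one (by exact_mod_cast Nat.factorial_pos j)]
      exact_mod_cast Nat.factorial_pos j
    calc K ^ j * ‖1 / (j.factorial : ℂ)‖ ≤ K ^ j * 1 := by gcongr
      _ ≤ (1+K)^j := by rw [mul_one]; gcongr; linarith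
      _ ≤ (1+K)^d := pow_le_pow_right₀ (by linarith) hj
  have hPAB : AB Q P (d * (1+K)^d) := by
    have := AB.sum (range d) (h := fun j n => (Complex.I * y n) ^ j / (j.factorial : ℂ)) (K := fun _ => (1+K)^d)
      (fun j hj => hterm j (mem_range.1 hj).le)
    simpa using this
  have hMAB : AB Q (fun n => (M n : ℂ)) ((1+K)^d) := by
    have h1 := AB.mul (by simp) (AB.const Q ((Complex.I ^ d)⁻¹)) (hterm d le_rfl)
    have : (fun n => (M n : ℂ)) = fun n => (Complex.I ^ d)⁻¹ * ((Complex.I * y n) ^ d / (d.factorial : ℂ)) := by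
      funext n
      simp only [hM]
      rw [Even.pow_abs hd]
      have : Complex.I ^ d ≠ 0 := pow_ne_zero _ Complex.I_ne_zero
      push_cast
      rw [mul_pow]; field_simp
    rw [this]
    refine h1.mono ?_
    simp
  have e1 := pf P _ hPAB (hlow fun t => ∑ j ∈ range d, (Complex.I * t) ^ j / (j.factorial : ℂ))
  have e2 := pf (fun n => (M n : ℂ)) _ hMAB (hlow fun t => ((|t| ^ d / d.factorial : ℝ):ℂ))
  have hFM : Fr Q (fun n => (M n : ℂ)) 0 = (EM : ℂ) := by
    rw [Fr_zero, hEM]; push_cast; rfl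
  have e3 : ∑ n ∈ s, wt n * M n ≤ EM * Ψ + (1+K)^d * er := by
    rw [hFM] at e2
    have : ∑ n ∈ s, (wt n : ℂ) * (M n : ℂ) - (EM:ℂ) * (Ψ:ℝ) = ((∑ n ∈ s, wt n * M n - EM * Ψ : ℝ):ℂ) := by push_cast; rfl
    rw [this, Complex.norm_real, Real.norm_eq_abs] at e2
    linarith [(abs_le.1 e2).2]
  have hR : ∀ n, ‖Complex.exp (Complex.I * y n) - P n‖ ≤ M n := fun n => taylor_I d (y n)
  have e4 : ‖∑ n ∈ s, (wt n : ℂ) * (Complex.exp (Complex.I * y n) - P n)‖ ≤ ∑ n ∈ s, wt n * M n := by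
    refine norm_sum_le_of_le _ fun n _ => ?_
    rw [norm_mul, Complex.norm_real, Real.norm_of_nonneg (hwt n)]
    exact mul_le_mul_of_nonneg_left (hR n) (hwt n)
  have e5 : ‖Fr Q (fun n => Complex.exp (Complex.I * y n)) 0 - Fr Q P 0‖ ≤ EM := by
    rw [Fr_zero, Fr_zero, ← mul_sub, ← Finset.sum_sub_distrib, norm_mul, hEM]
    have e : ‖1 / (Q:ℂ)‖ = 1 / (Q:ℝ) := by simp
    rw [e]
    refine mul_le_mul_of_nonneg_left ?_ (by positivity)
    exact norm_sum_le_of_le _ fun n _ => hR n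
  have e6 : ∑ n ∈ s, (wt n : ℂ) * Complex.exp (Complex.I * y n) - Fr Q (fun n => Complex.exp (Complex.I * y n)) 0 * (Ψ:ℝ)
      = (∑ n ∈ s, (wt n : ℂ) * P n - Fr Q P 0 * (Ψ:ℝ)) + ∑ n ∈ s, (wt n : ℂ) * (Complex.exp (Complex.I * y n) - P n)
       - (Fr Q (fun n => Complex.exp (Complex.I * y n)) 0 - Fr Q P 0) * (Ψ:ℝ) := by
    simp_rw [mul_sub, Finset.sum_sub_distrib]; ring
  rw [e6]
  refine (norm_sub_le _ _).trans ?_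
  refine (add_le_add (norm_add_le _ _) le_rfl).trans ?_
  rw [norm_mul, Complex.norm_real, Real.norm_of_nonneg hΨ0]
  have e7 := mul_le_mul_of_nonneg_right e5 hΨ0
  have : 2 * Ψ * EM = EM * Ψ + EM * Ψ := by ring
  rw [this]
  linarith

noncomputable def TT (g k1 k2 n : ℕ) : ℝ := ∑ j ∈ Ico k1 k2, ((dg g j n : ℝ) - ((g:ℝ)-1)/2)

lemma TT_low (g k1 k2 w v : ℕ) (hg : 2 ≤ g) (hw : w < g ^ k1) : TT g k1 k2 (w + g ^ k1 * v) = TT g k1 k2 (g ^ k1 * v) := by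
  unfold TT
  refine Finset.sum_congr rfl fun j hj => ?_
  have hj := (mem_Ico.1 hj).1
  obtain ⟨i, rfl⟩ := Nat.exists_eq_add_of_le hj
  have hp : 0 < g ^ k1 := by positivity
  unfold dg
  rw [pow_add, ← Nat.div_div_eq_div_mul, ← Nat.div_div_eq_div_mul, Nat.add_mul_div_left _ _ hp, Nat.div_eq_of_lt hw, zero_add, Nat.mul_div_cancel_left _ hp]

lemma TT_AB (g k1 k2 : ℕ) (hg : 2 ≤ g) :
    AB (g ^ k2) (fun n => (TT g k1 k2 n : ℂ)) (k2 * (16*(g:ℝ)^2*(1+Real.log ((g:ℝ)^k2)) + g)) := by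
  have hg1 : (1:ℝ) ≤ g := by exact_mod_cast (by omega : 1 ≤ g)
  have h : ∀ j ∈ Ico k1 k2, AB (g ^ k2) (fun n => (dg g j n : ℂ) + ((-(((g:ℝ)-1)/2):ℝ):ℂ)) (16*(g:ℝ)^2*(1+Real.log ((g:ℝ)^k2)) + g) := by
    intro j hj
    have hj := (mem_Ico.1 hj).2
    obtain ⟨i, rfl⟩ := Nat.exists_eq_add_of_le hj
    have h1 := AB.lift (g ^ i) (by positivity) (ab_dig hg j)
    rw [← pow_add] at h1
    refine (AB.add h1 (AB.const _ _)).mono ?_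
    refine add_le_add ?_ ?_
    · have : Real.log ((g:ℝ)^(j+1)) ≤ Real.log ((g:ℝ)^(j.succ+i)) :=
        Real.log_le_log (by positivity) (pow_le_pow_right₀ hg1 (by omega))
      gcongr
    · rw [Complex.norm_real, Real.norm_eq_abs, abs_neg, abs_of_nonneg (by linarith)]; linarith
  have h2 := AB.sum (Ico k1 k2) h
  have e : (fun n => (TT g k1 k2 n : ℂ)) = fun n => ∑ j ∈ Ico k1 k2, ((dg g j n : ℂ) + ((-(((g:ℝ)-1)/2):ℝ):ℂ)) := by
    funext n; unfold TT; rw [Complex.ofReal_sum]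
    refine Finset.sum_congr rfl fun j _ => ?_
    push_cast; ring
  rw [e]
  refine h2.mono ?_
  simp only [sum_const, Nat.card_Ico, nsmul_eq_mul]
  have : ((k2 - k1 : ℕ):ℝ) ≤ k2 := by exact_mod_cast Nat.sub_le _ _
  have h0 : 0 ≤ Real.log ((g:ℝ)^k2) := Real.log_nonneg (one_le_pow₀ hg1)
  exact mul_le_mul_of_nonneg_right this (by positivity)

noncomputable def p0 (g : ℕ) (α : ℝ) : ℝ := (1 / (g:ℝ)) * ∑ c ∈ range g, Real.cos (2 * Real.pi * (α * ((c:ℝ) - ((g:ℝ)-1)/2)))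

lemma p0_eq (g : ℕ) (hg : 2 ≤ g) (α : ℝ) :
    ∑ c ∈ range g, Complex.exp (Complex.I * ((2 * Real.pi * α * ((c:ℝ) - ((g:ℝ)-1)/2) : ℝ):ℂ)) = (g:ℂ) * (p0 g α : ℂ) := by
  have hgc : (g:ℂ) ≠ 0 := by exact_mod_cast (by omega : g ≠ 0)
  have hr : ∑ c ∈ range g, Complex.exp (Complex.I * ((2 * Real.pi * α * ((c:ℝ) - ((g:ℝ)-1)/2) : ℝ):ℂ)) =
      ∑ c ∈ range g, Complex.exp (-(Complex.I * ((2 * Real.pi * α * ((c:ℝ) - ((g:ℝ)-1)/2) : ℝ):ℂ))) := by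
    rw [← Finset.sum_range_reflect]
    refine Finset.sum_congr rfl fun c hc => ?_
    have hc := mem_range.1 hc
    congr 1
    have : ((g - 1 - c : ℕ):ℝ) = (g:ℝ) - 1 - c := by
      rw [Nat.cast_sub (by omega), Nat.cast_sub (by omega)]; simp
    rw [this]; push_cast; ring
  have h2 : ∀ c ∈ range g, (2:ℂ) * (Real.cos (2 * Real.pi * (α * ((c:ℝ) - ((g:ℝ)-1)/2))) : ℂ) =
     Complex.exp (Complex.I * ((2 * Real.pi * α * ((c:ℝ) - ((g:ℝ)-1)/2) : ℝ):ℂ)) +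
       Complex.exp (-(Complex.I * ((2 * Real.pi * α * ((c:ℝ) - ((g:ℝ)-1)/2) : ℝ):ℂ))) := by
    intro c _
    rw [Complex.ofReal_cos, Complex.cos]
    have e1 : ((2 * Real.pi * (α * ((c:ℝ) - ((g:ℝ)-1)/2)) : ℝ):ℂ) * Complex.I = Complex.I * ((2 * Real.pi * α * ((c:ℝ) - ((g:ℝ)-1)/2) : ℝ):ℂ) := by
      push_cast; ring
    rw [neg_mul, e1]; ring
  have h3 := Finset.sum_congr rfl h2
  rw [Finset.sum_add_distrib, ← hr, ← Finset.mul_sum] at h3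
  unfold p0
  push_cast at h3 ⊢
  rw [← mul_assoc, mul_one_div_cancel hgc, one_mul]
  linear_combination (-1/2) * h3

lemma exp_TT (g k1 k2 n : ℕ) (t : ℝ) : Real.exp (t * TT g k1 k2 n) = ∏ j ∈ Ico k1 k2, Real.exp (t * ((dg g j n : ℝ) - ((g:ℝ)-1)/2)) := by
  unfold TT; rw [Finset.mul_sum, Real.exp_sum]

lemma mom (g k1 k2 : ℕ) (hg : 2 ≤ g) (hk : k1 ≤ k2) (t : ℝ) :
    (1 / ((g ^ k2 : ℕ):ℝ)) * ∑ u ∈ range (g ^ k2), Real.exp (t * TT g k1 k2 u) ≤ Real.exp (t ^ 2 * (g:ℝ) ^ 2 / 8 * k2) := by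
  obtain ⟨m, rfl⟩ := Nat.exists_eq_add_of_le hk
  have hg0 : (0:ℝ) < g := by exact_mod_cast (by omega : 0 < g)
  simp_rw [exp_TT]
  have h := dig_prod hg (fun c => Real.exp (t * ((c : ℝ) - ((g:ℝ)-1)/2))) k1 m
  rw [h]
  have h2 := cosh_mean hg t
  have h3 : (∑ c ∈ range g, Real.exp (t * ((c:ℝ) - ((g:ℝ)-1)/2))) ^ m ≤ (g * Real.exp (t ^ 2 * (g:ℝ) ^ 2 / 8)) ^ m :=
    pow_le_pow_left₀ (Finset.sum_nonneg fun _ _ => (Real.exp_pos _).le) h2 m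
  calc 1 / ((g ^ (k1+m) : ℕ):ℝ) * (((g ^ k1 : ℕ):ℝ) * (∑ c ∈ range g, Real.exp (t * ((c:ℝ) - ((g:ℝ)-1)/2))) ^ m)
      ≤ 1 / ((g ^ (k1+m) : ℕ):ℝ) * (((g ^ k1 : ℕ):ℝ) * (g * Real.exp (t ^ 2 * (g:ℝ) ^ 2 / 8)) ^ m) := by gcongr
    _ = Real.exp (t ^ 2 * (g:ℝ) ^ 2 / 8) ^ m := by
        push_cast; rw [pow_add, mul_pow]; field_simp
    _ = Real.exp (t ^ 2 * (g:ℝ) ^ 2 / 8 * m) := by rw [← Real.exp_nat_mul, mul_comm]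
    _ ≤ _ := by
        apply Real.exp_le_exp.2
        push_cast
        have : 0 ≤ t ^ 2 * (g:ℝ) ^ 2 / 8 * k1 := by positivity
        linarith

lemma Fr_TT (g k1 k2 : ℕ) (hg : 2 ≤ g) (hk : k1 ≤ k2) (α : ℝ) :
    Fr (g ^ k2) (fun n => Complex.exp (Complex.I * ((2 * Real.pi * α * TT g k1 k2 n : ℝ):ℂ))) 0 = ((p0 g α ^ (k2 - k1) : ℝ):ℂ) := by
  obtain ⟨m, rfl⟩ := Nat.exists_eq_add_of_le hk
  have hgc : (g:ℂ) ≠ 0 := by exact_mod_cast (by omega : g ≠ 0)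
  rw [Fr_zero]
  have e : ∀ n, Complex.exp (Complex.I * ((2 * Real.pi * α * TT g k1 (k1+m) n : ℝ):ℂ)) =
      ∏ j ∈ Ico k1 (k1+m), Complex.exp (Complex.I * ((2 * Real.pi * α * ((dg g j n:ℝ) - ((g:ℝ)-1)/2) : ℝ):ℂ)) := by
    intro n
    unfold TT
    rw [← Complex.exp_sum, ← Finset.mul_sum, Finset.mul_sum, Complex.ofReal_sum]
  simp_rw [e]
  have h := dig_prod hg (fun c => Complex.exp (Complex.I * ((2 * Real.pi * α * ((c:ℝ) - ((g:ℝ)-1)/2) : ℝ):ℂ))) k1 m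
  rw [h, p0_eq g hg]
  rw [Nat.add_sub_cancel_left, mul_pow, pow_add]
  push_cast
  field_simp

end DS

namespace DS
open Finset

lemma er_nonneg (g X W k1 : ℕ) : 0 ≤ er g X W k1 := by
  unfold er
  have := Real.log_natCast_nonneg X
  positivity

lemma near_raw {g k1 k2 X W : ℕ} (hg : 2 ≤ g) (hW : 2 ≤ W) (hk : k1 ≤ k2)
    (hX1 : 2 * g ^ k2 * W ^ 8 ≤ X) (hX2 : g * W ^ 8 ≤ g ^ k2) (a : ℕ) (α : ℝ) (d : ℕ) (hd : Even d) (K : ℝ)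
    (hK : |2 * Real.pi * α| * (k2 * (16*(g:ℝ)^2*(1+Real.log ((g:ℝ)^k2)) + g)) ≤ K) :
    ‖∑ n ∈ Icc 1 X, (la (g-1) a n : ℂ) * Complex.exp (Complex.I * ((2 * Real.pi * α * TT g k1 k2 n : ℝ):ℂ))
        - ((p0 g α ^ (k2 - k1) : ℝ):ℂ) * (∑ n ∈ Icc 1 X, la (g-1) a n : ℝ)‖ ≤
      ((d:ℝ) + 1) * (1 + K) ^ d * er g X W k1 +
        2 * (∑ n ∈ Icc 1 X, la (g-1) a n) * (Real.exp (-(d:ℝ)) * (2 * Real.exp ((Real.exp 1 * (2 * Real.pi * α)) ^ 2 * (g:ℝ) ^ 2 / 8 * k2))) := by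
  have hg1 : (1:ℝ) ≤ g := by exact_mod_cast (by omega : 1 ≤ g)
  have h0 : 0 ≤ Real.log ((g:ℝ)^k2) := Real.log_nonneg (one_le_pow₀ hg1)
  have hK0 : 0 ≤ K := le_trans (by positivity) hK
  have hAB : AB (g ^ k2) (fun n => ((2 * Real.pi * α * TT g k1 k2 n : ℝ):ℂ)) K := by
    have h := AB.mul (by simp) (AB.const (g ^ k2) ((2 * Real.pi * α : ℝ):ℂ)) (TT_AB g k1 k2 hg)
    rw [Complex.norm_real, Real.norm_eq_abs] at h
    refine AB.mono ?_ hK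
    simpa only [Complex.ofReal_mul] using h
  have h := taylor_abs (Q := g ^ k2) (fun n => 2 * Real.pi * α * TT g k1 k2 n) K (er g X W k1) (∑ n ∈ Icc 1 X, la (g-1) a n)
    hK0 (er_nonneg _ _ _ _) (Icc 1 X) (la (g-1) a) (la_nonneg _ _) rfl
    (fun h => ∀ w v, w < g ^ k1 → h (w + g ^ k1 * v) = h (g ^ k1 * v))
    (fun p w v hw => by beta_reduce; rw [TT_low g k1 k2 w v hg hw]) hAB
    (fun h K' hh hl => prime_fourier hg hW hk hX1 hX2 h K' hh hl a) d hd
  rw [Fr_TT g k1 k2 hg hk] at h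
  refine h.trans ?_
  have hΨ0 : 0 ≤ ∑ n ∈ Icc 1 X, la (g-1) a n := Finset.sum_nonneg fun n _ => la_nonneg _ _ _
  refine add_le_add le_rfl (mul_le_mul_of_nonneg_left ?_ (by positivity))
  have h1 : ∑ u ∈ range (g ^ k2), |2 * Real.pi * α * TT g k1 k2 u| ^ d / (d.factorial:ℝ) ≤
     ∑ u ∈ range (g ^ k2), Real.exp (-(d:ℝ)) * (Real.exp ((Real.exp 1 * (2 * Real.pi * α)) * TT g k1 k2 u) + Real.exp ((-(Real.exp 1 * (2 * Real.pi * α))) * TT g k1 k2 u)) := by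
    refine Finset.sum_le_sum fun u _ => ?_
    refine (pow_le_cosh _).trans (le_of_eq ?_)
    congr 3 <;> ring
  have h2 := mom g k1 k2 hg hk (Real.exp 1 * (2 * Real.pi * α))
  have h3 := mom g k1 k2 hg hk (-(Real.exp 1 * (2 * Real.pi * α)))
  rw [neg_sq] at h3
  rw [← Finset.mul_sum, Finset.sum_add_distrib] at h1
  have h4 := mul_le_mul_of_nonneg_left h1 (by positivity : 0 ≤ 1 / ((g ^ k2 : ℕ):ℝ))
  refine h4.trans ?_
  rw [mul_left_comm]
  refine mul_le_mul_of_nonneg_left ?_ (Real.exp_pos _).le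
  rw [mul_add]; linarith

lemma sd_eq_sum {g : ℕ} (hg : 2 ≤ g) (J : ℕ) : ∀ n, n < g ^ J → sd g n = ∑ j ∈ range J, dg g j n := by
  induction J with
  | zero => intro n hn; simp at hn; subst hn; simp [sd]
  | succ J ih =>
    intro n hn
    have h1 : n / g < g ^ J := by
      rw [Nat.div_lt_iff_lt_mul (by omega)]; rwa [pow_succ] at hn
    have h2 := sd_add hg (n % g) (n / g) (Nat.mod_lt _ (by omega))
    rw [Nat.mod_add_div] at h2
    rw [h2, ih _ h1, Finset.sum_range_succ', add_comm]
    congr 1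
    · refine Finset.sum_congr rfl fun j _ => ?_
      unfold dg
      rw [pow_succ', Nat.div_div_eq_div_mul]
    · simp [dg]

lemma sd_TT {g : ℕ} (hg : 2 ≤ g) {J k1 k2 : ℕ} (hk : k1 ≤ k2) (hk2 : k2 ≤ J) (n : ℕ) (hn : n < g ^ J) :
    |((sd g n : ℝ) - ((g:ℝ)-1)/2 * J) - TT g k1 k2 n| ≤ g * (k1 + (J - k2 : ℕ)) := by
  have hg1 : (1:ℝ) ≤ g := by exact_mod_cast (by omega : 1 ≤ g)
  rw [sd_eq_sum hg J n hn]
  have e : ((∑ j ∈ range J, dg g j n : ℕ):ℝ) - ((g:ℝ)-1)/2 * J = ∑ j ∈ range J, ((dg g j n : ℝ) - ((g:ℝ)-1)/2) := by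
    rw [Finset.sum_sub_distrib]; simp; ring
  rw [e, TT]
  have hs : ∀ s : Finset ℕ, |∑ j ∈ s, ((dg g j n : ℝ) - ((g:ℝ)-1)/2)| ≤ g * #s := by
    intro s
    refine (Finset.abs_sum_le_sum_abs _ _).trans ?_
    have : ∀ j ∈ s, |(dg g j n : ℝ) - ((g:ℝ)-1)/2| ≤ g := by
      intro j _
      have h1 : (dg g j n : ℝ) ≤ g := by exact_mod_cast (dg_lt (by omega) j n).le
      have h2 : (0:ℝ) ≤ dg g j n := Nat.cast_nonneg _
      rw [abs_le]; constructor <;> linarith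
    refine (Finset.sum_le_sum this).trans ?_
    simp [mul_comm]
  have e2 : ∑ j ∈ range J, ((dg g j n : ℝ) - ((g:ℝ)-1)/2) = ∑ j ∈ range k1, ((dg g j n : ℝ) - ((g:ℝ)-1)/2)
     + ∑ j ∈ Ico k1 k2, ((dg g j n : ℝ) - ((g:ℝ)-1)/2) + ∑ j ∈ Ico k2 J, ((dg g j n : ℝ) - ((g:ℝ)-1)/2) := by
    rw [Finset.sum_range_add_sum_Ico _ hk, Finset.sum_range_add_sum_Ico _ hk2]
  rw [e2]
  have h1 := hs (range k1)
  have h2 := hs (Ico k2 J)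
  simp only [card_range, Nat.card_Ico] at h1 h2
  rw [show ∀ a b c : ℝ, a + b + c - b = a + c by intros; ring, mul_add]
  exact (abs_add_le _ _).trans (add_le_add h1 h2)

/-- real version of polylog -/
lemma polylogR (C : ℝ) (n : ℕ) {δ : ℝ} (hδ : 0 < δ) : ∀ᶠ L : ℝ in Filter.atTop, C * Real.log L ^ n ≤ L ^ δ := by
  have h := isLittleO_log_rpow_rpow_atTop (s := δ) (n:ℝ) hδ
  have h2 := h.def (c := 1 / (|C| + 1)) (by positivity)
  filter_upwards [h2, Filter.eventually_ge_atTop 1] with L hL h1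
  have hl : 0 ≤ Real.log L := Real.log_nonneg h1
  rw [Real.rpow_natCast, Real.norm_of_nonneg (by positivity), Real.norm_of_nonneg (by positivity)] at hL
  have h3 := mul_le_mul_of_nonneg_left hL (by positivity : 0 ≤ |C| + 1)
  have e : (|C| + 1) * (1 / (|C| + 1) * L ^ δ) = L ^ δ := by field_simp
  rw [e] at h3
  refine le_trans ?_ h3
  have : C ≤ |C| + 1 := by linarith [le_abs_self C]
  exact mul_le_mul_of_nonneg_right this (by positivity)
end DS

namespace DS
open Finset Filter

lemma near_params (G D C0 : ℝ) (hG : 2 ≤ G) (hD : 0 ≤ D) : ∀ᶠ L : ℝ in atTop,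
    (48 ≤ L ∧ (48 * (L ^ (1/4:ℝ) + 1) + 3) * Real.log G ≤ L ∧ 1 + 2 * Real.pi * (3 * L * (16 * G^2 * (1 + 2 * L) + G)) ≤ L ^ 4) ∧
    2 * (D * Real.log L + 1) + 1 ≤ L ∧
    (6 + 4 * (2 * D * Real.log L + 2)) * Real.log L + Real.log (2 * (1100 + 12 * G)) ≤ L ^ (1/4:ℝ) * Real.log 2 ∧
    Real.log G ≤ L ∧ C0 * Real.log L ≤ L := by
  have hlg : 0 ≤ Real.log G := Real.log_nonneg (by linarith)
  have h1 := (tendsto_rpow_atTop (y := 3/4) (by norm_num)).eventually_ge_atTop (99 * Real.log G)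
  have h2 := polylogR (2 * D + 3) 1 (δ := 1) one_pos
  set B := Real.log (2 * (1100 + 12 * G)) with hB
  have hB0 : 0 ≤ B := Real.log_nonneg (by linarith)
  have h3 := polylogR ((14 + 8 * D + B) * 2) 2 (δ := 1/4) (by norm_num)
  have h4 := polylogR C0 1 (δ := 1) one_pos
  filter_upwards [h1, h2, h3, h4, eventually_ge_atTop 48, eventually_ge_atTop (Real.log G),
    eventually_ge_atTop (1 + 2 * Real.pi * (3 * (16 * G^2 * 3 + G)))] with L h1 h2 h3 h4 h5 h6 h7
  have hlog : 1 ≤ Real.log L := by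
    rw [Real.le_log_iff_exp_le (by linarith)]
    linarith [Real.exp_one_lt_d9]
  rw [Real.rpow_one, pow_one] at h2 h4
  have hq : (1:ℝ) ≤ L ^ (1/4:ℝ) := Real.one_le_rpow (by linarith) (by norm_num)
  refine ⟨⟨h5, ?_, ?_⟩, ?_, ?_, h6, h4⟩
  · have e : L = L ^ (1/4:ℝ) * L ^ (3/4:ℝ) := by
      rw [← Real.rpow_add (by linarith)]; norm_num
    calc (48 * (L ^ (1/4:ℝ) + 1) + 3) * Real.log G ≤ (99 * L ^ (1/4:ℝ)) * Real.log G := by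
          apply mul_le_mul_of_nonneg_right _ hlg; linarith
      _ = L ^ (1/4:ℝ) * (99 * Real.log G) := by ring
      _ ≤ L ^ (1/4:ℝ) * L ^ (3/4:ℝ) := by gcongr
      _ = L := e.symm
  · have hA : 0 ≤ 2 * Real.pi * (3 * (16 * G^2 * 3 + G)) := by positivity
    have hp := Real.pi_pos
    calc 1 + 2 * Real.pi * (3 * L * (16 * G^2 * (1 + 2 * L) + G))
        ≤ 1 * L^2 + 2 * Real.pi * (3 * L * (16 * G^2 * (1 * L + 2 * L) + G * L)) := by
          gcongr <;> nlinarith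
      _ = (1 + 2 * Real.pi * (3 * (16 * G^2 * 3 + G))) * L^2 := by ring
      _ ≤ L * L^2 := by gcongr
      _ ≤ L^4 := by nlinarith [pow_pos (by linarith : 0 < L) 3]
  · nlinarith
  · have hl2 : (1/2:ℝ) ≤ Real.log 2 := by linarith [Real.log_two_gt_d9]
    have h8 : (6 + 4 * (2 * D * Real.log L + 2)) * Real.log L + B ≤ (14 + 8 * D + B) * Real.log L ^ 2 := by
      nlinarith [mul_nonneg hB0 (sub_nonneg.2 hlog), mul_nonneg hD (sub_nonneg.2 hlog)]
    nlinarith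

lemma er_bd {g X w : ℕ} (hg : 2 ≤ g) (hL : 1 ≤ Real.log X) :
    er g X (g ^ w) (30 * w) ≤ X * Real.log X ^ 3 * (1100 + 12 * g) / (g:ℝ) ^ w := by
  have hg0 : (0:ℝ) < g := by exact_mod_cast (by omega : 0 < g)
  have hg1 : (1:ℝ) ≤ g := by exact_mod_cast (by omega : 1 ≤ g)
  unfold er
  push_cast
  set L := Real.log X
  set V : ℝ := (g:ℝ) ^ w with hV
  have hV1 : 1 ≤ V := one_le_pow₀ hg1
  have e : (g:ℝ) ^ (30 * w) = V ^ 30 := by rw [hV, ← pow_mul, mul_comm]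
  rw [e]
  have e2 : 3 * V ^ 16 * (4 * g * V ^ 8 / V ^ 30 * (X * L)) = 12 * g * (X * L) / V ^ 6 := by
    field_simp; ring
  rw [e2]
  have h1 : 12 * g * (X * L) / V ^ 6 ≤ 12 * g * (X * L^3) / V := by
    have : L ≤ L ^ 3 := le_self_pow₀ hL (by norm_num)
    have hv : V ≤ V ^ 6 := le_self_pow₀ hV1 (by norm_num)
    gcongr
  calc _ ≤ 1100 * X * L^3 / V + 12 * g * (X * L^3) / V := by linarith
    _ = _ := by ring

lemma num_err {L X D B G : ℝ} {d w : ℕ} (h48 : 48 ≤ L) (hX : 0 ≤ X) (hG : 2 ≤ G) (hD0 : 0 ≤ D)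
    (hd1 : (d:ℝ) ≤ 2 * (D * Real.log L + 1)) (hd2 : 2 * (D * Real.log L) ≤ d) (hdL : 2 * (D * Real.log L + 1) + 1 ≤ L)
    (hD : B + 4 ≤ 2 * D) (hw : L ^ (1/4:ℝ) ≤ w)
    (he : (6 + 4 * (2 * D * Real.log L + 2)) * Real.log L + Real.log (2 * (1100 + 12 * G)) ≤ L ^ (1/4:ℝ) * Real.log 2)
    {E Ψ : ℝ} (hE : E ≤ X * L ^ 3 * (1100 + 12 * G) / G ^ w) (hΨ : Ψ ≤ 6 * X) (hΨ0 : 0 ≤ Ψ) :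
    ((d:ℝ) + 1) * (L ^ 4) ^ d * E + 2 * Ψ * (Real.exp (-(d:ℝ)) * (2 * Real.exp (B * Real.log L))) ≤ X / L ^ 2 := by
  have hL0 : 0 < L := by linarith
  have hL1 : 0 < Real.log L := Real.log_pos (by linarith)
  have hA : 0 < 2 * (1100 + 12 * G) := by linarith
  have k1 : (2 * (1100 + 12 * G)) * L ^ (6 + 4 * d) ≤ G ^ w := by
    have e1 : (2 * (1100 + 12 * G)) * L ^ (6 + 4 * d) = Real.exp (Real.log (2 * (1100 + 12 * G)) + (6 + 4 * d) * Real.log L) := by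
      rw [Real.exp_add, Real.exp_log hA]
      congr 1
      rw [← Real.rpow_natCast, Real.rpow_def_of_pos hL0]
      push_cast; ring_nf
    have e2 : Real.exp (w * Real.log 2) ≤ G ^ w := by
      rw [Real.exp_nat_mul, Real.exp_log (by norm_num)]
      exact pow_le_pow_left₀ (by norm_num) hG w
    rw [e1]
    refine le_trans (Real.exp_le_exp.2 ?_) e2
    have e3 : L ^ (1/4:ℝ) * Real.log 2 ≤ w * Real.log 2 := mul_le_mul_of_nonneg_right hw (Real.log_nonneg (by norm_num))
    have e4 : (6 + 4 * (d:ℝ)) * Real.log L ≤ (6 + 4 * (2 * D * Real.log L + 2)) * Real.log L := by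
      apply mul_le_mul_of_nonneg_right _ hL1.le; linarith
    linarith
  have p1 : ((d:ℝ) + 1) * (L ^ 4) ^ d * E ≤ X / L ^ 2 / 2 := by
    have hGw : 0 < G ^ w := pow_pos (by linarith) w
    calc ((d:ℝ) + 1) * (L ^ 4) ^ d * E ≤ L * (L ^ 4) ^ d * (X * L ^ 3 * (1100 + 12 * G) / G ^ w) := by
          have : (d:ℝ) + 1 ≤ L := by linarith
          have h0 : 0 ≤ X * L ^ 3 * (1100 + 12 * G) / G ^ w := by positivity
          calc _ ≤ ((d:ℝ) + 1) * (L ^ 4) ^ d * (X * L ^ 3 * (1100 + 12 * G) / G ^ w) :=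
                mul_le_mul_of_nonneg_left hE (by positivity)
            _ ≤ _ := by gcongr
      _ = (X / L^2 / 2) * (((2 * (1100 + 12 * G)) * L ^ (6 + 4 * d)) / G ^ w) := by
          rw [← pow_mul, pow_add]; field_simp
      _ ≤ (X / L^2 / 2) * 1 := by
          apply mul_le_mul_of_nonneg_left _ (by positivity)
          rw [div_le_one hGw]; exact k1
      _ = _ := mul_one _
  have p2 : 2 * Ψ * (Real.exp (-(d:ℝ)) * (2 * Real.exp (B * Real.log L))) ≤ X / L ^ 2 / 2 := by
    have h1 : Real.exp (-(d:ℝ)) * (2 * Real.exp (B * Real.log L)) ≤ 2 * Real.exp (-4 * Real.log L) := by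
      rw [mul_left_comm, ← Real.exp_add]
      apply mul_le_mul_of_nonneg_left _ (by norm_num)
      apply Real.exp_le_exp.2
      nlinarith
    have h2 : Real.exp (-4 * Real.log L) = 1 / L ^ 4 := by
      have : -4 * Real.log L = -(((4:ℕ):ℝ) * Real.log L) := by push_cast; ring
      rw [this, Real.exp_neg, Real.exp_nat_mul, Real.exp_log hL0, one_div]
    rw [h2] at h1
    calc _ ≤ 2 * (6 * X) * (2 * (1 / L^4)) := by gcongr
      _ = (X / L^2 / 2) * (48 / L^2) := by field_simp; ring
      _ ≤ (X / L^2 / 2) * 1 := by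
          apply mul_le_mul_of_nonneg_left _ (by positivity)
          rw [div_le_one (by positivity)]; nlinarith
      _ = _ := mul_one _
  linarith
end DS

namespace DS
open Finset Filter

lemma exp_eq_ee (t : ℝ) : Complex.exp (Complex.I * ((2 * Real.pi * t : ℝ):ℂ)) = ee t := by
  unfold ee; rw [mul_comm]

lemma la_sum_le (q a X : ℕ) : ∑ n ∈ Icc 1 X, la q a n ≤ 6 * X :=
  (Finset.sum_le_sum fun n _ => la_le q a n).trans (psi_nat_le X)

lemma log_tendsto : Tendsto (fun X : ℕ => Real.log X) atTop atTop :=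
  Real.tendsto_log_atTop.comp tendsto_natCast_atTop_atTop

set_option maxHeartbeats 1000000 in
theorem near (g : ℕ) (hg : 2 ≤ g) (C0 : ℝ) (hC0 : 0 ≤ C0) : ∃ C1 : ℝ, 0 ≤ C1 ∧ ∃ X0 : ℕ, ∀ X : ℕ, X0 ≤ X →
    ∃ m : ℕ, (m:ℝ) ≤ 3 * Real.log X ∧ ∀ α : ℝ, α ^ 2 * Real.log X ≤ C0 * Real.log (Real.log X) → ∀ a : ℕ,
    ‖∑ n ∈ Icc 1 X, (la (g-1) a n : ℂ) * ee (α * ((sd g n : ℝ) - ((g:ℝ)-1)/2 * ((Nat.log g X + 1 : ℕ):ℝ)))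
        - ((p0 g α ^ m : ℝ):ℂ) * (∑ n ∈ Icc 1 X, la (g-1) a n : ℝ)‖ ≤
      X * (C1 * |α| * Real.log X ^ (1/4:ℝ) + 1 / Real.log X ^ 2) := by
  have hgR : (2:ℝ) ≤ g := by exact_mod_cast hg
  have hg0 : (0:ℝ) < g := by linarith
  set B : ℝ := (Real.exp 1 * (2 * Real.pi)) ^ 2 * (g:ℝ)^2 / 8 * (3 * C0) with hB
  have hB0 : 0 ≤ B := by rw [hB]; positivity
  set D : ℝ := (B + 4) / 2 with hD
  have hD0 : 0 ≤ D := by rw [hD]; positivity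
  have ev := log_tendsto.eventually (near_params (g:ℝ) D C0 hgR hD0)
  obtain ⟨X0, hX0⟩ := eventually_atTop.1 ev
  refine ⟨2 * Real.pi * (g * 82) * 6, by positivity, X0 + 2, fun X hX => ?_⟩
  obtain ⟨⟨q1, q2, q3⟩, q4, q5, q6, q7⟩ := hX0 X (by omega)
  have hXne : X ≠ 0 := by omega
  have hXr : (0:ℝ) < X := by exact_mod_cast (Nat.pos_of_ne_zero hXne)
  set L := Real.log X with hL
  have hL0 : 0 < L := by linarith
  have hlogL : 0 < Real.log L := Real.log_pos (by linarith)
  set qt : ℝ := L ^ (1/4:ℝ) with hqt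
  have hqt1 : 1 ≤ qt := Real.one_le_rpow (by linarith) (by norm_num)
  set w : ℕ := ⌊qt⌋₊ + 1 with hw
  have hw1 : qt ≤ w := by rw [hw]; push_cast; exact (Nat.lt_floor_add_one qt).le
  have hw2 : (w:ℝ) ≤ qt + 1 := by
    rw [hw]; push_cast; linarith [Nat.floor_le (by linarith : 0 ≤ qt)]
  set J := Nat.log g X + 1 with hJ
  have hlg : 0 < Real.log g := Real.log_pos (by linarith)
  have hlg2 : (1/2:ℝ) ≤ Real.log g := by
    have := Real.log_le_log (by norm_num) hgR
    linarith [Real.log_two_gt_d9]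
  have hJ1 : g ^ (J - 1) ≤ X := Nat.pow_log_le_self g hXne
  have hJ2 : X < g ^ J := Nat.lt_pow_succ_log_self (by omega) X
  have hJ3 : ((J - 1 : ℕ):ℝ) * Real.log g ≤ L := by
    have : ((g ^ (J-1) : ℕ):ℝ) ≤ X := by exact_mod_cast hJ1
    have := Real.log_le_log (by positivity) this
    rwa [Nat.cast_pow, Real.log_pow] at this
  have hJ4 : L ≤ (J:ℝ) * Real.log g := by
    have : (X:ℝ) ≤ ((g ^ J : ℕ):ℝ) := by exact_mod_cast hJ2.le
    have := Real.log_le_log hXr this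
    rwa [Nat.cast_pow, Real.log_pow] at this
  have hJm : ((J - 1 : ℕ):ℝ) = (J:ℝ) - 1 := by rw [Nat.cast_sub (by omega)]; simp
  have hJ5 : (J:ℝ) ≤ 3 * L := by
    rw [hJm] at hJ3
    have : (0:ℝ) ≤ (J:ℝ) - 1 := by rw [hJ]; push_cast; linarith [Nat.cast_nonneg (α := ℝ) (Nat.log g X)]
    have h2 := mul_le_mul_of_nonneg_left hlg2 this
    linarith
  have hJ6 : 48 * w + 3 ≤ J := by
    have : ((48 * w + 3 : ℕ):ℝ) ≤ J := by
      push_cast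
      have : (48 * (w:ℝ) + 3) * Real.log g ≤ J * Real.log g := by
        refine le_trans (mul_le_mul_of_nonneg_right ?_ hlg.le) (q2.trans hJ4)
        linarith
      exact le_of_mul_le_mul_right this hlg
    exact_mod_cast this
  have hw0 : 1 ≤ w := by omega
  set k1 := 30 * w with hk1
  set k2 := J - 1 - 10 * w with hk2
  have hk : k1 ≤ k2 := by omega
  have hW : 2 ≤ g ^ w := hg.trans (Nat.le_self_pow (by omega) g)
  have hX1 : 2 * g ^ k2 * (g ^ w) ^ 8 ≤ X := by
    calc 2 * g ^ k2 * (g ^ w) ^ 8 ≤ g * g ^ k2 * (g ^ w) ^ 8 := by gcongr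
      _ = g ^ (1 + k2 + w * 8) := by rw [pow_add g (1 + k2), pow_add g 1 k2, pow_one, pow_mul]
      _ ≤ g ^ (J - 1) := Nat.pow_le_pow_right (by omega) (by omega)
      _ ≤ X := hJ1
  have hX2 : g * (g ^ w) ^ 8 ≤ g ^ k2 := by
    calc g * (g ^ w) ^ 8 = g ^ (1 + w * 8) := by rw [pow_add g 1, pow_one, pow_mul]
      _ ≤ g ^ k2 := Nat.pow_le_pow_right (by omega) (by omega)
  have hk2r : (k2:ℝ) ≤ 3 * L := le_trans (by exact_mod_cast (by omega : k2 ≤ J)) hJ5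
  refine ⟨k2 - k1, le_trans (by exact_mod_cast Nat.sub_le _ _) hk2r, fun α hα a => ?_⟩
  have hα1 : |α| ≤ 1 := by
    have : α ^ 2 * L ≤ 1 * L := by linarith
    have := le_of_mul_le_mul_right this hL0
    exact (sq_le_one_iff_abs_le_one α).1 this
  set dd : ℕ := 2 * ⌈D * Real.log L⌉₊ with hdd
  have hdl : 0 ≤ D * Real.log L := by positivity
  have hd1 : (dd:ℝ) ≤ 2 * (D * Real.log L + 1) := by
    rw [hdd]; push_cast; linarith [(Nat.ceil_lt_add_one hdl).le]
  have hd2 : 2 * (D * Real.log L) ≤ dd := by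
    rw [hdd]; push_cast; linarith [Nat.le_ceil (D * Real.log L)]
  have hlgk : Real.log ((g:ℝ) ^ k2) ≤ 2 * L := by
    rw [Real.log_pow]
    have : (k2:ℝ) ≤ ((J-1:ℕ):ℝ) := by exact_mod_cast (by omega : k2 ≤ J - 1)
    have := mul_le_mul_of_nonneg_right this hlg.le
    linarith
  have hK : |2 * Real.pi * α| * (k2 * (16*(g:ℝ)^2*(1+Real.log ((g:ℝ)^k2)) + g)) ≤ L ^ 4 - 1 := by
    have hpi := Real.pi_pos
    have h0 : 0 ≤ Real.log ((g:ℝ)^k2) := Real.log_nonneg (one_le_pow₀ (by linarith))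
    have h1 : |2 * Real.pi * α| ≤ 2 * Real.pi := by
      rw [abs_mul, abs_of_pos (by positivity)]
      exact mul_le_of_le_one_right (by positivity) hα1
    have : |2 * Real.pi * α| * (k2 * (16*(g:ℝ)^2*(1+Real.log ((g:ℝ)^k2)) + g)) ≤ 2 * Real.pi * (3 * L * (16 * (g:ℝ)^2 * (1 + 2 * L) + g)) := by
      gcongr
    linarith
  have hraw := near_raw hg hW hk hX1 hX2 a α dd (even_two_mul _) (L ^ 4 - 1) hK
  have hΨ := la_sum_le (g-1) a X
  have hΨ0 : 0 ≤ ∑ n ∈ Icc 1 X, la (g-1) a n := Finset.sum_nonneg fun n _ => la_nonneg _ _ _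
  have hnum := num_err (B := B) q1 hXr.le hgR hD0 hd1 hd2 q4 (by rw [hD]; linarith) hw1 q5
    (er_bd (w := w) hg (by linarith)) hΨ hΨ0
  have hexp : Real.exp ((Real.exp 1 * (2 * Real.pi * α)) ^ 2 * (g:ℝ) ^ 2 / 8 * k2) ≤ Real.exp (B * Real.log L) := by
    apply Real.exp_le_exp.2
    have h1 : α ^ 2 * k2 ≤ 3 * C0 * Real.log L := by
      have := mul_le_mul_of_nonneg_left hk2r (sq_nonneg α)
      linarith
    calc (Real.exp 1 * (2 * Real.pi * α)) ^ 2 * (g:ℝ) ^ 2 / 8 * k2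
        = ((Real.exp 1 * (2 * Real.pi)) ^ 2 * (g:ℝ)^2 / 8) * (α ^ 2 * k2) := by ring
      _ ≤ ((Real.exp 1 * (2 * Real.pi)) ^ 2 * (g:ℝ)^2 / 8) * (3 * C0 * Real.log L) := by gcongr
      _ = _ := by rw [hB]; ring
  have hmain : ‖∑ n ∈ Icc 1 X, (la (g-1) a n : ℂ) * Complex.exp (Complex.I * ((2 * Real.pi * α * TT g k1 k2 n : ℝ):ℂ))
        - ((p0 g α ^ (k2 - k1) : ℝ):ℂ) * (∑ n ∈ Icc 1 X, la (g-1) a n : ℝ)‖ ≤ X / L ^ 2 := by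
    refine hraw.trans (le_trans ?_ hnum)
    rw [add_sub_cancel]
    gcongr
  have hdiff : ‖∑ n ∈ Icc 1 X, (la (g-1) a n : ℂ) * ee (α * ((sd g n : ℝ) - ((g:ℝ)-1)/2 * (J:ℝ))) -
      ∑ n ∈ Icc 1 X, (la (g-1) a n : ℂ) * Complex.exp (Complex.I * ((2 * Real.pi * α * TT g k1 k2 n : ℝ):ℂ))‖ ≤
      X * (2 * Real.pi * (g * 82) * 6 * |α| * qt) := by
    rw [← Finset.sum_sub_distrib]
    have : ∀ n ∈ Icc 1 X, ‖(la (g-1) a n : ℂ) * ee (α * ((sd g n : ℝ) - ((g:ℝ)-1)/2 * (J:ℝ))) -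
        (la (g-1) a n : ℂ) * Complex.exp (Complex.I * ((2 * Real.pi * α * TT g k1 k2 n : ℝ):ℂ))‖ ≤
        la (g-1) a n * (2 * Real.pi * (g * 82) * |α| * qt) := by
      intro n hn
      have hn := mem_Icc.1 hn
      rw [← mul_sub, norm_mul, Complex.norm_real, Real.norm_of_nonneg (la_nonneg _ _ _)]
      refine mul_le_mul_of_nonneg_left ?_ (la_nonneg _ _ _)
      rw [mul_assoc (2 * Real.pi) α, exp_eq_ee]
      refine (norm_ee_sub_le _ _).trans ?_
      rw [← mul_sub, abs_mul]
      have h1 := sd_TT hg hk (by omega : k2 ≤ J) n (lt_of_le_of_lt hn.2 hJ2)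
      have h2 : (k1:ℝ) + (J - k2 : ℕ) ≤ 82 * qt := by
        have : k1 + (J - k2) = 40 * w + 1 := by omega
        have h3 : (k1:ℝ) + (J - k2 : ℕ) = 40 * w + 1 := by exact_mod_cast this
        rw [h3]; linarith
      calc 2 * Real.pi * (|α| * |((sd g n : ℝ) - ((g:ℝ)-1)/2 * J) - TT g k1 k2 n|)
          ≤ 2 * Real.pi * (|α| * (g * (82 * qt))) := by
            gcongr
            exact h1.trans (by gcongr)
        _ = _ := by ring
    refine (norm_sum_le_of_le _ this).trans ?_
    rw [← Finset.sum_mul]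
    calc _ ≤ (6 * X) * (2 * Real.pi * (g * 82) * |α| * qt) := by gcongr
      _ = _ := by ring
  refine (norm_sub_le_norm_sub_add_norm_sub _ _ _).trans ((add_le_add hdiff hmain).trans (le_of_eq ?_))
  ring
end DS

namespace DS
open Finset Filter ArithmeticFunction

lemma la_lower (q : ℕ) (hq : 0 < q) : ∃ c : ℝ, 0 < c ∧ ∃ X0 : ℕ, ∀ X : ℕ, X0 ≤ X → ∀ ℓ : ℕ, Nat.Coprime ℓ q →
    c * X ≤ ∑ n ∈ Icc 1 X, la q ℓ n := by
  haveI : NeZero q := ⟨hq.ne'⟩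
  have h : ∀ a : ZMod q, ∃ c : ℝ, 0 < c ∧ ∃ X0 : ℕ, IsUnit a → ∀ X : ℕ, X0 ≤ X →
      c * X ≤ ∑ n ∈ Icc 1 X, vonMangoldt.residueClass a n := by
    intro a
    by_cases ha : IsUnit a
    · obtain ⟨c, hc, X0, h⟩ := psi_ap_lower ha
      exact ⟨c, hc, X0, fun _ => h⟩
    · exact ⟨1, one_pos, 0, fun h => absurd h ha⟩
  choose c hc X0 hX using h
  obtain ⟨a0, _, ha0⟩ := Finset.exists_min_image (univ : Finset (ZMod q)) c ⟨0, mem_univ _⟩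
  refine ⟨c a0, hc a0, univ.sup X0, fun X hX0 ℓ hℓ => ?_⟩
  have hu : IsUnit (ℓ : ZMod q) := (ZMod.isUnit_iff_coprime ℓ q).2 hℓ
  have h1 := hX (ℓ : ZMod q) hu X ((Finset.le_sup (f := X0) (mem_univ _)).trans hX0)
  have h2 := ha0 (ℓ : ZMod q) (mem_univ _)
  have e : ∑ n ∈ Icc 1 X, vonMangoldt.residueClass (ℓ : ZMod q) n = ∑ n ∈ Icc 1 X, la q ℓ n := by
    refine Finset.sum_congr rfl fun n _ => ?_
    unfold la vonMangoldt.residueClass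
    have : (n : ZMod q) = (ℓ : ZMod q) ↔ (q:ℤ) ∣ (n:ℤ) - (ℓ:ℤ) := by
      rw [← ZMod.intCast_zmod_eq_zero_iff_dvd]
      push_cast
      rw [sub_eq_zero]
    by_cases hh : (n : ZMod q) = (ℓ : ZMod q)
    · rw [if_pos (this.1 hh), Set.indicator_of_mem (by exact hh)]
    · rw [if_neg (fun h => hh (this.2 h)), Set.indicator_of_notMem (by exact hh)]
  rw [← e]
  exact (mul_le_mul_of_nonneg_right h2 (Nat.cast_nonneg X)).trans h1

lemma integral_ee (k : ℤ) : ∫ β in (-(1/2):ℝ)..(1/2), ee (β * k) = if k = 0 then 1 else 0 := by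
  by_cases hk : k = 0
  · rw [if_pos hk]; subst hk; simp [ee_zero]; norm_num
  · rw [if_neg hk]
    have hc : ((2 * Real.pi * k : ℝ) * Complex.I : ℂ) ≠ 0 := by
      apply mul_ne_zero _ Complex.I_ne_zero
      have : (2 * Real.pi * k : ℝ) ≠ 0 := by
        have : (k:ℝ) ≠ 0 := by exact_mod_cast hk
        have := Real.pi_ne_zero
        positivity
      exact_mod_cast this
    have e : ∀ β : ℝ, ee (β * k) = Complex.exp (((2 * Real.pi * k : ℝ) * Complex.I : ℂ) * β) := by
      intro β; unfold ee; congr 1; push_cast; ring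
    simp_rw [e]
    rw [integral_exp_mul_complex hc, ← e, ← e]
    have : ee (1/2 * k) = ee (-(1/2) * k) := by
      have : (1/2 * k : ℝ) = -(1/2) * k + (k:ℤ) := by ring
      rw [this, ee_add_int]
    rw [this, sub_self, zero_div]

lemma int_lower (F : ℝ → ℝ) (hF : Continuous F) {η κ a b c : ℝ} (hη : 0 ≤ η) (hκ : η ≤ κ) (hκ2 : κ ≤ 1/2)
    (hb : 0 ≤ b) (hc : 0 ≤ c) (h1 : ∀ β, |β| ≤ η → a ≤ F β) (h2 : ∀ β, |β| ≤ κ → -b ≤ F β)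
    (h3 : ∀ β, κ ≤ |β| → |β| ≤ 1/2 → -c ≤ F β) :
    2 * η * a - 2 * κ * b - c ≤ ∫ β in (-(1/2):ℝ)..(1/2), F β := by
  have hi : ∀ u v, IntervalIntegrable F MeasureTheory.volume u v := fun u v => hF.intervalIntegrable u v
  have lb : ∀ u v C : ℝ, u ≤ v → (∀ x ∈ Set.Icc u v, C ≤ F x) → (v - u) * C ≤ ∫ β in u..v, F β := by
    intro u v C huv h
    have := intervalIntegral.integral_mono_on huv (_root_.intervalIntegrable_const) (hi u v) h
    simpa using this
  have s1 := intervalIntegral.integral_add_adjacent_intervals (hi (-(1/2)) (-κ)) (hi (-κ) (-η))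
  have s2 := intervalIntegral.integral_add_adjacent_intervals (hi (-(1/2)) (-η)) (hi (-η) η)
  have s3 := intervalIntegral.integral_add_adjacent_intervals (hi (-(1/2)) η) (hi η κ)
  have s4 := intervalIntegral.integral_add_adjacent_intervals (hi (-(1/2)) κ) (hi κ (1/2))
  have l1 := lb (-(1/2)) (-κ) (-c) (by linarith) (fun x hx => h3 x (by
    rw [abs_of_nonpos (by linarith [hx.2])]; linarith [hx.2]) (by
    rw [abs_of_nonpos (by linarith [hx.2])]; linarith [hx.1]))
  have l2 := lb (-κ) (-η) (-b) (by linarith) (fun x hx => h2 x (by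
    rw [abs_of_nonpos (by linarith [hx.2])]; linarith [hx.1]))
  have l3 := lb (-η) η a (by linarith) (fun x hx => h1 x (abs_le.2 hx))
  have l4 := lb η κ (-b) (by linarith) (fun x hx => h2 x (by
    rw [abs_of_nonneg (by linarith [hx.1])]; linarith [hx.2]))
  have l5 := lb κ (1/2) (-c) (by linarith) (fun x hx => h3 x (by
    rw [abs_of_nonneg (by linarith [hx.1])]; linarith [hx.1]) (by
    rw [abs_of_nonneg (by linarith [hx.1])]; linarith [hx.2]))
  have hηb : 0 ≤ η * b := by positivity
  have hκc : 0 ≤ κ * c := mul_nonneg (by linarith) hc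
  nlinarith

lemma sd_modEq (g : ℕ) (hg : 2 ≤ g) (n : ℕ) : ((g-1:ℕ):ℤ) ∣ (n:ℤ) - (sd g n : ℤ) := by
  have h : n ≡ (Nat.digits g n).sum [MOD (g-1)] := by
    by_cases h2 : g = 2
    · subst h2; exact Nat.modEq_one
    · apply Nat.modEq_digits_sum
      obtain ⟨k, rfl⟩ := Nat.exists_eq_add_of_le hg
      have : 2 + k - 1 = k + 1 := by omega
      rw [this]
      have e : 2 + k = 1 + (k+1) := by omega
      rw [e, Nat.add_mod_right]
      exact Nat.mod_eq_of_lt (by omega)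
  exact (Nat.modEq_iff_dvd.1 h.symm)

noncomputable def Sl (g ℓ X : ℕ) (β : ℝ) : ℂ :=
  ∑ n ∈ Icc 1 X, (la (g-1) ℓ n : ℂ) * ee (β / ((g-1:ℕ):ℝ) * ((sd g n : ℝ) - ℓ))

lemma Sl_cont (g ℓ X : ℕ) : Continuous (Sl g ℓ X) := by
  unfold Sl
  refine continuous_finsetSum _ fun n _ => continuous_const.mul (continuous_ee.comp (by fun_prop))

lemma Sl_int (g ℓ X : ℕ) (hg : 2 ≤ g) :
    ∫ β in (-(1/2):ℝ)..(1/2), (Sl g ℓ X β).re = ∑ n ∈ (Icc 1 X).filter (fun n => sd g n = ℓ), vonMangoldt n := by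
  have hq : 0 < g - 1 := by omega
  have hqr : (0:ℝ) < ((g-1:ℕ):ℝ) := by exact_mod_cast hq
  have h1 : ∫ β in (-(1/2):ℝ)..(1/2), Sl g ℓ X β = ((∑ n ∈ (Icc 1 X).filter (fun n => sd g n = ℓ), vonMangoldt n : ℝ):ℂ) := by
    unfold Sl
    rw [intervalIntegral.integral_finsetSum, Complex.ofReal_sum, Finset.sum_filter]
    · refine Finset.sum_congr rfl fun n _ => ?_
      rw [intervalIntegral.integral_const_mul]
      have hd := sd_modEq g hg n
      by_cases hl : ((g-1:ℕ):ℤ) ∣ (n:ℤ) - (ℓ:ℤ)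
      · have h2 : ((g-1:ℕ):ℤ) ∣ (sd g n:ℤ) - (ℓ:ℤ) := by
          have := dvd_sub hl hd
          have e : (n:ℤ) - ℓ - (n - sd g n) = (sd g n:ℤ) - (ℓ:ℤ) := by ring
          rwa [e] at this
        obtain ⟨k, hk⟩ := h2
        have hkr : (sd g n:ℝ) - ℓ = ((g-1:ℕ):ℝ) * k := by exact_mod_cast hk
        have e : ∀ β : ℝ, ee (β / ((g-1:ℕ):ℝ) * ((sd g n : ℝ) - ℓ)) = ee (β * k) := by
          intro β; rw [hkr]; congr 1; field_simp
        simp_rw [e]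
        rw [integral_ee, la, if_pos hl]
        by_cases hk0 : k = 0
        · have : sd g n = ℓ := by subst hk0; simp at hk; omega
          rw [if_pos hk0, if_pos this, mul_one]
        · have : ¬ sd g n = ℓ := by
            intro h; rw [h, sub_self] at hk
            have := mul_eq_zero.1 hk.symm
            rcases this with h | h
            · have : (g - 1 : ℕ) = 0 := by exact_mod_cast h
              omega
            · exact hk0 h
          rw [if_neg hk0, if_neg this, mul_zero]
      · have h3 : ¬ sd g n = ℓ := by
          intro h; rw [h] at hd; exact hl hd
        rw [la, if_neg hl, if_neg h3]; simp
    · intro n _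
      exact (continuous_const.mul (continuous_ee.comp (by fun_prop))).intervalIntegrable _ _
  have h2 : ∫ β in (-(1/2):ℝ)..(1/2), (Sl g ℓ X β).re = (∫ β in (-(1/2):ℝ)..(1/2), Sl g ℓ X β).re := by
    have := Complex.reCLM.intervalIntegral_comp_comm ((Sl_cont g ℓ X).intervalIntegrable (μ := MeasureTheory.volume) (-(1/2)) (1/2))
    simpa using this
  rw [h2, h1, Complex.ofReal_re]

end DS

namespace DS
open Finset Filter ArithmeticFunction

lemma Sl_minor (g : ℕ) (hg : 2 ≤ g) {C0 E : ℝ} (X : ℕ)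
    (h : ∀ α : ℝ, C0 ≤ nn (((g:ℝ)-1)*α)^2 * Real.log X → ‖∑ n ∈ Icc 1 X, (vonMangoldt n : ℂ) * fd g α n‖ ≤ E)
    (ℓ : ℕ) (β : ℝ) (hβ : |β| ≤ 1/2) (hC : C0 ≤ β ^ 2 * Real.log X) : ‖Sl g ℓ X β‖ ≤ E := by
  have hq : 0 < g - 1 := by omega
  have hqr : (0:ℝ) < ((g-1:ℕ):ℝ) := by exact_mod_cast hq
  have hqe : ((g-1:ℕ):ℝ) = (g:ℝ) - 1 := by rw [Nat.cast_sub (by omega)]; simp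
  unfold Sl
  refine la_norm hq ℓ X _ _ fun b hb => ?_
  have e : ∑ n ∈ Icc 1 X, (vonMangoldt n : ℂ) * ee ((b:ℝ) / ((g-1:ℕ):ℝ) * n) * ee (β / ((g-1:ℕ):ℝ) * ((sd g n : ℝ) - ℓ))
      = ee (-(β / ((g-1:ℕ):ℝ) * ℓ)) * ∑ n ∈ Icc 1 X, (vonMangoldt n : ℂ) * fd g ((β + b) / ((g-1:ℕ):ℝ)) n := by
    rw [Finset.mul_sum]
    refine Finset.sum_congr rfl fun n _ => ?_
    obtain ⟨k, hk⟩ := sd_modEq g hg n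
    have hkr : (n:ℝ) = sd g n + ((g-1:ℕ):ℝ) * k := by
      have : (n:ℝ) - sd g n = ((g-1:ℕ):ℝ) * k := by exact_mod_cast hk
      linarith
    have e1 : ee ((b:ℝ) / ((g-1:ℕ):ℝ) * n) = ee ((b:ℝ) / ((g-1:ℕ):ℝ) * sd g n) := by
      have : (b:ℝ) / ((g-1:ℕ):ℝ) * n = (b:ℝ) / ((g-1:ℕ):ℝ) * sd g n + ((b * k : ℤ):ℝ) := by
        rw [hkr]; push_cast; field_simp
      rw [this, ee_add_int]
    rw [e1]
    unfold fd
    have e2 : (β + b) / ((g-1:ℕ):ℝ) * sd g n = (b:ℝ) / ((g-1:ℕ):ℝ) * sd g n + (β / ((g-1:ℕ):ℝ) * ((sd g n : ℝ) - ℓ)) + β / ((g-1:ℕ):ℝ) * ℓ := by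
      ring
    rw [e2, ee_add, ee_add]
    have hi : ee (-(β / ((g-1:ℕ):ℝ) * ℓ)) * ee (β / ((g-1:ℕ):ℝ) * ℓ) = 1 := by
      rw [← ee_add, neg_add_cancel, ee_zero]
    linear_combination (-((vonMangoldt n : ℂ) * ee ((b:ℝ) / ((g-1:ℕ):ℝ) * sd g n) * ee (β / ((g-1:ℕ):ℝ) * ((sd g n : ℝ) - ℓ)))) * hi
  rw [e, norm_mul, norm_ee, one_mul]
  apply h
  have e3 : ((g:ℝ)-1) * ((β + b) / ((g-1:ℕ):ℝ)) = β + b := by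
    rw [hqe] at hqr ⊢; field_simp
  rw [e3, nn_add_nat, nn_eq_abs hβ, sq_abs]
  exact hC

lemma p0_ge (g : ℕ) (hg : 2 ≤ g) (α : ℝ) : 1 - 5 * (g:ℝ)^2 * α^2 ≤ p0 g α := by
  have hg0 : (0:ℝ) < g := by exact_mod_cast (by omega : 0 < g)
  unfold p0
  have : ∀ c ∈ range g, 1 - 5 * (g:ℝ)^2 * α^2 ≤ Real.cos (2 * Real.pi * (α * ((c:ℝ) - ((g:ℝ)-1)/2))) := by
    intro c hc
    have hc : (c:ℝ) + 1 ≤ g := by exact_mod_cast mem_range.1 hc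
    have hc0 : (0:ℝ) ≤ c := Nat.cast_nonneg c
    have h1 : ((c:ℝ) - ((g:ℝ)-1)/2)^2 ≤ (g:ℝ)^2/4 := by nlinarith
    refine le_trans ?_ (Real.one_sub_sq_div_two_le_cos)
    have hp : Real.pi ^ 2 ≤ 10 := by nlinarith [Real.pi_lt_d2, Real.pi_pos]
    have e : (2 * Real.pi * (α * ((c:ℝ) - ((g:ℝ)-1)/2)))^2 / 2 = 2 * α^2 * (Real.pi^2 * ((c:ℝ) - ((g:ℝ)-1)/2)^2) := by ring
    have h2 : Real.pi^2 * ((c:ℝ) - ((g:ℝ)-1)/2)^2 ≤ 10 * ((g:ℝ)^2/4) := mul_le_mul hp h1 (sq_nonneg _) (by norm_num)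
    have h3 := mul_le_mul_of_nonneg_left h2 (by positivity : 0 ≤ 2 * α^2)
    rw [e]; linarith
  have h2 := Finset.sum_le_sum this
  simp only [sum_const, card_range, nsmul_eq_mul] at h2
  calc 1 - 5 * (g:ℝ)^2 * α^2 = 1 / (g:ℝ) * (g * (1 - 5 * (g:ℝ)^2 * α^2)) := by field_simp
    _ ≤ _ := mul_le_mul_of_nonneg_left h2 (by positivity)

lemma Sl_near (g ℓ X m J : ℕ) (hg : 2 ≤ g) (β Ψ E : ℝ) (hΨ0 : 0 ≤ Ψ)
    (hE : ‖∑ n ∈ Icc 1 X, (la (g-1) ℓ n : ℂ) * ee (β / ((g-1:ℕ):ℝ) * ((sd g n : ℝ) - ((g:ℝ)-1)/2 * (J:ℝ)))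
        - ((p0 g (β / ((g-1:ℕ):ℝ)) ^ m : ℝ):ℂ) * (Ψ : ℝ)‖ ≤ E)
    (hℓ : |(ℓ:ℝ) - ((g:ℝ)-1)/2 * J| ≤ 2 * g) (hβ : 20 * g * |β| ≤ 1) :
    -E ≤ (Sl g ℓ X β).re ∧ (10 * (g:ℝ)^2 * β^2 * m ≤ 1 → Ψ / 4 - E ≤ (Sl g ℓ X β).re) := by
  have hgR : (2:ℝ) ≤ g := by exact_mod_cast hg
  have hq : 1 ≤ g - 1 := by omega
  have hqr : (1:ℝ) ≤ ((g-1:ℕ):ℝ) := by exact_mod_cast hq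
  set α := β / ((g-1:ℕ):ℝ) with hα
  have hαβ : |α| ≤ |β| := by
    rw [hα, abs_div, abs_of_pos (by linarith : (0:ℝ) < ((g-1:ℕ):ℝ))]
    exact div_le_self (abs_nonneg _) hqr
  have hα2 : α^2 ≤ β^2 := sq_le_sq.2 hαβ
  set S := ∑ n ∈ Icc 1 X, (la (g-1) ℓ n : ℂ) * ee (α * ((sd g n : ℝ) - ((g:ℝ)-1)/2 * (J:ℝ))) with hS
  set δ := ((g:ℝ)-1)/2 * J - ℓ with hδ
  have e : Sl g ℓ X β = ee (α * δ) * S := by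
    unfold Sl
    rw [hS, Finset.mul_sum]
    refine Finset.sum_congr rfl fun n _ => ?_
    have : β / ((g-1:ℕ):ℝ) * ((sd g n : ℝ) - ℓ) = α * δ + α * ((sd g n : ℝ) - ((g:ℝ)-1)/2 * (J:ℝ)) := by
      rw [hδ, hα]; ring
    rw [this, ee_add]; ring
  set P := p0 g α ^ m with hP
  have e2 : Sl g ℓ X β = ((P * Ψ : ℝ):ℂ) * ee (α * δ) + ee (α * δ) * (S - ((P:ℝ):ℂ) * (Ψ:ℝ)) := by
    rw [e]; push_cast; ring
  have e3 : (Sl g ℓ X β).re = P * Ψ * Real.cos (2 * Real.pi * (α * δ)) + (ee (α * δ) * (S - ((P:ℝ):ℂ) * (Ψ:ℝ))).re := by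
    rw [e2, Complex.add_re, Complex.re_ofReal_mul, ee_re]
  have e4 : -E ≤ (ee (α * δ) * (S - ((P:ℝ):ℂ) * (Ψ:ℝ))).re := by
    have h := Complex.abs_re_le_norm (ee (α * δ) * (S - ((P:ℝ):ℂ) * (Ψ:ℝ)))
    rw [norm_mul, norm_ee, one_mul] at h
    linarith [(abs_le.1 (h.trans hE)).1]
  have hcos : 1/2 ≤ Real.cos (2 * Real.pi * (α * δ)) := by
    refine le_trans ?_ (Real.one_sub_sq_div_two_le_cos)
    have h1 : |2 * Real.pi * (α * δ)| ≤ 1 := by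
      rw [abs_mul (2 * Real.pi), abs_mul α, abs_of_pos (by positivity : 0 < 2 * Real.pi), hδ, abs_sub_comm]
      have hp : 2 * Real.pi ≤ 7 := by linarith [Real.pi_lt_d2]
      calc 2 * Real.pi * (|α| * |(ℓ:ℝ) - ((g:ℝ)-1)/2 * J|) ≤ 7 * (|β| * (2 * g)) := by gcongr
        _ = 14 * (g * |β|) := by ring
        _ ≤ 20 * (g * |β|) := by gcongr; norm_num
        _ ≤ 1 := by linarith
    have := (sq_le_one_iff_abs_le_one _).2 h1
    linarith
  have hp0 : 1 - 5 * (g:ℝ)^2 * β^2 ≤ p0 g α := by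
    refine le_trans ?_ (p0_ge g hg α)
    have := mul_le_mul_of_nonneg_left hα2 (by positivity : 0 ≤ 5 * (g:ℝ)^2)
    linarith
  have hsm : 5 * (g:ℝ)^2 * β^2 ≤ 1 := by
    have h0 : 0 ≤ g * |β| := by positivity
    have h1 : (g * |β|)^2 ≤ 1/400 := by nlinarith
    rw [mul_pow, sq_abs] at h1
    linarith
  have hp00 : 0 ≤ p0 g α := by linarith
  have hP0 : 0 ≤ P := pow_nonneg hp00 m
  refine ⟨?_, fun hm => ?_⟩
  · rw [e3]
    have : 0 ≤ P * Ψ * Real.cos (2 * Real.pi * (α * δ)) := mul_nonneg (mul_nonneg hP0 hΨ0) (by linarith)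
    linarith
  · have hPh : 1/2 ≤ P := by
      have hb := one_add_mul_le_pow (a := -(5 * (g:ℝ)^2 * β^2)) (by linarith) m
      have : (1 + -(5 * (g:ℝ)^2 * β^2)) ^ m ≤ P := pow_le_pow_left₀ (by linarith) (by linarith) m
      have e5 : (m:ℝ) * -(5 * (g:ℝ)^2 * β^2) = -(10 * (g:ℝ)^2 * β^2 * m) / 2 := by ring
      rw [e5] at hb
      linarith
    rw [e3]
    have h1 : (1/2) * Ψ ≤ P * Ψ := mul_le_mul_of_nonneg_right hPh hΨ0
    have h2 : ((1/2) * Ψ) * (1/2) ≤ P * Ψ * Real.cos (2 * Real.pi * (α * δ)) :=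
      mul_le_mul h1 hcos (by norm_num) (mul_nonneg hP0 hΨ0)
    linarith

end DS

namespace DS
open Finset Filter ArithmeticFunction

lemma fin_num {X r lL C0 C1 A η κ cψ : ℝ} (hX : 0 ≤ X) (hr : 1 ≤ r) (hA : 0 < A) (hη : 2 * η * (cψ / 8) = 2 * A / r ^ 2)
    (hκ : κ ^ 2 * r ^ 4 = C0 * lL) (hκ1 : κ ≤ 1/2) (h1 : 4 * C1 * C0 * lL ≤ A * r) (h2 : 4 ≤ A * r ^ 2) :
    A * X / r ^ 2 ≤ 2 * η * (cψ * X / 8) - 2 * κ * (X * (C1 * κ * r + 1 / (r ^ 4) ^ 2)) - X / r ^ 4 := by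
  have hr0 : 0 < r := by linarith
  have e1 : 2 * η * (cψ * X / 8) = X * (2 * A / r ^ 2) := by rw [← hη]; ring
  have e2 : 2 * κ * (X * (C1 * κ * r + 1 / (r ^ 4) ^ 2)) = X * (2 * C1 * κ ^ 2 * r + 2 * κ / r ^ 8) := by
    field_simp
  have hκ2 : κ ^ 2 = C0 * lL / r ^ 4 := by rw [← hκ]; field_simp
  have e3 : 2 * C1 * κ ^ 2 * r ≤ A / 2 / r ^ 2 := by
    have : 2 * C1 * κ ^ 2 * r = (4 * C1 * C0 * lL) / (2 * r ^ 3) := by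
      rw [hκ2]; field_simp; ring
    rw [this]
    calc _ ≤ (A * r) / (2 * r ^ 3) := by gcongr
      _ = _ := by field_simp
  have e4 : 2 * κ / r ^ 8 ≤ 1 / r ^ 4 := by
    calc 2 * κ / r ^ 8 ≤ 1 / r ^ 8 := by gcongr; linarith
      _ ≤ 1 / r ^ 4 := by
        apply one_div_le_one_div_of_le (by positivity)
        exact pow_le_pow_right₀ hr (by norm_num)
  have e5 : 2 / r ^ 4 ≤ A / 2 / r ^ 2 := by
    rw [div_le_div_iff₀ (by positivity) (by positivity)]
    have : 0 < r ^ 2 := by positivity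
    nlinarith
  have e6 : A * X / r ^ 2 = X * (A / r ^ 2) := by ring
  have e7 : X / r ^ 4 = X * (1 / r ^ 4) := by ring
  have e8 : A / 2 / r ^ 2 = (A / r ^ 2) / 2 := by ring
  have e9 : 2 * A / r ^ 2 = 2 * (A / r ^ 2) := by ring
  have e10 : 2 / r ^ 4 = 2 * (1 / r ^ 4) := by ring
  rw [e1, e2, e6, e7, ← mul_sub, ← mul_sub]
  apply mul_le_mul_of_nonneg_left _ hX
  rw [e8] at e3 e5
  rw [e10] at e5
  rw [e9]
  linarith

set_option maxHeartbeats 2000000 in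
theorem weighted (g : ℕ) (hg : 2 ≤ g) : ∃ c : ℝ, 0 < c ∧ ∃ X0 : ℕ, ∀ X : ℕ, X0 ≤ X → ∀ ℓ : ℕ, Nat.Coprime ℓ (g-1) →
    |(ℓ:ℝ) - ((g:ℝ)-1)/2 * ((Nat.log g X + 1 : ℕ):ℝ)| ≤ 2 * g →
    c * X / Real.sqrt (Real.log X) ≤ ∑ n ∈ (Icc 1 X).filter (fun n => sd g n = ℓ), vonMangoldt n := by
  have hgR : (2:ℝ) ≤ g := by exact_mod_cast hg
  have hq : 1 ≤ g - 1 := by omega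
  have hqr : (1:ℝ) ≤ ((g-1:ℕ):ℝ) := by exact_mod_cast hq
  obtain ⟨C0, Xm, hC0, hminor⟩ := minor_fd g hg
  obtain ⟨C1, hC1, Xn, hnear⟩ := near g hg C0 (by linarith)
  obtain ⟨cψ, hcψ, Xψ, hψ⟩ := la_lower (g-1) (by omega)
  set A : ℝ := cψ / (48 * g) with hA
  have hA0 : 0 < A := by rw [hA]; positivity
  have ev1 := log_tendsto.eventually (polylogR (4 * C1 * C0 / A) 1 (δ := 1/4) (by norm_num))
  have ev2 := log_tendsto.eventually (polylogR (400 * (g:ℝ)^2 * C0) 1 (δ := 1) (by norm_num))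
  have ev3 := log_tendsto.eventually ((tendsto_rpow_atTop (y := 1/4) (by norm_num)).eventually_ge_atTop (1 + 4 / A + 8 * (C1 + 1) / cψ))
  have ev4 := log_tendsto.eventually (eventually_ge_atTop (4:ℝ))
  obtain ⟨X1, hX1⟩ := eventually_atTop.1 (ev1.and (ev2.and (ev3.and ev4)))
  refine ⟨A, hA0, X1 + Xm + Xn + Xψ, fun X hX ℓ hcop hℓ => ?_⟩
  obtain ⟨q1, q2, q3, q4⟩ := hX1 X (by omega)
  have hm := hminor X (by omega)
  obtain ⟨m, hmL, hn⟩ := hnear X (by omega)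
  have hΨ := hψ X (by omega) ℓ hcop
  set Ψ := ∑ n ∈ Icc 1 X, la (g-1) ℓ n with hΨdef
  have hΨ0 : 0 ≤ Ψ := Finset.sum_nonneg fun n _ => la_nonneg _ _ _
  have hXr : (0:ℝ) ≤ X := Nat.cast_nonneg X
  set L := Real.log X with hL
  have hL0 : 0 < L := by linarith
  set r : ℝ := L ^ (1/4:ℝ) with hr
  have hr4 : r ^ 4 = L := by
    rw [hr, ← Real.rpow_natCast, ← Real.rpow_mul hL0.le]; norm_num
  have hA4 : 0 ≤ 4 / A := by positivity
  have hc8 : 0 ≤ 8 * (C1 + 1) / cψ := by positivity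
  have hr1 : 1 ≤ r := by linarith
  have hr0 : 0 < r := by linarith
  have hsq : Real.sqrt L = r ^ 2 := by
    rw [← hr4, show r ^ 4 = (r ^ 2) ^ 2 by ring, Real.sqrt_sq (by positivity)]
  rw [pow_one] at q1 q2
  rw [Real.rpow_one] at q2
  have hlL : 1 ≤ Real.log L := by
    rw [Real.le_log_iff_exp_le hL0]
    linarith [Real.exp_one_lt_d9]
  have hCl : 1 ≤ C0 * Real.log L := by nlinarith
  set κ : ℝ := Real.sqrt (C0 * Real.log L) / r ^ 2 with hκ
  have hκ0 : 0 ≤ κ := by rw [hκ]; positivity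
  have hκ2 : κ ^ 2 * r ^ 4 = C0 * Real.log L := by
    rw [hκ, div_pow, Real.sq_sqrt (by linarith)]; field_simp
  set η : ℝ := 1 / (6 * g) / r ^ 2 with hη
  have hη0 : 0 ≤ η := by rw [hη]; positivity
  have hη1 : η ≤ 1 / r ^ 2 := by
    rw [hη]; gcongr
    rw [div_le_one (by positivity)]; linarith
  have hηκ : η ≤ κ := by
    refine hη1.trans ?_
    rw [hκ]
    gcongr
    exact Real.one_le_sqrt.2 hCl
  have hκg : 20 * g * κ ≤ 1 := by
    have : (20 * g * κ)^2 ≤ 1 ^ 2 := by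
      have e : (20 * g * κ)^2 * r ^ 4 = 400 * (g:ℝ)^2 * C0 * Real.log L := by
        rw [mul_pow, mul_assoc, hκ2]; ring
      have h4 : 0 < r ^ 4 := by positivity
      have : (20 * g * κ)^2 * r ^ 4 ≤ 1 ^ 2 * r ^ 4 := by rw [e, hr4]; linarith
      exact le_of_mul_le_mul_right this h4
    exact le_of_sq_le_sq this (by norm_num)
  have hκh : κ ≤ 1/2 := by nlinarith
  have hnb : ∀ β : ℝ, |β| ≤ κ → -(X * (C1 * |β| * r + 1 / L ^ 2)) ≤ (Sl g ℓ X β).re ∧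
      (10 * (g:ℝ)^2 * β^2 * m ≤ 1 → Ψ / 4 - X * (C1 * |β| * r + 1 / L ^ 2) ≤ (Sl g ℓ X β).re) := by
    intro β hβ
    have hαβ : |β / ((g-1:ℕ):ℝ)| ≤ |β| := by
      rw [abs_div, abs_of_pos (by linarith : (0:ℝ) < ((g-1:ℕ):ℝ))]
      exact div_le_self (abs_nonneg _) hqr
    have hα2 : (β / ((g-1:ℕ):ℝ)) ^ 2 * L ≤ C0 * Real.log L := by
      rw [← hκ2, hr4]
      apply mul_le_mul_of_nonneg_right _ hL0.le
      exact sq_le_sq.2 (hαβ.trans (hβ.trans (le_abs_self κ)))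
    have h1 := hn (β / ((g-1:ℕ):ℝ)) hα2 ℓ
    refine Sl_near g ℓ X m (Nat.log g X + 1) hg β Ψ _ hΨ0 (h1.trans ?_) hℓ ?_
    · gcongr
    · refine le_trans ?_ hκg
      gcongr
  rw [← Sl_int g ℓ X hg]
  have key := int_lower (fun β => (Sl g ℓ X β).re) (Complex.continuous_re.comp (Sl_cont g ℓ X)) (η := η) (κ := κ)
    (a := cψ * X / 8) (b := X * (C1 * κ * r + 1 / L ^ 2)) (c := X / L) hη0 hηκ hκh (by positivity) (by positivity)
    ?_ ?_ ?_
  · refine le_trans ?_ key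
    rw [hsq, ← hr4]
    refine fin_num hXr hr1 hA0 ?_ hκ2 hκh ?_ ?_
    · rw [hη, hA]; field_simp; norm_num
    · rw [div_mul_eq_mul_div, div_le_iff₀ hA0] at q1
      linarith
    · have : 4 / A ≤ r := by linarith
      rw [div_le_iff₀ hA0] at this
      nlinarith
  · intro β hβ
    refine le_trans ?_ ((hnb β (hβ.trans hηκ)).2 ?_)
    · have h1 : C1 * |β| * r + 1 / L ^ 2 ≤ cψ / 8 := by
        have h2 : C1 * |β| * r ≤ C1 / r := by
          calc C1 * |β| * r ≤ C1 * (1 / r^2) * r := by gcongr; exact hβ.trans hη1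
            _ = C1 / r := by field_simp
        have h3 : 1 / L ^ 2 ≤ 1 / r := by
          apply one_div_le_one_div_of_le hr0
          rw [← hr4, ← pow_mul]
          exact le_self_pow₀ hr1 (by norm_num)
        have h4 : (C1 + 1) / r ≤ cψ / 8 := by
          have : 8 * (C1 + 1) / cψ ≤ r := by linarith
          rw [div_le_iff₀ hcψ] at this
          rw [div_le_div_iff₀ hr0 (by norm_num)]
          linarith
        have : (C1 + 1) / r = C1 / r + 1 / r := add_div _ _ _
        linarith
      have h5 := mul_le_mul_of_nonneg_left h1 hXr
      have h6 : cψ * X / 8 = X * (cψ / 8) := by ring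
      linarith
    · have hb2 : β ^ 2 ≤ η ^ 2 := sq_le_sq.2 (hβ.trans (le_abs_self η))
      calc 10 * (g:ℝ)^2 * β^2 * m ≤ 10 * (g:ℝ)^2 * η^2 * (3 * L) := by gcongr
        _ = 30 / 36 := by rw [hη, ← hr4]; field_simp; norm_num
        _ ≤ 1 := by norm_num
  · intro β hβ
    refine le_trans ?_ (hnb β hβ).1
    apply neg_le_neg
    gcongr
  · intro β hβ hβ2
    have h1 : ‖Sl g ℓ X β‖ ≤ X / L := by
      refine Sl_minor g hg X hm ℓ β hβ2 ?_
      rw [← hκ2, hr4]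
      apply mul_le_mul_of_nonneg_right _ hL0.le
      rw [← sq_abs β]
      exact pow_le_pow_left₀ hκ0 hβ 2
    exact (abs_le.1 ((Complex.abs_re_le_norm _).trans h1)).1
end DS

namespace DS
open Finset ArithmeticFunction Filter

lemma log_small (K : ℝ) : ∃ X1 : ℕ, ∀ X : ℕ, X1 ≤ X → K ^ 2 * Real.log X ≤ X := by
  have h := Real.isLittleO_log_id_atTop.bound (show (0:ℝ) < 1 / (K^2 + 1) by positivity)
  have h2 := (tendsto_natCast_atTop_atTop (R := ℝ)).eventually h
  obtain ⟨N, hN⟩ := eventually_atTop.1 h2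
  refine ⟨N + 1, fun X hX => ?_⟩
  have h3 := hN X (by omega)
  have hX1 : (1:ℝ) ≤ X := by exact_mod_cast (by omega : 1 ≤ X)
  have hl : 0 ≤ Real.log X := Real.log_nonneg hX1
  simp only [id, Real.norm_eq_abs] at h3
  rw [abs_of_nonneg hl, abs_of_nonneg (by linarith : (0:ℝ) ≤ X), div_mul_eq_mul_div, one_mul,
    le_div_iff₀ (by positivity)] at h3
  nlinarith

lemma strip_powers (g ℓ X : ℕ) :
    ∑ n ∈ (Icc 1 X).filter (fun n => sd g n = ℓ), vonMangoldt n ≤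
      (((range (X + 1)).filter (fun p => Nat.Prime p ∧ (Nat.digits g p).sum = ℓ)).card : ℝ) * Real.log X
        + (Chebyshev.psi X - Chebyshev.theta X) := by
  rw [Chebyshev.psi_sub_theta_eq_sum_not_prime, Nat.floor_natCast,
    ← Finset.sum_filter_add_sum_filter_not _ (fun n => Nat.Prime n)]
  apply add_le_add
  · rw [← nsmul_eq_mul]
    refine (Finset.sum_le_card_nsmul _ _ (Real.log X) ?_).trans ?_
    · intro n hn
      simp only [mem_filter, mem_Icc] at hn
      refine vonMangoldt_le_log.trans ?_
      apply Real.log_le_log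
      · exact_mod_cast hn.2.pos
      · exact_mod_cast hn.1.1.2
    · rw [nsmul_eq_mul, nsmul_eq_mul]
      apply mul_le_mul_of_nonneg_right _ (Real.log_natCast_nonneg X)
      norm_cast
      apply Finset.card_le_card
      intro n hn
      simp only [mem_filter, mem_Icc, mem_range] at hn ⊢
      exact ⟨by omega, hn.2, hn.1.2⟩
  · apply Finset.sum_le_sum_of_subset_of_nonneg
    · intro n hn
      simp only [mem_filter, mem_Icc, mem_Ioc] at hn ⊢
      exact ⟨by omega, hn.2⟩
    · intros; exact vonMangoldt_nonneg

lemma log_floor (g : ℕ) (hg : 2 ≤ g) (x : ℝ) (hx : 1 ≤ x) :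
    |Real.log x / Real.log g - ((Nat.log g ⌊x⌋₊ + 1 : ℕ) : ℝ)| ≤ 1 := by
  have hX : 1 ≤ ⌊x⌋₊ := Nat.le_floor (by simpa using hx)
  have hgr : (1:ℝ) < g := by exact_mod_cast hg
  have hlg : 0 < Real.log g := Real.log_pos hgr
  have h1 : (g:ℝ) ^ (Nat.log g ⌊x⌋₊) ≤ x := by
    refine le_trans ?_ (Nat.floor_le (by linarith))
    exact_mod_cast Nat.pow_log_le_self g (by omega)
  have h2 : x ≤ (g:ℝ) ^ (Nat.log g ⌊x⌋₊ + 1) := by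
    refine (Nat.lt_floor_add_one x).le.trans ?_
    exact_mod_cast Nat.lt_pow_succ_log_self (by omega) ⌊x⌋₊
  have h3 := Real.log_le_log (by positivity) h1
  have h4 := Real.log_le_log (by linarith) h2
  rw [Real.log_pow] at h3 h4
  rw [← le_div_iff₀ hlg] at h3
  rw [← div_le_iff₀ hlg] at h4
  rw [abs_le]
  push_cast at h4 ⊢
  constructor <;> linarith

lemma mu_bound (g ℓ J : ℕ) (hg : 2 ≤ g) (lx lg : ℝ)
    (h : |(ℓ : ℝ) - ((g - 1 : ℝ) / 2) * lx / lg| ≤ (g : ℝ)) (hJ : |lx / lg - (J:ℝ)| ≤ 1) :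
    |(ℓ:ℝ) - ((g:ℝ)-1)/2 * (J:ℝ)| ≤ 2*g := by
  have hgr : (2:ℝ) ≤ g := by exact_mod_cast hg
  have e : (ℓ:ℝ) - ((g:ℝ)-1)/2 * (J:ℝ) =
    ((ℓ : ℝ) - ((g - 1 : ℝ) / 2) * lx / lg) + ((g:ℝ)-1)/2 * (lx / lg - J) := by ring
  rw [e]
  refine (abs_add_le _ _).trans ?_
  rw [abs_mul, abs_of_nonneg (by linarith : 0 ≤ ((g:ℝ)-1)/2)]
  nlinarith [abs_nonneg (lx / lg - (J:ℝ))]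

lemma count_num {c C X L N s : ℝ} (hX : 0 ≤ X) (hs : 0 < s) (hL : s ^ 2 = L) (hC : 0 ≤ C) (hc : 0 < c)
    (h : c * X / s ≤ N * L + C * Real.sqrt X) (hK : (2 * C / c) ^ 2 * L ≤ X) :
    c / 2 * X / s ^ 3 ≤ N := by
  have h1 : 2 * C / c * s ≤ Real.sqrt X := by
    apply Real.le_sqrt_of_sq_le
    rw [mul_pow, hL]; exact hK
  have h2 : C * s ≤ c / 2 * Real.sqrt X := by
    rw [div_mul_eq_mul_div, div_le_iff₀ hc] at h1
    linarith
  have hq : Real.sqrt X * Real.sqrt X = X := Real.mul_self_sqrt hX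
  rw [div_le_iff₀ hs] at h
  rw [div_le_iff₀ (by positivity)]
  have h3 := mul_le_mul_of_nonneg_right h2 (Real.sqrt_nonneg X)
  have e : (N * L + C * Real.sqrt X) * s = N * s ^ 3 + C * s * Real.sqrt X := by rw [← hL]; ring
  rw [e] at h
  have : c / 2 * Real.sqrt X * Real.sqrt X = c / 2 * X := by rw [mul_assoc, hq]
  linarith

end DS

theorem many_primes_with_central_digit_sum (g : ℕ) (hg : 2 ≤ g) :
    ∃ c : ℝ, 0 < c ∧ ∃ x₀ : ℝ, ∀ x : ℝ, x₀ ≤ x → ∀ ℓ : ℕ, Nat.Coprime ℓ (g - 1) →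
      |(ℓ : ℝ) - ((g - 1 : ℝ) / 2) * Real.log x / Real.log g| ≤ (g : ℝ) →
      c * x / Real.log x ^ ((3 : ℝ) / 2) ≤
        (((Finset.range (⌊x⌋₊ + 1)).filter
            (fun p => Nat.Prime p ∧ (Nat.digits g p).sum = ℓ)).card : ℝ) := by
  obtain ⟨c, hc, X0, hw⟩ := DS.weighted g hg
  obtain ⟨C, hC⟩ := Chebyshev.psi_sub_theta_le_mul_sqrt
  obtain ⟨X1, hX1⟩ := DS.log_small (2 * |C| / c)
  refine ⟨c / 4, by positivity, (X0 + X1 + 3 : ℕ), fun x hx ℓ hcop hℓ => ?_⟩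
  have hX : X0 + X1 + 3 ≤ ⌊x⌋₊ := Nat.le_floor hx
  have hx3 : (3:ℝ) ≤ x := le_trans (by push_cast; linarith [Nat.cast_nonneg (α := ℝ) X0, Nat.cast_nonneg (α := ℝ) X1]) hx
  have h1 := hw ⌊x⌋₊ (by omega) ℓ hcop
    (DS.mu_bound g ℓ _ hg _ _ hℓ (DS.log_floor g hg x (by linarith)))
  have h2 := h1.trans (DS.strip_powers g ℓ ⌊x⌋₊)
  have hXr : (3:ℝ) ≤ (⌊x⌋₊ : ℝ) := by exact_mod_cast (by omega : 3 ≤ ⌊x⌋₊)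
  have hL : 0 < Real.log (⌊x⌋₊ : ℝ) := Real.log_pos (by linarith)
  have hs : 0 < Real.sqrt (Real.log (⌊x⌋₊ : ℝ)) := Real.sqrt_pos.2 hL
  have hCa : Chebyshev.psi (⌊x⌋₊ : ℝ) - Chebyshev.theta (⌊x⌋₊ : ℝ) ≤ |C| * Real.sqrt (⌊x⌋₊ : ℝ) :=
    (hC _).trans (mul_le_mul_of_nonneg_right (le_abs_self C) (Real.sqrt_nonneg _))
  have h3 := DS.count_num (by linarith) hs (Real.sq_sqrt hL.le) (abs_nonneg C) hc
    (h2.trans (add_le_add_right hCa _)) (hX1 ⌊x⌋₊ (by omega))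
  refine le_trans ?_ h3
  have hfl : (⌊x⌋₊ : ℝ) ≤ x := Nat.floor_le (by linarith)
  have hfl2 := Nat.lt_floor_add_one x
  have hlx : Real.log (⌊x⌋₊ : ℝ) ≤ Real.log x := Real.log_le_log (by linarith) hfl
  have e : Real.log x ^ ((3:ℝ)/2) = Real.sqrt (Real.log x) ^ 3 := by
    rw [Real.sqrt_eq_rpow, ← Real.rpow_natCast, ← Real.rpow_mul (hL.le.trans hlx)]
    norm_num
  rw [e]
  apply div_le_div₀ (by positivity) _ (by positivity)
  · exact pow_le_pow_left₀ hs.le (Real.sqrt_le_sqrt hlx) 3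
  · nlinarith
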